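/- Let n ≥ 2. There is a constant C_n > 0, depending only on n, such that for every set of finite perimeter E ⊂ ℝⁿ with |E| = |B_1| one has P(E) − P(B_1) ≥ C_n · γ(E), where γ(E) = inf_{y∈ℝⁿ} ( ∫_{B_1(y)} (n−1)/|x−y| dx − ∫_E (n−1)/|x−y| dx ). -/

import Mathlib

open MeasureTheory Metric Set

noncomputable section

/-- The divergence of a vector field on `ℝⁿ`. -/
def vdiv {n : ℕ} (φ : EuclideanSpace ℝ (Fin n) → EuclideanSpace ℝ (Fin n))
    (x : EuclideanSpace ℝ (Fin n)) : ℝ :=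
  ∑ i, fderiv ℝ φ x (EuclideanSpace.single i 1) i

/-- The set of admissible values `∫_F div φ` in the variational definition of the
perimeter: `φ` ranges over compactly supported `C¹` vector fields with `‖φ‖ ≤ 1`. -/
def perimVals {n : ℕ} (F : Set (EuclideanSpace ℝ (Fin n))) : Set ℝ :=
  { r | ∃ φ : EuclideanSpace ℝ (Fin n) → EuclideanSpace ℝ (Fin n),
      ContDiff ℝ 1 φ ∧ HasCompactSupport φ ∧ (∀ x, ‖φ x‖ ≤ 1) ∧
      r = ∫ x in F, vdiv φ x }

/-- The (distributional) perimeter `P(F)`. -/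
def perimeter {n : ℕ} (F : Set (EuclideanSpace ℝ (Fin n))) : ℝ := sSup (perimVals F)

/-- `F` is a set of finite perimeter: it is measurable and the variational
definition of the perimeter is finite. -/
def HasFinitePerimeter {n : ℕ} (F : Set (EuclideanSpace ℝ (Fin n))) : Prop :=
  MeasurableSet F ∧ BddAbove (perimVals F)

/-- The Newtonian interaction energy `NL(F) = ∫∫ χ_F(x)χ_F(y)|x-y|^{2-n}`. -/
def NL {n : ℕ} (F : Set (EuclideanSpace ℝ (Fin n))) : ℝ :=
  ∫ x in F, ∫ y in F, ‖x - y‖ ^ (2 - (n : ℝ))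

/-- The function `f_E = χ_{B_1} - χ_E`. -/
def fE {n : ℕ} (E : Set (EuclideanSpace ℝ (Fin n))) (x : EuclideanSpace ℝ (Fin n)) : ℝ :=
  (ball (0 : EuclideanSpace ℝ (Fin n)) 1).indicator 1 x - E.indicator 1 x

/-- The Newtonian potential `v(y) = ∫ (χ_{B_1} - χ_E)(x) |x-y|^{2-n} dx`. -/
def newtPot {n : ℕ} (E : Set (EuclideanSpace ℝ (Fin n))) (y : EuclideanSpace ℝ (Fin n)) : ℝ :=
  ∫ x, fE E x * ‖x - y‖ ^ (2 - (n : ℝ))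

/-- The normalization constant `σ_{n,α}` of the Riesz potential. -/
def rieszConst (n : ℕ) (α : ℝ) : ℝ :=
  (Real.pi ^ ((n : ℝ) / 2) * 2 ^ α * Real.Gamma (α / 2) / Real.Gamma (((n : ℝ) - α) / 2))⁻¹

/-- The Riesz potential `I_α f(x) = σ_{n,α} ∫ f(ξ)|x-ξ|^{α-n} dξ`. -/
def rieszPot {n : ℕ} (α : ℝ) (f : EuclideanSpace ℝ (Fin n) → ℝ)
    (x : EuclideanSpace ℝ (Fin n)) : ℝ :=
  rieszConst n α * ∫ ξ, f ξ * ‖x - ξ‖ ^ (α - (n : ℝ))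

/-- The average of `g` over the sphere `∂B_r` with respect to the
`(n-1)`-dimensional Hausdorff measure. -/
def sphAvg {n : ℕ} (g : EuclideanSpace ℝ (Fin n) → ℝ) (r : ℝ) : ℝ :=
  (μH[(n : ℝ) - 1] (sphere (0 : EuclideanSpace ℝ (Fin n)) r)).toReal⁻¹ *
    ∫ y in sphere (0 : EuclideanSpace ℝ (Fin n)) r, g y ∂μH[(n : ℝ) - 1]

/-- The average of `g` over the ball `B_r` with respect to the Lebesgue measure. -/
def ballAvg {n : ℕ} (g : EuclideanSpace ℝ (Fin n) → ℝ) (r : ℝ) : ℝ :=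
  (volume (ball (0 : EuclideanSpace ℝ (Fin n)) r)).toReal⁻¹ *
    ∫ x in ball (0 : EuclideanSpace ℝ (Fin n)) r, g x

end

/-- The asymmetry `γ(E) = inf_y ( ∫_{B_1(y)} (n-1)/|x-y| dx - ∫_E (n-1)/|x-y| dx )`. -/
noncomputable def gammaAsym {n : ℕ} (E : Set (EuclideanSpace ℝ (Fin n))) : ℝ :=
  ⨅ y : EuclideanSpace ℝ (Fin n),
    ((∫ x in ball y 1, ((n : ℝ) - 1) / ‖x - y‖) - ∫ x in E, ((n : ℝ) - 1) / ‖x - y‖)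


set_option linter.all false
open Filter Topology
open ProbabilityTheory
open scoped ENNReal
noncomputable section
abbrev EV (n : ℕ) := EuclideanSpace ℝ (Fin n)
local notation:max "♮" x:max => (x : ℝ)
local notation "♠" => (by positivity)
local notation "♣" => (by norm_num)
local notation "♦" => (by linarith)
local notation "♥" => (by simp)
local notation "♩" => (by fun_prop)
local notation "♪" => (by omega)
local notation:max "𝔼" x:max => EV x × EV x
def PerLe {n : ℕ} (F : Set (EV n)) (p : ℝ) : Prop :=
  ∀ φ : EV n → EV n, ContDiff ℝ 1 φ → HasCompactSupport φ → (∀ x, ‖φ x‖ ≤ 1) →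
    ∫ x in F, vdiv φ x ≤ p
lemma vdiv_eq {n : ℕ} {φ : EV n → EV n} {x : EV n} (h : DifferentiableAt ℝ φ x) :
    vdiv φ x = ∑ i, fderiv ℝ (fun y ↦ φ y i) x (EuclideanSpace.single i 1) := by
  unfold vdiv
  refine Finset.sum_congr rfl fun i _ ↦ ?_
  have : (fun y ↦ φ y i) = (EuclideanSpace.proj i : EV n →L[ℝ] ℝ) ∘ φ := rfl
  rw [this, (ContinuousLinearMap.hasFDerivAt _ |>.comp x h.hasFDerivAt).fderiv]
  rfl
lemma clm_apply_eq {n : ℕ} (l : EV n →L[ℝ] ℝ) (x : EV n) :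
    l x = ∑ i, l (EuclideanSpace.single i 1) * x i := by
  conv_lhs => rw [← (EuclideanSpace.basisFun (Fin n) ℝ).sum_repr x]
  simp [mul_comm]
lemma vdiv_continuous {n : ℕ} {φ : EV n → EV n} (h : ContDiff ℝ 1 φ) : Continuous (vdiv φ) := by
  unfold vdiv
  have := h.continuous_fderiv one_ne_zero
  fun_prop
lemma vdiv_compact {n : ℕ} {φ : EV n → EV n} (h : HasCompactSupport φ) :
    HasCompactSupport (vdiv φ) := by
  refine (h.fderiv (𝕜 := ℝ)).mono' ?_
  intro x hx
  by_contra hc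
  apply hx
  have : fderiv ℝ φ x = 0 := image_eq_zero_of_notMem_tsupport hc
  simp [vdiv, this]
lemma vdiv_integrable {n : ℕ} {φ : EV n → EV n} (h : ContDiff ℝ 1 φ) (hc : HasCompactSupport φ) :
    Integrable (vdiv φ) :=
  (vdiv_continuous h).integrable_of_hasCompactSupport (vdiv_compact hc)
lemma ibp {n : ℕ} {f : EV n → ℝ} {ψ : EV n → EV n} (hf : ContDiff ℝ 1 f) (hψ : ContDiff ℝ 1 ψ)
    (hc : HasCompactSupport f ∨ HasCompactSupport ψ) :
    ∫ x, f x * vdiv ψ x = - ∫ x, fderiv ℝ f x (ψ x) := by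
  have hfd := hf.continuous_fderiv one_ne_zero
  have hψi : ∀ i, ContDiff ℝ 1 (fun x ↦ ψ x i) := fun i ↦
    (EuclideanSpace.proj (𝕜 := ℝ) i : EV n →L[ℝ] ℝ).contDiff.comp hψ
  have hψd := fun i ↦ (hψi i).continuous_fderiv one_ne_zero
  have hcs : HasCompactSupport f ∨ ∀ i, HasCompactSupport (fun x ↦ ψ x i) := by
    refine hc.imp id fun h i ↦ ?_
    exact h.comp_left (g := fun v : EV n ↦ v i) rfl
  have I1 : ∀ i, Integrable (fun x ↦ f x * fderiv ℝ (fun y ↦ ψ y i) x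
      (EuclideanSpace.single i 1)) := by
    intro i
    have c := hf.continuous
    have d := hψd i
    refine Continuous.integrable_of_hasCompactSupport ♩ ?_
    rcases hcs with h | h
    · exact h.mul_right
    · exact HasCompactSupport.mul_left ((h i).fderiv_apply ℝ _)
  have I2 : ∀ i, Integrable (fun x ↦ fderiv ℝ f x (EuclideanSpace.single i 1) * ψ x i) := by
    intro i
    have c := (hψi i).continuous
    refine Continuous.integrable_of_hasCompactSupport ♩ ?_
    rcases hcs with h | h
    · exact (h.fderiv_apply ℝ _).mul_right
    · exact HasCompactSupport.mul_left (h i)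
  have I3 : ∀ i, Integrable (fun x ↦ f x * ψ x i) := by
    intro i
    have c := (hψi i).continuous
    refine Continuous.integrable_of_hasCompactSupport (hf.continuous.mul c) ?_
    rcases hcs with h | h
    · exact h.mul_right
    · exact HasCompactSupport.mul_left (h i)
  calc ∫ x, f x * vdiv ψ x
      = ∫ x, ∑ i, f x * fderiv ℝ (fun y ↦ ψ y i) x (EuclideanSpace.single i 1) := by
        congr 1; ext x; rw [vdiv_eq (hψ.differentiable one_ne_zero x), Finset.mul_sum]
    _ = ∑ i, ∫ x, f x * fderiv ℝ (fun y ↦ ψ y i) x (EuclideanSpace.single i 1) :=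
        integral_finsetSum _ fun i _ ↦ I1 i
    _ = ∑ i, - ∫ x, fderiv ℝ f x (EuclideanSpace.single i 1) * ψ x i := by
        refine Finset.sum_congr rfl fun i _ ↦ ?_
        exact integral_mul_fderiv_eq_neg_fderiv_mul_of_integrable (I2 i) (I1 i) (I3 i)
          (fun x _ ↦ hf.differentiable one_ne_zero x)
          (fun x _ ↦ (hψi i).differentiable one_ne_zero x)
    _ = - ∫ x, ∑ i, fderiv ℝ f x (EuclideanSpace.single i 1) * ψ x i := by
        rw [integral_finsetSum _ fun i _ ↦ I2 i, Finset.sum_neg_distrib]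
    _ = _ := by
        congr 2; ext x; rw [clm_apply_eq (fderiv ℝ f x) (ψ x)]
lemma vdiv_comp_add {n : ℕ} (φ : EV n → EV n) (y x : EV n) :
    vdiv (fun z ↦ φ (z + y)) x = vdiv φ (x + y) := by
  simp [vdiv, fderiv_comp_add_right]
lemma setIntegral_vdiv_add {n : ℕ} (E : Set (EV n)) (hE : MeasurableSet E) (φ : EV n → EV n)
    (y : EV n) : ∫ x in E, vdiv φ (x + y) = ∫ x in (fun z ↦ z - y) ⁻¹' E, vdiv φ x := by
  rw [← integral_indicator hE, ← integral_indicator (measurable_sub_const y hE),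
    ← integral_add_right_eq_self (((fun z ↦ z - y) ⁻¹' E).indicator _) y]
  congr 1
  ext x
  have e : x + y ∈ (fun z ↦ z - y) ⁻¹' E ↔ x ∈ E := by
    rw [mem_preimage, add_sub_cancel_right]
  by_cases hx : x ∈ E
  · rw [indicator_of_mem hx, indicator_of_mem (e.2 hx)]
  · rw [indicator_of_notMem hx, indicator_of_notMem (mt e.1 hx)]
lemma PerLe.translate {n : ℕ} {E : Set (EV n)} (hE : MeasurableSet E) {p : ℝ} (h : PerLe E p)
    (y : EV n) : PerLe ((fun z ↦ z - y) ⁻¹' E) p := by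
  intro φ h1 h2 h3
  rw [← setIntegral_vdiv_add E hE]
  simp_rw [← vdiv_comp_add]
  exact h _ (h1.comp (contDiff_id.add contDiff_const))
    (h2.comp_homeomorph (Homeomorph.addRight y)) fun x ↦ h3 _
lemma PerLe.compl {n : ℕ} {E : Set (EV n)} (hE : MeasurableSet E) {p : ℝ} (h : PerLe E p) :
    PerLe Eᶜ p := by
  intro φ h1 h2 h3
  have h0 : ∫ x, vdiv φ x = 0 := by
    have := ibp (f := fun _ ↦ ♮1) contDiff_const h1 (Or.inr h2)
    simpa using this
  have hi := vdiv_integrable h1 h2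
  have h4 := integral_add_compl hE hi
  have h5 := h (fun x ↦ - φ x) h1.neg h2.neg (fun x ↦ by simpa using h3 x)
  have h6 : ∀ x, vdiv (fun x ↦ - φ x) x = - vdiv φ x := fun x ↦ by
    simp [vdiv]
  simp_rw [h6, integral_neg] at h5
  linarith
lemma perLe_of_fin {n : ℕ} {E : Set (EV n)} (h : HasFinitePerimeter E) :
    PerLe E (perimeter E) := fun φ h1 h2 h3 ↦ le_csSup h.2 ⟨φ, h1, h2, h3, rfl⟩
lemma perimeter_le {n : ℕ} {E : Set (EV n)} {p : ℝ} (h : PerLe E p) : perimeter E ≤ p := by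
  refine csSup_le ⟨_, 0, contDiff_const, HasCompactSupport.zero, by simp, rfl⟩ ?_
  rintro r ⟨φ, h1, h2, h3, rfl⟩
  exact h φ h1 h2 h3
lemma conv_test {n : ℕ} {E : Set (EV n)} (hE : MeasurableSet E) {p : ℝ} (h : PerLe E p)
    {ρ : EV n → ℝ} (hρc : Continuous ρ) (hρs : HasCompactSupport ρ) (hρ0 : ∀ x, 0 ≤ ρ x)
    (hρ1 : ∫ x, ρ x = 1) {ψ : EV n → EV n} (h1 : ContDiff ℝ 1 ψ) (h2 : HasCompactSupport ψ)
    (h3 : ∀ x, ‖ψ x‖ ≤ 1) :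
    ∫ x, (∫ t, ρ t * E.indicator 1 (x - t)) * vdiv ψ x ≤ p := by
  have hD := vdiv_integrable h1 h2
  have hρi : Integrable ρ := hρc.integrable_of_hasCompactSupport hρs
  have hχ : Measurable (E.indicator (1 : EV n → ℝ)) := measurable_one.indicator hE
  have hI : Integrable (fun z : 𝔼 n ↦ (ρ z.2 * E.indicator 1 (z.1 - z.2)) * vdiv ψ z.1)
      (volume.prod volume) := by
    refine (hD.mul_prod hρi).mono ?_ (Eventually.of_forall fun z ↦ ?_)
    · have := vdiv_continuous h1
      exact (((hρc.measurable.comp measurable_snd).mul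
        (hχ.comp (measurable_fst.sub measurable_snd))).mul
          (this.measurable.comp measurable_fst)).aestronglyMeasurable
    · simp only [norm_mul]
      have : ‖E.indicator (1 : EV n → ℝ) (z.1 - z.2)‖ ≤ 1 := by
        by_cases hz : z.1 - z.2 ∈ E <;> simp [hz]
      calc _ ≤ ‖ρ z.2‖ * 1 * ‖vdiv ψ z.1‖ := by gcongr
        _ = _ := by ring
  have e1 : (fun t ↦ ∫ x, (ρ t * E.indicator 1 (x - t)) * vdiv ψ x) =
      fun t ↦ ρ t * ∫ x in (fun z ↦ z - t) ⁻¹' E, vdiv ψ x := by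
    ext t
    rw [← integral_indicator (measurable_sub_const t hE), ← integral_const_mul]
    congr 1; ext x
    by_cases hx : x - t ∈ E
    · rw [indicator_of_mem hx, indicator_of_mem (s := (fun z ↦ z - t) ⁻¹' E) hx]; simp
    · rw [indicator_of_notMem hx, indicator_of_notMem (s := (fun z ↦ z - t) ⁻¹' E) hx]; simp
  have hI2 : Integrable (fun t ↦ ρ t * ∫ x in (fun z ↦ z - t) ⁻¹' E, vdiv ψ x) :=
    e1 ▸ hI.integral_prod_right
  calc ∫ x, (∫ t, ρ t * E.indicator 1 (x - t)) * vdiv ψ x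
      = ∫ x, ∫ t, (ρ t * E.indicator 1 (x - t)) * vdiv ψ x := by
        simp_rw [integral_mul_const]
    _ = ∫ t, ∫ x, (ρ t * E.indicator 1 (x - t)) * vdiv ψ x := integral_integral_swap hI
    _ = ∫ t, ρ t * ∫ x in (fun z ↦ z - t) ⁻¹' E, vdiv ψ x := by rw [e1]
    _ ≤ ∫ t, ρ t * p := integral_mono hI2 (hρi.mul_const p) fun t ↦
        mul_le_mul_of_nonneg_left (h.translate hE t ψ h1 h2 h3) (hρ0 t)
    _ = p := by rw [integral_mul_const, hρ1, one_mul]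
lemma var_le {n : ℕ} {g : EV n → ℝ} (hg : ContDiff ℝ 2 g) {p : ℝ}
    (h : ∀ ψ : EV n → EV n, ContDiff ℝ 1 ψ → HasCompactSupport ψ → (∀ x, ‖ψ x‖ ≤ 1) →
      ∫ x, g x * vdiv ψ x ≤ p) {η : EV n → ℝ} (hη : ContDiff ℝ 1 η) (hηc : HasCompactSupport η)
    (hη0 : ∀ x, 0 ≤ η x) (hη1 : ∀ x, η x ≤ 1) : ∫ x, η x * ‖fderiv ℝ g x‖ ≤ p := by
  have hηi : Integrable η := hη.continuous.integrable_of_hasCompactSupport hηc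
  have hg1 : ContDiff ℝ 1 g := hg.of_le ♣
  have hfd : ContDiff ℝ 1 (fderiv ℝ g) := hg.fderiv_right ♣
  suffices H : ∀ κ : ℝ, 0 < κ → ∫ x, η x * ‖fderiv ℝ g x‖ ≤ p + κ * ∫ x, η x by
    have : Tendsto (fun κ : ℝ ↦ p + κ * ∫ x, η x) (𝓝[>] 0) (𝓝 (p + 0 * ∫ x, η x)) :=
      (by fun_prop : Continuous fun κ : ℝ ↦ p + κ * ∫ x, η x).continuousAt.continuousWithinAt
    rw [zero_mul, add_zero] at this
    exact ge_of_tendsto this (eventually_mem_nhdsWithin.mono fun κ hκ ↦ H κ hκ)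
  intro κ hκ
  let G : EV n → EV n := fun x ↦ (InnerProductSpace.toDual ℝ (EV n)).symm (fderiv ℝ g x)
  have hG : ContDiff ℝ 1 G :=
    (InnerProductSpace.toDual ℝ (EV n)).symm.toContinuousLinearEquiv.contDiff.comp hfd
  have hGn : ∀ x, ‖G x‖ = ‖fderiv ℝ g x‖ := fun x ↦ by simp [G]
  have hGa : ∀ x, fderiv ℝ g x (G x) = ‖G x‖ ^ 2 := fun x ↦ by
    rw [← real_inner_self_eq_norm_sq]; exact (InnerProductSpace.toDual_symm_apply).symm
  have hpos : ∀ x, 0 < ‖G x‖ ^ 2 + κ ^ 2 := fun x ↦ by positivity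
  let S : EV n → ℝ := fun x ↦ √(‖G x‖ ^ 2 + κ ^ 2)
  have hS0 : ∀ x, 0 < S x := fun x ↦ Real.sqrt_pos.2 (hpos x)
  have hSG : ∀ x, ‖G x‖ ≤ S x := fun x ↦ Real.le_sqrt_of_sq_le (by nlinarith [sq_nonneg κ])
  have hSκ : ∀ x, S x ≤ ‖G x‖ + κ := fun x ↦
    Real.sqrt_le_iff.2 ⟨by positivity, by nlinarith [norm_nonneg (G x)]⟩
  have hS : ContDiff ℝ 1 S :=
    ((hG.norm_sq ℝ).add contDiff_const).sqrt fun x ↦ (hpos x).ne'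
  let ψ : EV n → EV n := fun x ↦ -((η x / S x) • G x)
  have hψ : ContDiff ℝ 1 ψ := ((hη.div hS fun x ↦ (hS0 x).ne').smul hG).neg
  have hψc : HasCompactSupport ψ := by
    refine hηc.mono ?_
    intro x hx hx'
    apply hx
    simp [ψ, hx']
  have hb : ∀ x, ‖ψ x‖ ≤ 1 := fun x ↦ by
    simp only [ψ, norm_neg, norm_smul, norm_div, Real.norm_eq_abs, abs_of_pos (hS0 x),
      abs_of_nonneg (hη0 x)]
    rw [div_mul_eq_mul_div, div_le_one (hS0 x)]
    calc η x * ‖G x‖ ≤ 1 * ‖G x‖ := by gcongr; exact hη1 x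
      _ ≤ _ := by simpa using hSG x
  have h1 := h ψ hψ hψc hb
  rw [ibp hg1 hψ (Or.inr hψc), ← integral_neg] at h1
  have hpt : ∀ x, η x * ‖fderiv ℝ g x‖ ≤ -(fderiv ℝ g x (ψ x)) + κ * η x := by
    intro x
    simp only [ψ, map_neg, map_smul, neg_neg, hGa, smul_eq_mul, ← hGn]
    have : ‖G x‖ * S x ≤ ‖G x‖ ^ 2 + κ * S x := by
      nlinarith [hSG x, hSκ x, norm_nonneg (G x)]
    have : ‖G x‖ ≤ ‖G x‖ ^ 2 / S x + κ := by
      rw [div_add' _ _ _ (hS0 x).ne', le_div_iff₀ (hS0 x)]; exact this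
    calc η x * ‖G x‖ ≤ η x * (‖G x‖ ^ 2 / S x + κ) := by gcongr; exact hη0 x
      _ = _ := by ring
  have hI1 : Integrable fun x ↦ -(fderiv ℝ g x (ψ x)) := by
    have := hfd.continuous
    have := hψ.continuous
    refine Continuous.integrable_of_hasCompactSupport ♩ ?_
    refine hψc.mono ?_
    intro x hx hx'
    apply hx
    simp [hx']
  have hI2 : Integrable fun x ↦ η x * ‖fderiv ℝ g x‖ := by
    have := hfd.continuous
    have := hη.continuous
    exact Continuous.integrable_of_hasCompactSupport ♩ hηc.mul_right
  calc _ ≤ ∫ x, (-(fderiv ℝ g x (ψ x)) + κ * η x) := integral_mono hI2 (hI1.add (hηi.const_mul κ)) hpt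
    _ = (∫ x, -(fderiv ℝ g x (ψ x))) + κ * ∫ x, η x := by
      rw [integral_add hI1 (hηi.const_mul κ), integral_const_mul]
    _ ≤ _ := by linarith
lemma moll {n : ℕ} {E : Set (EV n)} (hE : MeasurableSet E) (hfin : volume E ≠ ⊤)
    {p : ℝ} (h : PerLe E p) {ε : ℝ} (hε : 0 < ε) :
    ∃ g : EV n → ℝ, ContDiff ℝ 2 g ∧ (∀ x, 0 ≤ g x ∧ g x ≤ 1) ∧ Integrable g ∧
      ∫ x, |g x - E.indicator 1 x| ≤ ε ∧
      (∀ ψ : EV n → EV n, ContDiff ℝ 1 ψ → HasCompactSupport ψ → (∀ x, ‖ψ x‖ ≤ 1) →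
        ∫ x, g x * vdiv ψ x ≤ p) ∧
      (∀ r, ball 0 r ⊆ E → ∀ x, ‖x‖ < r - ε → g x = 1) ∧
      (∀ r, E ⊆ ball 0 r → ∀ x, r + ε < ‖x‖ → g x = 0) := by
  let b : ℕ → ContDiffBump (0 : EV n) := fun k ↦
    ⟨1 / (♮k + 1), 2 * (1 / (♮k + 1)), by positivity, by
      have : 0 < 1 / (♮k + 1) := by positivity
      linarith⟩
  let χ : EV n → ℝ := E.indicator 1
  have hχm : Measurable χ := measurable_one.indicator hE
  have hχi : Integrable χ := (integrable_indicator_iff hE).2 (integrableOn_const hfin)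
  have hχ0 : ∀ x, 0 ≤ χ x := fun x ↦ indicator_nonneg (fun _ _ ↦ zero_le_one) x
  have hχ1 : ∀ x, χ x ≤ 1 := fun x ↦ by by_cases hx : x ∈ E <;> simp [χ, hx]
  let ρ : ℕ → EV n → ℝ := fun k ↦ (b k).normed volume
  have hρc : ∀ k, Continuous (ρ k) := fun k ↦ (b k).continuous_normed
  have hρs : ∀ k, HasCompactSupport (ρ k) := fun k ↦ (b k).hasCompactSupport_normed
  have hρ0 : ∀ k x, 0 ≤ ρ k x := fun k x ↦ (b k).nonneg_normed x
  have hρ1 : ∀ k, ∫ x, ρ k x = 1 := fun k ↦ (b k).integral_normed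
  have hρi : ∀ k, Integrable (ρ k) := fun k ↦ (hρc k).integrable_of_hasCompactSupport (hρs k)
  let g : ℕ → EV n → ℝ := fun k ↦ convolution (ρ k) χ (ContinuousLinearMap.lsmul ℝ ℝ) volume
  have hg : ∀ k x, g k x = ∫ t, ρ k t * χ (x - t) := fun k x ↦ rfl
  have hgi : ∀ k, Integrable (g k) := fun k ↦ (hρi k).integrable_convolution _ hχi
  have hii : ∀ k x, Integrable fun t ↦ ρ k t * χ (x - t) := fun k x ↦ by
    refine (hρi k).mono ((hρc k).measurable.mul
      (hχm.comp (measurable_const.sub measurable_id))).aestronglyMeasurable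
      (Eventually.of_forall fun t ↦ ?_)
    rw [norm_mul]
    refine mul_le_of_le_one_right (norm_nonneg _) ?_
    rw [Real.norm_eq_abs, abs_of_nonneg (hχ0 _)]; exact hχ1 _
  have hg0 : ∀ k x, 0 ≤ g k x := fun k x ↦
    integral_nonneg fun t ↦ mul_nonneg (hρ0 k t) (hχ0 _)
  have hg1 : ∀ k x, g k x ≤ 1 := fun k x ↦ by
    rw [hg, ← hρ1 k]
    exact integral_mono (hii k x) (hρi k) fun t ↦ mul_le_of_le_one_right (hρ0 k t) (hχ1 _)
  have hgint : ∀ k, ∫ x, g k x = ∫ x, χ x := fun k ↦ by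
    have := integral_convolution (L := ContinuousLinearMap.lsmul ℝ ℝ) (hρi k) hχi
    simp only [g]
    rw [this]
    simp [hρ1]
  have htail : Tendsto (fun k : ℕ ↦ 2 * (1 / (♮k + 1))) atTop (𝓝 0) := by
    simpa using (tendsto_one_div_add_atTop_nhds_zero_nat (𝕜 := ℝ)).const_mul 2
  have hlim : ∀ᵐ x, Tendsto (fun k ↦ g k x) atTop (𝓝 (χ x)) :=
    ContDiffBump.ae_convolution_tendsto_right_of_locallyIntegrable (K := 2) htail
      (Eventually.of_forall fun k ↦ le_rfl) hχi.locallyIntegrable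
  have hpos : Tendsto (fun k ↦ ∫ x, max (χ x - g k x) 0) atTop (𝓝 (∫ x : EV n, ♮0)) := by
    refine tendsto_integral_of_dominated_convergence χ (fun k ↦ ?_) hχi (fun k ↦ ?_) ?_
    · exact ((hχi.sub (hgi k)).sup (integrable_zero _ _ _)).aestronglyMeasurable
    · refine Eventually.of_forall fun x ↦ ?_
      rw [Real.norm_eq_abs, abs_of_nonneg (le_max_right _ _)]
      exact max_le (by linarith [hg0 k x]) (hχ0 x)
    · filter_upwards [hlim] with x hx
      have := (tendsto_const_nhds (x := χ x)).sub hx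
      simpa using this.max (tendsto_const_nhds (x := ♮0))
  have habs : ∀ k, ∫ x, |g k x - χ x| = 2 * ∫ x, max (χ x - g k x) 0 := fun k ↦ by
    have e : ∀ x, |g k x - χ x| = 2 * max (χ x - g k x) 0 + (g k x - χ x) := fun x ↦ by
      rcases le_total (g k x) (χ x) with h | h
      · rw [abs_of_nonpos ♦, max_eq_left ♦]; ring
      · rw [abs_of_nonneg ♦, max_eq_right ♦]; ring
    simp_rw [e]
    have hm : Integrable fun x ↦ max (χ x - g k x) 0 :=
      (hχi.sub (hgi k)).sup (integrable_zero _ _ _)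
    have hs : Integrable fun x ↦ g k x - χ x := (hgi k).sub hχi
    rw [integral_add (hm.const_mul 2) hs, integral_const_mul, integral_sub (hgi k) hχi, hgint]
    ring
  have h2 : Tendsto (fun k ↦ ∫ x, |g k x - χ x|) atTop (𝓝 0) := by
    simp_rw [habs]
    simpa using hpos.const_mul 2
  obtain ⟨k, hk1, hk2⟩ := ((h2.eventually_lt_const hε).and (htail.eventually_lt_const hε)).exists
  have hsupp : ∀ t, ε ≤ ‖t‖ → ρ k t = 0 := fun t ht ↦ by
    have : t ∉ Function.support (ρ k) := by
      rw [(b k).support_normed_eq]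
      simp only [mem_ball, dist_zero_right, not_lt]
      exact le_trans hk2.le ht
    simpa using this
  refine ⟨g k, ?_, fun x ↦ ⟨hg0 k x, hg1 k x⟩, hgi k, hk1.le, ?_, ?_, ?_⟩
  · exact (hρs k).contDiff_convolution_left (n := 2) _ (b k).contDiff_normed hχi.locallyIntegrable
  · intro ψ h1 h2 h3
    exact conv_test hE h (hρc k) (hρs k) (hρ0 k) (hρ1 k) h1 h2 h3
  · intro r hr x hx
    rw [hg, ← hρ1 k]
    congr 1; ext t
    by_cases ht : ε ≤ ‖t‖
    · simp [hsupp t ht]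
    · have : x - t ∈ E := hr (by
        rw [mem_ball_zero_iff]
        have := norm_sub_le x t
        push Not at ht; linarith)
      simp [χ, this]
  · intro r hr x hx
    rw [hg, ← integral_zero (EV n) ℝ]
    congr 1; ext t
    by_cases ht : ε ≤ ‖t‖
    · simp [hsupp t ht]
    · have : x - t ∉ E := fun hc ↦ by
        have h1 := mem_ball_zero_iff.1 (hr hc)
        have := norm_sub_norm_le x t
        push Not at ht; linarith
      simp [χ, this]
lemma approx {n : ℕ} {E : Set (EV n)} (hE : MeasurableSet E) (hfin : volume E ≠ ⊤)
    {p : ℝ} (h : PerLe E p) {ε : ℝ} (hε : 0 < ε) :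
    ∃ f : EV n → ℝ, ContDiff ℝ 1 f ∧ HasCompactSupport f ∧ (∀ x, 0 ≤ f x ∧ f x ≤ 1) ∧
      ∫ x, |f x - E.indicator 1 x| ≤ ε ∧ ∫ x, ‖fderiv ℝ f x‖ ≤ p + ε ∧
      (∀ r, r ≤ 2 → ball 0 r ⊆ E → ∀ x, ‖x‖ < r - ε → f x = 1) ∧
      (∀ r, E ⊆ ball 0 r → ∀ x, r + ε < ‖x‖ → f x = 0) := by
  obtain ⟨g, hg, hg01, hgi, hgε, hgt, hgin, hgout⟩ := moll hE hfin h (half_pos hε)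
  have hg1 : ContDiff ℝ 1 g := hg.of_le ♣
  have hgd := hg1.continuous_fderiv one_ne_zero
  let b : ContDiffBump (0 : EV n) := ⟨1, 2, by norm_num, by norm_num⟩
  have hb1 : ContDiff ℝ 1 b := b.contDiff
  obtain ⟨L, hL⟩ := (hb1.continuous_fderiv one_ne_zero).bounded_above_of_compact_support
    (b.hasCompactSupport.fderiv ℝ)
  let η : ℕ → EV n → ℝ := fun k x ↦ b ((♮k + 1)⁻¹ • x)
  have hk0 : ∀ k : ℕ, ♮0 < (♮k + 1)⁻¹ := fun k ↦ by positivity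
  have hη : ∀ k, ContDiff ℝ 1 (η k) := fun k ↦ hb1.comp (contDiff_const_smul _)
  have hηc : ∀ k, HasCompactSupport (η k) := fun k ↦ 
    b.hasCompactSupport.comp_homeomorph (Homeomorph.smulOfNeZero _ (hk0 k).ne')
  have hη0 : ∀ k x, 0 ≤ η k x := fun k x ↦ b.nonneg
  have hη1 : ∀ k x, η k x ≤ 1 := fun k x ↦ b.le_one
  have hηd : ∀ k x, ‖fderiv ℝ (η k) x‖ ≤ L * (♮k + 1)⁻¹ := fun k x ↦ by
    have : fderiv ℝ (η k) x = (♮k + 1)⁻¹ • fderiv ℝ b ((♮k + 1)⁻¹ • x) :=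
      fderiv_comp_smul _
    rw [this, norm_smul, Real.norm_eq_abs, abs_of_pos (hk0 k), mul_comm]
    exact mul_le_mul_of_nonneg_right (hL _) (hk0 k).le
  have hηone : ∀ (k : ℕ) x, ‖x‖ ≤ ♮k + 1 → η k x = 1 := fun k x hx ↦ by
    apply b.one_of_mem_closedBall
    rw [mem_closedBall_zero_iff, norm_smul, Real.norm_eq_abs, abs_of_pos (hk0 k),
      inv_mul_le_iff₀ ♠]
    simpa [b] using hx
  have hlim1 : Tendsto (fun k ↦ ∫ x, |η k x * g x - g x|) atTop (𝓝 (∫ x : EV n, ♮0)) := by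
    refine tendsto_integral_of_dominated_convergence g (fun k ↦ ?_) hgi (fun k ↦ ?_) ?_
    · have := (hη k).continuous
      have := hg.continuous
      exact (by fun_prop : Continuous _).aestronglyMeasurable
    · refine Eventually.of_forall fun x ↦ ?_
      rw [Real.norm_eq_abs, abs_abs, abs_le]
      constructor <;> nlinarith [hη0 k x, hη1 k x, (hg01 x).1]
    · refine Eventually.of_forall fun x ↦ tendsto_const_nhds.congr' ?_
      filter_upwards [eventually_ge_atTop ⌈‖x‖⌉₊] with k hk
      have : ‖x‖ ≤ ♮k + 1 := by have := Nat.ceil_le.1 hk; linarith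
      simp [hηone k x this]
  have hlim2 : Tendsto (fun k : ℕ ↦ L * (♮k + 1)⁻¹ * ∫ x, g x) atTop (𝓝 0) := by
    have := (tendsto_one_div_add_atTop_nhds_zero_nat (𝕜 := ℝ)).const_mul L
    simpa using this.mul_const (∫ x, g x)
  rw [integral_zero] at hlim1
  obtain ⟨k, ⟨hk1, hk2⟩, hk3⟩ := (((hlim1.eventually_lt_const (half_pos hε)).and
    (hlim2.eventually_lt_const hε)).and (eventually_ge_atTop 2)).exists
  have hk3' : ♮2 ≤ k := by exact_mod_cast hk3
  have hχi : Integrable (E.indicator (1 : EV n → ℝ)) :=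
    (integrable_indicator_iff hE).2 (integrableOn_const hfin)
  have hf : ContDiff ℝ 1 (fun x ↦ η k x * g x) := (hη k).mul hg1
  have hfc : HasCompactSupport (fun x ↦ η k x * g x) := (hηc k).mul_right
  have hfi : Integrable (fun x ↦ η k x * g x) := hf.continuous.integrable_of_hasCompactSupport hfc
  refine ⟨fun x ↦ η k x * g x, hf, hfc, fun x ↦ ⟨mul_nonneg (hη0 k x) (hg01 x).1,
    mul_le_one₀ (hη1 k x) (hg01 x).1 (hg01 x).2⟩, ?_, ?_, ?_, ?_⟩
  · calc ∫ x, |η k x * g x - E.indicator 1 x|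
        ≤ ∫ x, (|η k x * g x - g x| + |g x - E.indicator 1 x|) :=
          integral_mono (hfi.sub hχi).abs ((hfi.sub hgi).abs.add (hgi.sub hχi).abs)
            fun x ↦ abs_sub_le _ _ _
      _ = (∫ x, |η k x * g x - g x|) + ∫ x, |g x - E.indicator 1 x| :=
          integral_add (hfi.sub hgi).abs (hgi.sub hχi).abs
      _ ≤ ε := by linarith
  · have hd : ∀ x, ‖fderiv ℝ (fun x ↦ η k x * g x) x‖ ≤
        η k x * ‖fderiv ℝ g x‖ + L * (♮k + 1)⁻¹ * g x := fun x ↦ by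
      rw [fderiv_fun_mul ((hη k).differentiable one_ne_zero x) (hg1.differentiable one_ne_zero x)]
      refine (norm_add_le _ _).trans ?_
      rw [norm_smul, norm_smul, Real.norm_eq_abs, Real.norm_eq_abs, abs_of_nonneg (hη0 k x),
        abs_of_nonneg (hg01 x).1, mul_comm (g x)]
      gcongr
      · exact (hg01 x).1
      · exact hηd k x
    have hI1 : Integrable fun x ↦ ‖fderiv ℝ (fun x ↦ η k x * g x) x‖ :=
      ((hf.continuous_fderiv one_ne_zero).integrable_of_hasCompactSupport (hfc.fderiv ℝ)).norm
    have hI2 : Integrable fun x ↦ η k x * ‖fderiv ℝ g x‖ := by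
      have := (hη k).continuous
      exact Continuous.integrable_of_hasCompactSupport ♩ (hηc k).mul_right
    calc _ ≤ ∫ x, (η k x * ‖fderiv ℝ g x‖ + L * (♮k + 1)⁻¹ * g x) :=
          integral_mono hI1 (hI2.add (hgi.const_mul _)) hd
      _ = (∫ x, η k x * ‖fderiv ℝ g x‖) + L * (♮k + 1)⁻¹ * ∫ x, g x := by
          rw [integral_add hI2 (hgi.const_mul _), integral_const_mul]
      _ ≤ p + ε := add_le_add (var_le hg hgt (hη k) (hηc k) (hη0 k) (hη1 k)) hk2.le
  · intro r hr2 hr x hx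
    simp only
    rw [hgin r hr x ♦, hηone k x ♦, one_mul]
  · intro r hr x hx
    simp only
    rw [hgout r hr x ♦, mul_zero]
def ww (n : ℕ) : ℝ := volume.real (ball (0 : EV n) 1)
lemma ww_pos (n : ℕ) : 0 < ww n :=
  ENNReal.toReal_pos (measure_ball_pos _ _ one_pos).ne' measure_ball_lt_top.ne
lemma vol_cball {n : ℕ} (x : EV n) {r : ℝ} (hr : 0 ≤ r) :
    volume.real (closedBall x r) = r ^ n * ww n := by
  simpa [ww] using Measure.addHaar_real_closedBall (μ := (volume : Measure (EV n))) x hr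
lemma sT_deriv_nonneg (x : ℝ) : 0 ≤ deriv Real.smoothTransition x :=
  Real.smoothTransition.monotone.deriv_nonneg
lemma sT_bound : ∃ L : ℝ, 0 < L ∧ ∀ x, deriv Real.smoothTransition x ≤ L := by
  have hc : Continuous (deriv Real.smoothTransition) :=
    (Real.smoothTransition.contDiff (n := 1)).continuous_deriv le_rfl
  obtain ⟨C, hC⟩ := isCompact_Icc.exists_bound_of_continuousOn (s := Icc ♮0 1) hc.continuousOn
  refine ⟨max C 1, by positivity, fun x ↦ ?_⟩
  by_cases hx : x ∈ Icc ♮0 1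
  · exact (le_abs_self _).trans ((hC x hx).trans (le_max_left _ _))
  · have : deriv Real.smoothTransition x = 0 := by
      rw [mem_Icc, not_and_or, not_le, not_le] at hx
      rcases hx with h | h
      · have : Real.smoothTransition =ᶠ[𝓝 x] fun _ ↦ ♮0 := by
          filter_upwards [Iio_mem_nhds h] with y hy
          exact Real.smoothTransition.zero_of_nonpos (le_of_lt hy)
        rw [this.deriv_eq]; simp
      · have : Real.smoothTransition =ᶠ[𝓝 x] fun _ ↦ ♮1 := by
          filter_upwards [Ioi_mem_nhds h] with y hy
          exact Real.smoothTransition.one_of_one_le (le_of_lt hy)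
        rw [this.deriv_eq]; simp
    rw [this]; positivity
lemma cutoff : ∃ L : ℝ, 0 < L ∧ ∀ (n : ℕ) (a b : ℝ), 0 < a → a < b → ∃ η : EV n → ℝ,
    ContDiff ℝ 1 η ∧ HasCompactSupport η ∧ (∀ x, 0 ≤ η x ∧ η x ≤ 1) ∧
    (∀ x, ‖x‖ ≤ a → η x = 1) ∧ (∀ x, b ≤ ‖x‖ → η x = 0) ∧
    (∀ x, ‖fderiv ℝ η x‖ ≤ L / (b - a)) ∧
    (∀ x, x ∉ closedBall 0 b \ ball 0 a → fderiv ℝ η x = 0) ∧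
    (∀ x, a * ‖fderiv ℝ η x‖ ≤ - fderiv ℝ η x x) := by
  obtain ⟨L, hL0, hL⟩ := sT_bound
  refine ⟨2 * L, by positivity, fun n a b ha hab ↦ ?_⟩
  have hD : 0 < b ^ 2 - a ^ 2 := by nlinarith
  set D := b ^ 2 - a ^ 2 with hDdef
  let η : EV n → ℝ := fun x ↦ Real.smoothTransition ((b ^ 2 - ‖x‖ ^ 2) / D)
  let s' : EV n → ℝ := fun x ↦ deriv Real.smoothTransition ((b ^ 2 - ‖x‖ ^ 2) / D)
  have hs0 : ∀ x, 0 ≤ s' x := fun x ↦ sT_deriv_nonneg _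
  have hfd : ∀ x, HasFDerivAt η (-(2 * s' x / D) • innerSL ℝ x) x := fun x ↦ by
    have h1 : HasFDerivAt (fun x : EV n ↦ (b ^ 2 - ‖x‖ ^ 2) / D) (-(2 / D) • innerSL ℝ x) x := by
      have := ((hasStrictFDerivAt_norm_sq x).hasFDerivAt.const_sub (b ^ 2)).const_mul D⁻¹
      refine (this.congr_fderiv ?_).congr_of_eventuallyEq
        (Eventually.of_forall fun y ↦ by simp only; ring)
      ext y
      simp; ring
    have h2 : HasDerivAt Real.smoothTransition (s' x) ((b ^ 2 - ‖x‖ ^ 2) / D) :=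
      ((Real.smoothTransition.contDiff (n := 1)).differentiable one_ne_zero _).hasDerivAt
    refine (h2.comp_hasFDerivAt x h1).congr_fderiv ?_
    rw [smul_smul]; congr 1; ring
  have hzero : ∀ x, b ≤ ‖x‖ → η x = 0 := fun x hx ↦
    Real.smoothTransition.zero_of_nonpos (div_nonpos_of_nonpos_of_nonneg (by nlinarith) hD.le)
  have hone : ∀ x, ‖x‖ ≤ a → η x = 1 := fun x hx ↦
    Real.smoothTransition.one_of_one_le (by
      rw [le_div_iff₀ hD]; nlinarith [norm_nonneg x])
  have hout : ∀ x, x ∉ closedBall 0 b \ ball 0 a → fderiv ℝ η x = 0 := fun x hx ↦ by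
    simp only [Set.mem_sdiff, mem_closedBall_zero_iff, mem_ball_zero_iff, not_and, not_not] at hx
    rcases lt_or_ge b ‖x‖ with h | h
    · have : η =ᶠ[𝓝 x] fun _ ↦ ♮0 := by
        filter_upwards [(isOpen_lt continuous_const continuous_norm).mem_nhds h] with y hy
        exact hzero y (le_of_lt hy)
      rw [this.fderiv_eq]; simp
    · have : η =ᶠ[𝓝 x] fun _ ↦ ♮1 := by
        filter_upwards [(isOpen_lt continuous_norm continuous_const).mem_nhds (hx h)] with y hy
        exact hone y (le_of_lt hy)
      rw [this.fderiv_eq]; simp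
  have hnorm : ∀ x, ‖fderiv ℝ η x‖ = 2 * s' x / D * ‖x‖ := fun x ↦ by
    rw [(hfd x).fderiv, norm_smul, innerSL_apply_norm, norm_neg, Real.norm_of_nonneg]
    have := hs0 x
    positivity
  refine ⟨η, ?_, ?_, fun x ↦ ⟨Real.smoothTransition.nonneg _, Real.smoothTransition.le_one _⟩,
    hone, hzero, fun x ↦ ?_, hout, fun x ↦ ?_⟩
  · exact (Real.smoothTransition.contDiff (n := 1)).comp
      ((contDiff_const.sub (contDiff_norm_sq ℝ)).div_const _)
  · refine HasCompactSupport.intro (isCompact_closedBall 0 b) fun x hx ↦ hzero x ?_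
    rw [mem_closedBall_zero_iff, not_le] at hx; exact hx.le
  · by_cases hx : x ∈ closedBall 0 b \ ball 0 a
    · have hb : ‖x‖ ≤ b := mem_closedBall_zero_iff.1 hx.1
      rw [hnorm, div_mul_eq_mul_div, div_le_div_iff₀ hD ♦]
      have h1 : s' x ≤ L := hL _
      have h2 := hs0 x
      have : 2 * s' x * ‖x‖ ≤ 2 * L * (b + a) := by
        have := norm_nonneg x
        gcongr; linarith
      calc 2 * s' x * ‖x‖ * (b - a) ≤ 2 * L * (b + a) * (b - a) := by gcongr
        _ = _ := by rw [hDdef]; ring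
    · rw [hout x hx, norm_zero]; have : 0 < b - a := by linarith
      positivity
  · by_cases hx : x ∈ closedBall 0 b \ ball 0 a
    · have ha' : a ≤ ‖x‖ := by simpa using hx.2
      rw [hnorm, (hfd x).fderiv]
      simp only [smul_apply, innerSL_apply_apply, smul_eq_mul,
        real_inner_self_eq_norm_sq]
      have := hs0 x
      have h3 : 0 ≤ 2 * s' x / D * ‖x‖ := by positivity
      nlinarith
    · rw [hout x hx]; simp
lemma perLe_ball (n : ℕ) : PerLe (ball (0 : EV n) 1) (n * ww n) := by
  intro φ h1 h2 h3
  obtain ⟨L, -, hL⟩ := cutoff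
  have hb : ∀ k : ℕ, ♮1 < 1 + 1 / (♮k + 1) := fun k ↦ by
    have : 0 < 1 / (♮k + 1) := by positivity
    linarith
  choose η hη hηc h01 hone hzero _hs1 _hs2 hrad using fun k : ℕ ↦ hL n 1 (1 + 1 / (♮k + 1)) one_pos (hb k)
  have hdiv := vdiv_integrable h1 h2
  have hbt : Tendsto (fun k : ℕ ↦ 1 + 1 / (♮k + 1)) atTop (𝓝 1) := by
    simpa using (tendsto_one_div_add_atTop_nhds_zero_nat (𝕜 := ℝ)).const_add 1
  have hsph : volume (sphere (0 : EV n) 1) = 0 :=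
    Measure.addHaar_sphere_of_ne_zero _ _ one_ne_zero
  have hlim : Tendsto (fun k ↦ ∫ x, η k x * vdiv φ x) atTop (𝓝 (∫ x in ball 0 1, vdiv φ x)) := by
    rw [← integral_indicator measurableSet_ball]
    refine tendsto_integral_of_dominated_convergence (fun x ↦ ‖vdiv φ x‖) (fun k ↦ ?_)
      hdiv.norm (fun k ↦ Eventually.of_forall fun x ↦ ?_) ?_
    · exact ((hη k).continuous.mul (vdiv_continuous h1)).aestronglyMeasurable
    · rw [norm_mul, Real.norm_of_nonneg (h01 k x).1]
      exact mul_le_of_le_one_left (norm_nonneg _) (h01 k x).2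
    · filter_upwards [compl_mem_ae_iff.2 hsph] with x hx
      have hx : ‖x‖ ≠ 1 := by simpa using hx
      refine tendsto_const_nhds.congr' ?_
      rcases lt_or_gt_of_ne hx with hx | hx
      · refine Eventually.of_forall fun k ↦ ?_
        simp [hone k x hx.le, indicator_of_mem (show x ∈ ball (0 : EV n) 1 by simpa using hx)]
      · filter_upwards [hbt.eventually_lt_const hx] with k hk
        rw [hzero k x hk.le, indicator_of_notMem (show x ∉ ball (0 : EV n) 1 by simpa using hx.le),
          zero_mul]
  have hvid : ∀ x : EV n, vdiv (fun x ↦ x) x = n := fun x ↦ by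
    simp [vdiv]
  have hbd : ∀ k : ℕ, ∫ x, η k x * vdiv φ x ≤ n * ((1 + 1 / (♮k + 1)) ^ n * ww n) := fun k ↦ by
    have hfc := (hη k).continuous_fderiv one_ne_zero
    have i1 : ∀ ψ : EV n → EV n, Continuous ψ → Integrable fun x ↦ fderiv ℝ (η k) x (ψ x) :=
      fun ψ hψ ↦ by
        refine Continuous.integrable_of_hasCompactSupport ♩ ?_
        refine ((hηc k).fderiv ℝ).mono ?_
        intro x hx hx'
        apply hx; simp only [hx']; simp
    have i2 : Integrable (η k) := (hη k).continuous.integrable_of_hasCompactSupport (hηc k)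
    rw [ibp (hη k) h1 (Or.inr h2), ← integral_neg]
    calc ∫ x, -(fderiv ℝ (η k) x (φ x)) ≤ ∫ x, -(fderiv ℝ (η k) x x) := by
          refine integral_mono (i1 _ h1.continuous).neg (i1 _ continuous_id).neg fun x ↦ ?_
          have := (fderiv ℝ (η k) x).le_opNorm (φ x)
          have h4 := hrad k x
          have h5 := neg_le_abs (fderiv ℝ (η k) x (φ x))
          rw [Real.norm_eq_abs] at this
          have h6 := mul_le_of_le_one_right (norm_nonneg (fderiv ℝ (η k) x)) (h3 x)
          simp only
          linarith
      _ = ∫ x, η k x * vdiv (fun x ↦ x) x := by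
          rw [ibp (hη k) (ψ := fun x ↦ x) contDiff_id (Or.inl (hηc k)), integral_neg]
      _ = n * ∫ x, η k x := by simp_rw [hvid]; rw [integral_mul_const, mul_comm]
      _ ≤ n * volume.real (closedBall (0 : EV n) (1 + 1 / (♮k + 1))) := by
          gcongr
          rw [← integral_indicator_one measurableSet_closedBall]
          refine integral_mono i2 ((integrable_indicator_iff measurableSet_closedBall).2
            (integrableOn_const measure_closedBall_lt_top.ne)) fun x ↦ ?_
          by_cases hx : x ∈ closedBall (0 : EV n) (1 + 1 / (♮k + 1))
          · rw [indicator_of_mem hx]; exact (h01 k x).2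
          · rw [indicator_of_notMem hx]
            refine (hzero k x ?_).le
            rw [mem_closedBall_zero_iff, not_le] at hx; exact hx.le
      _ = _ := by rw [vol_cball _ (by linarith [hb k])]
  have hlim2 : Tendsto (fun k : ℕ ↦ n * ((1 + 1 / (♮k + 1)) ^ n * ww n)) atTop
      (𝓝 (n * (1 ^ n * ww n))) := ((hbt.pow n).mul_const _).const_mul _
  simpa using le_of_tendsto_of_tendsto' hlim hlim2 hbd
lemma vdiv_smul {n : ℕ} {η : EV n → ℝ} {φ : EV n → EV n} {x : EV n} (h : DifferentiableAt ℝ η x)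
    (h' : DifferentiableAt ℝ φ x) :
    vdiv (fun x ↦ η x • φ x) x = η x * vdiv φ x + fderiv ℝ η x (φ x) := by
  rw [clm_apply_eq (fderiv ℝ η x) (φ x)]
  simp only [vdiv]
  rw [fderiv_fun_smul h h', Finset.mul_sum, ← Finset.sum_add_distrib]
  rfl
lemma vdiv_add {n : ℕ} {φ ψ : EV n → EV n} {x : EV n} (h : DifferentiableAt ℝ φ x)
    (h' : DifferentiableAt ℝ ψ x) : vdiv (fun x ↦ φ x + ψ x) x = vdiv φ x + vdiv ψ x := by
  simp only [vdiv]
  rw [fderiv_fun_add h h', ← Finset.sum_add_distrib]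
  rfl
lemma glue : ∃ L : ℝ, 0 < L ∧ ∀ (n : ℕ) (F : Set (EV n)), MeasurableSet F → ∀ p, PerLe F p →
    ∀ (r A : ℝ) (a b : ℕ → ℝ), (∀ k, 0 < a k) → (∀ k, a k < b k) →
    (∀ k, a k ≤ r) → (∀ k, r ≤ b k) → Tendsto a atTop (𝓝 r) → Tendsto b atTop (𝓝 r) →
    (∀ k, volume.real (F ∩ (closedBall 0 (b k) \ ball 0 (a k))) ≤ A * (b k - a k)) →
    ∀ φ₁ φ₂ : EV n → EV n, ContDiff ℝ 1 φ₁ → HasCompactSupport φ₁ → (∀ x, ‖φ₁ x‖ ≤ 1) →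
      ContDiff ℝ 1 φ₂ → HasCompactSupport φ₂ → (∀ x, ‖φ₂ x‖ ≤ 1) →
    (∫ x in F ∩ closedBall 0 r, vdiv φ₁ x) + ∫ x in F \ closedBall 0 r, vdiv φ₂ x
      ≤ p + L * A := by
  obtain ⟨L, hL0, hL⟩ := cutoff
  refine ⟨2 * L, by positivity, fun n F hF p hp r A a b ha hab har hrb hat hbt hA φ₁ φ₂ h1 h1c h1b
    h2 h2c h2b => ?_⟩
  choose η hη hηc h01 hone hzero hsl hout _hs1 using fun k : ℕ ↦ hL n (a k) (b k) (ha k) (hab k)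
  have hr0 : r ≠ 0 := ((ha 0).trans_le (har 0)).ne'
  have hsph : volume (sphere (0 : EV n) r) = 0 :=
    Measure.addHaar_sphere_of_ne_zero _ _ hr0
  have hd1 := vdiv_integrable h1 h1c
  have hd2 := vdiv_integrable h2 h2c
  have key : ∀ k, (∫ x in F, η k x * vdiv φ₁ x) + ∫ x in F, (1 - η k x) * vdiv φ₂ x
      ≤ p + 2 * L * A := fun k ↦ by
    have hη' : ContDiff ℝ 1 (fun x ↦ 1 - η k x) := contDiff_const.sub (hη k)
    have hη'' : ∀ x, fderiv ℝ (fun x ↦ 1 - η k x) x = - fderiv ℝ (η k) x := fun x ↦ by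
      rw [fderiv_const_sub]
    have hdd : ∀ x, vdiv (fun x ↦ η k x • φ₁ x + (1 - η k x) • φ₂ x) x =
        η k x * vdiv φ₁ x + (1 - η k x) * vdiv φ₂ x + fderiv ℝ (η k) x (φ₁ x - φ₂ x) := fun x ↦ by
      have e1 := vdiv_smul ((hη k).differentiable one_ne_zero x) (h1.differentiable one_ne_zero x)
      have e2 : vdiv (fun x ↦ (1 - η k x) • φ₂ x) x =
          (1 - η k x) * vdiv φ₂ x + fderiv ℝ (fun x ↦ 1 - η k x) x (φ₂ x) :=
        vdiv_smul (hη'.differentiable one_ne_zero x) (h2.differentiable one_ne_zero x)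
      have d1 : ContDiff ℝ 1 (fun x ↦ η k x • φ₁ x) := (hη k).smul h1
      have d2 : ContDiff ℝ 1 (fun x ↦ (1 - η k x) • φ₂ x) := hη'.smul h2
      rw [vdiv_add (d1.differentiable one_ne_zero x) (d2.differentiable one_ne_zero x), e1, e2,
        hη'', map_sub, neg_apply]
      ring
    have hadm : ∀ x, ‖η k x • φ₁ x + (1 - η k x) • φ₂ x‖ ≤ 1 := fun x ↦ by
      refine (norm_add_le _ _).trans ?_
      rw [norm_smul, norm_smul, Real.norm_of_nonneg (h01 k x).1,
        Real.norm_of_nonneg (by linarith [(h01 k x).2])]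
      nlinarith [h1b x, h2b x, (h01 k x).1, (h01 k x).2]
    have s1 : HasCompactSupport (fun x ↦ η k x • φ₁ x) :=
      h1c.mono fun x hx h0 ↦ hx (by simp only [h0, smul_zero])
    have s2 : HasCompactSupport (fun x ↦ (1 - η k x) • φ₂ x) :=
      h2c.mono fun x hx h0 ↦ hx (by simp only [h0, smul_zero])
    have s3 : HasCompactSupport (fun x ↦ η k x • φ₁ x + (1 - η k x) • φ₂ x) := s1.add s2
    have s4 : ContDiff ℝ 1 (fun x ↦ η k x • φ₁ x + (1 - η k x) • φ₂ x) :=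
      ((hη k).smul h1).add (hη'.smul h2)
    have h := hp _ s4 s3 hadm
    simp_rw [hdd] at h
    have c1 := (hη k).continuous
    have c2 := (hη k).continuous_fderiv one_ne_zero
    have c3 := h1.continuous
    have c4 := h2.continuous
    have i1 : Integrable fun x ↦ η k x * vdiv φ₁ x :=
      (c1.mul (vdiv_continuous h1)).integrable_of_hasCompactSupport (vdiv_compact h1c).mul_left
    have i2 : Integrable fun x ↦ (1 - η k x) * vdiv φ₂ x :=
      ((continuous_const.sub c1).mul (vdiv_continuous h2)).integrable_of_hasCompactSupport
        (vdiv_compact h2c).mul_left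
    have i3 : Integrable fun x ↦ fderiv ℝ (η k) x (φ₁ x - φ₂ x) := by
      have c5 : Continuous fun x ↦ fderiv ℝ (η k) x (φ₁ x - φ₂ x) := by fun_prop
      refine c5.integrable_of_hasCompactSupport ?_
      refine ((hηc k).fderiv ℝ).mono ?_
      intro x hx hx'
      apply hx; simp only [hx']; simp
    have i4 : Integrable fun x ↦ η k x * vdiv φ₁ x + (1 - η k x) * vdiv φ₂ x := i1.add i2
    rw [integral_add i4.integrableOn i3.integrableOn,
      integral_add i1.integrableOn i2.integrableOn] at h
    have hS : MeasurableSet (closedBall (0 : EV n) (b k) \ ball 0 (a k)) :=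
      measurableSet_closedBall.diff measurableSet_ball
    have hSf : volume (closedBall (0 : EV n) (b k) \ ball 0 (a k)) ≠ ⊤ :=
      (measure_mono diff_subset |>.trans_lt measure_closedBall_lt_top).ne
    have h4 : -(∫ x in F, fderiv ℝ (η k) x (φ₁ x - φ₂ x)) ≤ 2 * L * A := by
      have hpos : 0 < b k - a k := sub_pos.2 (hab k)
      calc -(∫ x in F, fderiv ℝ (η k) x (φ₁ x - φ₂ x))
          = ∫ x in F, -(fderiv ℝ (η k) x (φ₁ x - φ₂ x)) := (integral_neg _).symm
        _ ≤ ∫ x in F, (closedBall (0 : EV n) (b k) \ ball 0 (a k)).indicator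
              (fun _ ↦ L / (b k - a k) * 2) x := by
            refine integral_mono i3.neg.integrableOn
              ((integrable_indicator_iff hS).2 (integrableOn_const hSf)).integrableOn fun x ↦ ?_
            by_cases hx : x ∈ closedBall (0 : EV n) (b k) \ ball 0 (a k)
            · rw [indicator_of_mem hx]
              calc _ ≤ ‖fderiv ℝ (η k) x (φ₁ x - φ₂ x)‖ := neg_le_abs _
                _ ≤ ‖fderiv ℝ (η k) x‖ * ‖φ₁ x - φ₂ x‖ := ContinuousLinearMap.le_opNorm _ _
                _ ≤ L / (b k - a k) * 2 := by
                  have := norm_sub_le (φ₁ x) (φ₂ x)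
                  have := h1b x
                  have := h2b x
                  gcongr
                  · exact hsl k x
                  · linarith
            · rw [indicator_of_notMem hx]
              simp [hout k x hx]
        _ = volume.real (F ∩ (closedBall (0 : EV n) (b k) \ ball 0 (a k))) * (L / (b k - a k) * 2) := by
            rw [setIntegral_indicator hS, setIntegral_const, smul_eq_mul]
        _ ≤ A * (b k - a k) * (L / (b k - a k) * 2) := by gcongr; exact hA k
        _ = 2 * L * A := by field_simp
    linarith
  have lim : Tendsto (fun k ↦ (∫ x in F, η k x * vdiv φ₁ x) + ∫ x in F, (1 - η k x) * vdiv φ₂ x)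
      atTop (𝓝 ((∫ x in F ∩ closedBall 0 r, vdiv φ₁ x) + ∫ x in F \ closedBall 0 r, vdiv φ₂ x)) := by
    have hae : ∀ᵐ x : EV n, Tendsto (fun k ↦ η k x) atTop (𝓝 ((closedBall 0 r).indicator 1 x)) := by
      filter_upwards [compl_mem_ae_iff.2 hsph] with x hx
      have hx : ‖x‖ ≠ r := by simpa using hx
      refine tendsto_const_nhds.congr' ?_
      rcases lt_or_gt_of_ne hx with hx | hx
      · filter_upwards [hat.eventually_const_lt hx] with k hk
        simp [hone k x hk.le, hx.le]
      · filter_upwards [hbt.eventually_lt_const hx] with k hk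
        rw [hzero k x hk.le, indicator_of_notMem (by simpa using hx)]
    rw [Set.sdiff_eq, ← setIntegral_indicator measurableSet_closedBall,
      ← setIntegral_indicator measurableSet_closedBall.compl]
    refine Tendsto.add ?_ ?_
    · refine tendsto_integral_of_dominated_convergence (fun x ↦ ‖vdiv φ₁ x‖) (fun k ↦ ?_)
        hd1.norm.integrableOn (fun k ↦ Eventually.of_forall fun x ↦ ?_) ?_
      · exact ((hη k).continuous.mul (vdiv_continuous h1)).aestronglyMeasurable
      · rw [norm_mul, Real.norm_of_nonneg (h01 k x).1]
        exact mul_le_of_le_one_left (norm_nonneg _) (h01 k x).2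
      · filter_upwards [ae_restrict_of_ae hae] with x hx
        convert hx.mul_const (vdiv φ₁ x) using 2
        by_cases h : x ∈ closedBall (0 : EV n) r <;> simp [indicator, h]
    · refine tendsto_integral_of_dominated_convergence (fun x ↦ ‖vdiv φ₂ x‖) (fun k ↦ ?_)
        hd2.norm.integrableOn (fun k ↦ Eventually.of_forall fun x ↦ ?_) ?_
      · exact ((continuous_const.sub (hη k).continuous).mul
          (vdiv_continuous h2)).aestronglyMeasurable
      · rw [norm_mul, Real.norm_of_nonneg (by linarith [(h01 k x).2])]
        exact mul_le_of_le_one_left (norm_nonneg _) (by linarith [(h01 k x).1])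
      · filter_upwards [ae_restrict_of_ae hae] with x hx
        convert (hx.const_sub 1).mul_const (vdiv φ₂ x) using 2
        by_cases h : x ∈ closedBall (0 : EV n) r <;> simp [indicator, h]
  exact le_of_tendsto' lim key
variable {m : ℕ}
def ins (i : Fin (m + 1)) (t : ℝ) (x : EV m) : EV (m + 1) :=
  WithLp.toLp 2 (i.insertNth (α := fun _ ↦ ℝ) t (WithLp.ofLp x))
lemma ins_same (i : Fin (m + 1)) (t : ℝ) (x : EV m) : ins i t x i = t := by
  simp [ins]
lemma ins_succ (i : Fin (m + 1)) (t : ℝ) (x : EV m) (j : Fin m) : ins i t x (i.succAbove j) = x j := by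
  simp [ins]
lemma ins_norm_sq (i : Fin (m + 1)) (t : ℝ) (x : EV m) : ‖ins i t x‖ ^ 2 = t ^ 2 + ‖x‖ ^ 2 := by
  rw [EuclideanSpace.norm_sq_eq, EuclideanSpace.norm_sq_eq, Fin.sum_univ_succAbove _ i]
  simp [ins_same, ins_succ]
def insJ (i : Fin (m + 1)) : EV m →ₗᵢ[ℝ] EV (m + 1) where
  toFun x := ins i 0 x
  map_add' x y := by
    ext j
    obtain rfl | ⟨k, rfl⟩ := Fin.eq_self_or_eq_succAbove i j <;> simp [ins_same, ins_succ]
  map_smul' c x := by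
    ext j
    obtain rfl | ⟨k, rfl⟩ := Fin.eq_self_or_eq_succAbove i j <;> simp [ins_same, ins_succ]
  norm_map' x := by
    have := ins_norm_sq i 0 x
    simp only [LinearMap.coe_mk, AddHom.coe_mk]
    have h : ‖ins i 0 x‖ ^ 2 = ‖x‖ ^ 2 := by linarith
    exact (pow_left_inj₀ (norm_nonneg _) (norm_nonneg _) two_ne_zero).1 h
lemma ins_eq (i : Fin (m + 1)) (t : ℝ) (x : EV m) :
    ins i t x = t • EuclideanSpace.single i ♮1 + insJ i x := by
  ext j
  obtain rfl | ⟨k, rfl⟩ := Fin.eq_self_or_eq_succAbove i j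
  · simp [ins_same, insJ]
  · simp [ins_succ, insJ, Fin.succAbove_ne]
lemma ins_continuous (i : Fin (m + 1)) : Continuous fun p : ℝ × EV m ↦ ins i p.1 p.2 := by
  simp_rw [ins_eq]
  exact (continuous_fst.smul continuous_const).add ((insJ i).continuous.comp continuous_snd)
lemma ins_mp (i : Fin (m + 1)) : MeasurePreserving (fun p : ℝ × EV m ↦ ins i p.1 p.2)
    ((volume : Measure ℝ).prod (volume : Measure (EV m))) volume := by
  have h1 : MeasurePreserving (fun p : ℝ × EV m ↦ (p.1, WithLp.ofLp p.2))
      ((volume : Measure ℝ).prod volume) ((volume : Measure ℝ).prod volume) :=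
    (MeasurePreserving.id _).prod (PiLp.volume_preserving_ofLp (Fin m))
  have h2 := (volume_preserving_piFinSuccAbove (fun _ : Fin (m + 1) ↦ ℝ) i).symm
  exact (PiLp.volume_preserving_toLp (Fin (m + 1))).comp (h2.comp h1)
lemma ins_emb (i : Fin (m + 1)) : MeasurableEmbedding (fun p : ℝ × EV m ↦ ins i p.1 p.2) := by
  refine (ins_continuous i).measurableEmbedding ?_
  rintro ⟨t, x⟩ ⟨s, y⟩ h
  have h1 := ins_same i t x
  simp only at h
  rw [h, ins_same] at h1
  refine Prod.ext h1.symm ?_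
  ext j
  have h2 := ins_succ i t x j
  rw [h, ins_succ] at h2
  exact h2.symm
lemma ins_integrable (i : Fin (m + 1)) {g : EV (m + 1) → ℝ} (hg : Integrable g) :
    Integrable (fun p : ℝ × EV m ↦ g (ins i p.1 p.2))
      ((volume : Measure ℝ).prod (volume : Measure (EV m))) :=
  ((ins_mp i).integrable_comp_emb (ins_emb i)).2 hg
lemma fub (i : Fin (m + 1)) {g : EV (m + 1) → ℝ} (hg : Integrable g) :
    ∫ x, g x = ∫ t, ∫ x, g (ins i t x) := by
  rw [← (ins_mp i).integral_comp (ins_emb i), integral_prod _ (ins_integrable i hg)]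
lemma fub_int (i : Fin (m + 1)) {g : EV (m + 1) → ℝ} (hg : Integrable g) :
    Integrable fun t ↦ ∫ x, g (ins i t x) :=
  (ins_integrable i hg).integral_prod_left
lemma ins_norm_ge (i : Fin (m + 1)) (t : ℝ) (x : EV m) : |t| ≤ ‖ins i t x‖ ∧ ‖x‖ ≤ ‖ins i t x‖ := by
  have h := ins_norm_sq i t x
  constructor
  · refine pow_le_pow_iff_left₀ (abs_nonneg _) (norm_nonneg _) two_ne_zero |>.1 ?_
    rw [sq_abs]; nlinarith
  · exact pow_le_pow_iff_left₀ (norm_nonneg _) (norm_nonneg _) two_ne_zero |>.1 (by nlinarith)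
def sl (i : Fin (m + 1)) (g : EV (m + 1) → ℝ) (t : ℝ) : ℝ := ∫ x, g (ins i t x)
lemma slice_cs (i : Fin (m + 1)) {g : EV (m + 1) → ℝ} (hc : HasCompactSupport g) :
    ∃ R : ℝ, 0 < R ∧ (∀ x, R < ‖x‖ → g x = 0) ∧ (∀ t x, R < |t| → g (ins i t x) = 0) ∧
      ∀ t x, R < ‖x‖ → g (ins i t x) = 0 := by
  obtain ⟨R, hR⟩ := hc.isCompact.isBounded.subset_closedBall 0
  have h0 : ∀ x, max R 1 < ‖x‖ → g x = 0 := fun x hx ↦ by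
    by_contra h
    have := hR (subset_tsupport g h)
    rw [mem_closedBall_zero_iff] at this
    exact absurd hx (not_lt.2 (this.trans (le_max_left _ _)))
  exact ⟨max R 1, by positivity, h0, fun t x h ↦ h0 _ (h.trans_le (ins_norm_ge i t x).1),
    fun t x h ↦ h0 _ (h.trans_le (ins_norm_ge i t x).2)⟩
lemma sl_continuous (i : Fin (m + 1)) {g : EV (m + 1) → ℝ} (hg : Continuous g)
    (hc : HasCompactSupport g) : Continuous (sl i g) := by
  obtain ⟨R, -, -, -, h⟩ := slice_cs i hc
  have h1 : sl i g = fun t ↦ ∫ x in closedBall (0 : EV m) R, g (ins i t x) := by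
    ext t
    rw [sl, setIntegral_eq_integral_of_forall_compl_eq_zero]
    intro x hx
    rw [mem_closedBall_zero_iff, not_le] at hx
    exact h t x hx
  rw [h1]
  exact continuous_parametric_integral_of_continuous (f := fun t x ↦ g (ins i t x)) (hg.comp (ins_continuous i))
    (isCompact_closedBall _ _)
lemma sl_cs (i : Fin (m + 1)) {g : EV (m + 1) → ℝ} (hc : HasCompactSupport g) :
    ∃ R : ℝ, 0 < R ∧ ∀ t, R < |t| → sl i g t = 0 := by
  obtain ⟨R, hR, -, h, -⟩ := slice_cs i hc
  exact ⟨R, hR, fun t ht ↦ by simp [sl, h t _ ht]⟩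
lemma sl_nonneg (i : Fin (m + 1)) {g : EV (m + 1) → ℝ} (hg : ∀ x, 0 ≤ g x) (t : ℝ) : 0 ≤ sl i g t :=
  integral_nonneg fun _ ↦ hg _
lemma slice_diff (i : Fin (m + 1)) {f : EV (m + 1) → ℝ} (hf : ContDiff ℝ 1 f) (t : ℝ) :
    ContDiff ℝ 1 (fun x ↦ f (ins i t x)) ∧
    ∀ x, fderiv ℝ (fun x ↦ f (ins i t x)) x =
      (fderiv ℝ f (ins i t x)).comp (insJ i).toContinuousLinearMap := by
  have h : ∀ x, HasFDerivAt (fun x ↦ ins i t x) (insJ i).toContinuousLinearMap x := fun x ↦ by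
    simp_rw [ins_eq]
    exact (insJ i).toContinuousLinearMap.hasFDerivAt.const_add _
  have h2 : ContDiff ℝ 1 (fun x ↦ ins i t x) := by
    simp_rw [ins_eq]
    exact contDiff_const.add (insJ i).toContinuousLinearMap.contDiff
  refine ⟨hf.comp h2, fun x ↦ ?_⟩
  exact ((hf.differentiable one_ne_zero _).hasFDerivAt.comp x (h x)).fderiv
lemma slice_compact (i : Fin (m + 1)) {f : EV (m + 1) → ℝ} (hc : HasCompactSupport f) (t : ℝ) :
    HasCompactSupport (fun x ↦ f (ins i t x)) := by
  obtain ⟨R, -, -, -, h⟩ := slice_cs i hc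
  refine HasCompactSupport.intro (isCompact_closedBall 0 R) fun x hx ↦ h t x ?_
  simpa using hx
lemma grad_ge (i : Fin (m + 1)) (l : EV (m + 1) →L[ℝ] ℝ) {τ : ℝ} (hτ : |τ| ≤ 1) :
    -τ * l (EuclideanSpace.single i 1) +
      Real.sqrt (1 - τ ^ 2) * ‖l.comp (insJ i).toContinuousLinearMap‖ ≤ ‖l‖ := by
  have hτ2 : τ ^ 2 ≤ 1 := by rw [← sq_abs]; exact pow_le_one₀ (abs_nonneg _) hτ
  set s := Real.sqrt (1 - τ ^ 2) with hs
  have hs2 : s ^ 2 = 1 - τ ^ 2 := Real.sq_sqrt ♦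
  have hs0 : 0 ≤ s := Real.sqrt_nonneg _
  have key : ∀ y : EV m, ‖y‖ ≤ 1 → -τ * l (EuclideanSpace.single i 1) + s * l (insJ i y) ≤ ‖l‖ := by
    intro y hy
    have h1 : -τ * l (EuclideanSpace.single i 1) + s * l (insJ i y) = l (ins i (-τ) (s • y)) := by
      rw [ins_eq]; simp
    have h2 : ‖ins i (-τ) (s • y)‖ ≤ 1 := by
      have h3 := ins_norm_sq i (-τ) (s • y)
      rw [norm_smul, Real.norm_of_nonneg hs0, mul_pow, hs2] at h3
      have h4 : ‖y‖ ^ 2 ≤ 1 := pow_le_one₀ (norm_nonneg _) hy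
      have : ‖ins i (-τ) (s • y)‖ ^ 2 ≤ 1 := by nlinarith
      exact (sq_le_one_iff₀ (norm_nonneg _)).1 this
    rw [h1]
    calc l (ins i (-τ) (s • y)) ≤ ‖l (ins i (-τ) (s • y))‖ := le_abs_self _
      _ ≤ ‖l‖ * ‖ins i (-τ) (s • y)‖ := l.le_opNorm _
      _ ≤ ‖l‖ := mul_le_of_le_one_right (norm_nonneg _) h2
  rcases hs0.eq_or_lt with h | h
  · have := key 0 ♥
    rw [← h] at this ⊢
    simpa using this
  · have : ‖l.comp (insJ i).toContinuousLinearMap‖ ≤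
        (‖l‖ + τ * l (EuclideanSpace.single i 1)) / s := by
      have h0 := key 0 ♥
      rw [map_zero, map_zero, mul_zero] at h0
      refine ContinuousLinearMap.opNorm_le_of_unit_norm (div_nonneg ♦ hs0) fun y hy ↦ ?_
      rw [le_div_iff₀ h, Real.norm_eq_abs]
      have h5 := key y hy.le
      have h6 := key (-y) (by simpa using hy.le)
      simp only [map_neg] at h6
      change |l (insJ i y)| * s ≤ _
      rcases abs_cases (l (insJ i y)) with ⟨h7, -⟩ | ⟨h7, -⟩ <;> rw [h7] <;> nlinarith
    rw [le_div_iff₀ h] at this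
    linarith
lemma ww_rec (m : ℕ) : ww (m + 1) = ∫ s in (-1:ℝ)..1, ww m * Real.sqrt (1 - s ^ 2) ^ m := by
  have h1 : ww (m + 1) = ∫ x, (ball (0 : EV (m + 1)) 1).indicator 1 x := by
    rw [integral_indicator_one measurableSet_ball]; rfl
  have h0 : Integrable ((ball (0 : EV (m + 1)) 1).indicator (1 : EV (m+1) → ℝ)) :=
    (integrable_indicator_iff measurableSet_ball).2 (integrableOn_const measure_ball_lt_top.ne)
  rw [h1, fub 0 h0, intervalIntegral.integral_of_le ♣,
    integral_Ioc_eq_integral_Ioo, ← integral_indicator measurableSet_Ioo]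
  congr 1
  ext t
  by_cases ht : t ∈ Ioo (-1:ℝ) 1
  · rw [indicator_of_mem ht]
    have ht2 : 0 < 1 - t ^ 2 := by nlinarith [ht.1, ht.2]
    have : (fun x ↦ (ball (0 : EV (m + 1)) 1).indicator (1 : EV (m+1) → ℝ) (ins 0 t x)) =
        (ball (0 : EV m) (Real.sqrt (1 - t ^ 2))).indicator 1 := by
      ext x
      have h2 : ins 0 t x ∈ ball (0 : EV (m + 1)) 1 ↔ x ∈ ball (0 : EV m) (Real.sqrt (1 - t ^ 2)) := by
        rw [mem_ball_zero_iff, mem_ball_zero_iff, Real.lt_sqrt (norm_nonneg _),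
          ← sq_lt_one_iff₀ (norm_nonneg _), ins_norm_sq]
        constructor <;> intro h <;> linarith
      by_cases hx : x ∈ ball (0 : EV m) (Real.sqrt (1 - t ^ 2))
      · rw [indicator_of_mem hx, indicator_of_mem (h2.2 hx)]; simp
      · rw [indicator_of_notMem hx, indicator_of_notMem (fun h ↦ hx (h2.1 h))]
    rw [this, integral_indicator_one measurableSet_ball]
    have h3 := Measure.addHaar_ball_of_pos (volume : Measure (EV m)) 0 (Real.sqrt_pos.2 ht2)
    rw [measureReal_def, h3, ENNReal.toReal_mul, ENNReal.toReal_ofReal ♠]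
    simp [ww, measureReal_def, mul_comm]
  · rw [indicator_of_notMem ht]
    have : ∀ x, (ball (0 : EV (m + 1)) 1).indicator (1 : EV (m+1) → ℝ) (ins 0 t x) = 0 := fun x ↦ by
      rw [indicator_of_notMem]
      rw [mem_ball_zero_iff, not_lt]
      refine le_trans ?_ (ins_norm_ge 0 t x).1
      by_contra h
      exact ht (abs_lt.1 (not_le.1 h))
    simp [this]
def vB (m : ℕ) (s : ℝ) : ℝ := ww m * Real.sqrt (1 - s ^ 2) ^ m
lemma vB_continuous (m : ℕ) : Continuous (vB m) := by unfold vB; fun_prop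
lemma vB_nonneg (m : ℕ) (s : ℝ) : 0 ≤ vB m s := by
  have := ww_pos m
  unfold vB; positivity
lemma vB_pos (m : ℕ) {s : ℝ} (hs : |s| < 1) : 0 < vB m s := by
  have := ww_pos m
  have : 0 < Real.sqrt (1 - s ^ 2) := Real.sqrt_pos.2 (by
    rw [← sq_abs]; nlinarith [abs_nonneg s])
  unfold vB; positivity
lemma vB_even (m : ℕ) (s : ℝ) : vB m (-s) = vB m s := by simp [vB]
lemma quantile (m : ℕ) : ∃ T : ℝ → ℝ, T 0 = 0 ∧ StrictMono T ∧ Continuous T ∧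
    (∀ u, |u| < 1 / 2 → |T u| < 1) ∧ ∀ u, |u| < 1 / 2 → HasDerivAt T (ww (m + 1) / vB m (T u)) u := by
  let k : ℝ → ℝ := fun s ↦ vB m s / ww (m + 1) + max 0 (|s| - 1)
  have hw := ww_pos (m + 1)
  have hk : Continuous k := by
    have := vB_continuous m
    fun_prop
  have hk0 : ∀ s, 0 ≤ k s := fun s ↦ by
    have := vB_nonneg m s
    positivity
  have hkp : ∀ s, |s| ≠ 1 → 0 < k s := fun s hs ↦ by
    rcases lt_or_gt_of_ne hs with h | h
    · have := vB_pos m h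
      positivity
    · have := vB_nonneg m s
      have : 0 < max 0 (|s| - 1) := lt_max_of_lt_right ♦
      positivity
  have hke : ∀ s, k (-s) = k s := fun s ↦ by simp [k, vB_even]
  let Φ : ℝ → ℝ := fun s ↦ ∫ t in ♮0..s, k t
  have hii : ∀ a b, IntervalIntegrable k volume a b := fun a b ↦ hk.intervalIntegrable a b
  have hd : ∀ s, HasDerivAt Φ (k s) s := fun s ↦ hk.integral_hasStrictDerivAt 0 s |>.hasDerivAt
  have hΦc : Continuous Φ := continuous_iff_continuousAt.2 fun s ↦ (hd s).continuousAt
  have hsub : ∀ a b, Φ b - Φ a = ∫ t in a..b, k t := fun a b ↦ by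
    simp only [Φ]; exact intervalIntegral.integral_interval_sub_left (hii _ _) (hii _ _)
  have hmono : StrictMono Φ := fun a b hab ↦ by
    have : 0 < ∫ t in a..b, k t := by
      refine intervalIntegral.integral_pos hab hk.continuousOn (fun x _ ↦ hk0 x) ?_
      by_contra! h
      have h1 : ∀ c ∈ Icc a b, |c| = 1 := fun c hc ↦ by
        by_contra h2
        exact absurd (h c hc) (not_le.2 (hkp c h2))
      have e1 := h1 a ⟨le_rfl, hab.le⟩
      have e2 := h1 b ⟨hab.le, le_rfl⟩
      have e3 := h1 ((a + b) / 2) ⟨by linarith, by linarith⟩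
      rcases abs_eq zero_le_one |>.1 e1 with e1 | e1 <;>
      rcases abs_eq zero_le_one |>.1 e2 with e2 | e2 <;>
      rcases abs_eq zero_le_one |>.1 e3 with e3 | e3 <;> linarith
    linarith [hsub a b]
  have hodd : ∀ s, Φ (-s) = -Φ s := fun s ↦ by
    have := intervalIntegral.integral_comp_neg (a := 0) (b := -s) k
    simp only [hke, neg_zero, neg_neg] at this
    simp only [Φ]
    rw [this, intervalIntegral.integral_symm]
  have htop : Tendsto Φ atTop atTop := by
    have h0 : Φ 0 = 0 := by simp [Φ]
    refine tendsto_atTop_mono' atTop (f₁ := fun s ↦ s - 2) ?_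
      (tendsto_atTop_add_const_right atTop _ tendsto_id)
    filter_upwards [eventually_ge_atTop 2] with s hs
    have h1 : (∫ t in ♮2..s, ♮1) ≤ ∫ t in ♮2..s, k t := by
      refine intervalIntegral.integral_mono_on hs ♥ (hii _ _) fun x hx ↦ ?_
      have := vB_nonneg m x
      have h2 : 1 ≤ max 0 (|x| - 1) := le_max_of_le_right (by linarith [le_abs_self x, hx.1])
      have : 0 ≤ vB m x / ww (m + 1) := by positivity
      simp only [k]; linarith
    have h3 := hsub 2 s
    have h4 := hmono (show ♮0 < 2 by norm_num)
    simp at h1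
    linarith
  have hbot : Tendsto Φ atBot atBot := by
    have : Tendsto (fun s ↦ -Φ (-s)) atBot atBot :=
      tendsto_neg_atTop_atBot.comp (htop.comp tendsto_neg_atBot_atTop)
    simpa [hodd] using this
  have hΦ1 : Φ 1 = 1 / 2 := by
    have h1 : Φ 1 - Φ (-1) = 1 := by
      rw [hsub]
      have : ∀ s ∈ uIcc (-1:ℝ) 1, k s = vB m s / ww (m + 1) := fun s hs ↦ by
        rw [uIcc_of_le ♣] at hs
        have : |s| ≤ 1 := abs_le.2 hs
        simp [k, this]
      rw [intervalIntegral.integral_congr this, intervalIntegral.integral_div]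
      have h2 := ww_rec m
      change ww (m+1) = ∫ s in (-1:ℝ)..1, vB m s at h2
      rw [← h2, div_self hw.ne']
    rw [hodd] at h1; linarith
  let e := hmono.orderIsoOfSurjective Φ (hΦc.surjective htop hbot)
  have heΦ : ∀ u, Φ (e.symm u) = u := fun u ↦ e.apply_symm_apply u
  have hΦe : ∀ u, e.symm (Φ u) = u := fun u ↦ e.symm_apply_apply u
  have hlt : ∀ u, |u| < 1 / 2 → |e.symm u| < 1 := fun u hu ↦ by
    rw [abs_lt] at hu ⊢
    constructor
    · rw [← hmono.lt_iff_lt, heΦ, hodd, hΦ1]; exact hu.1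
    · rw [← hmono.lt_iff_lt, heΦ, hΦ1]; exact hu.2
  refine ⟨e.symm, ?_, e.symm.strictMono, e.symm.continuous, hlt, fun u hu ↦ ?_⟩
  · have h0 : Φ 0 = 0 := by simp [Φ]
    conv_lhs => rw [← h0]
    exact hΦe 0
  · have h1 := hlt u hu
    have h2 : k (e.symm u) = vB m (e.symm u) / ww (m + 1) := by simp [k, h1.le]
    have h3 := HasDerivAt.of_local_left_inverse (f := Φ) (g := e.symm) (a := u)
      e.symm.continuous.continuousAt (hd _) (hkp _ h1.ne).ne' (Eventually.of_forall heΦ)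
    rw [h2, inv_div] at h3
    exact h3
def gg (z : ℝ) : ℝ := (max 0 (1 - z)) ^ 2 / 2
lemma gg_nonneg (z : ℝ) : 0 ≤ gg z := by unfold gg; positivity
lemma G_ge {m : ℕ} (hm : 1 ≤ m) {z : ℝ} (hz : 0 < z) :
    (m + 1 : ℝ) + gg z ≤ z + m * z ^ (-(1 / ♮m)) := by
  have hm0 : ♮0 < m := by exact_mod_cast hm
  have h1 : ♮m - Real.log z ≤ m * z ^ (-(1 / ♮m)) := by
    rw [Real.rpow_def_of_pos hz]
    have := Real.add_one_le_exp (Real.log z * -(1 / ♮m))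
    have h2 := mul_le_mul_of_nonneg_left this hm0.le
    have h3 : ♮m * (Real.log z * -(1 / ♮m) + 1) = m - Real.log z := by field_simp; ring
    linarith
  have h2 : 1 + gg z ≤ z - Real.log z := by
    rcases le_or_gt 1 z with h | h
    · have : gg z = 0 := by simp [gg, h]
      have := Real.log_le_sub_one_of_pos hz
      linarith
    · have h3 : gg z = (1 - z) ^ 2 / 2 := by rw [gg, max_eq_right ♦]
      have h4 := Real.hasSum_pow_div_log_of_abs_lt_one (x := 1 - z) (by
        rw [abs_lt]; constructor <;> linarith)
      have h5 := h4.summable.sum_le_tsum (Finset.range 2) (fun i _ ↦ by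
        have : 0 < 1 - z := by linarith
        positivity)
      rw [h4.tsum_eq] at h5
      simp [Finset.sum_range_succ] at h5
      norm_num at h5
      linarith
  linarith
lemma alg_pt {m : ℕ} (hm : 1 ≤ m) {c s v M D : ℝ} (hc : 0 < c) (hs : 0 < s) (hv : 0 < v) (hM : 0 ≤ M)
    (hH : ♮m * ww m ^ (1 / ♮m) * M ≤ D * v ^ (1 / ♮m)) :
    c ^ (1 / (m + 1 : ℝ)) * (M * ((m + 1 : ℝ) + gg (c ^ (m / (m + 1 : ℝ)) * (v / (ww m * s ^ m)))))
      ≤ c * M / (ww m * s ^ m) * v + s * D := by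
  have hm0 : ♮0 < m := by exact_mod_cast hm
  have hw := ww_pos m
  set y := v / (ww m * s ^ m) with hy
  have hy0 : 0 < y := by positivity
  set z := c ^ (m / (m + 1 : ℝ)) * y with hz
  have hz0 : 0 < z := by positivity
  have e1 : y ^ (1 / ♮m) = v ^ (1 / ♮m) / (ww m ^ (1 / ♮m) * s) := by
    rw [hy, Real.div_rpow hv.le ♠, Real.mul_rpow hw.le ♠,
      ← Real.rpow_natCast_mul hs.le, mul_one_div_cancel hm0.ne', Real.rpow_one]
  have hyp : 0 < y ^ (1 / ♮m) := by positivity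
  have e2 : m * M * y ^ (-(1 / ♮m)) ≤ s * D := by
    rw [Real.rpow_neg hy0.le, ← div_eq_mul_inv, div_le_iff₀ hyp, e1]
    rw [mul_div_assoc', le_div_iff₀ ♠]
    have := mul_le_mul_of_nonneg_right hH hs.le
    linarith
  have e3 : c ^ (1 / (m + 1 : ℝ)) * z = c * y := by
    rw [hz, ← mul_assoc, ← Real.rpow_add hc, ← add_div, add_comm ♮1, div_self ♠,
      Real.rpow_one]
  have e4 : c ^ (1 / (m + 1 : ℝ)) * z ^ (-(1 / ♮m)) = y ^ (-(1 / ♮m)) := by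
    rw [hz, Real.mul_rpow ♠ hy0.le, ← Real.rpow_mul hc.le, ← mul_assoc,
      ← Real.rpow_add hc]
    have : 1 / (m + 1 : ℝ) + m / (m + 1 : ℝ) * -(1 / ♮m) = 0 := by field_simp; ring
    rw [this, Real.rpow_zero, one_mul]
  have hG := G_ge hm hz0
  have hc1 : 0 < c ^ (1 / (m + 1 : ℝ)) := by positivity
  calc _ ≤ c ^ (1 / (m + 1 : ℝ)) * (M * (z + m * z ^ (-(1 / ♮m)))) := by gcongr
    _ = M * (c ^ (1 / (m + 1 : ℝ)) * z) + m * M * (c ^ (1 / (m + 1 : ℝ)) * z ^ (-(1 / ♮m))) := by ring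
    _ = c * M / (ww m * s ^ m) * v + m * M * y ^ (-(1 / ♮m)) := by
        rw [e3, e4, hy]; ring
    _ ≤ _ := by linarith
variable {m : ℕ}
def Hm (m : ℕ) : Prop := ∀ f : EV m → ℝ, ContDiff ℝ 1 f → HasCompactSupport f → (∀ x, 0 ≤ f x) →
  ♮m * ww m ^ (1 / ♮m) * ∫ x, f x ^ ((m + 1 : ℝ) / m) ≤
    (∫ x, ‖fderiv ℝ f x‖) * (∫ x, f x) ^ (1 / ♮m)
lemma rpow_cs {n : ℕ} {f : EV n → ℝ} (hf : Continuous f) (hc : HasCompactSupport f)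
    {q : ℝ} (hq : 0 < q) :
    Continuous (fun x ↦ f x ^ q) ∧ HasCompactSupport (fun x ↦ f x ^ q) :=
  ⟨hf.rpow_const fun _ ↦ Or.inr hq.le, hc.comp_left (g := fun y : ℝ ↦ y ^ q) (Real.zero_rpow hq.ne')⟩
def cdfF (M : ℝ → ℝ) (t : ℝ) : ℝ := ∫ s in Iic t, M s
lemma cdf_deriv {M : ℝ → ℝ} (hM : Continuous M) (hi : Integrable M) (t : ℝ) :
    HasDerivAt (cdfF M) (M t) t := by
  have h : cdfF M = fun t ↦ cdfF M 0 + ∫ s in ♮0..t, M s := by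
    ext s
    have := intervalIntegral.integral_Iic_sub_Iic (f := M) (μ := volume) (a := 0) (b := s)
      hi.integrableOn hi.integrableOn
    simp only [cdfF]; linarith
  rw [h]
  exact (hM.integral_hasStrictDerivAt 0 t).hasDerivAt.const_add _
lemma cdf_mem {M : ℝ → ℝ} (h0 : ∀ t, 0 ≤ M t) (hi : Integrable M) (t : ℝ) :
    0 ≤ cdfF M t ∧ cdfF M t ≤ ∫ s, M s :=
  ⟨setIntegral_nonneg measurableSet_Iic fun s _ ↦ h0 s,
    setIntegral_le_integral hi (Eventually.of_forall h0)⟩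
def tauF (T M : ℝ → ℝ) (η t : ℝ) : ℝ := T ((1 - 2 * η) * (cdfF M t / (∫ s, M s) - 1 / 2))
def QT (m : ℕ) (T : ℝ → ℝ) : Prop := T 0 = 0 ∧ StrictMono T ∧ Continuous T ∧
    (∀ u, |u| < 1 / 2 → |T u| < 1) ∧ ∀ u, |u| < 1 / 2 → HasDerivAt T (ww (m + 1) / vB m (T u)) u
def cc (m : ℕ) (η W : ℝ) : ℝ := (1 - 2 * η) * ww (m + 1) / W
lemma tau_props {T M : ℝ → ℝ} (hT : QT m T) (hM : Continuous M) (hi : Integrable M)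
    (h0 : ∀ t, 0 ≤ M t) (hW : 0 < ∫ s, M s) {η : ℝ} (hη : 0 < η) (hη' : η < 1 / 2) (t : ℝ) :
    |tauF T M η t| < 1 ∧
      HasDerivAt (tauF T M η) (cc m η (∫ s, M s) * M t / vB m (tauF T M η t)) t := by
  obtain ⟨-, -, -, hT1, hT2⟩ := hT
  have hV := cdf_mem h0 hi t
  have hu : |(1 - 2 * η) * (cdfF M t / (∫ s, M s) - 1 / 2)| < 1 / 2 := by
    have h1 : 0 ≤ cdfF M t / (∫ s, M s) := by have := hV.1; positivity
    have h2 : cdfF M t / (∫ s, M s) ≤ 1 := (div_le_one hW).2 hV.2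
    rw [abs_lt]; constructor <;> nlinarith
  refine ⟨hT1 _ hu, ?_⟩
  have hd := (((cdf_deriv hM hi t).div_const (∫ s, M s)).sub_const (1 / 2)).const_mul (1 - 2 * η)
  have := (hT2 _ hu).comp t hd
  refine this.congr_deriv ?_
  simp only [tauF, cc]; ring
lemma slice_main (hm : 1 ≤ m) (H : Hm m) {f : EV (m + 1) → ℝ} (hf : ContDiff ℝ 1 f)
    (hc : HasCompactSupport f) (h0 : ∀ x, 0 ≤ f x) (i : Fin (m + 1)) {W : ℝ}
    (hW : W = ∫ x, f x ^ ((m + 1 : ℝ) / m)) (hWp : 0 < W)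
    {T : ℝ → ℝ} (hT : QT m T) {η : ℝ} (hη : 0 < η) (hη' : η < 1 / 2) {M τ : ℝ → ℝ}
    (hMd : M = sl i fun x ↦ f x ^ ((m + 1 : ℝ) / m)) (hτd : τ = tauF T M η) :
    cc m η W ^ (1 / (m + 1 : ℝ)) * ((m + 1) * W +
      ∫ t, M t * gg (cc m η W ^ (m / (m + 1 : ℝ)) * (sl i f t / vB m (τ t)))) ≤
      ∫ x, ‖fderiv ℝ f x‖ := by
  have hm0 : ♮0 < m := by exact_mod_cast hm
  have hq : ♮0 < (m + 1 : ℝ) / m := by positivity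
  obtain ⟨fq1, fq2⟩ := rpow_cs hf.continuous hc hq
  have fqi : Integrable fun x ↦ f x ^ ((m + 1 : ℝ) / m) := fq1.integrable_of_hasCompactSupport fq2
  have hMc : Continuous M := hMd ▸ sl_continuous i fq1 fq2
  have hMi : Integrable M := hMd ▸ fub_int i fqi
  have hM0 : ∀ t, 0 ≤ M t := hMd ▸ sl_nonneg i (fun x ↦ Real.rpow_nonneg (h0 x) _)
  have hMW : ∫ s, M s = W := by rw [hW, fub i fqi, hMd]; rfl
  have hτp := fun t ↦ tau_props hT hMc hMi hM0 (hMW ▸ hWp) hη hη' t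
  rw [← hτd, hMW] at hτp
  set c := cc m η W with hcdef
  have hc0 : 0 < c := by
    have := ww_pos (m + 1)
    have : 0 < 1 - 2 * η := by linarith
    rw [hcdef, cc]; positivity
  have hτc : Continuous τ := continuous_iff_continuousAt.2 fun t ↦ (hτp t).2.continuousAt
  have hvBp : ∀ t, 0 < vB m (τ t) := fun t ↦ vB_pos m (hτp t).1
  have hvBc : Continuous fun t ↦ vB m (τ t) := (vB_continuous m).comp hτc
  set τ' : ℝ → ℝ := fun t ↦ c * M t / vB m (τ t) with hτ'
  have hτ'c : Continuous τ' := (continuous_const.mul hMc).div hvBc fun t ↦ (hvBp t).ne'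
  have hτ1 : ContDiff ℝ 1 τ := by
    rw [contDiff_one_iff_deriv]
    refine ⟨fun t ↦ (hτp t).2.differentiableAt, ?_⟩
    rw [show deriv τ = τ' from funext fun t ↦ (hτp t).2.deriv]
    exact hτ'c
  let e : EV (m + 1) := EuclideanSpace.single i 1
  let pr : EV (m + 1) →L[ℝ] ℝ := EuclideanSpace.proj i
  let ψ : EV (m + 1) → EV (m + 1) := fun x ↦ τ (x i) • e
  have hψ : ContDiff ℝ 1 ψ := by
    have : ContDiff ℝ 1 fun x : EV (m + 1) ↦ τ (x i) := hτ1.comp pr.contDiff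
    exact this.smul contDiff_const
  have hvd : ∀ x, vdiv ψ x = τ' (x i) := fun x ↦ by
    have h1 : HasFDerivAt (fun x : EV (m+1) ↦ τ (x i)) (τ' (x i) • pr) x :=
      (hτp (x i)).2.comp_hasFDerivAt x pr.hasFDerivAt
    have h2 := h1.smul_const e
    simp only [vdiv, ψ]
    rw [h2.fderiv, Finset.sum_eq_single i]
    · simp [pr, e]
    · intro j _ hj
      simp [pr, e, hj]
    · simp
  have hib := ibp hf hψ (Or.inl hc)
  simp_rw [hvd] at hib
  set S : ℝ → ℝ := fun t ↦ Real.sqrt (1 - τ t ^ 2) with hS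
  have hSc : Continuous S := by fun_prop
  have hSp : ∀ t, 0 < S t := fun t ↦ Real.sqrt_pos.2 (by
    have := (hτp t).1
    rw [← sq_abs]; nlinarith [abs_nonneg (τ t)])
  have hfc := hf.continuous_fderiv one_ne_zero
  have hprc : Continuous fun x : EV (m + 1) ↦ x i := pr.continuous
  have hDc : Continuous fun x ↦ ‖(fderiv ℝ f x).comp (insJ i).toContinuousLinearMap‖ :=
    (hfc.clm_comp continuous_const).norm
  have hDs : HasCompactSupport fun x ↦ ‖(fderiv ℝ f x).comp (insJ i).toContinuousLinearMap‖ :=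
    (hc.fderiv ℝ).mono fun x hx h ↦ hx (by simp only [h]; simp)
  have i0 : Integrable fun x ↦ ‖fderiv ℝ f x‖ :=
    hfc.norm.integrable_of_hasCompactSupport (hc.fderiv ℝ).norm
  have i1 : Integrable fun x ↦ f x * τ' (x i) :=
    (hf.continuous.mul (hτ'c.comp hprc)).integrable_of_hasCompactSupport hc.mul_right
  have i2 : Integrable fun x ↦ S (x i) * ‖(fderiv ℝ f x).comp (insJ i).toContinuousLinearMap‖ :=
    ((hSc.comp hprc).mul hDc).integrable_of_hasCompactSupport hDs.mul_left
  have i3 : Integrable fun x ↦ fderiv ℝ f x (ψ x) := by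
    have c5 : Continuous fun x ↦ fderiv ℝ f x (ψ x) := hfc.clm_apply hψ.continuous
    refine c5.integrable_of_hasCompactSupport ?_
    exact (hc.fderiv ℝ).mono fun x hx h ↦ hx (by simp only [h]; simp)
  have i4 : Integrable fun x ↦ f x * τ' (x i) +
      S (x i) * ‖(fderiv ℝ f x).comp (insJ i).toContinuousLinearMap‖ := i1.add i2
  have step1 : ∫ x, (f x * τ' (x i) +
      S (x i) * ‖(fderiv ℝ f x).comp (insJ i).toContinuousLinearMap‖) ≤ ∫ x, ‖fderiv ℝ f x‖ := by
    have i5 : Integrable fun x ↦ -fderiv ℝ f x (ψ x) := i3.neg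
    rw [integral_add i1 i2, hib, ← integral_neg, ← integral_add i5 i2]
    refine integral_mono (i5.add i2) i0 fun x ↦ ?_
    have := grad_ge i (fderiv ℝ f x) (hτp (x i)).1.le
    simp only [ψ, map_smul, smul_eq_mul, e, S]
    linarith
  refine le_trans ?_ step1
  rw [fub i i4]
  have hzc : Continuous fun t ↦ M t * gg (c ^ (m / (m + 1 : ℝ)) * (sl i f t / vB m (τ t))) := by
    have h1 := sl_continuous i hf.continuous hc
    have h2 : Continuous fun t ↦ sl i f t / vB m (τ t) := h1.div hvBc fun t ↦ (hvBp t).ne'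
    unfold gg
    fun_prop
  obtain ⟨R, hR, hMR⟩ : ∃ R : ℝ, 0 < R ∧ ∀ t, R < |t| → M t = 0 := hMd ▸ sl_cs i fq2
  have hzi : Integrable fun t ↦ M t * gg (c ^ (m / (m + 1 : ℝ)) * (sl i f t / vB m (τ t))) := by
    refine hzc.integrable_of_hasCompactSupport ?_
    refine HasCompactSupport.intro (isCompact_closedBall 0 R) fun t ht ↦ ?_
    rw [mem_closedBall_zero_iff, not_le] at ht
    rw [hMR t ht, zero_mul]
  rw [← hMW, ← integral_const_mul, ← integral_add (hMi.const_mul _) hzi, ← integral_const_mul]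
  refine integral_mono (((hMi.const_mul _).add hzi).const_mul _) (fub_int i i4) fun t ↦ ?_
  simp only
  have hsl := slice_diff i hf t
  have hslc := slice_compact i hc t
  have hHt := H _ hsl.1 hslc (fun x ↦ h0 _)
  simp_rw [hsl.2] at hHt
  have hts : Integrable fun x ↦ ‖(fderiv ℝ f (ins i t x)).comp (insJ i).toContinuousLinearMap‖ := by
    refine Continuous.integrable_of_hasCompactSupport ?_ (slice_compact i hDs t)
    exact hDc.comp ((ins_continuous i).comp (continuous_const.prodMk continuous_id))
  have hti : Integrable fun x ↦ f (ins i t x) :=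
    hsl.1.continuous.integrable_of_hasCompactSupport hslc
  have eR : ∫ x, (f (ins i t x) * τ' (ins i t x i) + S (ins i t x i) *
      ‖(fderiv ℝ f (ins i t x)).comp (insJ i).toContinuousLinearMap‖) =
      τ' t * sl i f t + S t * ∫ x, ‖(fderiv ℝ f (ins i t x)).comp (insJ i).toContinuousLinearMap‖ := by
    simp_rw [ins_same]
    rw [integral_add (hti.mul_const _) (hts.const_mul _), integral_mul_const, integral_const_mul]
    rw [sl]; ring
  rw [eR]
  set D := ∫ x, ‖(fderiv ℝ f (ins i t x)).comp (insJ i).toContinuousLinearMap‖ with hD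
  have hD0 : 0 ≤ D := integral_nonneg fun _ ↦ norm_nonneg _
  have hMt : M t = ∫ x, f (ins i t x) ^ ((m + 1 : ℝ) / m) := by rw [hMd]; rfl
  rw [← hMt] at hHt
  have hv0 : 0 ≤ sl i f t := sl_nonneg i h0 t
  rcases hv0.eq_or_lt with hv | hv
  · have hM1 : M t = 0 := by
      rw [show (∫ x, f (ins i t x)) = sl i f t from rfl, ← hv, Real.zero_rpow ♠,
        mul_zero] at hHt
      have : 0 < ♮m * ww m ^ (1 / ♮m) := by have := ww_pos m; positivity
      exact le_antisymm (by nlinarith) (hM0 t)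
    rw [hM1, ← hv]
    have := (hSp t).le
    simp only [mul_zero, zero_mul, add_zero, zero_add]
    positivity
  · have := alg_pt hm hc0 (hSp t) hv (hM0 t) hHt
    refine le_trans (le_of_eq ?_) this
    simp only [vB, S]; ring
lemma Sob_of_Hm (hm : 1 ≤ m) (H : Hm m) {f : EV (m + 1) → ℝ} (hf : ContDiff ℝ 1 f)
    (hc : HasCompactSupport f) (h0 : ∀ x, 0 ≤ f x) :
    (m + 1 : ℝ) * ww (m + 1) ^ (1 / (m + 1 : ℝ)) *
      (∫ x, f x ^ ((m + 1 : ℝ) / m)) ^ (m / (m + 1 : ℝ)) ≤ ∫ x, ‖fderiv ℝ f x‖ := by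
  have hm0 : ♮0 < m := by exact_mod_cast hm
  set W := ∫ x, f x ^ ((m + 1 : ℝ) / m) with hW
  have hW0 : 0 ≤ W := integral_nonneg fun x ↦ Real.rpow_nonneg (h0 x) _
  rcases hW0.eq_or_lt with h | h
  · rw [← h, Real.zero_rpow ♠, mul_zero]
    exact integral_nonneg fun _ ↦ norm_nonneg _
  obtain ⟨T, hT⟩ := quantile m
  have hw := ww_pos (m + 1)
  have key : ∀ k : ℕ, cc m (1 / (♮k + 3)) W ^ (1 / (m + 1 : ℝ)) * ((m + 1) * W) ≤
      ∫ x, ‖fderiv ℝ f x‖ := fun k ↦ by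
    have h1 : 1 / (♮k + 3) < 1 / 2 := by
      apply one_div_lt_one_div_of_lt <;> linarith [(Nat.cast_nonneg k : ♮0 ≤ k)]
    refine le_trans ?_ (slice_main hm H hf hc h0 0 hW h hT ♠ h1 rfl rfl)
    have h2 : 0 ≤ cc m (1 / (♮k + 3)) W := by
      have : 0 < 1 - 2 * (1 / (♮k + 3)) := by linarith
      rw [cc]; positivity
    have h3 : 0 ≤ ∫ t, sl 0 (fun x ↦ f x ^ ((m + 1 : ℝ) / m)) t *
        gg (cc m (1 / (♮k + 3)) W ^ (m / (m + 1 : ℝ)) * (sl 0 f t /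
          vB m (tauF T (sl 0 fun x ↦ f x ^ ((m + 1 : ℝ) / m)) (1 / (♮k + 3)) t))) :=
      integral_nonneg fun t ↦ mul_nonneg (sl_nonneg 0 (fun x ↦ Real.rpow_nonneg (h0 x) _) t)
        (gg_nonneg _)
    gcongr
    linarith
  have lim : Tendsto (fun k : ℕ ↦ cc m (1 / (♮k + 3)) W ^ (1 / (m + 1 : ℝ)) * ((m + 1) * W)) atTop
      (𝓝 ((ww (m + 1) / W) ^ (1 / (m + 1 : ℝ)) * ((m + 1) * W))) := by
    refine Tendsto.mul_const _ (Tendsto.rpow_const ?_ (Or.inr ♠))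
    unfold cc
    refine Tendsto.div_const ?_ _
    have h1 : Tendsto (fun k : ℕ ↦ 1 / (♮k + 3)) atTop (𝓝 0) := by
      have h2 := tendsto_natCast_atTop_atTop (R := ℝ)
      have := (tendsto_atTop_add_const_right atTop ♮3 h2).inv_tendsto_atTop
      simpa [Pi.inv_def] using this
    have h3 := ((h1.const_mul 2).const_sub 1).mul_const (ww (m + 1))
    simpa using h3
  have := le_of_tendsto' lim key
  refine le_trans (le_of_eq ?_) this
  rw [Real.div_rpow hw.le h.le]
  have e : W = W ^ (1 / (m + 1 : ℝ)) * W ^ (m / (m + 1 : ℝ)) := by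
    rw [← Real.rpow_add h, ← add_div, add_comm ♮1, div_self ♠, Real.rpow_one]
  have hp : 0 < W ^ (1 / (m + 1 : ℝ)) := by positivity
  conv_rhs => rw [e]
  rw [← e]
  field_simp
  rw [mul_comm, ← e]
lemma Hm_succ (hm : 1 ≤ m) (H : Hm m) : Hm (m + 1) := by
  intro f hf hc h0
  have hm0 : ♮0 < m := by exact_mod_cast hm
  have hS := Sob_of_Hm hm H hf hc h0
  push_cast
  have hw := ww_pos (m + 1)
  have i1 : Integrable f := hf.continuous.integrable_of_hasCompactSupport hc
  have hpq : Real.HolderConjugate ((m + 1 : ℝ) / m) (m + 1 : ℝ) := by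
    rw [Real.holderConjugate_iff]
    constructor
    · rw [lt_div_iff₀ hm0]; linarith
    · field_simp
  have hol := integral_mul_le_Lp_mul_Lq_of_nonneg (μ := (volume : Measure (EV (m + 1)))) hpq
    (f := f) (g := fun x ↦ f x ^ (1 / (m + 1 : ℝ))) (Eventually.of_forall h0)
    (Eventually.of_forall fun x ↦ Real.rpow_nonneg (h0 x) _)
    (hf.continuous.memLp_of_hasCompactSupport hc)
    ((rpow_cs hf.continuous hc (q := 1 / (m + 1 : ℝ)) ♠).1.memLp_of_hasCompactSupport
      (rpow_cs hf.continuous hc ♠).2)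
  have e1 : ∀ x, f x * f x ^ (1 / (m + 1 : ℝ)) = f x ^ ((m + 1 + 1 : ℝ) / (m + 1)) := fun x ↦ by
    rcases (h0 x).eq_or_lt with h | h
    · rw [← h, zero_mul, Real.zero_rpow ♠]
    · rw [show (m + 1 + 1 : ℝ) / (m + 1) = 1 + 1 / (m + 1) by field_simp, Real.rpow_add h,
        Real.rpow_one]
  have e2 : ∀ x, (f x ^ (1 / (m + 1 : ℝ))) ^ (m + 1 : ℝ) = f x := fun x ↦ by
    rw [← Real.rpow_mul (h0 x), one_div_mul_cancel ♠, Real.rpow_one]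
  simp_rw [e1, e2] at hol
  rw [one_div_div] at hol
  calc _ ≤ (m + 1 : ℝ) * ww (m + 1) ^ (1 / (m + 1 : ℝ)) * ((∫ x, f x ^ ((m + 1 : ℝ) / m)) ^ (m / (m + 1 : ℝ)) *
        (∫ x, f x) ^ (1 / (m + 1 : ℝ))) := by gcongr
    _ = _ := by rw [← mul_assoc]
    _ ≤ _ := by
      have : 0 ≤ ∫ x, f x := integral_nonneg h0
      gcongr
lemma Hm_one : Hm 1 := by
  intro f hf hc h0
  have hw : ww 1 = 2 := by
    have h0 : ww 0 = 1 := by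
      have : ball (0 : EV 0) 1 = univ := by ext x; simp [Subsingleton.elim x 0]
      rw [ww, this, volume_euclideanSpace_eq_dirac]; simp
    have := ww_rec 0
    rw [zero_add] at this
    rw [this, h0]; norm_num
  have i1 : Integrable f := hf.continuous.integrable_of_hasCompactSupport hc
  have i0 : Integrable fun x ↦ ‖fderiv ℝ f x‖ :=
    (hf.continuous_fderiv one_ne_zero).norm.integrable_of_hasCompactSupport (hc.fderiv ℝ).norm
  set D := ∫ x, ‖fderiv ℝ f x‖ with hD
  have key : ∀ x, 2 * f x ≤ D := by
    intro x0
    have hcs : HasCompactSupport fun t : ℝ ↦ f (ins 0 t 0) := by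
      obtain ⟨R, -, -, h, -⟩ := slice_cs (m := 0) 0 hc
      refine HasCompactSupport.intro (isCompact_closedBall 0 R) fun t ht ↦ h t 0 ?_
      simpa using ht
    have hd : ∀ t, HasDerivAt (fun t : ℝ ↦ f (ins 0 t 0))
        (fderiv ℝ f (ins 0 t 0) (EuclideanSpace.single 0 1)) t := fun t ↦ by
      have h1 : HasDerivAt (fun t : ℝ ↦ ins (m := 0) 0 t 0) (EuclideanSpace.single 0 1) t := by
        simp_rw [ins_eq]
        simpa using ((hasDerivAt_id t).smul_const (EuclideanSpace.single (0 : Fin 1) ♮1)).add_const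
          (insJ (m := 0) 0 0)
      exact (hf.differentiable one_ne_zero _).hasFDerivAt.comp_hasDerivAt t h1
    have hdd := fun t ↦ (hd t).deriv
    have hc1 : ContDiff ℝ 1 fun t : ℝ ↦ f (ins 0 t 0) := by
      rw [contDiff_one_iff_deriv]
      refine ⟨fun t ↦ (hd t).differentiableAt, ?_⟩
      rw [funext hdd]
      have : Continuous fun t : ℝ ↦ ins (m := 0) 0 t 0 :=
        (ins_continuous 0).comp (continuous_id.prodMk continuous_const)
      exact ((hf.continuous_fderiv one_ne_zero).comp this).clm_apply continuous_const
    have e0 : x0 = ins 0 (x0 0) 0 := by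
      ext j; rw [Subsingleton.elim j 0, ins_same]
    have hval : ∀ t, ∫ y, ‖fderiv ℝ f (ins (m := 0) 0 t y)‖ = ‖fderiv ℝ f (ins 0 t 0)‖ := fun t ↦ by
      rw [volume_euclideanSpace_eq_dirac, integral_dirac]
    have hint := fub_int (m := 0) 0 i0
    rw [hD, fub (m := 0) 0 i0]
    simp_rw [hval] at hint ⊢
    have hgi : Integrable (deriv fun t : ℝ ↦ f (ins 0 t 0)) :=
      (hc1.continuous_deriv le_rfl).integrable_of_hasCompactSupport hcs.deriv
    have a1 := hcs.integral_Iic_deriv_eq hc1 (x0 0)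
    have a2 := hcs.integral_Ioi_deriv_eq hc1 (x0 0)
    rw [← e0] at a1 a2
    have hb : ∀ t, |deriv (fun t : ℝ ↦ f (ins 0 t 0)) t| ≤ ‖fderiv ℝ f (ins 0 t 0)‖ := fun t ↦ by
      rw [hdd]
      simpa using (fderiv ℝ f (ins 0 t 0)).le_opNorm (EuclideanSpace.single 0 1)
    rw [← intervalIntegral.integral_Iic_add_Ioi (b := x0 0) hint.integrableOn hint.integrableOn]
    have b1 := setIntegral_mono (μ := volume) (s := Iic (x0 0)) hgi.integrableOn hint.integrableOn
      (fun t ↦ (le_abs_self _).trans (hb t))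
    have b2 := setIntegral_mono (μ := volume) (s := Ioi (x0 0)) hgi.neg.integrableOn hint.integrableOn
      (fun t ↦ (neg_le_abs _).trans (hb t))
    have b3 : ∫ t in Ioi (x0 0), (-deriv fun t : ℝ ↦ f (ins 0 t 0)) t = f x0 := by
      simp only [Pi.neg_apply]
      rw [integral_neg, a2, neg_neg]
    linarith
  rw [hw]
  norm_num
  rw [← integral_const_mul, ← integral_const_mul]
  refine integral_mono ?_ (i1.const_mul _) fun x ↦ ?_
  · have : Continuous fun x ↦ 2 * f x ^ 2 := by have := hf.continuous; fun_prop
    exact this.integrable_of_hasCompactSupport (hc.mono fun x hx h ↦ hx (by simp [h]))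
  · have := key x
    simp only
    nlinarith [h0 x]
lemma Hm_all (m : ℕ) (hm : 1 ≤ m) : Hm m := by
  induction m, hm using Nat.le_induction with
  | base => exact Hm_one
  | succ k hk ih => exact Hm_succ hk ih
variable {m : ℕ}
lemma exists_theta (s : ℝ) {h : ℝ} (hh : 0 < h) : ∃ θ : ℝ → ℝ, ContDiff ℝ 1 θ ∧ (∀ t, 0 ≤ θ t ∧ θ t ≤ 1) ∧
    (∀ t ≤ s, θ t = 0) ∧ (∀ t, s + h ≤ t → θ t = 1) ∧ (∀ t, 0 ≤ deriv θ t) ∧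
    (∀ t, t ∉ Icc s (s + h) → deriv θ t = 0) := by
  refine ⟨fun t ↦ Real.smoothTransition ((t - s) / h), ?_, ?_, ?_, ?_, ?_, ?_⟩
  · exact (Real.smoothTransition.contDiff (n := 1)).comp ♩
  · exact fun t ↦ ⟨Real.smoothTransition.nonneg _, Real.smoothTransition.le_one _⟩
  · exact fun t ht ↦ Real.smoothTransition.zero_of_nonpos (div_nonpos_of_nonpos_of_nonneg ♦ hh.le)
  · exact fun t ht ↦ Real.smoothTransition.one_of_one_le ((one_le_div hh).2 ♦)
  · intro t
    apply Monotone.deriv_nonneg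
    intro a b hab
    apply Real.smoothTransition.monotone
    gcongr
  · intro t ht
    rw [mem_Icc, not_and_or, not_le, not_le] at ht
    rcases ht with ht | ht
    · have : (fun t ↦ Real.smoothTransition ((t - s) / h)) =ᶠ[𝓝 t] fun _ ↦ 0 := by
        filter_upwards [Iio_mem_nhds ht] with u hu
        exact Real.smoothTransition.zero_of_nonpos (div_nonpos_of_nonpos_of_nonneg (by linarith [mem_Iio.1 hu]) hh.le)
      rw [this.deriv_eq]; simp
    · have : (fun t ↦ Real.smoothTransition ((t - s) / h)) =ᶠ[𝓝 t] fun _ ↦ 1 := by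
        filter_upwards [Ioi_mem_nhds ht] with u hu
        exact Real.smoothTransition.one_of_one_le ((one_le_div hh).2 (by linarith [mem_Ioi.1 hu]))
      rw [this.deriv_eq]; simp
lemma cut1 {f : EV (m + 1) → ℝ} (hf : ContDiff ℝ 1 f)
    (hc : HasCompactSupport f) (h0 : ∀ x, 0 ≤ f x) (i : Fin (m + 1)) {θ : ℝ → ℝ} (hθ : ContDiff ℝ 1 θ)
    (h01 : ∀ t, 0 ≤ θ t ∧ θ t ≤ 1) (hd : ∀ t, 0 ≤ deriv θ t) :
    (∫ x, ‖fderiv ℝ (fun x ↦ (1 - θ (x i)) * f x) x‖) + (∫ x, ‖fderiv ℝ (fun x ↦ θ (x i) * f x) x‖)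
      ≤ (∫ x, ‖fderiv ℝ f x‖) + 2 * ∫ t, deriv θ t * sl i f t := by
  let pr : EV (m + 1) →L[ℝ] ℝ := EuclideanSpace.proj i
  have hpr : ‖pr‖ ≤ 1 := pr.opNorm_le_bound zero_le_one fun x ↦ by
    rw [one_mul]; exact PiLp.norm_apply_le x i
  have hfc := hf.continuous_fderiv one_ne_zero
  have d1 : ∀ x, HasFDerivAt (fun x : EV (m+1) ↦ θ (x i)) (deriv θ (x i) • pr) x := fun x ↦
    (hθ.differentiable one_ne_zero (x i)).hasDerivAt.comp_hasFDerivAt x pr.hasFDerivAt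
  have hcc : ContDiff ℝ 1 fun x : EV (m + 1) ↦ θ (x i) := hθ.comp pr.contDiff
  have c2 : ContDiff ℝ 1 (fun x ↦ θ (x i) * f x) := hcc.mul hf
  have c1 : ContDiff ℝ 1 (fun x ↦ (1 - θ (x i)) * f x) := (contDiff_const.sub hcc).mul hf
  have s2 : HasCompactSupport (fun x ↦ θ (x i) * f x) := hc.mul_left
  have s1 : HasCompactSupport (fun x ↦ (1 - θ (x i)) * f x) := hc.mul_left
  have ii : ∀ g : EV (m + 1) → ℝ, ContDiff ℝ 1 g → HasCompactSupport g → Integrable fun x ↦ ‖fderiv ℝ g x‖ :=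
    fun g h1 h2 ↦ (h1.continuous_fderiv one_ne_zero).norm.integrable_of_hasCompactSupport (h2.fderiv ℝ).norm
  have hdc : Continuous (deriv θ) := hθ.continuous_deriv le_rfl
  have i3 : Integrable fun x ↦ deriv θ (x i) * f x :=
    ((hdc.comp pr.continuous).mul hf.continuous).integrable_of_hasCompactSupport hc.mul_left
  have e3 : ∫ t, deriv θ t * sl i f t = ∫ x, deriv θ (x i) * f x := by
    rw [fub i i3]
    congr 1; ext t
    simp_rw [ins_same, integral_const_mul]; rfl
  rw [e3, ← integral_const_mul, ← integral_add (ii _ c1 s1) (ii _ c2 s2),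
    ← integral_add (ii _ hf hc) (i3.const_mul _)]
  refine integral_mono ((ii _ c1 s1).add (ii _ c2 s2)) ((ii _ hf hc).add (i3.const_mul _)) fun x ↦ ?_
  have hfd := (hf.differentiable one_ne_zero x).hasFDerivAt
  have e2 := ((d1 x).mul hfd).fderiv
  have e1 := (((d1 x).const_sub 1).mul hfd).fderiv
  change fderiv ℝ (fun x ↦ (1 - θ (x i)) * f x) x = _ at e1
  change fderiv ℝ (fun x ↦ θ (x i) * f x) x = _ at e2
  simp only
  rw [e1, e2]
  have n1 : ‖(1 - θ (x i)) • fderiv ℝ f x + f x • -(deriv θ (x i) • pr)‖ ≤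
      (1 - θ (x i)) * ‖fderiv ℝ f x‖ + f x * deriv θ (x i) := by
    refine (norm_add_le _ _).trans ?_
    rw [norm_smul, norm_smul, norm_neg, norm_smul, Real.norm_of_nonneg (h0 x), Real.norm_of_nonneg (hd _),
      Real.norm_of_nonneg (by linarith [(h01 (x i)).2])]
    have := mul_nonneg (h0 x) (hd (x i))
    nlinarith
  have n2 : ‖(θ (x i)) • fderiv ℝ f x + f x • (deriv θ (x i) • pr)‖ ≤
      (θ (x i)) * ‖fderiv ℝ f x‖ + f x * deriv θ (x i) := by
    refine (norm_add_le _ _).trans ?_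
    rw [norm_smul, norm_smul, norm_smul, Real.norm_of_nonneg (h0 x), Real.norm_of_nonneg (hd _),
      Real.norm_of_nonneg (h01 (x i)).1]
    have := mul_nonneg (h0 x) (hd (x i))
    nlinarith
  linarith
lemma cdf_eq {g : EV (m + 1) → ℝ} (hg : Integrable g) (i : Fin (m + 1)) (s : ℝ) :
    cdfF (sl i g) s = ∫ x, (Iic s).indicator 1 (x i) * g x := by
  have hm : Measurable fun x : EV (m + 1) ↦ x i := (EuclideanSpace.proj (𝕜 := ℝ) i).continuous.measurable
  have hi : Integrable fun x ↦ (Iic s).indicator (1 : ℝ → ℝ) (x i) * g x := by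
    refine hg.bdd_mul (c := 1) ?_ ?_
    · exact ((measurable_one.indicator measurableSet_Iic).comp hm).aestronglyMeasurable
    · refine Eventually.of_forall fun x ↦ ?_
      by_cases h : x i ∈ Iic s
      · rw [indicator_of_mem h]; simp
      · rw [indicator_of_notMem h]; simp
  rw [fub i hi, cdfF, ← integral_indicator measurableSet_Iic]
  congr 1; ext t
  simp_rw [ins_same, integral_const_mul]
  by_cases h : t ∈ Iic s
  · rw [indicator_of_mem h, indicator_of_mem h, Pi.one_apply, one_mul]; rfl
  · rw [indicator_of_notMem h, indicator_of_notMem h, zero_mul]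
lemma cut (hm : 1 ≤ m) {f : EV (m + 1) → ℝ} (hf : ContDiff ℝ 1 f)
    (hc : HasCompactSupport f) (h0 : ∀ x, 0 ≤ f x) (i : Fin (m + 1)) {M : ℝ → ℝ} {W : ℝ}
    (hW : W = ∫ x, f x ^ ((m + 1 : ℝ) / m))
    (hMd : M = sl i fun x ↦ f x ^ ((m + 1 : ℝ) / m)) (s : ℝ) :
    (m + 1 : ℝ) * ww (m + 1) ^ (1 / (m + 1 : ℝ)) *
      (cdfF M s ^ (m / (m + 1 : ℝ)) + (W - cdfF M s) ^ (m / (m + 1 : ℝ))) ≤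
      (∫ x, ‖fderiv ℝ f x‖) + 2 * sl i f s := by
  have hm0 : ♮0 < m := by exact_mod_cast hm
  have hq : ♮0 < (m + 1 : ℝ) / m := by positivity
  set q := (m + 1 : ℝ) / m with hqd
  obtain ⟨fq1, fq2⟩ := rpow_cs hf.continuous hc hq
  have fqi : Integrable fun x ↦ f x ^ q := fq1.integrable_of_hasCompactSupport fq2
  have hMc : Continuous M := hMd ▸ sl_continuous i fq1 fq2
  have hMi : Integrable M := hMd ▸ fub_int i fqi
  have hM0 : ∀ t, 0 ≤ M t := hMd ▸ sl_nonneg i (fun x ↦ Real.rpow_nonneg (h0 x) _)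
  have hMW : ∫ s, M s = W := by rw [hW, fub i fqi, hMd]; rfl
  have hcdc : Continuous (cdfF M) := continuous_iff_continuousAt.2 fun t ↦ (cdf_deriv hMc hMi t).continuousAt
  have hvc := sl_continuous i hf.continuous hc
  set K := (m + 1 : ℝ) * ww (m + 1) ^ (1 / (m + 1 : ℝ)) with hK
  have hK0 : 0 ≤ K := by have := ww_pos (m + 1); positivity
  have hp : ♮0 < m / (m + 1 : ℝ) := by positivity
  refine le_of_forall_pos_le_add fun ε hε ↦ ?_
  have hev : ∀ᶠ h in 𝓝[>] ♮0, K * (cdfF M s ^ (m / (m + 1 : ℝ)) + (W - cdfF M (s + h)) ^ (m / (m + 1 : ℝ))) ≤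
      (∫ x, ‖fderiv ℝ f x‖) + 2 * sl i f s + ε := by
    obtain ⟨r, hr, hrr⟩ := Metric.continuousAt_iff.1 (hvc.continuousAt (x := s)) (ε / 2) ♦
    filter_upwards [Ioo_mem_nhdsGT hr] with h hh
    obtain ⟨θ, t1, t2, t3, t4, t5, t6⟩ := exists_theta s hh.1
    have hcut := cut1 hf hc h0 i t1 t2 t5
    have hcc : ContDiff ℝ 1 fun x : EV (m + 1) ↦ θ (x i) :=
      t1.comp (EuclideanSpace.proj (𝕜 := ℝ) i).contDiff
    have c2 : ContDiff ℝ 1 (fun x ↦ θ (x i) * f x) := hcc.mul hf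
    have c1 : ContDiff ℝ 1 (fun x ↦ (1 - θ (x i)) * f x) := (contDiff_const.sub hcc).mul hf
    have s2 : HasCompactSupport (fun x ↦ θ (x i) * f x) := hc.mul_left
    have s1 : HasCompactSupport (fun x ↦ (1 - θ (x i)) * f x) := hc.mul_left
    have p1 : ∀ x, 0 ≤ (1 - θ (x i)) * f x := fun x ↦ mul_nonneg (by linarith [(t2 (x i)).2]) (h0 x)
    have p2 : ∀ x, 0 ≤ θ (x i) * f x := fun x ↦ mul_nonneg (t2 (x i)).1 (h0 x)
    have S1 := Sob_of_Hm hm (Hm_all m hm) c1 s1 p1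
    have S2 := Sob_of_Hm hm (Hm_all m hm) c2 s2 p2
    obtain ⟨g1, g1'⟩ := rpow_cs c1.continuous s1 hq
    obtain ⟨g2, g2'⟩ := rpow_cs c2.continuous s2 hq
    rw [← hqd] at S1 S2
    have mm : Measurable fun x : EV (m + 1) ↦ x i := (EuclideanSpace.proj (𝕜 := ℝ) i).continuous.measurable
    have ind : ∀ u, Integrable fun x ↦ (Iic u).indicator (1 : ℝ → ℝ) (x i) * f x ^ q := fun u ↦ by
      refine fqi.bdd_mul (c := 1) ?_ ?_
      · exact ((measurable_one.indicator measurableSet_Iic).comp mm).aestronglyMeasurable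
      · refine Eventually.of_forall fun x ↦ ?_
        by_cases h : x i ∈ Iic u
        · rw [indicator_of_mem h]; simp
        · rw [indicator_of_notMem h]; simp
    have b1 : cdfF M s ≤ ∫ x, ((1 - θ (x i)) * f x) ^ q := by
      rw [hMd, cdf_eq fqi]
      refine integral_mono (ind s) (g1.integrable_of_hasCompactSupport g1') fun x ↦ ?_
      by_cases h : x i ∈ Iic s
      · simp only [indicator_of_mem h, t3 _ h]; simp
      · simp only [indicator_of_notMem h, zero_mul]; exact Real.rpow_nonneg (p1 x) _
    have b2 : W - cdfF M (s + h) ≤ ∫ x, (θ (x i) * f x) ^ q := by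
      rw [hMd, cdf_eq fqi, hW, ← integral_sub fqi (ind _)]
      refine integral_mono (fqi.sub (ind _)) (g2.integrable_of_hasCompactSupport g2') fun x ↦ ?_
      by_cases h : x i ∈ Iic (s + h)
      · simp only [indicator_of_mem h]; simpa using Real.rpow_nonneg (p2 x) _
      · simp only [indicator_of_notMem h, t4 _ (not_le.1 h).le]; simp
    have k1 := (cdf_mem hM0 hMi s).1
    have k2 : 0 ≤ W - cdfF M (s + h) := by have := (cdf_mem hM0 hMi (s + h)).2; linarith
    have r1 := Real.rpow_le_rpow k1 b1 hp.le
    have r2 := Real.rpow_le_rpow k2 b2 hp.le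
    have hth : ∫ t, deriv θ t * sl i f t ≤ sl i f s + ε / 2 := by
      have e1 : ∫ t, deriv θ t * sl i f t = ∫ t in s..(s+h), deriv θ t * sl i f t := by
        rw [intervalIntegral.integral_of_le (by linarith [hh.1]), ← integral_Icc_eq_integral_Ioc,
          setIntegral_eq_integral_of_forall_compl_eq_zero]
        intro t ht
        rw [t6 t ht, zero_mul]
      have hdc : Continuous (deriv θ) := t1.continuous_deriv le_rfl
      have e2 : ∫ t in s..(s+h), deriv θ t * (sl i f s + ε / 2) = sl i f s + ε / 2 := by
        rw [intervalIntegral.integral_mul_const, intervalIntegral.integral_deriv_eq_sub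
          (fun x _ ↦ t1.differentiable one_ne_zero x) (hdc.intervalIntegrable _ _), t4 _ le_rfl, t3 _ le_rfl]
        ring
      rw [e1, ← e2]
      refine intervalIntegral.integral_mono_on (by linarith [hh.1]) ((hdc.mul hvc).intervalIntegrable _ _)
        ((hdc.mul continuous_const).intervalIntegrable _ _) fun t ht ↦ ?_
      refine mul_le_mul_of_nonneg_left ?_ (t5 t)
      have := hrr (x := t) (by rw [Real.dist_eq, abs_lt]; constructor <;> linarith [ht.1, ht.2, hh.1, hh.2])
      rw [Real.dist_eq, abs_lt] at this
      linarith [this.2]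
    rw [mul_add]
    have := mul_le_mul_of_nonneg_left r1 hK0
    have := mul_le_mul_of_nonneg_left r2 hK0
    linarith
  refine le_of_tendsto ?_ hev
  have hc3 : Continuous fun h ↦ K * (cdfF M s ^ (m / (m + 1 : ℝ)) + (W - cdfF M (s + h)) ^ (m / (m + 1 : ℝ))) := by
    refine continuous_const.mul (continuous_const.add (Continuous.rpow_const ?_ fun _ ↦ Or.inr hp.le))
    exact continuous_const.sub (hcdc.comp ♩)
  have := (hc3.tendsto 0).mono_left (nhdsWithin_le_nhds (s := Ioi 0))
  simpa using this
variable {m : ℕ}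
lemma fubk (i : Fin (m + 1)) {g : EV (m + 1) → ℝ} (hg : Continuous g) (hgc : HasCompactSupport g)
    {k : ℝ → ℝ} (hk : Continuous k) {I : Set ℝ} (hI : MeasurableSet I) :
    ∫ x in {x : EV (m + 1) | x i ∈ I}, k (x i) * g x = ∫ t in I, k t * sl i g t := by
  have hm : Continuous fun x : EV (m + 1) ↦ x i := (EuclideanSpace.proj (𝕜 := ℝ) i).continuous
  have hS : MeasurableSet {x : EV (m + 1) | x i ∈ I} := hm.measurable hI
  have hi : Integrable fun x ↦ k (x i) * g x :=
    ((hk.comp hm).mul hg).integrable_of_hasCompactSupport hgc.mul_left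
  rw [← integral_indicator hS, ← integral_indicator hI, fub i (hi.indicator hS)]
  congr 1; ext t
  by_cases ht : t ∈ I
  · rw [indicator_of_mem ht]
    have : ∀ x, ({x : EV (m + 1) | x i ∈ I}).indicator (fun x ↦ k (x i) * g x) (ins i t x) =
        k t * g (ins i t x) := fun x ↦ by
      rw [indicator_of_mem (by simpa [ins_same] using ht)]; simp only [ins_same]
    simp_rw [this, integral_const_mul]; rfl
  · rw [indicator_of_notMem ht]
    have : ∀ x, ({x : EV (m + 1) | x i ∈ I}).indicator (fun x ↦ k (x i) * g x) (ins i t x) = 0 := fun x ↦ by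
      rw [indicator_of_notMem (by simpa [ins_same] using ht)]
    simp_rw [this]; simp
lemma sq_aux {x t σ : ℝ} (hx : 0 ≤ x) (ht : 0 ≤ t) (h1 : t ≤ 1) (hσ : 0 ≤ σ) (h : x ≤ t + σ) :
    x ^ 2 ≤ t ^ 2 + (2 * σ + σ ^ 2) := by nlinarith
set_option maxHeartbeats 1000000 in
lemma coord1 (hm : 1 ≤ m) {f : EV (m + 1) → ℝ} (hf : ContDiff ℝ 1 f)
    (hc : HasCompactSupport f) (h0 : ∀ x, 0 ≤ f x ∧ f x ≤ 1) (i : Fin (m + 1)) {W : ℝ}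
    (hW : W = ∫ x, f x ^ ((m + 1 : ℝ) / m)) (hWp : 0 < W)
    {T : ℝ → ℝ} (hT : QT m T) {η : ℝ} (hη : 0 < η) (hη' : η < 1 / 2) {M τ : ℝ → ℝ}
    (hMd : M = sl i fun x ↦ f x ^ ((m + 1 : ℝ) / m)) (hτd : τ = tauF T M η)
    {ζ b v0 d ω lam c' : ℝ} (hζ : 0 < ζ) (hζ' : ζ < 1 / 2) (hb0 : 0 < b) (hb : ∀ u, |u| ≤ 1 / 2 - ζ → b ≤ vB m (T u))
    (hv0 : 0 < v0) (hv : ∀ s, ζ * W ≤ cdfF M s → cdfF M s ≤ (1 - ζ) * W → v0 ≤ sl i f s)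
    (hω : ∫ t, M t * gg (cc m η W ^ (m / (m + 1 : ℝ)) * (sl i f t / vB m (τ t))) ≤ ω)
    (hd : (∫ x, f x) - W ≤ d) (hlam : 0 < lam) (hc' : c' = cc m η W ^ (1 / (m + 1 : ℝ))) (hc2 : c' ≤ 2)
    {σ : ℝ} (hσ : (2 * lam + |1 - c'|) * ((W + d) / v0) + 1 / (v0 * lam) * (ω + d / 2) + cc m η W * d / b ≤ σ) :
    ∃ c t0 t1 : ℝ, ∫ x in {x : EV (m + 1) | x i ∈ (Icc t0 t1)ᶜ}, f x ^ ((m + 1 : ℝ) / m) ≤ 2 * ζ * W ∧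
      ∫ x in {x : EV (m + 1) | x i ∈ (Icc t0 t1)}, (x i - c) ^ 2 * f x ^ ((m + 1 : ℝ) / m) ≤
        (∫ s in (-1:ℝ)..1, s ^ 2 * vB m s) / cc m η W + (2 * σ + σ ^ 2) * W := by
  have hm0 : ♮0 < m := by exact_mod_cast hm
  have hq : ♮0 < (m + 1 : ℝ) / m := by positivity
  have hq1 : ♮1 ≤ (m + 1 : ℝ) / m := by rw [le_div_iff₀ hm0]; linarith
  set q := (m + 1 : ℝ) / m with hqd
  obtain ⟨fq1, fq2⟩ := rpow_cs hf.continuous hc hq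
  have fqi : Integrable fun x ↦ f x ^ q := fq1.integrable_of_hasCompactSupport fq2
  have fi : Integrable f := hf.continuous.integrable_of_hasCompactSupport hc
  have hMc : Continuous M := hMd ▸ sl_continuous i fq1 fq2
  have hMi : Integrable M := hMd ▸ fub_int i fqi
  have hM0 : ∀ t, 0 ≤ M t := hMd ▸ sl_nonneg i (fun x ↦ Real.rpow_nonneg (h0 x).1 _)
  have hMW : ∫ s, M s = W := by rw [hW, fub i fqi, hMd]; rfl
  have hvc : Continuous (sl i f) := sl_continuous i hf.continuous hc
  have hvi : Integrable (sl i f) := fub_int i fi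
  have hvM : ∀ t, M t ≤ sl i f t := fun t ↦ by
    rw [hMd]
    refine integral_mono ?_ ?_ fun x ↦ ?_
    · exact (fq1.comp ((ins_continuous i).comp (continuous_const.prodMk continuous_id))).integrable_of_hasCompactSupport
        (slice_compact i fq2 t)
    · exact (slice_diff i hf t).1.continuous.integrable_of_hasCompactSupport (slice_compact i hc t)
    · have := Real.rpow_le_rpow_of_exponent_ge' (h0 (ins i t x)).1 (h0 (ins i t x)).2 zero_le_one hq1
      simpa using this
  have hvint : ∫ t, sl i f t = ∫ x, f x := (fub i fi).symm
  have hτp := fun t ↦ tau_props hT hMc hMi hM0 (hMW ▸ hWp) hη hη' t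
  rw [← hτd, hMW] at hτp
  set c := cc m η W with hcdef
  have hc0 : 0 < c := by
    have := ww_pos (m + 1)
    have : 0 < 1 - 2 * η := by linarith
    rw [hcdef, cc]; positivity
  have hτc : Continuous τ := continuous_iff_continuousAt.2 fun t ↦ (hτp t).2.continuousAt
  have hvBp : ∀ t, 0 < vB m (τ t) := fun t ↦ vB_pos m (hτp t).1
  have hvBc : Continuous fun t ↦ vB m (τ t) := (vB_continuous m).comp hτc
  obtain ⟨R, hR, hMR⟩ : ∃ R : ℝ, 0 < R ∧ ∀ t, R < |t| → M t = 0 := hMd ▸ sl_cs i fq2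
  have hcdc : Continuous (cdfF M) := continuous_iff_continuousAt.2 fun t ↦ (cdf_deriv hMc hMi t).continuousAt
  have hmono : Monotone (cdfF M) := fun a b hab ↦
    setIntegral_mono_set hMi.integrableOn (Eventually.of_forall hM0) (Iic_subset_Iic.2 hab).eventuallyLE
  have k0 : cdfF M (-(R + 1)) = 0 := by
    rw [cdfF, setIntegral_eq_zero_of_forall_eq_zero]
    intro t ht
    exact hMR t (by rw [lt_abs]; right; linarith [mem_Iic.1 ht])
  have k1 : cdfF M (R + 1) = W := by
    rw [cdfF, setIntegral_eq_integral_of_forall_compl_eq_zero, hMW]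
    intro t ht
    exact hMR t (by rw [lt_abs]; left; linarith [not_le.1 (fun h ↦ ht (mem_Iic.2 h))])
  have hiv : ∀ a ∈ Icc 0 1, ∃ t, cdfF M t = a * W := fun a ha ↦ by
    obtain ⟨t, -, ht⟩ := intermediate_value_Icc (by linarith : -(R + 1) ≤ R + 1) hcdc.continuousOn
      (show a * W ∈ Icc _ _ by rw [k0, k1]; exact ⟨mul_nonneg ha.1 hWp.le, mul_le_of_le_one_left hWp.le ha.2⟩)
    exact ⟨t, ht⟩
  obtain ⟨t0, ht0⟩ := hiv ζ ⟨by linarith, by linarith⟩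
  obtain ⟨t1, ht1⟩ := hiv (1 - ζ) ⟨by linarith, by linarith⟩
  obtain ⟨tc, htc⟩ := hiv (1 / 2) ⟨by norm_num, by norm_num⟩
  have hτtc : τ tc = 0 := by rw [hτd, tauF, htc, hMW, mul_div_cancel_right₀ _ hWp.ne']; simpa using hT.1
  have h01 : t0 < t1 := by
    by_contra h
    have := hmono (not_lt.1 h)
    rw [ht0, ht1] at this; linarith [le_of_mul_le_mul_right this hWp]
  have h0c : t0 < tc := by
    by_contra h
    have := hmono (not_lt.1 h)
    rw [ht0, htc] at this; linarith [le_of_mul_le_mul_right this hWp]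
  have hc1 : tc < t1 := by
    by_contra h
    have := hmono (not_lt.1 h)
    rw [htc, ht1] at this; linarith [le_of_mul_le_mul_right this hWp]
  have core : ∀ t ∈ Icc t0 t1, v0 ≤ sl i f t ∧ b ≤ vB m (τ t) := fun t ht ↦ by
    have a1 := hmono ht.1
    have a2 := hmono ht.2
    rw [ht0] at a1; rw [ht1] at a2
    refine ⟨hv t a1 a2, ?_⟩
    rw [hτd, tauF, hMW]
    apply hb
    have b1 : ζ ≤ cdfF M t / W := (le_div_iff₀ hWp).2 a1
    have b2 : cdfF M t / W ≤ 1 - ζ := (div_le_iff₀ hWp).2 a2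
    rw [abs_mul, abs_of_pos (by linarith : 0 < 1 - 2 * η)]
    have : |cdfF M t / W - 1 / 2| ≤ 1 / 2 - ζ := by rw [abs_le]; constructor <;> linarith
    exact (mul_le_of_le_one_left (abs_nonneg _) ♦).trans this
  set z : ℝ → ℝ := fun t ↦ c ^ (m / (m + 1 : ℝ)) * (sl i f t / vB m (τ t)) with hz
  have hzc : Continuous z := continuous_const.mul (hvc.div hvBc fun t ↦ (hvBp t).ne')
  have hggc : Continuous gg := by unfold gg; fun_prop
  have hvn : ∀ t, 0 ≤ sl i f t := sl_nonneg i fun x ↦ (h0 x).1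
  have hz0 : ∀ t, 0 ≤ z t := fun t ↦ mul_nonneg (Real.rpow_nonneg hc0.le _) (div_nonneg (hvn t) (hvBp t).le)
  have hgg2 : ∀ t, gg (z t) ≤ 1 / 2 := fun t ↦ by
    have : max 0 (1 - z t) ≤ 1 := max_le zero_le_one (by linarith [hz0 t])
    have h2 : 0 ≤ max 0 (1 - z t) := le_max_left _ _
    unfold gg; linarith [pow_le_one₀ (n := 2) h2 this]
  have hMgi : Integrable fun t ↦ M t * gg (z t) := by
    refine (hMc.mul (hggc.comp hzc)).integrable_of_hasCompactSupport ?_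
    refine HasCompactSupport.intro (isCompact_closedBall 0 R) fun t ht ↦ ?_
    rw [mem_closedBall_zero_iff, not_le] at ht
    exact mul_eq_zero_of_left (hMR t ht) _
  have hlen : t1 - t0 ≤ (W + d) / v0 := by
    rw [le_div_iff₀ hv0]
    have : ∫ t in t0..t1, v0 ≤ ∫ t, sl i f t := by
      refine le_trans (intervalIntegral.integral_mono_on h01.le ♥ (hvc.intervalIntegrable _ _)
        fun t ht ↦ (core t ht).1) ?_
      rw [intervalIntegral.integral_of_le h01.le]
      exact setIntegral_le_integral hvi (Eventually.of_forall hvn)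
    rw [intervalIntegral.integral_const, smul_eq_mul, hvint] at this
    linarith
  have hcc' : c * 1 = c' * c ^ (m / (m + 1 : ℝ)) := by
    rw [hc', ← Real.rpow_add hc0, ← add_div, add_comm ♮1, div_self ♠, Real.rpow_one, mul_one]
  have hc'0 : 0 < c' := hc' ▸ Real.rpow_pos_of_pos hc0 _
  set B : ℝ → ℝ := fun t ↦ (2 * lam + |1 - c'|) + (1 / (v0 * lam) * (M t * gg (z t) + (sl i f t - M t) / 2)
      + c / b * (sl i f t - M t)) with hB
  have hBc : Continuous B := by
    have := hggc.comp hzc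
    simp only [hB]
    fun_prop
  have hτ'c : Continuous fun t ↦ c * M t / vB m (τ t) := (continuous_const.mul hMc).div hvBc fun t ↦ (hvBp t).ne'
  have hpt : ∀ t ∈ Icc t0 t1, 1 - c * M t / vB m (τ t) ≤ B t := fun t ht ↦ by
    obtain ⟨a1, a2⟩ := core t ht
    have hvp := hvBp t
    have e1 : 1 - c * M t / vB m (τ t) = c' * (1 - z t) + (1 - c') + c * ((sl i f t - M t) / vB m (τ t)) := by
      have : c' * z t = c * (sl i f t / vB m (τ t)) := by rw [hz]; simp only; rw [← mul_assoc, ← hcc', mul_one]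
      rw [mul_sub, this]; ring
    have e2 : (sl i f t - M t) / vB m (τ t) ≤ (sl i f t - M t) / b :=
      div_le_div_of_nonneg_left (by linarith [hvM t]) hb0 a2
    have e3 : 1 - z t ≤ lam + gg (z t) / (2 * lam) := by
      have h1 : 1 - z t ≤ max 0 (1 - z t) := le_max_right _ _
      have h2 : max 0 (1 - z t) ≤ lam + gg (z t) / (2 * lam) := by
        unfold gg
        set a := max 0 (1 - z t)
        have : lam + a ^ 2 / 2 / (2 * lam) - a = (a - 2 * lam) ^ 2 / (4 * lam) := by field_simp; ring
        have h3 : 0 ≤ (a - 2 * lam) ^ 2 / (4 * lam) := by positivity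
        linarith
      linarith
    have e4 : gg (z t) ≤ (M t * gg (z t) + (sl i f t - M t) / 2) / v0 := by
      rw [le_div_iff₀ hv0]
      have g1 := mul_le_mul_of_nonneg_left a1 (gg_nonneg (z t))
      have g2 := mul_le_mul_of_nonneg_right (hgg2 t) (sub_nonneg.2 (hvM t))
      linarith
    have e5 : lam + gg (z t) / (2 * lam) ≤ lam + 1 / (v0 * lam) * (M t * gg (z t) + (sl i f t - M t) / 2) / 2 := by
      have : gg (z t) / (2 * lam) ≤ (M t * gg (z t) + (sl i f t - M t) / 2) / v0 / (2 * lam) := by gcongr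
      refine add_le_add_right (this.trans (le_of_eq ?_)) _
      field_simp
    have e6 : c' * (1 - z t) ≤ 2 * (lam + 1 / (v0 * lam) * (M t * gg (z t) + (sl i f t - M t) / 2) / 2) := by
      have p : 0 ≤ 1 / (v0 * lam) * (M t * gg (z t) + (sl i f t - M t) / 2) := by
        have := hvM t; have := hM0 t; have := gg_nonneg (z t)
        have : 0 ≤ sl i f t - M t := by linarith
        positivity
      calc c' * (1 - z t) ≤ c' * (lam + 1 / (v0 * lam) * (M t * gg (z t) + (sl i f t - M t) / 2) / 2) :=
            mul_le_mul_of_nonneg_left (e3.trans e5) hc'0.le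
        _ ≤ _ := mul_le_mul_of_nonneg_right hc2 ♦
    have e7 : c * ((sl i f t - M t) / vB m (τ t)) ≤ c / b * (sl i f t - M t) := by
      calc _ ≤ c * ((sl i f t - M t) / b) := by gcongr
        _ = _ := by ring
    have e8 := le_abs_self (1 - c')
    rw [e1]; simp only [hB]; linarith
  have hd0 : ∫ t, (sl i f t - M t) ≤ d := by rw [integral_sub hvi hMi, hvint, hMW]; exact hd
  have key : ∀ t t', t0 ≤ t → t ≤ t' → t' ≤ t1 → t' - t ≤ τ t' - τ t + σ := fun t t' ha hab hbb ↦ by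
    have e1 : ∫ s in t..t', (1 - c * M s / vB m (τ s)) = t' - t - (τ t' - τ t) := by
      rw [intervalIntegral.integral_sub ♥ (hτ'c.intervalIntegrable _ _),
        intervalIntegral.integral_eq_sub_of_hasDerivAt (fun s _ ↦ (hτp s).2) (hτ'c.intervalIntegrable _ _)]
      simp
    have e2 : ∫ s in t..t', (1 - c * M s / vB m (τ s)) ≤ ∫ s in t..t', B s :=
      intervalIntegral.integral_mono_on hab ((continuous_const.sub hτ'c).intervalIntegrable _ _)
        (hBc.intervalIntegrable _ _) fun s hs ↦ hpt s ⟨by linarith [hs.1], by linarith [hs.2]⟩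
    have hdi : Integrable fun s ↦ (sl i f s - M s) := hvi.sub hMi
    have i1 : Integrable fun s ↦ 1 / (v0 * lam) * (M s * gg (z s) + (sl i f s - M s) / 2) :=
      (hMgi.add (hdi.div_const 2)).const_mul _
    have i2 : Integrable fun s ↦ c / b * (sl i f s - M s) := hdi.const_mul _
    have e3 : ∫ s in t..t', B s ≤ (2 * lam + |1 - c'|) * ((W + d) / v0) + (1 / (v0 * lam) * (ω + d / 2) + c / b * d) := by
      simp only [hB]
      have i12 : Integrable fun s ↦ 1 / (v0 * lam) * (M s * gg (z s) + (sl i f s - M s) / 2) +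
        c / b * (sl i f s - M s) := i1.add i2
      rw [intervalIntegral.integral_add intervalIntegrable_const i12.intervalIntegrable, intervalIntegral.integral_const, smul_eq_mul]
      refine add_le_add ?_ ?_
      · rw [mul_comm]
        have : 0 ≤ 2 * lam + |1 - c'| := by positivity
        gcongr; linarith
      · rw [intervalIntegral.integral_of_le hab]
        refine (setIntegral_le_integral i12 (Eventually.of_forall fun s ↦ ?_)).trans ?_
        · have := hvM s; have := hM0 s; have := gg_nonneg (z s)
          have : 0 ≤ sl i f s - M s := by linarith
          simp only [Pi.zero_apply]
          positivity
        · rw [integral_add i1 i2, integral_const_mul, integral_const_mul, integral_add hMgi (hdi.div_const 2),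
            integral_div]
          gcongr
    have : cc m η W * d / b = c / b * d := by rw [← hcdef]; ring
    linarith
  refine ⟨tc, t0, t1, ?_, ?_⟩
  · have := fubk i fq1 fq2 (continuous_const (y := ♮1)) (measurableSet_Icc (a := t0) (b := t1)).compl
    simp only [one_mul] at this
    rw [this, ← hMd, setIntegral_compl measurableSet_Icc hMi, hMW, integral_Icc_eq_integral_Ioc,
      ← intervalIntegral.integral_of_le h01.le, ← intervalIntegral.integral_Iic_sub_Iic hMi.integrableOn hMi.integrableOn]
    change W - (cdfF M t1 - cdfF M t0) ≤ _
    rw [ht0, ht1]; apply le_of_eq; ring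
  · have := fubk i fq1 fq2 (k := fun t ↦ (t - tc) ^ 2) ♩ (measurableSet_Icc (a := t0) (b := t1))
    rw [this, ← hMd]
    have hσ0 : 0 ≤ σ := by have := key t0 t0 le_rfl le_rfl h01.le; linarith
    have cM : ∀ k : ℝ → ℝ, Continuous k → Integrable fun t ↦ k t * M t := fun k hk ↦ by
      refine (hk.mul hMc).integrable_of_hasCompactSupport ?_
      refine HasCompactSupport.intro (isCompact_closedBall 0 R) fun t ht ↦ ?_
      rw [mem_closedBall_zero_iff, not_le] at ht
      exact mul_eq_zero_of_right _ (hMR t ht)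
    have e1 : ∫ t in Icc t0 t1, (t - tc) ^ 2 * M t ≤ ∫ t in Icc t0 t1, (τ t ^ 2 + (2 * σ + σ ^ 2)) * M t := by
      refine setIntegral_mono_on (cM _ ♩).integrableOn (cM _ ♩).integrableOn measurableSet_Icc
        fun t ht ↦ mul_le_mul_of_nonneg_right ?_ (hM0 t)
      have hab : |t - tc| ≤ |τ t| + σ := by
        rcases le_total t tc with h | h
        · have := key t tc ht.1 h hc1.le
          rw [hτtc] at this
          rw [abs_of_nonpos ♦]; linarith [neg_abs_le (τ t)]
        · have := key tc t h0c.le h ht.2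
          rw [hτtc] at this
          rw [abs_of_nonneg ♦]; linarith [le_abs_self (τ t)]
      rw [← sq_abs, ← sq_abs (τ t)]
      have h1 := (hτp t).1
      exact sq_aux (abs_nonneg _) (abs_nonneg _) h1.le hσ0 hab
    have e2 : ∫ t in Icc t0 t1, (τ t ^ 2 + (2 * σ + σ ^ 2)) * M t ≤ ∫ t, (τ t ^ 2 + (2 * σ + σ ^ 2)) * M t :=
      setIntegral_le_integral (cM _ ♩) (Eventually.of_forall fun t ↦ by
        have := hM0 t; simp only [Pi.zero_apply]; positivity)
    have e3 : ∫ t, (τ t ^ 2 + (2 * σ + σ ^ 2)) * M t = (∫ t, τ t ^ 2 * M t) + (2 * σ + σ ^ 2) * W := by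
      have : ∀ t, (τ t ^ 2 + (2 * σ + σ ^ 2)) * M t = τ t ^ 2 * M t + (2 * σ + σ ^ 2) * M t := fun t ↦ add_mul _ _ _
      simp_rw [this]
      rw [integral_add (cM (fun t ↦ τ t ^ 2) (hτc.pow 2)) (hMi.const_mul _), integral_const_mul, hMW]
    have e4 : ∫ t, τ t ^ 2 * M t = ∫ t in (-R)..R, τ t ^ 2 * M t := by
      rw [intervalIntegral.integral_of_le ♦, ← integral_Icc_eq_integral_Ioc,
        setIntegral_eq_integral_of_forall_compl_eq_zero]
      intro t ht
      rw [hMR t, mul_zero]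
      by_contra h
      exact ht (abs_le.1 (not_lt.1 h))
    have hsc : Continuous fun s : ℝ ↦ s ^ 2 * vB m s := (continuous_pow 2).mul (vB_continuous m)
    have e5 : ∫ t in (-R)..R, τ t ^ 2 * M t = (∫ s in τ (-R)..τ R, s ^ 2 * vB m s) / c := by
      rw [← intervalIntegral.integral_comp_mul_deriv (fun s _ ↦ (hτp s).2) hτ'c.continuousOn hsc,
        ← intervalIntegral.integral_div]
      congr 1; ext t
      have := (hvBp t).ne'
      simp only [Function.comp]; field_simp
    have e6 : ∫ s in τ (-R)..τ R, s ^ 2 * vB m s ≤ ∫ s in (-1:ℝ)..1, s ^ 2 * vB m s := by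
      have hτm : Monotone τ := monotone_of_hasDerivAt_nonneg (fun t ↦ (hτp t).2) fun t ↦ by
        have := hvBp t; have := hM0 t
        simp only [Pi.zero_apply]; positivity
      have := abs_lt.1 (hτp (-R)).1
      have := abs_lt.1 (hτp R).1
      refine intervalIntegral.integral_mono_interval ♦ (hτm ♦) ♦ ?_
        (hsc.intervalIntegrable _ _)
      refine Eventually.of_forall fun s ↦ ?_
      exact mul_nonneg (sq_nonneg s) (vB_nonneg m s)
    have e7 := div_le_div_of_nonneg_right e6 hc0.le
    linarith
variable {m : ℕ}
lemma kappa_ex {p ζ : ℝ} (hp : 0 < p) (hp1 : p < 1) (hζ : 0 < ζ) (hζ' : ζ < 1 / 2) :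
    ∃ κ > 0, ∀ a ∈ Icc ζ (1 - ζ), 1 + κ ≤ a ^ p + (1 - a) ^ p := by
  have hc : ContinuousOn (fun a : ℝ ↦ a ^ p + (1 - a) ^ p) (Icc ζ (1 - ζ)) := by
    refine Continuous.continuousOn ?_
    exact (continuous_id.rpow_const fun _ ↦ Or.inr hp.le).add
      ((continuous_const.sub continuous_id).rpow_const fun _ ↦ Or.inr hp.le)
  obtain ⟨a, ha, hmin⟩ := isCompact_Icc.exists_isMinOn (nonempty_Icc.2 ♦) hc
  refine ⟨a ^ p + (1 - a) ^ p - 1, ?_, fun x hx ↦ ?_⟩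
  · have h1 := Real.self_lt_rpow_of_lt_one (x := a) (y := p) (by linarith [ha.1]) (by linarith [ha.2]) hp1
    have h2 := Real.self_lt_rpow_of_lt_one (x := 1 - a) (y := p) (by linarith [ha.2]) (by linarith [ha.1]) hp1
    linarith
  · have := isMinOn_iff.1 hmin x hx
    linarith
lemma b_ex {T : ℝ → ℝ} (hT : QT m T) {ζ : ℝ} (hζ : 0 < ζ) (hζ' : ζ < 1 / 2) :
    ∃ b > 0, ∀ u, |u| ≤ 1 / 2 - ζ → b ≤ vB m (T u) := by
  obtain ⟨a, ha, hmin⟩ := (isCompact_Icc (a := -(1 / 2 - ζ)) (b := 1 / 2 - ζ)).exists_isMinOn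
    (nonempty_Icc.2 ♦) ((vB_continuous m).comp hT.2.2.1).continuousOn
  refine ⟨vB m (T a), vB_pos m (hT.2.2.2.1 a ?_), fun u hu ↦ isMinOn_iff.1 hmin u (abs_le.1 hu)⟩
  have := abs_le.2 ha; linarith
set_option maxHeartbeats 1000000 in
lemma coord2 (hm : 1 ≤ m) {ζ σ : ℝ} (hζ : 0 < ζ) (hζ' : ζ < 1 / 2) (hσ : 0 < σ) :
    ∃ d > 0, ∀ f : EV (m + 1) → ℝ, ContDiff ℝ 1 f → HasCompactSupport f → (∀ x, 0 ≤ f x ∧ f x ≤ 1) →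
      ∫ x, ‖fderiv ℝ f x‖ ≤ (m + 1) * ww (m + 1) + d →
      |(∫ x, f x ^ ((m + 1 : ℝ) / m)) - ww (m + 1)| ≤ d →
      (∫ x, f x) - (∫ x, f x ^ ((m + 1 : ℝ) / m)) ≤ d →
      ∀ i : Fin (m + 1), ∃ c t0 t1 : ℝ, ∫ x in {x : EV (m + 1) | x i ∈ (Icc t0 t1)ᶜ}, f x ^ ((m + 1 : ℝ) / m) ≤
        2 * ζ * (2 * ww (m + 1)) ∧
      ∫ x in {x : EV (m + 1) | x i ∈ (Icc t0 t1)}, (x i - c) ^ 2 * f x ^ ((m + 1 : ℝ) / m) ≤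
        (∫ s in (-1:ℝ)..1, s ^ 2 * vB m s) + σ := by
  have hm0 : ♮0 < m := by exact_mod_cast hm
  obtain ⟨T, hT⟩ : ∃ T, QT m T := quantile m
  obtain ⟨b, hb0, hb⟩ := b_ex hT hζ hζ'
  have hp : ♮0 < m / (m + 1 : ℝ) := by positivity
  have hp1 : m / (m + 1 : ℝ) < 1 := by rw [div_lt_one ♠]; linarith
  obtain ⟨κ, hκ, hκ'⟩ := kappa_ex hp hp1 hζ hζ'
  have hw := ww_pos (m + 1)
  set w := ww (m + 1) with hwd
  set p := m / (m + 1 : ℝ) with hpd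
  set r := 1 / (m + 1 : ℝ) with hrd
  have hr0 : 0 < r := by positivity
  have hrp : r + p = 1 := by rw [hrd, hpd]; field_simp; ring
  set K := (m + 1 : ℝ) * w ^ r with hK
  have hK0 : 0 < K := by positivity
  have hKw : K * w ^ p = (m + 1) * w := by rw [hK, mul_assoc, ← Real.rpow_add hw, hrp, Real.rpow_one]
  set v0 := (m + 1) * w * κ / 4 with hv0
  have hv0p : 0 < v0 := by positivity
  set σ1 := min 1 (σ / (12 * w)) with hσ1
  have hσ1p : 0 < σ1 := lt_min one_pos ♠
  have hσ1' : (2 * σ1 + σ1 ^ 2) * (2 * w) ≤ σ / 2 := by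
    have h1 : σ1 ≤ 1 := min_le_left _ _
    have h2 : σ1 * (12 * w) ≤ σ := (le_div_iff₀ ♠).1 (min_le_right _ _)
    have h3 := mul_le_mul_of_nonneg_right (mul_le_mul_of_nonneg_left h1 hσ1p.le) hw.le
    linarith
  set lam := σ1 * v0 / (12 * w) with hlam
  have hlamp : 0 < lam := by positivity
  set J := ∫ s in (-1:ℝ)..1, s ^ 2 * vB m s with hJ
  have hJ0 : 0 ≤ J := intervalIntegral.integral_nonneg ♣ fun s _ ↦ mul_nonneg (sq_nonneg s) (vB_nonneg m s)
  let cm : ℝ → ℝ := fun d ↦ (1 - 2 * d) * w / (w + d)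
  let cp : ℝ → ℝ := fun d ↦ w / (w - d)
  have tid : Tendsto (fun d : ℝ ↦ d) (𝓝 0) (𝓝 0) := tendsto_id
  have tcm : Tendsto cm (𝓝 0) (𝓝 1) := by
    have : ContinuousAt cm 0 := by
      refine ContinuousAt.div ♩ ♩ (by simpa using hw.ne')
    have h2 : cm 0 = 1 := by simp [cm, hw.ne']
    rw [← h2]; exact this
  have tcp : Tendsto cp (𝓝 0) (𝓝 1) := by
    have : ContinuousAt cp 0 := by
      refine ContinuousAt.div ♩ ♩ (by simpa using hw.ne')
    have h2 : cp 0 = 1 := by simp [cp, hw.ne']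
    rw [← h2]; exact this
  have tcmr : Tendsto (fun d ↦ cm d ^ r) (𝓝 0) (𝓝 1) := by
    have := tcm.rpow_const (p := r) (Or.inr hr0.le)
    rwa [Real.one_rpow] at this
  have tcpr : Tendsto (fun d ↦ cp d ^ r) (𝓝 0) (𝓝 1) := by
    have := tcp.rpow_const (p := r) (Or.inr hr0.le)
    rwa [Real.one_rpow] at this
  have tE : Tendsto (fun d ↦ (cp d ^ r - 1) + (1 - cm d ^ r)) (𝓝 0) (𝓝 0) := by
    simpa using (tcpr.sub_const 1).add (tcmr.const_sub 1)
  have tω : Tendsto (fun d ↦ ((m + 1) * w + d) / cm d ^ r - (m + 1) * (w - d)) (𝓝 0) (𝓝 0) := by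
    have := ((tid.const_add ((m + 1) * w)).div tcmr one_ne_zero).sub ((tid.const_sub w).const_mul (m + 1 : ℝ))
    simpa using this
  have E1 : ∀ᶠ d in 𝓝 ♮0, (m + 1) * w + d + 2 * v0 < K * ((w - d) ^ p * (1 + κ)) := by
    have h1 : Tendsto (fun d : ℝ ↦ (m + 1) * w + d + 2 * v0) (𝓝 0) (𝓝 ((m + 1) * w + 0 + 2 * v0)) :=
      (tid.const_add _).add_const _
    have h2 : Tendsto (fun d : ℝ ↦ K * ((w - d) ^ p * (1 + κ))) (𝓝 0) (𝓝 (K * ((w - 0) ^ p * (1 + κ)))) :=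
      (((tid.const_sub w).rpow_const (Or.inr hp.le)).mul_const _).const_mul _
    refine h1.eventually_lt h2 ?_
    rw [sub_zero, ← mul_assoc, hKw, hv0]
    linarith [mul_pos (mul_pos (by positivity : ♮0 < m + 1) hw) hκ]
  have E2 : ∀ᶠ d in 𝓝 ♮0, cp d ^ r < 2 := tcpr.eventually_lt_const ♣
  have E3 : ∀ᶠ d in 𝓝 ♮0, (2 * lam + ((cp d ^ r - 1) + (1 - cm d ^ r))) * ((w + d + d) / v0) +
      1 / (v0 * lam) * ((((m + 1) * w + d) / cm d ^ r - (m + 1) * (w - d)) + d / 2) + cp d * d / b < σ1 := by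
    have h := ((tE.const_add (2 * lam)).mul (((tid.const_add w).add tid).div_const v0)).add
      ((tω.add (tid.div_const 2)).const_mul (1 / (v0 * lam))) |>.add ((tcp.mul tid).div_const b)
    refine h.eventually_lt_const ?_
    have : 2 * lam * (w / v0) = σ1 / 6 := by rw [hlam]; field_simp; norm_num
    simp only [add_zero, zero_div, mul_zero, this]; linarith
  have E4 : ∀ᶠ d in 𝓝 ♮0, J / cm d < J + σ / 2 := by
    have h : Tendsto (fun d ↦ J / cm d) (𝓝 0) (𝓝 (J / 1)) := tendsto_const_nhds.div tcm one_ne_zero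
    exact h.eventually_lt_const (by rw [div_one]; linarith)
  have E5 : ∀ᶠ d in 𝓝 ♮0, d < min (1 / 4) (w / 2) :=
    tid.eventually_lt_const (lt_min ♣ ♦)
  obtain ⟨d, ⟨e1, e2, e3, e4, e5⟩, hd⟩ := (((E1.and (E2.and (E3.and (E4.and E5)))).filter_mono
    (nhdsWithin_le_nhds (s := Ioi 0))).and self_mem_nhdsWithin).exists
  have hd1 : d < 1 / 4 := e5.trans_le (min_le_left _ _)
  have hd2 : d < w / 2 := e5.trans_le (min_le_right _ _)
  refine ⟨d, hd, fun f hf hc h0 hD hW hfW i ↦ ?_⟩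
  set W := ∫ x, f x ^ ((m + 1 : ℝ) / m) with hWd
  obtain ⟨hW1, hW2⟩ := abs_le.1 hW
  have hWp : 0 < W := by linarith
  set M := sl i fun x ↦ f x ^ ((m + 1 : ℝ) / m) with hMd
  have cW1 : cm d ≤ cc m d W := by
    simp only [cm, cc, ← hwd]
    have : 0 < 1 - 2 * d := by linarith
    gcongr; linarith
  have cW2 : cc m d W ≤ cp d := by
    simp only [cp, cc, ← hwd]
    have : 0 < w - d := by linarith
    gcongr
    · exact mul_le_of_le_one_left hw.le ♦
    · linarith
  have cm0 : 0 < cm d := by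
    have : 0 < 1 - 2 * d := by linarith
    simp only [cm]; positivity
  have cm1 : cm d ≤ 1 := by simp only [cm]; rw [div_le_one ♦]; linarith [mul_pos hd hw]
  have cp1 : 1 ≤ cp d := by simp only [cp]; rw [one_le_div ♦]; linarith
  have cW0 : 0 < cc m d W := cm0.trans_le cW1
  have r1 : cm d ^ r ≤ cc m d W ^ r := Real.rpow_le_rpow cm0.le cW1 hr0.le
  have r2 : cc m d W ^ r ≤ cp d ^ r := Real.rpow_le_rpow cW0.le cW2 hr0.le
  have r3 : cm d ^ r ≤ 1 := Real.rpow_le_one cm0.le cm1 hr0.le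
  have r4 : 1 ≤ cp d ^ r := Real.one_le_rpow cp1 hr0.le
  have r0 : 0 < cm d ^ r := Real.rpow_pos_of_pos cm0 _
  have hmain := slice_main hm (Hm_all m hm) hf hc (fun x ↦ (h0 x).1) i hWd hWp hT hd ♦ hMd rfl
  have hωb : ∫ t, M t * gg (cc m d W ^ (m / (m + 1 : ℝ)) * (sl i f t / vB m (tauF T M d t))) ≤
      ((m + 1) * w + d) / cm d ^ r - (m + 1) * (w - d) := by
    have h1 : (m + 1) * W + ∫ t, M t * gg (cc m d W ^ (m / (m + 1 : ℝ)) * (sl i f t / vB m (tauF T M d t))) ≤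
        ((m + 1) * w + d) / cm d ^ r := by
      rw [le_div_iff₀ r0, mul_comm]
      refine le_trans (mul_le_mul_of_nonneg_right r1 ?_) (hmain.trans hD)
      refine add_nonneg ♠ (integral_nonneg fun t ↦ mul_nonneg ?_ (gg_nonneg _))
      rw [hMd]; exact sl_nonneg i (fun x ↦ Real.rpow_nonneg (h0 x).1 _) t
    have h2 : (m + 1) * (w - d) ≤ (m + 1) * W := by gcongr; linarith
    linarith
  have hvb : ∀ s, ζ * W ≤ cdfF M s → cdfF M s ≤ (1 - ζ) * W → v0 ≤ sl i f s := fun s a1 a2 ↦ by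
    have hcut := cut hm hf hc (fun x ↦ (h0 x).1) i hWd hMd s
    have hk := hκ' (cdfF M s / W) ⟨(le_div_iff₀ hWp).2 a1, (div_le_iff₀ hWp).2 a2⟩
    have hs : 0 ≤ cdfF M s := le_trans ♠ a1
    have hs2 : 0 ≤ 1 - cdfF M s / W := by rw [sub_nonneg, div_le_one hWp]; linarith [mul_pos hζ hWp]
    have e : cdfF M s ^ p + (W - cdfF M s) ^ p = W ^ p * ((cdfF M s / W) ^ p + (1 - cdfF M s / W) ^ p) := by
      rw [mul_add, ← Real.mul_rpow hWp.le ♠, ← Real.mul_rpow hWp.le hs2, mul_sub, mul_one,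
        mul_div_cancel₀ _ hWp.ne']
    rw [← hpd, ← hrd, ← hwd, ← hK, e] at hcut
    have h1 : (w - d) ^ p ≤ W ^ p := Real.rpow_le_rpow ♦ ♦ hp.le
    have h2 : (w - d) ^ p * (1 + κ) ≤ W ^ p * ((cdfF M s / W) ^ p + (1 - cdfF M s / W) ^ p) :=
      mul_le_mul h1 hk ♦ (Real.rpow_nonneg hWp.le _)
    have h3 := mul_le_mul_of_nonneg_left h2 hK0.le
    linarith
  have habs : |1 - cc m d W ^ r| ≤ (cp d ^ r - 1) + (1 - cm d ^ r) := by
    rw [abs_le]; constructor <;> linarith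
  have hσb : (2 * lam + |1 - cc m d W ^ r|) * ((W + d) / v0) + 1 / (v0 * lam) *
      ((((m + 1) * w + d) / cm d ^ r - (m + 1) * (w - d)) + d / 2) + cc m d W * d / b ≤ σ1 := by
    refine le_trans ?_ e3.le
    have : 0 ≤ 2 * lam + ((cp d ^ r - 1) + (1 - cm d ^ r)) := by linarith
    gcongr
    linarith
  obtain ⟨c, t0, t1, g1, g2⟩ := coord1 hm hf hc h0 i hWd hWp hT hd ♦ hMd rfl hζ hζ' hb0 hb hv0p hvb
    hωb hfW hlamp rfl ♦ hσb
  refine ⟨c, t0, t1, g1.trans ?_, g2.trans ?_⟩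
  · gcongr; linarith
  · have q1 : J / cc m d W ≤ J / cm d := by gcongr
    have q2 : (2 * σ1 + σ1 ^ 2) * W ≤ (2 * σ1 + σ1 ^ 2) * (2 * w) := by gcongr; linarith
    linarith
variable {m : ℕ}
lemma ball_coord (i : Fin (m + 1)) {k : ℝ → ℝ} (hk : Continuous k) :
    ∫ x in ball (0 : EV (m + 1)) 1, k (x i) = ∫ s in (-1:ℝ)..1, k s * vB m s := by
  have hmm : Continuous fun x : EV (m + 1) ↦ k (x i) := hk.comp (EuclideanSpace.proj (𝕜 := ℝ) i).continuous
  have h0 : Integrable ((ball (0 : EV (m + 1)) 1).indicator (fun x : EV (m + 1) ↦ k (x i))) := by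
    rw [integrable_indicator_iff measurableSet_ball]
    exact (hmm.continuousOn.integrableOn_compact (isCompact_closedBall 0 1)).mono_set ball_subset_closedBall
  rw [← integral_indicator measurableSet_ball, fub i h0, intervalIntegral.integral_of_le ♣,
    integral_Ioc_eq_integral_Ioo, ← integral_indicator measurableSet_Ioo]
  congr 1
  ext t
  by_cases ht : t ∈ Ioo (-1:ℝ) 1
  · rw [indicator_of_mem ht]
    have ht2 : 0 < 1 - t ^ 2 := by nlinarith [ht.1, ht.2]
    have : ∀ x, (ball (0 : EV (m + 1)) 1).indicator (fun x : EV (m + 1) ↦ k (x i)) (ins i t x) =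
        k t * (ball (0 : EV m) (Real.sqrt (1 - t ^ 2))).indicator 1 x := by
      intro x
      have h2 : ins i t x ∈ ball (0 : EV (m + 1)) 1 ↔ x ∈ ball (0 : EV m) (Real.sqrt (1 - t ^ 2)) := by
        rw [mem_ball_zero_iff, mem_ball_zero_iff, Real.lt_sqrt (norm_nonneg _),
          ← sq_lt_one_iff₀ (norm_nonneg _), ins_norm_sq]
        constructor <;> intro h <;> linarith
      by_cases hx : x ∈ ball (0 : EV m) (Real.sqrt (1 - t ^ 2))
      · rw [indicator_of_mem hx, indicator_of_mem (h2.2 hx)]; simp [ins_same]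
      · rw [indicator_of_notMem hx, indicator_of_notMem (fun h ↦ hx (h2.1 h)), mul_zero]
    simp_rw [this]
    rw [integral_const_mul, integral_indicator_one measurableSet_ball]
    have h3 := Measure.addHaar_ball_of_pos (volume : Measure (EV m)) 0 (Real.sqrt_pos.2 ht2)
    rw [measureReal_def, h3, ENNReal.toReal_mul, ENNReal.toReal_ofReal ♠]
    simp [ww, vB, measureReal_def, mul_comm]
  · rw [indicator_of_notMem ht]
    have : ∀ x, (ball (0 : EV (m + 1)) 1).indicator (fun x : EV (m + 1) ↦ k (x i)) (ins i t x) = 0 := fun x ↦ by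
      rw [indicator_of_notMem]
      rw [mem_ball_zero_iff, not_lt]
      refine le_trans ?_ (ins_norm_ge i t x).1
      by_contra h
      exact ht (abs_lt.1 (not_le.1 h))
    simp [this]
lemma bath_g (c : EV (m + 1)) : Integrable (fun x ↦ max 0 (1 - ‖x - c‖ ^ 2)) ∧
    ∫ x, max 0 (1 - ‖x - c‖ ^ 2) = ww (m + 1) - (m + 1) * ∫ s in (-1:ℝ)..1, s ^ 2 * vB m s := by
  have hc : Continuous fun x : EV (m + 1) ↦ max 0 (1 - ‖x - c‖ ^ 2) := by fun_prop
  refine ⟨hc.integrable_of_hasCompactSupport (HasCompactSupport.intro (isCompact_closedBall c 1) fun x hx ↦ ?_), ?_⟩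
  · rw [mem_closedBall, not_le, dist_eq_norm] at hx
    exact max_eq_left (by nlinarith)
  · rw [integral_sub_right_eq_self (fun x : EV (m + 1) ↦ max 0 (1 - ‖x‖ ^ 2)) c]
    have e1 : ∫ x : EV (m + 1), max 0 (1 - ‖x‖ ^ 2) = ∫ x in ball (0 : EV (m + 1)) 1, (1 - ∑ i, x i ^ 2) := by
      rw [← integral_indicator measurableSet_ball]
      congr 1; ext x
      by_cases hx : x ∈ ball (0 : EV (m + 1)) 1
      · rw [indicator_of_mem hx]
        rw [mem_ball_zero_iff] at hx
        rw [max_eq_right (by nlinarith [norm_nonneg x]), EuclideanSpace.real_norm_sq_eq]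
      · rw [indicator_of_notMem hx]
        rw [mem_ball_zero_iff, not_lt] at hx
        exact max_eq_left (by nlinarith)
    have hi : ∀ i : Fin (m + 1), IntegrableOn (fun x : EV (m + 1) ↦ x i ^ 2) (ball 0 1) := fun i ↦ by
      have : Continuous fun x : EV (m + 1) ↦ x i ^ 2 := (EuclideanSpace.proj (𝕜 := ℝ) i).continuous.pow 2
      exact (this.continuousOn.integrableOn_compact (isCompact_closedBall 0 1)).mono_set ball_subset_closedBall
    have hk : Integrable (fun _ : EV (m + 1) ↦ ♮1) (volume.restrict (ball 0 1)) :=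
      integrableOn_const measure_ball_lt_top.ne
    have hk2 : Integrable (fun x : EV (m + 1) ↦ ∑ i, x i ^ 2) (volume.restrict (ball 0 1)) :=
      integrable_finsetSum _ fun i _ ↦ hi i
    rw [e1, integral_sub hk hk2,
      integral_finsetSum _ fun i _ ↦ hi i]
    simp_rw [fun i : Fin (m + 1) ↦ ball_coord i (k := fun s ↦ s ^ 2) ♩]
    simp [ww]
lemma bath (f : EV (m + 1) → ℝ) (hfc : Continuous f) (hcs : HasCompactSupport f) (h0 : ∀ x, 0 ≤ f x)
    (c t0 t1 : Fin (m + 1) → ℝ) {A B : ℝ} (hA : ∀ i, ∫ x in {x : EV (m + 1) | x i ∈ (Icc (t0 i) (t1 i))ᶜ}, f x ≤ A)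
    (hB : ∀ i, ∫ x in {x : EV (m + 1) | x i ∈ Icc (t0 i) (t1 i)}, (x i - c i) ^ 2 * f x ≤ B) :
    ∃ h : EV (m + 1) → ℝ, Integrable h ∧ (∀ x, 0 ≤ h x ∧ h x ≤ f x) ∧
      (∫ x, f x) - (m + 1) * A - (m + 1) * B ≤ ∫ x, max 0 (1 - ‖x - WithLp.toLp 2 c‖ ^ 2) * h x := by
  have mi : ∀ i : Fin (m + 1), Continuous fun x : EV (m + 1) ↦ x i := fun i ↦
    (EuclideanSpace.proj (𝕜 := ℝ) i).continuous
  let S : Fin (m + 1) → Set (EV (m + 1)) := fun i ↦ {x | x i ∈ Icc (t0 i) (t1 i)}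
  have hS : ∀ i, MeasurableSet (S i) := fun i ↦ (mi i).measurable measurableSet_Icc
  have hC : MeasurableSet (⋂ i, S i) := MeasurableSet.iInter hS
  have hi : Integrable f := hfc.integrable_of_hasCompactSupport hcs
  set h := (⋂ i, S i).indicator f with hh
  have hhi : Integrable h := hi.indicator hC
  have hb : ∀ x, 0 ≤ h x ∧ h x ≤ f x := fun x ↦ by
    by_cases hx : x ∈ ⋂ i, S i
    · rw [hh, indicator_of_mem hx]; exact ⟨h0 x, le_rfl⟩
    · rw [hh, indicator_of_notMem hx]; exact ⟨le_rfl, h0 x⟩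
  refine ⟨h, hhi, hb, ?_⟩
  have i2 : ∀ i, Integrable fun x ↦ (x i - c i) ^ 2 * f x := fun i ↦
    ((((mi i).sub continuous_const).pow 2).mul hfc).integrable_of_hasCompactSupport hcs.mul_left
  have i3 : ∀ i, Integrable ((S i)ᶜ.indicator f) := fun i ↦ hi.indicator (hS i).compl
  have i4 : ∀ i, Integrable ((S i).indicator fun x ↦ (x i - c i) ^ 2 * f x) := fun i ↦ (i2 i).indicator (hS i)
  have i5 : Integrable fun x ↦ max 0 (1 - ‖x - WithLp.toLp 2 c‖ ^ 2) * h x := by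
    refine hhi.bdd_mul (c := 1) ?_ (Eventually.of_forall fun x ↦ ?_)
    · have : Continuous fun x : EV (m + 1) ↦ max 0 (1 - ‖x - WithLp.toLp 2 c‖ ^ 2) := by fun_prop
      exact this.aestronglyMeasurable
    · rw [Real.norm_of_nonneg (le_max_left _ _)]
      exact max_le zero_le_one (by linarith [sq_nonneg ‖x - WithLp.toLp 2 c‖])
  have i6 : Integrable fun x ↦ ∑ i, (S i)ᶜ.indicator f x := integrable_finsetSum _ fun i _ ↦ i3 i
  have i7 : Integrable fun x ↦ ∑ i, (S i).indicator (fun x ↦ (x i - c i) ^ 2 * f x) x :=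
    integrable_finsetSum _ fun i _ ↦ i4 i
  have main : ∫ x, (f x - ∑ i, (S i)ᶜ.indicator f x - ∑ i, (S i).indicator (fun x ↦ (x i - c i) ^ 2 * f x) x) ≤
      ∫ x, max 0 (1 - ‖x - WithLp.toLp 2 c‖ ^ 2) * h x := by
    refine integral_mono ((hi.sub i6).sub i7) i5 fun x ↦ ?_
    have p1 : ∀ i, 0 ≤ (S i)ᶜ.indicator f x := fun i ↦ indicator_nonneg (fun x _ ↦ h0 x) x
    have p2 : ∀ i, 0 ≤ (S i).indicator (fun x ↦ (x i - c i) ^ 2 * f x) x := fun i ↦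
      indicator_nonneg (fun x _ ↦ mul_nonneg (sq_nonneg _) (h0 x)) x
    by_cases hx : x ∈ ⋂ i, S i
    · have e1 : ∑ i, (S i).indicator (fun x ↦ (x i - c i) ^ 2 * f x) x = ‖x - WithLp.toLp 2 c‖ ^ 2 * f x := by
        rw [EuclideanSpace.real_norm_sq_eq, Finset.sum_mul]
        refine Finset.sum_congr rfl fun i _ ↦ ?_
        rw [indicator_of_mem (mem_iInter.1 hx i)]; simp
      have e2 : 0 ≤ ∑ i, (S i)ᶜ.indicator f x := Finset.sum_nonneg fun i _ ↦ p1 i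
      simp only [e1]
      rw [hh, indicator_of_mem hx]
      have := mul_le_mul_of_nonneg_right (le_max_right 0 (1 - ‖x - WithLp.toLp 2 c‖ ^ 2)) (h0 x)
      linarith
    · have e0 : h x = 0 := by rw [hh, indicator_of_notMem hx]
      rw [mem_iInter, not_forall] at hx
      obtain ⟨i, hxi⟩ := hx
      have e2 : f x ≤ ∑ i, (S i)ᶜ.indicator f x := by
        refine le_trans (le_of_eq ?_) (Finset.single_le_sum (fun i _ ↦ p1 i) (Finset.mem_univ i))
        rw [indicator_of_mem (mem_compl hxi)]
      have e3 : 0 ≤ ∑ i, (S i).indicator (fun x ↦ (x i - c i) ^ 2 * f x) x := Finset.sum_nonneg fun i _ ↦ p2 i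
      simp only [e0]; linarith
  refine le_trans ?_ main
  have i8 : Integrable fun x ↦ f x - ∑ i, (S i)ᶜ.indicator f x := hi.sub i6
  rw [integral_sub i8 i7, integral_sub hi i6, integral_finsetSum _ fun i _ ↦ i3 i,
    integral_finsetSum _ fun i _ ↦ i4 i]
  have s1 : ∑ i, ∫ x, (S i)ᶜ.indicator f x ≤ (m + 1) * A := by
    refine (Finset.sum_le_sum (g := fun _ ↦ A) fun i _ ↦ ?_).trans ♥
    rw [integral_indicator (hS i).compl]; exact hA i
  have s2 : ∑ i, ∫ x, (S i).indicator (fun x ↦ (x i - c i) ^ 2 * f x) x ≤ (m + 1) * B := by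
    refine (Finset.sum_le_sum (g := fun _ ↦ B) fun i _ ↦ ?_).trans ♥
    rw [integral_indicator (hS i)]; exact hB i
  linarith
lemma exists_rho {n : ℕ} {ε : ℝ} (hε : 0 < ε) :
    ∃ ρ : ℝ, 0 < ρ ∧ ρ < 1 ∧ ww n - ρ ^ n * ww n ≤ ε := by
  have h : Tendsto (fun ρ : ℝ ↦ ww n - ρ ^ n * ww n) (𝓝[<] 1) (𝓝 (ww n - 1 ^ n * ww n)) := by
    have : Continuous fun ρ : ℝ ↦ ww n - ρ ^ n * ww n := by fun_prop
    exact (this.tendsto 1).mono_left nhdsWithin_le_nhds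
  obtain ⟨ρ, h1, h2⟩ := ((h.eventually_lt_const (u := ε) (by simpa using hε)).and
    (Ioo_mem_nhdsLT (zero_lt_one' ℝ))).exists
  exact ⟨ρ, h2.1, h2.2, h1.le⟩
lemma weak (hm : 1 ≤ m) {ε : ℝ} (hε : 0 < ε) : ∃ d > 0, ∀ E : Set (EV (m + 1)), MeasurableSet E →
    volume E = volume (ball (0 : EV (m + 1)) 1) → PerLe E ((m + 1) * ww (m + 1) + d) →
    ∃ c : EV (m + 1), volume.real (ball c 1 \ E) ≤ ε := by
  have hm0 : ♮0 < m := by exact_mod_cast hm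
  have hw := ww_pos (m + 1)
  obtain ⟨ρ, hρ0, hρ1, hρ⟩ := exists_rho (n := m + 1) (half_pos hε)
  have hρ2 : 0 < 1 - ρ ^ 2 := by nlinarith
  set s := ε / 2 * (1 - ρ ^ 2) with hs
  have hs0 : 0 < s := by positivity
  set ζ := min (1 / 4) (s / (12 * (m + 1) * ww (m + 1))) with hζd
  have hζ : 0 < ζ := lt_min ♣ ♠
  have hζ2 : 4 * (m + 1) * ζ * ww (m + 1) ≤ s / 3 := by
    have : ζ * (12 * (m + 1) * ww (m + 1)) ≤ s := (le_div_iff₀ ♠).1 (min_le_right _ _)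
    linarith
  obtain ⟨d, hd, H⟩ := coord2 hm hζ (by linarith [min_le_left (1/4) (s / (12 * (m + 1) * ww (m + 1)))] : ζ < 1 / 2)
    (σ := s / (3 * (m + 1))) ♠
  refine ⟨d / 2, by linarith, fun E hE hvE hP ↦ ?_⟩
  have hvE' : volume.real E = ww (m + 1) := by rw [measureReal_def, hvE]; rfl
  have hfin : volume E ≠ ⊤ := by rw [hvE]; exact measure_ball_lt_top.ne
  set e := min (d / 2) (s / 9) with he
  have he0 : 0 < e := lt_min ♦ ♦
  have he1 : e ≤ d / 2 := min_le_left _ _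
  have he2 : e ≤ s / 9 := min_le_right _ _
  obtain ⟨f, hf, hc, h0, h1, h2, -, -⟩ := approx hE hfin hP he0
  have hq : ♮0 < (m + 1 : ℝ) / m := by positivity
  set q := (m + 1 : ℝ) / m with hqd
  have hq1 : 1 ≤ q := by rw [hqd, le_div_iff₀ hm0]; linarith
  have hq2 : q ≤ 2 := by
    rw [hqd, div_le_iff₀ hm0]
    have : ♮1 ≤ m := by exact_mod_cast hm
    linarith
  obtain ⟨fq1, fq2⟩ := rpow_cs hf.continuous hc hq
  have fqi : Integrable fun x ↦ f x ^ q := fq1.integrable_of_hasCompactSupport fq2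
  have fi : Integrable f := hf.continuous.integrable_of_hasCompactSupport hc
  have ei : Integrable (E.indicator (1 : EV (m + 1) → ℝ)) :=
    (integrable_indicator_iff hE).2 (integrableOn_const hfin)
  have ai : Integrable fun x ↦ |f x - E.indicator 1 x| := (fi.sub ei).abs
  have hE1 : ∫ x, E.indicator (1 : EV (m + 1) → ℝ) x = ww (m + 1) := by rw [integral_indicator_one hE, hvE']
  have b1 : |(∫ x, f x) - ww (m + 1)| ≤ e := by
    rw [← hE1, ← integral_sub fi ei]
    exact (abs_integral_le_integral_abs).trans h1
  have b2 : (∫ x, f x) - ∫ x, f x ^ q ≤ e := by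
    rw [← integral_sub fi fqi]
    refine (integral_mono (fi.sub fqi) ai fun x ↦ ?_).trans h1
    change f x - f x ^ q ≤ |f x - E.indicator 1 x|
    by_cases hx : x ∈ E
    · rw [indicator_of_mem hx, Pi.one_apply, abs_of_nonpos (by linarith [(h0 x).2])]
      have := one_add_mul_self_le_rpow_one_add (s := f x - 1) (by linarith [(h0 x).1]) hq1
      rw [add_sub_cancel] at this
      have h3 : (2 - q) * (1 - f x) ≥ 0 := mul_nonneg ♦ (by linarith [(h0 x).2])
      linarith
    · rw [indicator_of_notMem hx, sub_zero, abs_of_nonneg (h0 x).1]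
      linarith [Real.rpow_nonneg (h0 x).1 q]
  have b3 : ∫ x, f x ^ q ≤ ∫ x, f x := integral_mono fqi fi fun x ↦ by
    have := Real.rpow_le_rpow_of_exponent_ge' (h0 x).1 (h0 x).2 zero_le_one hq1
    simpa using this
  have b1' := abs_le.1 b1
  obtain hH := H f hf hc h0 ♦ (by rw [abs_le]; constructor <;> linarith) ♦
  choose c t0 t1 g1 g2 using hH
  obtain ⟨h, hhi, hh0, hh⟩ := bath (fun x ↦ f x ^ q) fq1 fq2 (fun x ↦ Real.rpow_nonneg (h0 x).1 _) c t0 t1 g1 g2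
  set C : EV (m + 1) := WithLp.toLp 2 c with hC
  refine ⟨C, ?_⟩
  obtain ⟨gi, gint⟩ := bath_g C
  set g : EV (m + 1) → ℝ := fun x ↦ max 0 (1 - ‖x - C‖ ^ 2) with hg
  have hgc : Continuous g := by simp only [hg]; fun_prop
  have hg0 : ∀ x, 0 ≤ g x := fun x ↦ le_max_left _ _
  have hg1 : ∀ x, g x ≤ 1 := fun x ↦ max_le zero_le_one (by linarith [sq_nonneg ‖x - C‖])
  have gh : Integrable fun x ↦ g x * h x := hhi.bdd_mul (c := 1) hgc.aestronglyMeasurable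
    (Eventually.of_forall fun x ↦ by rw [Real.norm_of_nonneg (hg0 x)]; exact hg1 x)
  have k1 : ∫ x, Eᶜ.indicator g x ≤ s := by
    have : ∫ x, Eᶜ.indicator g x ≤ ∫ x, (g x - g x * h x + |f x - E.indicator 1 x|) := by
      refine integral_mono (gi.indicator hE.compl) ((gi.sub gh).add ai) fun x ↦ ?_
      have hhf : h x ≤ f x := (hh0 x).2.trans (by
        have := Real.rpow_le_rpow_of_exponent_ge' (h0 x).1 (h0 x).2 zero_le_one hq1
        simpa using this)
      by_cases hx : x ∈ E
      · simp only [indicator_of_notMem (show x ∉ Eᶜ from fun h ↦ h hx)]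
        have : g x * h x ≤ g x := mul_le_of_le_one_right (hg0 x) (hhf.trans (h0 x).2)
        linarith [abs_nonneg (f x - E.indicator 1 x)]
      · simp only [indicator_of_mem (show x ∈ Eᶜ from hx), indicator_of_notMem hx, sub_zero, abs_of_nonneg (h0 x).1]
        have : g x * h x ≤ h x := mul_le_of_le_one_left (hh0 x).1 (hg1 x)
        linarith
    have gsi : Integrable fun x ↦ g x - g x * h x := gi.sub gh
    rw [integral_add gsi ai, integral_sub gi gh, gint] at this
    have e1 : (m + 1 : ℝ) * ((∫ s in (-1:ℝ)..1, s ^ 2 * vB m s) + s / (3 * (m + 1))) =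
      (m + 1) * (∫ s in (-1:ℝ)..1, s ^ 2 * vB m s) + s / 3 := by field_simp
    rw [e1] at hh
    linarith
  have hsub : ball C 1 \ E ⊆ (ball C 1 \ closedBall C ρ) ∪ (closedBall C ρ \ E) := fun x hx ↦ by
    by_cases h : x ∈ closedBall C ρ
    · exact Or.inr ⟨h, hx.2⟩
    · exact Or.inl ⟨hx.1, h⟩
  have fin1 : volume ((ball C 1 \ closedBall C ρ) ∪ (closedBall C ρ \ E)) ≠ ⊤ :=
    (measure_union_lt_top ((measure_mono Set.sdiff_subset).trans_lt measure_ball_lt_top)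
      ((measure_mono Set.sdiff_subset).trans_lt measure_closedBall_lt_top)).ne
  refine (measureReal_mono hsub fin1).trans ((measureReal_union_le _ _).trans ?_)
  have m1 : volume.real (ball C 1 \ closedBall C ρ) ≤ ε / 2 := by
    refine le_trans (measureReal_mono (Set.sdiff_subset_sdiff_left ball_subset_closedBall)
      ((measure_mono Set.sdiff_subset).trans_lt measure_closedBall_lt_top).ne) ?_
    rw [measureReal_sdiff (closedBall_subset_closedBall hρ1.le) measurableSet_closedBall measure_closedBall_lt_top.ne, vol_cball _ zero_le_one,
      vol_cball _ hρ0.le, one_pow, one_mul]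
    exact hρ
  have m2 : (1 - ρ ^ 2) * volume.real (closedBall C ρ \ E) ≤ s := by
    refine le_trans ?_ k1
    rw [← integral_indicator_one (measurableSet_closedBall.diff hE), ← integral_const_mul]
    refine integral_mono (((integrable_indicator_iff (measurableSet_closedBall.diff hE)).2 (integrableOn_const
      ((measure_mono Set.sdiff_subset).trans_lt measure_closedBall_lt_top).ne)).const_mul _) (gi.indicator hE.compl) fun x ↦ ?_
    by_cases hx : x ∈ closedBall C ρ \ E
    · simp only [indicator_of_mem hx, indicator_of_mem (show x ∈ Eᶜ from hx.2), Pi.one_apply, mul_one]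
      have h4 : ‖x - C‖ ≤ ρ := by simpa [dist_eq_norm] using hx.1
      refine le_trans ?_ (le_max_right _ _)
      have := pow_le_pow_left₀ (norm_nonneg _) h4 2
      linarith
    · simp only [indicator_of_notMem hx, mul_zero]
      exact indicator_nonneg (fun x _ ↦ hg0 x) x
  have m3 : volume.real (closedBall C ρ \ E) ≤ ε / 2 := by
    rw [hs, mul_comm (ε / 2)] at m2
    exact le_of_mul_le_mul_left m2 hρ2
  linarith
variable {m : ℕ}
lemma fq_ge (hm : 1 ≤ m) {E : Set (EV (m + 1))} (hE : MeasurableSet E) (hfin : volume E ≠ ⊤) {f : EV (m + 1) → ℝ}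
    (hf : Continuous f) (hc : HasCompactSupport f) (h0 : ∀ x, 0 ≤ f x ∧ f x ≤ 1) {e : ℝ}
    (h1 : ∫ x, |f x - E.indicator 1 x| ≤ e) : volume.real E - 2 * e ≤ ∫ x, f x ^ ((m + 1 : ℝ) / m) := by
  have hm0 : ♮0 < m := by exact_mod_cast hm
  have hq : ♮0 < (m + 1 : ℝ) / m := by positivity
  set q := (m + 1 : ℝ) / m with hqd
  have hq1 : 1 ≤ q := by rw [hqd, le_div_iff₀ hm0]; linarith
  have hq2 : q ≤ 2 := by
    rw [hqd, div_le_iff₀ hm0]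
    have : ♮1 ≤ m := by exact_mod_cast hm
    linarith
  obtain ⟨fq1, fq2⟩ := rpow_cs hf hc hq
  have fqi : Integrable fun x ↦ f x ^ q := fq1.integrable_of_hasCompactSupport fq2
  have fi : Integrable f := hf.integrable_of_hasCompactSupport hc
  have ei : Integrable (E.indicator (1 : EV (m + 1) → ℝ)) :=
    (integrable_indicator_iff hE).2 (integrableOn_const hfin)
  have ai : Integrable fun x ↦ |f x - E.indicator 1 x| := (fi.sub ei).abs
  have a2 : Integrable fun x ↦ 2 * |f x - E.indicator 1 x| := ai.const_mul 2
  have := integral_mono (ei.sub a2) fqi fun x ↦ by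
    change E.indicator 1 x - 2 * |f x - E.indicator 1 x| ≤ f x ^ q
    by_cases hx : x ∈ E
    · rw [indicator_of_mem hx, Pi.one_apply, abs_of_nonpos (by linarith [(h0 x).2])]
      have := one_add_mul_self_le_rpow_one_add (s := f x - 1) (by linarith [(h0 x).1]) hq1
      rw [add_sub_cancel] at this
      have h3 : (2 - q) * (1 - f x) ≥ 0 := mul_nonneg ♦ (by linarith [(h0 x).2])
      linarith
    · rw [indicator_of_notMem hx, sub_zero, abs_of_nonneg (h0 x).1]
      linarith [Real.rpow_nonneg (h0 x).1 q, (h0 x).1]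
  rw [integral_sub' ei a2, integral_const_mul, integral_indicator_one hE] at this
  linarith
lemma iso (hm : 1 ≤ m) {E : Set (EV (m + 1))} (hE : MeasurableSet E) (hfin : volume E ≠ ⊤) {p : ℝ} (h : PerLe E p) :
    (m + 1 : ℝ) * ww (m + 1) ^ (1 / (m + 1 : ℝ)) * volume.real E ^ (m / (m + 1 : ℝ)) ≤ p := by
  have hm0 : ♮0 < m := by exact_mod_cast hm
  have hθ : ♮0 < m / (m + 1) := by positivity
  rcases eq_or_lt_of_le (measureReal_nonneg : 0 ≤ volume.real E) with h0 | hpos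
  · rw [← h0, Real.zero_rpow hθ.ne', mul_zero]
    have := h 0 contDiff_const HasCompactSupport.zero ♥
    simpa [vdiv] using this
  · have t1 : Tendsto (fun e : ℝ ↦ (m + 1 : ℝ) * ww (m + 1) ^ (1 / (m + 1 : ℝ)) * (volume.real E - 2 * e) ^ (m / (m + 1 : ℝ)))
        (𝓝[>] 0) (𝓝 ((m + 1 : ℝ) * ww (m + 1) ^ (1 / (m + 1 : ℝ)) * volume.real E ^ (m / (m + 1 : ℝ)))) := by
      have : ContinuousAt (fun e : ℝ ↦ (volume.real E - 2 * e) ^ (m / (m + 1 : ℝ))) 0 :=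
        ContinuousAt.rpow_const ♩ (Or.inr hθ.le)
      have h2 := (this.tendsto.const_mul ((m + 1 : ℝ) * ww (m + 1) ^ (1 / (m + 1 : ℝ))))
      simp only [mul_zero, sub_zero] at h2
      exact h2.mono_left nhdsWithin_le_nhds
    have t2 : Tendsto (fun e : ℝ ↦ p + e) (𝓝[>] 0) (𝓝 p) := by
      have : Tendsto (fun e : ℝ ↦ p + e) (𝓝 0) (𝓝 (p + 0)) := (continuous_const.add continuous_id).tendsto 0
      rw [add_zero] at this
      exact this.mono_left nhdsWithin_le_nhds
    have ev : ∀ᶠ e : ℝ in 𝓝[>] 0, e < volume.real E / 2 := nhdsWithin_le_nhds (eventually_lt_nhds ♦)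
    refine le_of_tendsto_of_tendsto t1 t2 ?_
    filter_upwards [ev, self_mem_nhdsWithin] with e he he0
    obtain ⟨f, hf, hc, h0, h1, h2, -, -⟩ := approx hE hfin h he0
    refine le_trans ?_ ((Sob_of_Hm hm (Hm_all m hm) hf hc fun x ↦ (h0 x).1).trans h2)
    have := (ww_pos (m + 1)).le
    refine mul_le_mul_of_nonneg_left (Real.rpow_le_rpow ♦ (fq_ge hm hE hfin hf.continuous hc h0 h1) hθ.le) ♠
lemma cutR {V : ℝ → ℝ} {δ κ : ℝ} (hδ : 0 < δ) (hκ : 0 < κ) (hV : ContinuousOn V (Icc 1 (1 + δ)))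
    (h0 : ∀ r, 0 ≤ V r) (hmono : ∀ r s, r ≤ s → V s ≤ V r)
    (h1 : V 1 ^ (1 / (m + 1 : ℝ)) < κ * δ) :
    ∃ r, 1 ≤ r ∧ r < 1 + δ ∧ ∀ s, r ≤ s → s ≤ 1 + δ →
      V r - V s ≤ (m + 1) * κ * V r ^ (m / (m + 1 : ℝ)) * (s - r) := by
  have hn : ♮0 < m + 1 := by positivity
  set v : ℝ → ℝ := fun r ↦ V r ^ (1 / (m + 1 : ℝ)) with hv
  have hv0 : ∀ r, 0 ≤ v r := fun r ↦ Real.rpow_nonneg (h0 r) _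
  have hvc : ContinuousOn (fun r ↦ v r + κ * r) (Icc 1 (1 + δ)) :=
    (hV.rpow_const fun x _ ↦ Or.inr ♠).add ♩
  obtain ⟨r, hr, hmin⟩ := isCompact_Icc.exists_isMinOn (nonempty_Icc.2 (by linarith : ♮1 ≤ 1 + δ)) hvc
  refine ⟨r, hr.1, lt_of_le_of_ne hr.2 fun he ↦ ?_, fun s hs1 hs2 ↦ ?_⟩
  · have := hmin (left_mem_Icc.2 (by linarith : ♮1 ≤ 1 + δ))
    simp only [mem_ofPred_eq, he] at this
    have h2 := hv0 (1 + δ)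
    have h3 : v 1 < κ * δ := h1
    linarith
  · have h2 := hmin (⟨hr.1.trans hs1, hs2⟩ : s ∈ Icc 1 (1 + δ))
    simp only [mem_ofPred_eq] at h2
    have e1 : ∀ r, V r = v r ^ (m + 1) := fun r ↦ by
      rw [hv]; simp only
      rw [← Real.rpow_natCast, ← Real.rpow_mul (h0 r)]; push_cast; rw [one_div_mul_cancel hn.ne', Real.rpow_one]
    have e2 : V r ^ (m / (m + 1 : ℝ)) = v r ^ m := by
      rw [hv]; simp only
      rw [← Real.rpow_natCast, ← Real.rpow_mul (h0 r)]; congr 1; field_simp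
    have hvs : v s ≤ v r := Real.rpow_le_rpow (h0 s) (hmono r s hs1) ♠
    have key : ∀ k : ℕ, v r ^ (k + 1) - v s ^ (k + 1) ≤ (k + 1) * v r ^ k * (v r - v s) := by
      intro k
      induction k with
      | zero => simp
      | succ k ih =>
        have a1 := mul_le_mul_of_nonneg_left ih (hv0 r)
        have a2 := mul_le_mul_of_nonneg_right (pow_le_pow_left₀ (hv0 s) hvs (k + 1)) (sub_nonneg.2 hvs)
        push_cast
        ring_nf at a1 a2 ⊢
        linarith
    rw [e2, e1 r, e1 s]
    refine (key m).trans ?_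
    have := mul_le_mul_of_nonneg_left (by linarith : v r - v s ≤ κ * (s - r)) (by positivity [pow_nonneg (hv0 r) m] : 0 ≤ (m + 1 : ℝ) * v r ^ m)
    linarith
lemma volI_cont (F : Set (EV (m + 1))) (hF : MeasurableSet F) :
    ContinuousOn (fun r ↦ volume.real (F ∩ closedBall 0 r)) (Ici 0) := by
  have key : ∀ r s : ℝ, 0 ≤ r → r ≤ s → volume.real (F ∩ closedBall 0 s) - volume.real (F ∩ closedBall 0 r) ≤
      s ^ (m + 1) * ww (m + 1) - r ^ (m + 1) * ww (m + 1) := fun r s hr hrs ↦ by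
    rw [← vol_cball (0 : EV (m + 1)) hr, ← vol_cball (0 : EV (m + 1)) (hr.trans hrs)]
    have hb : ∀ t, volume (closedBall (0 : EV (m + 1)) t) ≠ ⊤ := fun t ↦ measure_closedBall_lt_top.ne
    have e : ∀ t, volume.real (F ∩ closedBall 0 t) = volume.real (closedBall (0 : EV (m + 1)) t) -
        volume.real (closedBall 0 t \ F) := fun t ↦ by
      have := measureReal_inter_add_sdiff (μ := volume) (s := closedBall (0 : EV (m + 1)) t) hF (hb t)
      rw [inter_comm]; linarith
    have : volume.real (closedBall 0 r \ F) ≤ volume.real (closedBall 0 s \ F) :=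
      measureReal_mono (sdiff_subset_sdiff_left (closedBall_subset_closedBall hrs))
        ((measure_mono Set.sdiff_subset).trans_lt measure_closedBall_lt_top).ne
    rw [e, e]; linarith
  have mono : ∀ r s : ℝ, r ≤ s → volume.real (F ∩ closedBall 0 r) ≤ volume.real (F ∩ closedBall 0 s) := fun r s h ↦
    measureReal_mono (inter_subset_inter_right _ (closedBall_subset_closedBall h))
      ((measure_mono inter_subset_right).trans_lt measure_closedBall_lt_top).ne
  intro r hr
  rw [ContinuousWithinAt, tendsto_iff_dist_tendsto_zero]
  have t : Tendsto (fun s ↦ dist (s ^ (m + 1) * ww (m + 1)) (r ^ (m + 1) * ww (m + 1))) (𝓝[Ici 0] r) (𝓝 0) := by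
    rw [← tendsto_iff_dist_tendsto_zero]
    exact Continuous.continuousWithinAt ♩
  refine squeeze_zero' (Eventually.of_forall fun s ↦ dist_nonneg) ?_ t
  filter_upwards [self_mem_nhdsWithin] with s hs
  rw [Real.dist_eq, Real.dist_eq]
  rcases le_total r s with h | h
  · rw [abs_of_nonneg (sub_nonneg.2 (mono _ _ h))]
    exact (key r s hr h).trans (le_abs_self _)
  · rw [abs_sub_comm, abs_of_nonneg (sub_nonneg.2 (mono _ _ h)), abs_sub_comm]
    exact (key s r hs h).trans (le_abs_self _)
variable {m : ℕ}
set_option maxHeartbeats 1000000 in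
lemma trunc (hm : 1 ≤ m) {δ : ℝ} (hδ : 0 < δ) (hδ1 : δ < 1) : ∃ ε > 0, ∀ (E : Set (EV (m + 1))) (p : ℝ), MeasurableSet E →
    volume E ≠ ⊤ → PerLe E p → volume.real (E \ closedBall 0 1) < ε → volume.real (closedBall 0 1 \ E) < ε →
    ∃ r₁ r₂ : ℝ, 1 ≤ r₁ ∧ r₁ < 1 + δ ∧ r₂ ≤ 1 ∧ 1 - δ < r₂ ∧
      PerLe ((E ∩ closedBall 0 r₁) ∪ closedBall 0 r₂) (p - (m + 1) * ww (m + 1) ^ (1 / (m + 1 : ℝ)) / 2 *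
        (volume.real (E \ closedBall 0 r₁) ^ (m / (m + 1 : ℝ)) + volume.real (closedBall 0 r₂ \ E) ^ (m / (m + 1 : ℝ)))) := by
  obtain ⟨L, hL, hglue⟩ := glue
  have hw := ww_pos (m + 1)
  set K := (m + 1 : ℝ) * ww (m + 1) ^ (1 / (m + 1 : ℝ)) with hK
  have hK0 : 0 < K := by positivity
  set κ := K / (2 * (m + 1) * L) with hκd
  have hκ : 0 < κ := by positivity
  have hLA : ∀ x : ℝ, L * ((m + 1) * κ * x) = K / 2 * x := fun x ↦ by rw [hκd]; field_simp
  have hfinB : ∀ t, volume (closedBall (0 : EV (m + 1)) t) ≠ ⊤ := fun t ↦ measure_closedBall_lt_top.ne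
  have hrp : ∀ x : ℝ, 0 ≤ x → x < (κ * δ) ^ (m + 1) → x ^ (1 / (m + 1 : ℝ)) < κ * δ := fun x hx h ↦ by
    have := Real.rpow_lt_rpow hx h (by positivity : ♮0 < 1 / (m + 1 : ℝ))
    have e : ((κ * δ) ^ (m + 1)) ^ (1 / (m + 1 : ℝ)) = κ * δ := by
      have := Real.pow_rpow_inv_natCast (by positivity : 0 ≤ κ * δ) (Nat.succ_ne_zero m)
      push_cast at this; rw [one_div]; exact this
    rwa [e] at this
  have seq : ∀ t : ℝ, 0 < t → ∃ h : ℕ → ℝ, (∀ k, 0 < h k ∧ h k ≤ t) ∧ Tendsto h atTop (𝓝 0) := fun t ht ↦ by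
    refine ⟨fun k ↦ t * (1 / (♮k + 1)), fun k ↦ ⟨by positivity, ?_⟩, ?_⟩
    · refine mul_le_of_le_one_right ht.le ?_
      rw [div_le_one ♠]; linarith [Nat.cast_nonneg (α := ℝ) k]
    · have := (tendsto_one_div_add_atTop_nhds_zero_nat (𝕜 := ℝ)).const_mul t
      rwa [mul_zero] at this
  refine ⟨(κ * δ) ^ (m + 1), by positivity, fun E p hE hfin hP hV1 hV2 ↦ ?_⟩
  have hfinE : ∀ t, volume (E \ closedBall 0 t) ≠ ⊤ := fun t ↦ ((measure_mono Set.sdiff_subset).trans_lt hfin.lt_top).ne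
  have eV : ∀ t, volume.real (E \ closedBall 0 t) = volume.real E - volume.real (E ∩ closedBall 0 t) := fun t ↦ by
    have := measureReal_inter_add_sdiff (μ := volume) (s := E) (measurableSet_closedBall (x := (0 : EV (m + 1))) (ε := t)) hfin
    linarith
  have c1 : ContinuousOn (fun t ↦ volume.real (E \ closedBall 0 t)) (Icc 1 (1 + δ)) := by
    simp_rw [eV]
    exact continuousOn_const.sub ((volI_cont E hE).mono fun t ht ↦ zero_le_one.trans ht.1)
  obtain ⟨r₁, h1, h2, h3⟩ := cutR (m := m) hδ hκ c1 (fun _ ↦ measureReal_nonneg)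
    (fun r s hrs ↦ measureReal_mono (sdiff_subset_sdiff_right (closedBall_subset_closedBall hrs)) (hfinE _))
    (hrp _ measureReal_nonneg hV1)
  obtain ⟨h, hh, hht⟩ := seq (1 + δ - r₁) ♦
  have P1 : PerLe (E ∩ closedBall 0 r₁) (p - K / 2 * volume.real (E \ closedBall 0 r₁) ^ (m / (m + 1 : ℝ))) := by
    intro φ a1 a2 a3
    have hP2 : PerLe (E \ closedBall 0 r₁) (p + K / 2 * volume.real (E \ closedBall 0 r₁) ^ (m / (m + 1 : ℝ)) -
        ∫ x in E ∩ closedBall 0 r₁, vdiv φ x) := by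
      intro φ₂ b1 b2 b3
      have := hglue (m + 1) E hE p hP r₁ ((m + 1) * κ * volume.real (E \ closedBall 0 r₁) ^ (m / (m + 1 : ℝ)))
        (fun _ ↦ r₁) (fun k ↦ r₁ + h k) (fun _ ↦ by linarith) (fun k ↦ by linarith [(hh k).1]) (fun _ ↦ le_rfl)
        (fun k ↦ by linarith [(hh k).1]) tendsto_const_nhds
        (by simpa using hht.const_add r₁) (fun k ↦ by
          refine le_trans ?_ (h3 (r₁ + h k) (by linarith [(hh k).1]) (by linarith [(hh k).2]))
          have e1 : volume.real (E ∩ (closedBall 0 (r₁ + h k) \ ball 0 r₁)) ≤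
              volume.real ((E \ closedBall 0 r₁) \ (E \ closedBall 0 (r₁ + h k))) + volume.real (sphere (0 : EV (m + 1)) r₁) := by
            refine (measureReal_mono (fun x hx ↦ ?_) ?_).trans (measureReal_union_le _ _)
            · by_cases hs : x ∈ sphere (0 : EV (m + 1)) r₁
              · exact Or.inr hs
              · refine Or.inl ⟨⟨hx.1, fun h ↦ hs ?_⟩, fun h ↦ h.2 hx.2.1⟩
                rw [← closedBall_sdiff_ball]; exact ⟨h, hx.2.2⟩
            · exact (measure_union_lt_top ((measure_mono (Set.sdiff_subset.trans Set.sdiff_subset)).trans_lt hfin.lt_top)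
                ((measure_mono sphere_subset_closedBall).trans_lt measure_closedBall_lt_top)).ne
          have e2 : volume.real (sphere (0 : EV (m + 1)) r₁) = 0 := by
            rw [measureReal_def, Measure.addHaar_sphere_of_ne_zero _ _ ♦]; rfl
          rw [e2, add_zero, measureReal_sdiff (sdiff_subset_sdiff_right (closedBall_subset_closedBall (by linarith [(hh k).1])))
            (hE.diff measurableSet_closedBall) (hfinE _)] at e1
          exact e1) φ φ₂ a1 a2 a3 b1 b2 b3
      rw [hLA] at this
      linarith
    have := iso hm (hE.diff measurableSet_closedBall) (hfinE _) hP2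
    rw [← hK] at this
    linarith
  set E' := E ∩ closedBall 0 r₁ with hE'
  have mE' : MeasurableSet E' := hE.inter measurableSet_closedBall
  have PF := P1.compl mE'
  have eF : ∀ t, t ≤ 1 → E'ᶜ ∩ closedBall 0 t = closedBall 0 t \ E := fun t ht ↦ by
    ext x
    simp only [hE', mem_inter_iff, mem_compl_iff, Set.mem_sdiff, not_and]
    have : x ∈ closedBall (0 : EV (m + 1)) t → x ∈ closedBall (0 : EV (m + 1)) r₁ :=
      fun h ↦ closedBall_subset_closedBall (ht.trans h1) h
    tauto
  have hfinF : ∀ t, volume (E'ᶜ ∩ closedBall 0 t) ≠ ⊤ := fun t ↦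
    ((measure_mono inter_subset_right).trans_lt measure_closedBall_lt_top).ne
  have c2 : ContinuousOn (fun t ↦ volume.real (E'ᶜ ∩ closedBall 0 (2 - t))) (Icc 1 (1 + δ)) :=
    (volI_cont E'ᶜ mE'.compl).comp (f := fun t : ℝ ↦ 2 - t) ♩ fun t ht ↦ by
      have := ht.2; simp only [mem_Ici]; linarith
  obtain ⟨t, k1, k2, k3⟩ := cutR (m := m) hδ hκ c2 (fun _ ↦ measureReal_nonneg)
    (fun r s hrs ↦ measureReal_mono (inter_subset_inter_right _ (closedBall_subset_closedBall ♦)) (hfinF _))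
    (hrp _ measureReal_nonneg (by rw [show ♮2 - 1 = 1 by norm_num, eF 1 le_rfl]; exact hV2))
  set r₂ := 2 - t with hr₂
  obtain ⟨h', hh', hht'⟩ := seq (1 + δ - t) ♦
  refine ⟨r₁, r₂, h1, h2, by linarith, by linarith, ?_⟩
  rw [← eF r₂ ♦]
  have P2 : PerLe (E'ᶜ \ closedBall 0 r₂) (p - K / 2 * volume.real (E \ closedBall 0 r₁) ^ (m / (m + 1 : ℝ)) -
      K / 2 * volume.real (E'ᶜ ∩ closedBall 0 r₂) ^ (m / (m + 1 : ℝ))) := by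
    intro φ a1 a2 a3
    have hP2 : PerLe (E'ᶜ ∩ closedBall 0 r₂) (p - K / 2 * volume.real (E \ closedBall 0 r₁) ^ (m / (m + 1 : ℝ)) +
        K / 2 * volume.real (E'ᶜ ∩ closedBall 0 r₂) ^ (m / (m + 1 : ℝ)) - ∫ x in E'ᶜ \ closedBall 0 r₂, vdiv φ x) := by
      intro φ₂ b1 b2 b3
      have := hglue (m + 1) E'ᶜ mE'.compl _ PF r₂ ((m + 1) * κ * volume.real (E'ᶜ ∩ closedBall 0 r₂) ^ (m / (m + 1 : ℝ)))
        (fun k ↦ r₂ - h' k) (fun _ ↦ r₂) (fun k ↦ by linarith [(hh' k).2]) (fun k ↦ by linarith [(hh' k).1])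
        (fun k ↦ by linarith [(hh' k).1]) (fun k ↦ le_rfl) (by simpa using hht'.const_sub r₂) tendsto_const_nhds
        (fun k ↦ by
          have k4 := k3 (t + h' k) (by linarith [(hh' k).1]) (by linarith [(hh' k).2])
          rw [show 2 - (t + h' k) = r₂ - h' k by rw [hr₂]; ring] at k4
          rw [show r₂ - (r₂ - h' k) = t + h' k - t by ring]
          refine le_trans ?_ k4
          have e1 : volume.real (E'ᶜ ∩ (closedBall 0 r₂ \ ball 0 (r₂ - h' k))) ≤
              volume.real ((E'ᶜ ∩ closedBall 0 r₂) \ (E'ᶜ ∩ closedBall 0 (r₂ - h' k))) +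
                volume.real (sphere (0 : EV (m + 1)) (r₂ - h' k)) := by
            refine (measureReal_mono (fun x hx ↦ ?_) ?_).trans (measureReal_union_le _ _)
            · by_cases hs : x ∈ sphere (0 : EV (m + 1)) (r₂ - h' k)
              · exact Or.inr hs
              · refine Or.inl ⟨⟨hx.1, hx.2.1⟩, fun h ↦ hs ?_⟩
                rw [← closedBall_sdiff_ball]; exact ⟨h.2, hx.2.2⟩
            · exact (measure_union_lt_top ((measure_mono Set.sdiff_subset).trans_lt (hfinF _).lt_top)
                ((measure_mono sphere_subset_closedBall).trans_lt measure_closedBall_lt_top)).ne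
          have e2 : volume.real (sphere (0 : EV (m + 1)) (r₂ - h' k)) = 0 := by
            rw [measureReal_def, Measure.addHaar_sphere_of_ne_zero _ _ (by linarith [(hh' k).2])]; rfl
          rw [e2, add_zero, measureReal_sdiff (inter_subset_inter_right _ (closedBall_subset_closedBall (by linarith [(hh' k).1])))
            (mE'.compl.inter measurableSet_closedBall) (hfinF _)] at e1
          exact e1) φ₂ φ b1 b2 b3 a1 a2 a3
      rw [hLA] at this
      linarith
    have := iso hm (mE'.compl.inter measurableSet_closedBall) (hfinF _) hP2
    rw [← hK] at this
    linarith
  have P3 := P2.compl (mE'.compl.diff measurableSet_closedBall)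
  have e3 : (E'ᶜ \ closedBall 0 r₂)ᶜ = E' ∪ closedBall 0 r₂ := by
    rw [sdiff_eq, compl_inter, compl_compl, compl_compl]
  rw [e3] at P3
  intro φ a1 a2 a3
  have := P3 φ a1 a2 a3
  linarith
abbrev gm (n : ℕ) : Measure (EV n) := stdGaussian (EV n)
abbrev nv {n : ℕ} (x : EV n) : EV n := ‖x‖⁻¹ • x
def rm (n : ℕ) : Measure ℝ := (volume.restrict (Ioi 0)).withDensity fun r ↦ ENNReal.ofReal (r ^ (n - 1))
def gd {n : ℕ} (x : EV n) : ℝ := Real.exp (-(1 / 2) * ‖x‖ ^ 2)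
lemma gd_int (n : ℕ) : Integrable (gd (n := n)) ∧ 0 < ∫ x, gd (n := n) x ∧
    ∀ t : EV n, ∫ v : EV n, Complex.exp (-(1/2 : ℂ) * ‖v‖ ^ 2 + Complex.I * inner ℝ t v) =
      ((∫ x, gd (n := n) x : ℝ) : ℂ) * Complex.exp (-‖t‖ ^ 2 / 2) := by
  have h1 : ∫ x : EV n, gd x = (Real.pi / (1 / 2)) ^ (Module.finrank ℝ (EV n) / 2 : ℝ) :=
    GaussianFourier.integral_rexp_neg_mul_sq_norm (V := EV n) (by norm_num : ♮0 < 1 / 2)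
  have h2 : 0 < ∫ x : EV n, gd x := by rw [h1]; exact Real.rpow_pos_of_pos ♠ _
  refine ⟨by_contra fun h ↦ h2.ne' (integral_undef h), h2, fun t ↦ ?_⟩
  have h3 := GaussianFourier.integral_cexp_neg_mul_sq_norm_add (V := EV n) (b := (1 / 2 : ℂ)) ♣ Complex.I t
  have h4 := GaussianFourier.integral_cexp_neg_mul_sq_norm (V := EV n) (b := (1 / 2 : ℂ)) ♣
  rw [h3, ← h4, Complex.I_sq]
  congr 1
  · rw [← integral_complex_ofReal]
    congr 1; ext x; simp [gd]
  · congr 1; ring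
lemma gm_dens (n : ℕ) : gm n = volume.withDensity fun x ↦ ENNReal.ofReal ((∫ x, gd (n := n) x)⁻¹ * gd x) := by
  obtain ⟨hi, hp, hc⟩ := gd_int n
  set J := ∫ x, gd (n := n) x with hJ
  have hdi : Integrable fun x ↦ J⁻¹ * gd (n := n) x := hi.const_mul _
  have hd0 : ∀ x, 0 ≤ J⁻¹ * gd (n := n) x := fun x ↦ mul_nonneg (inv_nonneg.2 hp.le) (Real.exp_pos _).le
  have hm : Measurable fun x : EV n ↦ ENNReal.ofReal (J⁻¹ * gd x) := by unfold gd; fun_prop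
  have : IsFiniteMeasure (volume.withDensity fun x ↦ ENNReal.ofReal (J⁻¹ * gd (n := n) x)) :=
    isFiniteMeasure_withDensity_ofReal hdi.2
  refine Measure.ext_of_charFun (funext fun t ↦ ?_)
  rw [charFun_stdGaussian, charFun_apply, integral_withDensity_eq_integral_toReal_smul hm ♥]
  simp_rw [fun x ↦ ENNReal.toReal_ofReal (hd0 x)]
  have e : ∀ x : EV n, (J⁻¹ * gd x) • Complex.exp (inner ℝ x t * Complex.I) =
      (J⁻¹ : ℂ) * Complex.exp (-(1/2 : ℂ) * ‖x‖ ^ 2 + Complex.I * inner ℝ t x) := fun x ↦ by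
    rw [Complex.exp_add, Complex.real_smul, real_inner_comm]
    simp only [gd]; push_cast
    rw [mul_comm Complex.I, mul_assoc]
  simp_rw [e]
  rw [integral_const_mul, hc, ← mul_assoc, inv_mul_cancel₀ (by exact_mod_cast hp.ne'), one_mul]
lemma gm_lint {n : ℕ} {H : EV n → ℝ≥0∞} (hH : Measurable H) :
    ∫⁻ x, H x ∂(gm n) = ENNReal.ofReal (∫ x, gd (n := n) x)⁻¹ * ∫⁻ x, H x * ENNReal.ofReal (gd x) := by
  have hd : Measurable fun x : EV n ↦ gd x := by unfold gd; fun_prop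
  rw [gm_dens, lintegral_withDensity_eq_lintegral_mul _ ♩ hH, ← lintegral_const_mul _ ♩]
  congr 1; ext x
  rw [Pi.mul_apply, ENNReal.ofReal_mul (inv_nonneg.2 (gd_int n).2.1.le)]; ring
instance (n : ℕ) : SFinite (rm n) := by unfold rm; infer_instance
lemma pol {n : ℕ} {H : EV n → ℝ≥0∞} (hH : Measurable H) (hn : 1 ≤ n) :
    ∫⁻ x, H x = ∫⁻ ω : sphere (0 : EV n) 1, ∫⁻ r, H (r • ω.1) ∂(rm n) ∂(volume : Measure (EV n)).toSphere := by
  have : Nontrivial (EV n) := Module.nontrivial_of_finrank_pos (R := ℝ) (by rw [finrank_euclideanSpace_fin]; omega)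
  have h1 := (Measure.measurePreserving_homeomorphUnitSphereProd (volume : Measure (EV n)))
  have e1 : ∫⁻ x, H x = ∫⁻ x : ({0}ᶜ : Set (EV n)), H x.1 ∂((volume : Measure (EV n)).comap (↑)) := by
    rw [lintegral_subtype_comap (measurableSet_singleton _).compl, restrict_compl_singleton]
  have e2 : ∀ x : ({0}ᶜ : Set (EV n)), H x.1 = (fun p : sphere (0 : EV n) 1 × Ioi ♮0 ↦ H (p.2.1 • p.1.1))
      (homeomorphUnitSphereProd (EV n) x) := fun x ↦ by
    simp only [homeomorphUnitSphereProd_apply_snd_coe, homeomorphUnitSphereProd_apply_fst_coe]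
    rw [smul_smul, mul_inv_cancel₀ (norm_ne_zero_iff.2 x.2), one_smul]
  have m1 : Measurable fun p : sphere (0 : EV n) 1 × Ioi ♮0 ↦ H (p.2.1 • p.1.1) := hH.comp ♩
  simp_rw [e1, e2]
  rw [h1.lintegral_comp m1, lintegral_prod _ m1.aemeasurable]
  congr 1; ext ω
  have m2 : Measurable fun r : ℝ ↦ H (r • ω.1) := hH.comp ♩
  rw [Measure.volumeIoiPow, lintegral_withDensity_eq_lintegral_mul _ ♩ (by exact m2.comp measurable_subtype_coe),
    rm, lintegral_withDensity_eq_lintegral_mul _ ♩ m2, finrank_euclideanSpace_fin]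
  exact lintegral_subtype_comap measurableSet_Ioi fun r ↦ (ENNReal.ofReal (r ^ (n - 1)) * H (r • ω.1))
lemma rm_ae (n : ℕ) : ∀ᵐ r ∂(rm n), 0 < r :=
  (withDensity_absolutelyContinuous _ _).ae_le (ae_restrict_mem measurableSet_Ioi)
lemma nv_meas {n : ℕ} : Measurable (nv (n := n)) := by fun_prop
lemma nv_sph {n : ℕ} (ω : sphere (0 : EV n) 1) {r : ℝ} (hr : 0 < r) : nv (r • ω.1) = ω.1 ∧ ‖r • ω.1‖ = r := by
  have h : ‖ω.1‖ = 1 := by simpa using ω.2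
  have e : ‖r • ω.1‖ = r := by rw [norm_smul, h, mul_one, Real.norm_of_nonneg hr.le]
  refine ⟨?_, e⟩
  rw [nv, e, smul_smul, inv_mul_cancel₀ hr.ne', one_smul]
lemma gm_polar {n : ℕ} (hn : 1 ≤ n) {H : EV n → ℝ → ℝ≥0∞} (hH : Measurable fun p : EV n × ℝ ↦ H p.1 p.2) :
    ∫⁻ x, H (nv x) ‖x‖ ∂(gm n) = ENNReal.ofReal (∫ x, gd (n := n) x)⁻¹ *
      ∫⁻ ω : sphere (0 : EV n) 1, ∫⁻ r, H ω.1 r * ENNReal.ofReal (Real.exp (-(1/2) * r ^ 2)) ∂(rm n)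
        ∂(volume : Measure (EV n)).toSphere := by
  have m1 : Measurable fun x : EV n ↦ H (nv x) ‖x‖ := hH.comp (nv_meas.prodMk measurable_norm)
  have hd : Measurable fun x : EV n ↦ gd x := by unfold gd; fun_prop
  rw [gm_lint m1, pol ♩ hn]
  congr 2; ext ω
  refine lintegral_congr_ae ?_
  filter_upwards [rm_ae n] with r hr
  rw [(nv_sph ω hr).1, gd, (nv_sph ω hr).2]
lemma gm_ang {n : ℕ} (hn : 1 ≤ n) : ∃ c : ℝ≥0∞, (c * (ENNReal.ofReal (n * ww n)) = 1 ∧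
    ∀ K : EV n → ℝ≥0∞, Measurable K → ∫⁻ x, K (nv x) ∂(gm n) =
      c * ∫⁻ ω : sphere (0 : EV n) 1, K ω.1 ∂(volume : Measure (EV n)).toSphere) := by
  have key : ∀ K : EV n → ℝ≥0∞, Measurable K → ∫⁻ x, K (nv x) ∂(gm n) =
      (ENNReal.ofReal (∫ x, gd (n := n) x)⁻¹ * ∫⁻ r, ENNReal.ofReal (Real.exp (-(1/2) * r ^ 2)) ∂(rm n)) *
        ∫⁻ ω : sphere (0 : EV n) 1, K ω.1 ∂(volume : Measure (EV n)).toSphere := fun K hK ↦ by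
    rw [gm_polar hn (H := fun y _ ↦ K y) ♩]
    simp_rw [fun ω : sphere (0 : EV n) 1 ↦ lintegral_const_mul (μ := rm n) (K ω.1)
      (show Measurable fun r : ℝ ↦ ENNReal.ofReal (Real.exp (-(1/2) * r ^ 2)) by fun_prop)]
    rw [lintegral_mul_const _ ♩]
    ring
  refine ⟨_, ?_, key⟩
  have := key (fun _ ↦ 1) measurable_const
  rw [lintegral_one, measure_univ, lintegral_one, Measure.toSphere_apply_univ, finrank_euclideanSpace_fin] at this
  rw [this]
  congr 1
  rw [ww, ENNReal.ofReal_mul ♠, ENNReal.ofReal_natCast, ofReal_measureReal measure_ball_lt_top.ne]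
lemma polA {n : ℕ} (hn : 1 ≤ n) : Measure.map (fun p : EV n × ℝ ↦ p.2 • nv p.1) ((gm n).prod (rm n)) =
    ENNReal.ofReal (n * ww n)⁻¹ • volume := by
  obtain ⟨c, hc, h⟩ := gm_ang hn
  have hw : ♮0 < n * ww n := mul_pos (by exact_mod_cast hn) (ww_pos n)
  have hc2 : ENNReal.ofReal (n * ww n)⁻¹ = c := by
    rw [ENNReal.ofReal_inv_of_pos hw]; exact (ENNReal.eq_inv_of_mul_eq_one_left hc).symm
  have mm : Measurable fun p : EV n × ℝ ↦ p.2 • nv p.1 := by fun_prop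
  refine Measure.ext_of_lintegral _ fun G hG ↦ ?_
  have m2 : Measurable fun p : EV n × ℝ ↦ G (p.2 • p.1) := hG.comp ♩
  have mG : Measurable fun p : EV n × ℝ ↦ G (p.2 • nv p.1) := hG.comp mm
  rw [lintegral_map hG mm, lintegral_prod _ mG.aemeasurable, lintegral_smul_measure, pol hG hn, hc2]
  exact h (fun y ↦ ∫⁻ r, G (r • y) ∂(rm n)) m2.lintegral_prod_right'
lemma polB {n : ℕ} (hn : 1 ≤ n) : Measure.map (fun p : 𝔼 n ↦ ‖p.2‖ • nv p.1) ((gm n).prod (gm n)) = gm n := by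
  obtain ⟨c, hc, h⟩ := gm_ang hn
  have mm : Measurable fun p : 𝔼 n ↦ ‖p.2‖ • nv p.1 := by fun_prop
  refine Measure.ext_of_lintegral _ fun G hG ↦ ?_
  have m2 : Measurable fun p : 𝔼 n ↦ G (‖p.2‖ • p.1) := hG.comp ♩
  have m3 : Measurable fun p : EV n × ℝ ↦ G (p.2 • p.1) := hG.comp ♩
  have m4 : Measurable fun y : EV n ↦ ∫⁻ r, G (r • y) * ENNReal.ofReal (Real.exp (-(1/2) * r ^ 2)) ∂(rm n) := by
    refine Measurable.lintegral_prod_right' (f := fun p : EV n × ℝ ↦ G (p.2 • p.1) * ENNReal.ofReal (Real.exp (-(1/2) * p.2 ^ 2))) ?_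
    exact m3.mul ♩
  have mG : Measurable fun p : 𝔼 n ↦ G (‖p.2‖ • nv p.1) := hG.comp mm
  rw [lintegral_map hG mm, lintegral_prod _ mG.aemeasurable]
  have e1 := h (fun y ↦ ∫⁻ x', G (‖x'‖ • y) ∂(gm n)) m2.lintegral_prod_right'
  refine e1.trans ?_
  have e2 : ∀ y : EV n, ∫⁻ x', G (‖x'‖ • y) ∂(gm n) = ENNReal.ofReal (∫ x, gd (n := n) x)⁻¹ *
      ((∫⁻ r, G (r • y) * ENNReal.ofReal (Real.exp (-(1/2) * r ^ 2)) ∂(rm n)) * ENNReal.ofReal (n * ww n)) := fun y ↦ by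
    rw [gm_polar hn (H := fun _ r ↦ G (r • y)) (by exact hG.comp ♩), lintegral_const, Measure.toSphere_apply_univ, finrank_euclideanSpace_fin]
    congr 2
    rw [ww, ENNReal.ofReal_mul ♠, ENNReal.ofReal_natCast, ofReal_measureReal measure_ball_lt_top.ne]
  simp_rw [e2]
  have m5 : Measurable fun ω : sphere (0 : EV n) 1 ↦ ∫⁻ r, G (r • ω.1) * ENNReal.ofReal (Real.exp (-(1/2) * r ^ 2)) ∂(rm n) :=
    m4.comp measurable_subtype_coe
  rw [lintegral_const_mul _ (m5.mul_const _), lintegral_mul_const _ m5]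
  have e3 : ∫⁻ x, G x ∂(gm n) = ∫⁻ x, (fun (y : EV n) r ↦ G (r • y)) (nv x) ‖x‖ ∂(gm n) := by
    congr 1; ext x
    rcases eq_or_ne x 0 with rfl | hx
    · simp
    · simp only [nv]; rw [smul_smul, mul_inv_cancel₀ (norm_ne_zero_iff.2 hx), one_smul]
  rw [e3, gm_polar hn (H := fun (y : EV n) r ↦ G (r • y)) m3]
  calc _ = c * ENNReal.ofReal (n * ww n) * (ENNReal.ofReal (∫ x, gd (n := n) x)⁻¹ * ∫⁻ ω : sphere (0 : EV n) 1, ∫⁻ r, G (r • ω.1) * ENNReal.ofReal (Real.exp (-(1/2) * r ^ 2)) ∂(rm n)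
        ∂(volume : Measure (EV n)).toSphere) := by ring
    _ = _ := by rw [hc, one_mul]
variable {n : ℕ}
abbrev gp (n : ℕ) : Measure (𝔼 n) := (gm n).prod (gm n)
def ro (θ : ℝ) (p : 𝔼 n) : 𝔼 n :=
  (Real.cos θ • p.1 + Real.sin θ • p.2, -Real.sin θ • p.1 + Real.cos θ • p.2)
lemma ro_mp (θ : ℝ) : MeasurePreserving (ro (n := n) θ) (gp n) (gp n) := by
  have h := IsGaussian.map_rotation_eq_self (μ := gm n) (by simpa using integral_id_stdGaussian (E := EV n)) θ
  refine ⟨by unfold ro; fun_prop, ?_⟩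
  rw [← h.symm.trans (congrArg (fun f ↦ Measure.map f (gp n)) (funext fun p ↦ ?_))]
  simp [ro, ContinuousLinearMap.rotation_apply]
lemma ro_meas : Measurable fun q : (𝔼 n) × ℝ ↦ ro q.2 q.1 := by unfold ro; fun_prop
lemma ro_add (s t : ℝ) (p : 𝔼 n) : ro s (ro t p) = ro (s + t) p := by
  simp only [ro, Real.cos_add, Real.sin_add]
  ext1 <;> simp only <;> module
lemma ro_norm (θ : ℝ) (p : 𝔼 n) : ‖ro θ p‖ ≤ 2 * ‖p‖ := by
  have h1 := Real.abs_cos_le_one θ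
  have h2 := Real.abs_sin_le_one θ
  have a : ∀ s t : ℝ, |s| ≤ 1 → |t| ≤ 1 → ‖s • p.1 + t • p.2‖ ≤ 2 * ‖p‖ := fun s t hs ht ↦ by
    have := norm_add_le (s • p.1) (t • p.2)
    rw [norm_smul, norm_smul, Real.norm_eq_abs, Real.norm_eq_abs] at this
    have h3 := mul_le_mul hs (norm_fst_le p) (norm_nonneg _) zero_le_one
    have h4 := mul_le_mul ht (norm_snd_le p) (norm_nonneg _) zero_le_one
    linarith
  exact max_le (a _ _ h1 h2) (a _ _ (by rwa [abs_neg]) h1)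
lemma gp_sq : Integrable (fun p : 𝔼 n ↦ ‖p‖ ^ 2) (gp n) := by
  have := (IsGaussian.memLp_id (gp n) 2 ♥).integrable_norm_pow ♣
  simpa using this
lemma intP {S : Type*} [MeasurableSpace S] {ν : Measure S} [IsFiniteMeasure ν] {Φ : (𝔼 n) × S → ℝ} {K : ℝ}
    (hm : Measurable Φ) (h : ∀ q, |Φ q| ≤ K * ‖q.1‖ ^ 2) : Integrable Φ ((gp n).prod ν) := by
  have h1 : Integrable (fun q : (𝔼 n) × S ↦ K * ‖q.1‖ ^ 2) ((gp n).prod ν) :=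
    (gp_sq.comp_fst ν).const_mul K
  exact h1.mono' hm.aestronglyMeasurable (Eventually.of_forall h)
lemma intP' {Φ : 𝔼 n → ℝ} {K : ℝ}
    (hm : Measurable Φ) (h : ∀ q, |Φ q| ≤ K * ‖q‖ ^ 2) : Integrable Φ (gp n) :=
  (gp_sq.const_mul K).mono' hm.aestronglyMeasurable (Eventually.of_forall h)
lemma polC (hn : 1 ≤ n) : MeasurePreserving (fun q : EV n × (𝔼 n) ↦ ((‖q.2.1‖ • nv q.1, q.2.2) : 𝔼 n))
    ((gm n).prod (gp n)) (gp n) := by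
  have h1 : MeasurePreserving (fun p : 𝔼 n ↦ ‖p.2‖ • nv p.1) (gp n) (gm n) := ⟨by fun_prop, polB hn⟩
  have h2 : MeasurePreserving (Prod.map (fun p : 𝔼 n ↦ ‖p.2‖ • nv p.1) id) ((gp n).prod (gm n)) (gp n) :=
    h1.prod (MeasurePreserving.id (gm n))
  have h3 : MeasurePreserving (MeasurableEquiv.prodAssoc (α := EV n) (β := EV n) (γ := EV n)).symm ((gm n).prod (gp n)) ((gp n).prod (gm n)) :=
    (measurePreserving_prodAssoc (gm n) (gm n) (gm n)).symm
  have e : (fun q : EV n × (𝔼 n) ↦ ((‖q.2.1‖ • nv q.1, q.2.2) : 𝔼 n)) =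
      Prod.map (fun p : 𝔼 n ↦ ‖p.2‖ • nv p.1) id ∘ (MeasurableEquiv.prodAssoc (α := EV n) (β := EV n) (γ := EV n)).symm := rfl
  rw [e]
  exact MeasurePreserving.comp h2 h3
lemma rotFTC {F : EV n → ℝ} {D : EV n → EV n →L[ℝ] ℝ} {K : ℝ}
    (hF : Continuous F) (hD : ∀ x ≠ 0, HasFDerivAt F (D x) x) (mD : Measurable fun q : 𝔼 n ↦ D q.1 q.2)
    (bD : ∀ q : 𝔼 n, |D q.1 q.2| ≤ K * ‖q‖) (hk : 0 ≤ K) {α β : ℝ} (hαβ : α ≤ β) (hπ : β - α < Real.pi)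
    {p : 𝔼 n} (hp : p ≠ 0) :
    ∫ σ in α..β, D (ro (-σ) p).1 (ro (-σ) p).2 = F (ro (-α) p).1 - F (ro (-β) p).1 := by
  have q : ∀ x, (ro (-x) p).1 = Real.cos x • p.1 - Real.sin x • p.2 := fun x ↦ by simp [ro, sub_eq_add_neg]
  have hd : ∀ σ, HasDerivAt (fun σ ↦ (ro (-σ) p).1) (-(ro (-σ) p).2) σ := fun σ ↦ by
    have h3 := ((Real.hasDerivAt_cos σ).smul_const p.1).sub ((Real.hasDerivAt_sin σ).smul_const p.2)
    have e : (fun σ ↦ (ro (-σ) p).1) = fun σ ↦ Real.cos σ • p.1 - Real.sin σ • p.2 := funext q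
    rw [e]
    refine HasDerivAt.congr_deriv (f := fun σ ↦ Real.cos σ • p.1 - Real.sin σ • p.2) h3 ?_
    simp only [ro, Real.sin_neg, Real.cos_neg]; module
  have hc : Continuous fun σ ↦ -F (ro (-σ) p).1 := (hF.comp (continuous_iff_continuousAt.2 fun σ ↦ (hd σ).continuousAt)).neg
  have m3 : Measurable fun σ ↦ D (ro (-σ) p).1 (ro (-σ) p).2 := by
    have : Measurable fun σ ↦ ro (-σ) p := by unfold ro; fun_prop
    exact mD.comp this
  have hs : {σ | σ ∈ Ioo α β ∧ (ro (-σ) p).1 = 0}.Countable := by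
    refine Set.Subsingleton.countable fun s hs t ht ↦ ?_
    obtain ⟨⟨h1, h2⟩, h3⟩ := hs
    obtain ⟨⟨h4, h5⟩, h6⟩ := ht
    rw [q, sub_eq_zero] at h3 h6
    by_contra hne
    have hz : Real.sin (s - t) ≠ 0 := by
      rcases lt_or_gt_of_ne hne with h | h
      · rw [← neg_sub, Real.sin_neg]
        exact neg_ne_zero.2 (Real.sin_pos_of_pos_of_lt_pi ♦ ♦).ne'
      · exact (Real.sin_pos_of_pos_of_lt_pi ♦ ♦).ne'
    have h7 : Real.sin (s - t) • p.1 = 0 := by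
      rw [Real.sin_sub, sub_smul, mul_smul, h6, mul_comm (Real.cos s), mul_smul, h3]; module
    have h8 : Real.sin (s - t) • p.2 = 0 := by
      rw [Real.sin_sub, sub_smul, mul_comm, mul_smul, ← h3, mul_smul, ← h6]; module
    exact hp (Prod.ext ((smul_eq_zero.1 h7).resolve_left hz) ((smul_eq_zero.1 h8).resolve_left hz))
  have := MeasureTheory.integral_eq_of_hasDerivAt_off_countable_of_le (fun σ ↦ -F (ro (-σ) p).1) (fun σ ↦ D (ro (-σ) p).1 (ro (-σ) p).2)
    hαβ hs hc.continuousOn (fun σ hσ ↦ ?_) ?_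
  · rw [this]; ring
  · have h0 : (ro (-σ) p).1 ≠ 0 := fun h ↦ hσ.2 ⟨hσ.1, h⟩
    have := ((hD _ h0).comp_hasDerivAt σ (hd σ)).neg
    rw [map_neg, neg_neg] at this
    exact this
  · rw [intervalIntegrable_iff_integrableOn_Ioc_of_le hαβ]
    refine Measure.integrableOn_of_bounded (M := K * (2 * ‖p‖)) measure_Ioc_lt_top.ne m3.aestronglyMeasurable (Eventually.of_forall fun σ ↦ ?_)
    exact (bD _).trans (mul_le_mul_of_nonneg_left (ro_norm _ _) hk)
lemma bnd {s t u v : ℝ} (h1 : |s| ≤ u) (h2 : |t| ≤ v) : |s * t| ≤ u * v := by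
  rw [abs_mul]; exact mul_le_mul h1 h2 (abs_nonneg _) ((abs_nonneg _).trans h1)
lemma rotPair {a F : EV n → ℝ} {D : EV n → EV n →L[ℝ] ℝ} {k K : ℝ} (ha : Measurable a) (ba : ∀ q : 𝔼 n, |a q.1| ≤ k * ‖q‖)
    (hF : Continuous F) (hD : ∀ x ≠ 0, HasFDerivAt F (D x) x) (mD : Measurable fun q : 𝔼 n ↦ D q.1 q.2)
    (bD : ∀ q : 𝔼 n, |D q.1 q.2| ≤ K * ‖q‖) (hk : 0 ≤ K) (hk' : 0 ≤ k) {α β : ℝ} (hαβ : α ≤ β) (hπ : β - α < Real.pi) :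
    (∫ p, (∫ σ in α..β, D p.1 p.2 * a (ro σ p).1) ∂(gp n)) =
      ∫ p, a p.1 * (F (ro (-α) p).1 - F (ro (-β) p).1) ∂(gp n) := by
  have rm1 : Measurable fun q : (𝔼 n) × ℝ ↦ (ro q.2 q.1).1 := by
    unfold ro; fun_prop
  have rm2 : Measurable fun q : (𝔼 n) × ℝ ↦ ro (-q.2) q.1 := by
    unfold ro; fun_prop
  have mD1 : Measurable fun q : (𝔼 n) × ℝ ↦ D q.1.1 q.1.2 := mD.comp measurable_fst
  have mD2 : Measurable fun q : (𝔼 n) × ℝ ↦ D (ro (-q.2) q.1).1 (ro (-q.2) q.1).2 := mD.comp rm2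
  have ma2 : Measurable fun q : (𝔼 n) × ℝ ↦ a q.1.1 := by fun_prop
  have i1 : Integrable (fun q : (𝔼 n) × ℝ ↦ D q.1.1 q.1.2 * a (ro q.2 q.1).1) ((gp n).prod (volume.restrict (Ioc α β))) := by
    refine intP (K := 2 * K * k) (mD1.mul (ha.comp rm1)) fun q ↦ ?_
    refine (bnd (bD q.1) ((ba (ro q.2 q.1)).trans (mul_le_mul_of_nonneg_left (ro_norm q.2 q.1) hk'))).trans (le_of_eq (by ring))
  have i2 : Integrable (fun q : (𝔼 n) × ℝ ↦ D (ro (-q.2) q.1).1 (ro (-q.2) q.1).2 * a q.1.1) ((gp n).prod (volume.restrict (Ioc α β))) := by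
    refine intP (K := 2 * K * k) (mD2.mul ma2) fun q ↦ ?_
    refine (bnd ((bD _).trans (mul_le_mul_of_nonneg_left (ro_norm (-q.2) q.1) hk)) (ba q.1)).trans (le_of_eq (by ring))
  have e1 : ∀ σ : ℝ, ∫ p, D p.1 p.2 * a (ro σ p).1 ∂(gp n) = ∫ p, D (ro (-σ) p).1 (ro (-σ) p).2 * a p.1 ∂(gp n) := fun σ ↦ by
    have m1 : Measurable fun p : 𝔼 n ↦ (ro σ p).1 := (ro_mp σ).measurable.fst
    have h := integral_map (μ := gp n) (ro_mp (n := n) (-σ)).measurable.aemeasurable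
      (f := fun p ↦ D p.1 p.2 * a (ro σ p).1) (mD.mul (ha.comp m1)).aestronglyMeasurable
    rw [(ro_mp (-σ)).map_eq] at h
    rw [h]
    refine integral_congr_ae (Eventually.of_forall fun p ↦ ?_)
    change D (ro (-σ) p).1 (ro (-σ) p).2 * a (ro σ (ro (-σ) p)).1 = _
    rw [ro_add]; simp [ro]
  have e2 : ∀ p : 𝔼 n, ∫ σ in α..β, D (ro (-σ) p).1 (ro (-σ) p).2 * a p.1 = a p.1 * (F (ro (-α) p).1 - F (ro (-β) p).1) := fun p ↦ by
    rcases eq_or_ne p 0 with rfl | hp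
    · have : a 0 = 0 := by simpa using ba 0
      simp [this]
    rw [intervalIntegral.integral_mul_const, mul_comm, rotFTC hF hD mD bD hk hαβ hπ hp]
  simp_rw [← e2, intervalIntegral.integral_of_le hαβ]
  refine (integral_integral_swap (f := fun (p : 𝔼 n) (σ : ℝ) ↦ D p.1 p.2 * a (ro σ p).1) i1).trans (Eq.trans ?_
    (integral_integral_swap (f := fun (p : 𝔼 n) (σ : ℝ) ↦ D (ro (-σ) p).1 (ro (-σ) p).2 * a p.1) i2).symm)
  simp_rw [e1]
variable {n : ℕ}
lemma oneD {R : ℝ → ℝ} {M A B : ℝ} (hR : Measurable R) (hM : ∀ t, |R t| ≤ M) (he : ∀ t, R (-t) = R t) (hA : 0 ≤ A)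
    (hB : 0 ≤ B) (hAB : 2 * B ≤ A) :
    (∫ s in ♮0..A, ∫ t in ♮0..A, R (t - s)) - 2 * B * ∫ s in ♮0..A, (R s + R (A - s)) ≤
      M * ((A - 2 * B) ^ 2 + 4 * B ^ 2) := by
  have hI : ∀ u v, IntervalIntegrable R volume u v := fun u v ↦ by
    rw [intervalIntegrable_iff]
    exact Measure.integrableOn_of_bounded (M := M) ♥ hR.aestronglyMeasurable (Eventually.of_forall hM)
  set h : ℝ → ℝ := fun s ↦ ∫ t in ♮0..s, R t with hh
  have hc : Continuous h := intervalIntegral.continuous_primitive hI 0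
  have e1 : ∀ s, ∫ t in ♮0..A, R (t - s) = h s + h (A - s) := fun s ↦ by
    rw [intervalIntegral.integral_comp_sub_right, ← intervalIntegral.integral_add_adjacent_intervals (hI _ 0) (hI _ _)]
    congr 1
    have := intervalIntegral.integral_comp_neg (a := 0) (b := s) R
    rw [neg_zero] at this
    rw [zero_sub, ← this]; simp_rw [he]; rfl
  have e2 : ∫ s in ♮0..A, (R s + R (A - s)) = 2 * h A := by
    have hI2 : IntervalIntegrable (fun s ↦ R (A - s)) volume 0 A := by
      rw [intervalIntegrable_iff]
      exact Measure.integrableOn_of_bounded (M := M) ♥ (hR.comp ♩).aestronglyMeasurable (Eventually.of_forall fun x ↦ hM _)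
    rw [intervalIntegral.integral_add (hI _ _) hI2, intervalIntegral.integral_comp_sub_left]
    simp only [sub_self, sub_zero, hh]; ring
  have e3 : ∫ s in ♮0..A, (h s + h (A - s)) = 2 * ∫ s in ♮0..A, h s := by
    rw [intervalIntegral.integral_add (hc.intervalIntegrable _ _) (Continuous.intervalIntegrable (u := fun s ↦ h (A - s)) ♩ _ _)]
    have := intervalIntegral.integral_comp_sub_left (a := 0) (b := A) h A
    rw [sub_self, sub_zero] at this
    change _ + ∫ s in ♮0..A, h (A - s) = _
    rw [this]; ring
  have b1 : ∀ u v, u ≤ v → |h v - h u| ≤ M * (v - u) := fun u v huv ↦ by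
    rw [hh]; simp only
    rw [intervalIntegral.integral_interval_sub_left (hI _ _) (hI _ _)]
    have := intervalIntegral.norm_integral_le_of_norm_le_const (a := u) (b := v) (f := R) (C := M) (fun x _ ↦ hM x)
    rwa [abs_of_nonneg (by linarith : 0 ≤ v - u)] at this
  have h0 : h 0 = 0 := by simp [hh]
  set c := A - 2 * B with hcd
  have b2 : ∫ s in ♮0..c, h s ≤ ∫ s in ♮0..c, M * s := by
    refine intervalIntegral.integral_mono_on ♦ (hc.intervalIntegrable _ _) (by fun_prop |> fun (h : Continuous fun s : ℝ ↦ M * s) => h.intervalIntegrable _ _) fun s hs ↦ ?_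
    have := (abs_le.1 (b1 0 s hs.1)).2
    rw [h0] at this; linarith
  have b3 : ∫ s in c..A, h s ≤ ∫ s in c..A, (h A + M * (A - s)) := by
    refine intervalIntegral.integral_mono_on ♦ (hc.intervalIntegrable _ _) (by fun_prop |> fun (h : Continuous fun s : ℝ ↦ _ + M * (A - s)) => h.intervalIntegrable _ _) fun s hs ↦ ?_
    have := (abs_le.1 (b1 s A hs.2)).1
    linarith
  have e4 : ∫ s in ♮0..c, M * s = M * c ^ 2 / 2 := by
    rw [intervalIntegral.integral_const_mul, integral_id]; ring
  have e5 : ∫ s in c..A, (h A + M * (A - s)) = 2 * B * h A + M * (2 * B) ^ 2 / 2 := by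
    rw [intervalIntegral.integral_add ♥ (Continuous.intervalIntegrable ♩ _ _), intervalIntegral.integral_const_mul,
      intervalIntegral.integral_sub ♥ ♥, integral_id]
    simp only [intervalIntegral.integral_const, smul_eq_mul, hcd]; ring
  simp_rw [e1]
  rw [e2, e3, ← intervalIntegral.integral_add_adjacent_intervals (hc.intervalIntegrable 0 c) (hc.intervalIntegrable c A)]
  nlinarith [b2, b3, e4, e5]
set_option maxHeartbeats 1000000 in
lemma roVar {d : 𝔼 n → ℝ} {k A B : ℝ} (hd : Measurable d) (bd : ∀ p, |d p| ≤ k * ‖p‖) (hk : 0 ≤ k) (hA : 0 ≤ A)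
    (hB : 0 ≤ B) (hAB : 2 * B ≤ A) :
    ∫ p, ((∫ s in ♮0..A, d (ro s p)) - B * (d p + d (ro A p))) ^ 2 ∂(gp n) ≤
      (∫ p, d p ^ 2 ∂(gp n)) * ((A - 2 * B) ^ 2 + 4 * B ^ 2) + B ^ 2 * ∫ p, (d p + d (ro A p)) ^ 2 ∂(gp n) := by
  set ν : Measure ℝ := volume.restrict (Ioc 0 A) with hν
  set R : ℝ → ℝ := fun t ↦ ∫ p, d p * d (ro t p) ∂(gp n) with hR
  have mr : ∀ t, Measurable fun p ↦ d (ro (n := n) t p) := fun t ↦ hd.comp (ro_mp t).measurable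
  have br : ∀ t p, |d (ro (n := n) t p)| ≤ 2 * k * ‖p‖ := fun t p ↦ (bd _).trans ((mul_le_mul_of_nonneg_left (ro_norm t p) hk).trans (le_of_eq (by ring)))
  have i0 : ∀ s t, Integrable (fun p ↦ d (ro (n := n) s p) * d (ro t p)) (gp n) := fun s t ↦
    intP' (K := 4 * k ^ 2) ((mr s).mul (mr t)) fun p ↦ (bnd (br s p) (br t p)).trans (le_of_eq (by ring))
  have cov : ∀ s t, ∫ p, d (ro s p) * d (ro t p) ∂(gp n) = R (t - s) := fun s t ↦ by
    have h := integral_map (μ := gp n) (ro_mp (n := n) s).measurable.aemeasurable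
      (f := fun p ↦ d p * d (ro (t - s) p)) (hd.mul (mr _)).aestronglyMeasurable
    rw [(ro_mp s).map_eq] at h
    rw [hR]; simp only
    rw [h]; simp_rw [ro_add, sub_add_cancel]
  have r0 : ∀ p : 𝔼 n, ro 0 p = p := fun p ↦ by simp [ro]
  have hM : ∀ t, |R t| ≤ ∫ p, d p ^ 2 ∂(gp n) := fun t ↦ by
    have h1 : ∫ p, d (ro t p) * d (ro t p) ∂(gp n) = ∫ p, d p ^ 2 ∂(gp n) := by
      rw [cov, sub_self, hR]; simp_rw [r0, sq]
    have h2 : ∫ p, d (ro 0 p) * d (ro 0 p) ∂(gp n) = ∫ p, d p ^ 2 ∂(gp n) := by simp_rw [r0, sq]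
    have h3 : R t = ∫ p, d (ro 0 p) * d (ro t p) ∂(gp n) := by rw [cov, sub_zero]
    rw [h3, abs_le]
    have i1 := i0 0 t
    have i2 := i0 t t
    have i3 := i0 0 0
    constructor
    · have := integral_mono (i3.add i2 |>.add (i1.const_mul 2) |> fun h ↦ (integrable_zero _ ℝ (gp n))) ((i3.add i2).add (i1.const_mul 2)) fun p ↦ by
        change 0 ≤ d (ro 0 p) * d (ro 0 p) + d (ro t p) * d (ro t p) + 2 * (d (ro 0 p) * d (ro t p))
        nlinarith [sq_nonneg (d (ro 0 p) + d (ro t p))]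
      rw [integral_add' (i3.add i2) (i1.const_mul 2), integral_add' i3 i2, integral_const_mul, h1, h2] at this
      simp at this; linarith
    · have := integral_mono (i1.const_mul 2) (i3.add i2) fun p ↦ by
        change 2 * (d (ro 0 p) * d (ro t p)) ≤ d (ro 0 p) * d (ro 0 p) + d (ro t p) * d (ro t p)
        nlinarith [sq_nonneg (d (ro 0 p) - d (ro t p))]
      rw [integral_add' i3 i2, integral_const_mul, h1, h2] at this
      linarith
  have he : ∀ t, R (-t) = R t := fun t ↦ by
    have h1 := cov t 0
    have h2 := cov 0 t
    rw [zero_sub] at h1; rw [sub_zero] at h2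
    rw [← h1, ← h2]; congr 1; ext p; ring
  have mm : Measurable fun q : (𝔼 n) × ℝ ↦ d (ro q.2 q.1) := hd.comp ro_meas
  have mR : Measurable R := by
    have h1 : Measurable fun q : ℝ × (𝔼 n) ↦ ro q.1 q.2 := by unfold ro; fun_prop
    have : Measurable fun q : ℝ × (𝔼 n) ↦ d q.2 * d (ro q.1 q.2) := (hd.comp measurable_snd).mul (hd.comp h1)
    exact (this.stronglyMeasurable.integral_prod_right' (ν := gp n)).measurable
  have key := oneD mR hM he hA hB hAB
  set S : 𝔼 n → ℝ := fun p ↦ ∫ s in ♮0..A, d (ro s p) with hS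
  have hSν : ∀ p, S p = ∫ s, d (ro s p) ∂ν := fun p ↦ intervalIntegral.integral_of_le hA
  have mS : Measurable S := by
    rw [funext hSν]
    exact (mm.stronglyMeasurable.integral_prod_right' (ν := ν)).measurable
  have bS : ∀ p, |S p| ≤ 2 * k * A * ‖p‖ := fun p ↦ by
    have := intervalIntegral.norm_integral_le_of_norm_le_const (a := 0) (b := A) (f := fun s ↦ d (ro s p)) (C := 2 * k * ‖p‖) (fun x _ ↦ br x p)
    rw [sub_zero, abs_of_nonneg hA] at this
    exact this.trans (le_of_eq (by ring))
  have iSS : Integrable (fun p ↦ S p * S p) (gp n) :=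
    intP' (K := (2 * k * A) ^ 2) (mS.mul mS) fun p ↦ (bnd (bS p) (bS p)).trans (le_of_eq (by ring))
  have me : Measurable fun p ↦ d p + d (ro (n := n) A p) := hd.add (mr A)
  have be : ∀ p, |d p + d (ro (n := n) A p)| ≤ 3 * k * ‖p‖ := fun p ↦
    (abs_add_le _ _).trans ((add_le_add (bd p) (br A p)).trans (le_of_eq (by ring)))
  have iSe : Integrable (fun p ↦ S p * (d p + d (ro A p))) (gp n) :=
    intP' (K := (2 * k * A) * (3 * k)) (mS.mul me) fun p ↦ (bnd (bS p) (be p)).trans (le_of_eq (by ring))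
  have iee : Integrable (fun p ↦ (d p + d (ro A p)) ^ 2) (gp n) := by
    simp_rw [sq]
    exact intP' (K := (3 * k) * (3 * k)) (me.mul me) fun p ↦ (bnd (be p) (be p)).trans (le_of_eq (by ring))
  have f1 : ∫ p, S p * S p ∂(gp n) = ∫ s in ♮0..A, ∫ t in ♮0..A, R (t - s) := by
    have h1 : Measurable fun q : (𝔼 n) × (ℝ × ℝ) ↦ ro q.2.1 q.1 := by unfold ro; fun_prop
    have h2 : Measurable fun q : (𝔼 n) × (ℝ × ℝ) ↦ ro q.2.2 q.1 := by unfold ro; fun_prop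
    have m2 : Measurable fun q : (𝔼 n) × (ℝ × ℝ) ↦ d (ro q.2.1 q.1) * d (ro q.2.2 q.1) :=
      (hd.comp h1).mul (hd.comp h2)
    have i2 : Integrable (fun q : (𝔼 n) × (ℝ × ℝ) ↦ d (ro q.2.1 q.1) * d (ro q.2.2 q.1)) ((gp n).prod (ν.prod ν)) :=
      intP (K := 4 * k ^ 2) m2 fun q ↦ (bnd (br _ _) (br _ _)).trans (le_of_eq (by ring))
    have h1 : ∀ p, S p * S p = ∫ q : ℝ × ℝ, d (ro q.1 p) * d (ro q.2 p) ∂(ν.prod ν) := fun p ↦ by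
      rw [integral_prod_mul (fun s ↦ d (ro s p)) (fun s ↦ d (ro s p)), hSν]
    simp_rw [h1]
    rw [integral_integral_swap (f := fun (p : 𝔼 n) (q : ℝ × ℝ) ↦ d (ro q.1 p) * d (ro q.2 p)) i2,
      integral_prod _ i2.integral_prod_right]
    simp_rw [cov, intervalIntegral.integral_of_le hA]; rfl
  have f2 : ∫ p, S p * (d p + d (ro A p)) ∂(gp n) = ∫ s in ♮0..A, (R s + R (A - s)) := by
    have m2 : Measurable fun q : (𝔼 n) × ℝ ↦ d (ro q.2 q.1) * (d q.1 + d (ro A q.1)) :=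
      mm.mul (me.comp measurable_fst)
    have i2 : Integrable (fun q : (𝔼 n) × ℝ ↦ d (ro q.2 q.1) * (d q.1 + d (ro A q.1))) ((gp n).prod ν) :=
      intP (K := (2 * k) * (3 * k)) m2 fun q ↦ (bnd (br _ _) (be _)).trans (le_of_eq (by ring))
    simp_rw [hSν, ← integral_mul_const]
    rw [integral_integral_swap (f := fun (p : 𝔼 n) (s : ℝ) ↦ d (ro s p) * (d p + d (ro A p))) i2, intervalIntegral.integral_of_le hA]
    congr 1; ext s
    have e : ∀ p, d (ro s p) * (d p + d (ro (n := n) A p)) = d (ro s p) * d (ro 0 p) + d (ro s p) * d (ro A p) := fun p ↦ by rw [r0]; ring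
    simp_rw [e]
    rw [integral_add (i0 s 0) (i0 s A), cov, cov, zero_sub, he]
  have e : ∀ p, (S p - B * (d p + d (ro A p))) ^ 2 = S p * S p - 2 * B * (S p * (d p + d (ro A p))) + B ^ 2 * (d p + d (ro A p)) ^ 2 := fun p ↦ by ring
  change ∫ p, (S p - B * (d p + d (ro A p))) ^ 2 ∂(gp n) ≤ _
  simp_rw [e]
  have iX : Integrable (fun p ↦ S p * S p - 2 * B * (S p * (d p + d (ro A p)))) (gp n) := iSS.sub (iSe.const_mul _)
  rw [integral_add iX (iee.const_mul _), integral_sub iSS (iSe.const_mul _), integral_const_mul, integral_const_mul, f1, f2]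
  linarith
variable {n : ℕ}
lemma gm_neg (G : EV n → ℝ) : ∫ z, G (-z) ∂(gm n) = ∫ z, G z ∂(gm n) := by
  have h : MeasurePreserving (fun z : EV n ↦ -z) (gm n) (gm n) :=
    ⟨measurable_neg, stdGaussian_map (LinearIsometryEquiv.neg ℝ (E := EV n))⟩
  exact h.integral_comp (Homeomorph.neg (EV n)).measurableEmbedding G
lemma gm_int2 {Φ : EV n → ℝ} {K : ℝ} (hm : Measurable Φ) (h : ∀ x, |Φ x| ≤ K * ‖x‖ ^ 2) : Integrable Φ (gm n) := by
  have h1 := (IsGaussian.memLp_id (gm n) 2 ♥).integrable_norm_pow ♣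
  have h2 : Integrable (fun x : EV n ↦ ‖x‖ ^ 2) (gm n) := by simpa using h1
  exact (h2.const_mul K).mono' hm.aestronglyMeasurable (Eventually.of_forall h)
lemma gm_int1 {Φ : EV n → ℝ} {K : ℝ} (hm : Measurable Φ) (h : ∀ x, |Φ x| ≤ K * ‖x‖) : Integrable Φ (gm n) := by
  have h1 := ((IsGaussian.memLp_id (gm n) 1 ♥).integrable le_rfl).norm
  exact (h1.const_mul K).mono' hm.aestronglyMeasurable (Eventually.of_forall h)
lemma gm_sq (b : EV n) : ∫ z, (inner ℝ b z) ^ 2 ∂(gm n) = ‖b‖ ^ 2 := by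
  have h := variance_dual_stdGaussian (E := EV n) (innerSL ℝ b)
  rw [variance_eq_integral ♩, integral_strongDual_stdGaussian, innerSL_apply_norm] at h
  rw [← h]; congr 1; ext z; simp
def dd (a : EV n → ℝ) (p : 𝔼 n) : ℝ := a p.1 - a (-p.2)
def vv (a : EV n → ℝ) (p : 𝔼 n) : ℝ :=
  1 / 2 * ((∫ s in ♮0..(Real.pi / 2), dd a (ro s p)) - Real.pi / 10 * (dd a p + dd a (ro (Real.pi / 2) p)))
lemma roA (p : 𝔼 n) : ro (Real.pi / 2) p = (p.2, -p.1) := by simp [ro]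
section
variable {a : EV n → ℝ} {δ : ℝ} (ha : Measurable a) (hb : ∀ x, |a x| ≤ δ * ‖x‖) (hδ : 0 ≤ δ)
include ha
lemma dd_meas : Measurable (dd a) := by unfold dd; fun_prop
lemma vv_meas : Measurable (vv a) := by
  have mm : Measurable fun q : (𝔼 n) × ℝ ↦ dd a (ro q.2 q.1) := (dd_meas ha).comp ro_meas
  have h1 : Measurable fun p : 𝔼 n ↦ ∫ s in ♮0..(Real.pi / 2), dd a (ro s p) := by
    simp_rw [intervalIntegral.integral_of_le Real.pi_div_two_pos.le]
    exact (mm.stronglyMeasurable.integral_prod_right' (ν := volume.restrict (Ioc 0 (Real.pi / 2)))).measurable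
  exact (h1.sub (((dd_meas ha).add ((dd_meas ha).comp (ro_mp _).measurable)).const_mul _)).const_mul _
omit ha
include hb hδ
lemma dd_bd (p : 𝔼 n) : |dd a p| ≤ 2 * δ * ‖p‖ := by
  have h1 := (hb p.1).trans (mul_le_mul_of_nonneg_left (norm_fst_le p) hδ)
  have h2 := hb (-p.2)
  rw [norm_neg] at h2
  have h3 := h2.trans (mul_le_mul_of_nonneg_left (norm_snd_le p) hδ)
  exact (abs_sub _ _).trans ♦
lemma vv_bd (p : 𝔼 n) : |vv a p| ≤ 8 * δ * ‖p‖ := by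
  have hr : ∀ s, |dd a (ro s p)| ≤ 4 * δ * ‖p‖ := fun s ↦ (dd_bd hb hδ _).trans
    ((mul_le_mul_of_nonneg_left (ro_norm s p) ♠).trans (le_of_eq (by ring)))
  have h1 := intervalIntegral.norm_integral_le_of_norm_le_const (a := 0) (b := Real.pi / 2) (f := fun s ↦ dd a (ro s p)) (C := 4 * δ * ‖p‖) (fun x _ ↦ hr x)
  have h0 := Real.pi_pos
  have h4 := Real.pi_le_four
  rw [sub_zero, abs_of_pos ♠, Real.norm_eq_abs] at h1
  have h2 := (abs_add_le _ _).trans (add_le_add (dd_bd hb hδ p) (hr (Real.pi / 2)))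
  have h3 : |Real.pi / 10 * (dd a p + dd a (ro (Real.pi / 2) p))| ≤ Real.pi / 10 * (2 * δ * ‖p‖ + 4 * δ * ‖p‖) := by
    rw [abs_mul, abs_of_pos ♠]; exact mul_le_mul_of_nonneg_left h2 ♠
  rw [vv, abs_mul, abs_of_pos ♣]
  have h5 := (abs_sub (∫ s in ♮0..(Real.pi / 2), dd a (ro s p)) (Real.pi / 10 * (dd a p + dd a (ro (Real.pi / 2) p))))
  have h6 : 0 ≤ δ * ‖p‖ := by positivity
  have h7 := mul_le_mul_of_nonneg_right h4 h6
  linarith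
end
lemma vv_sq {a : EV n → ℝ} {δ : ℝ} (ha : Measurable a) (hb : ∀ x, |a x| ≤ δ * ‖x‖) (hδ : 0 ≤ δ) (h0 : ∫ x, a x ∂(gm n) = 0) :
    ∫ p, vv a p ^ 2 ∂(gp n) ≤ 3 / 4 * ∫ x, a x ^ 2 ∂(gm n) := by
  have key := roVar (n := n) (A := Real.pi / 2) (B := Real.pi / 10) (dd_meas ha) (dd_bd hb hδ) ♠ ♠ ♠ (by linarith [Real.pi_pos])
  have e1 : ∀ p : 𝔼 n, vv a p ^ 2 = 1 / 4 * ((∫ s in ♮0..(Real.pi / 2), dd a (ro s p)) - Real.pi / 10 * (dd a p + dd a (ro (Real.pi / 2) p))) ^ 2 := fun p ↦ by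
    rw [vv]; ring
  simp_rw [e1]; rw [integral_const_mul]
  have han : Measurable fun z ↦ a (-z) := by fun_prop
  have bsq : ∀ x, |a x ^ 2| ≤ δ ^ 2 * ‖x‖ ^ 2 := fun x ↦ by
    rw [sq (a x)]; exact (bnd (hb x) (hb x)).trans (le_of_eq (by ring))
  have isq : Integrable (fun x ↦ a x ^ 2) (gm n) := gm_int2 (ha.pow_const 2) bsq
  have isn : Integrable (fun x ↦ a (-x) ^ 2) (gm n) := gm_int2 (han.pow_const 2) fun x ↦ by simpa using bsq (-x)
  have j1 : Integrable (fun p : 𝔼 n ↦ a p.1 ^ 2) (gp n) := isq.comp_fst _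
  have j2 : Integrable (fun p : 𝔼 n ↦ a (-p.2) ^ 2) (gp n) := isn.comp_snd _
  have j3 : Integrable (fun p : 𝔼 n ↦ a p.2 ^ 2) (gp n) := isq.comp_snd _
  have j4 : Integrable (fun p : 𝔼 n ↦ a p.1 * a (-p.2)) (gp n) :=
    (gm_int1 ha hb).mul_prod (gm_int1 (K := δ) han fun x ↦ by simpa using hb (-x))
  have v1 : ∫ p : 𝔼 n, a p.1 ^ 2 ∂(gp n) = ∫ x, a x ^ 2 ∂(gm n) := by
    rw [integral_fun_fst (fun x ↦ a x ^ 2)]; simp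
  have v2 : ∫ p : 𝔼 n, a (-p.2) ^ 2 ∂(gp n) = ∫ x, a x ^ 2 ∂(gm n) := by
    rw [integral_fun_snd (fun x ↦ a (-x) ^ 2), gm_neg fun x ↦ a x ^ 2]; simp
  have v3 : ∫ p : 𝔼 n, a p.2 ^ 2 ∂(gp n) = ∫ x, a x ^ 2 ∂(gm n) := by
    rw [integral_fun_snd (fun x ↦ a x ^ 2)]; simp
  have v4 : ∫ p : 𝔼 n, a p.1 * a (-p.2) ∂(gp n) = 0 := by
    rw [integral_prod_mul a fun x ↦ a (-x), h0, zero_mul]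
  have k1 : ∫ p : 𝔼 n, dd a p ^ 2 ∂(gp n) = 2 * ∫ x, a x ^ 2 ∂(gm n) := by
    have e : ∀ p : 𝔼 n, dd a p ^ 2 = (a p.1 ^ 2 + a (-p.2) ^ 2) - 2 * (a p.1 * a (-p.2)) := fun p ↦ by rw [dd]; ring
    have j5 : Integrable (fun p : 𝔼 n ↦ a p.1 ^ 2 + a (-p.2) ^ 2) (gp n) := j1.add j2
    simp_rw [e]
    rw [integral_sub j5 (j4.const_mul 2), integral_add j1 j2, integral_const_mul, v1, v2, v4]; ring
  have k2 : ∫ p : 𝔼 n, (dd a p + dd a (ro (Real.pi / 2) p)) ^ 2 ∂(gp n) ≤ 4 * ∫ x, a x ^ 2 ∂(gm n) := by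
    have j5 : Integrable (fun p : 𝔼 n ↦ a p.2 ^ 2 + a (-p.2) ^ 2) (gp n) := j3.add j2
    have : ∫ p : 𝔼 n, 2 * (a p.2 ^ 2 + a (-p.2) ^ 2) ∂(gp n) = 4 * ∫ x, a x ^ 2 ∂(gm n) := by
      rw [integral_const_mul, integral_add j3 j2, v2, v3]; ring
    rw [← this]
    refine integral_mono_of_nonneg (Eventually.of_forall fun p ↦ sq_nonneg _) (j5.const_mul 2) (Eventually.of_forall fun p ↦ ?_)
    simp only [roA, dd, neg_neg]
    nlinarith [sq_nonneg (a p.2 + a (-p.2))]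
  rw [k1] at key
  have hp : Real.pi ^ 2 ≤ 10 := by nlinarith [Real.pi_lt_d2, Real.pi_pos]
  have hI : 0 ≤ ∫ x, a x ^ 2 ∂(gm n) := integral_nonneg fun x ↦ sq_nonneg _
  have k3 := mul_le_mul_of_nonneg_left k2 (sq_nonneg (Real.pi / 10))
  have k4 := mul_le_mul_of_nonneg_right hp hI
  nlinarith [key, k3, k4]
def bb (a : EV n → ℝ) (x : EV n) : EV n := ∫ p, vv a (‖p.1‖ • nv x, p.2) • p.2 ∂(gp n)
lemma nv_le (x : EV n) : ‖nv x‖ ≤ 1 := by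
  rw [nv, norm_smul, norm_inv, norm_norm]; exact inv_mul_le_one
lemma pr_norm (x : EV n) (p : 𝔼 n) : ‖((‖p.1‖ • nv x, p.2) : 𝔼 n)‖ ≤ ‖p‖ := by
  refine max_le ?_ (norm_snd_le p)
  change ‖‖p.1‖ • nv x‖ ≤ _
  rw [norm_smul, norm_norm]
  exact (mul_le_of_le_one_right (norm_nonneg _) (nv_le x)).trans (norm_fst_le p)
section
variable {a : EV n → ℝ} {δ : ℝ} (ha : Measurable a) (hb : ∀ x, |a x| ≤ δ * ‖x‖) (hδ : 0 ≤ δ)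
include ha
lemma bb_m : Measurable fun q : EV n × (𝔼 n) ↦ vv a (‖q.2.1‖ • nv q.1, q.2.2) := by
  have : Measurable fun q : EV n × (𝔼 n) ↦ ((‖q.2.1‖ • nv q.1, q.2.2) : 𝔼 n) := by fun_prop
  exact (vv_meas ha).comp this
lemma bb_m1 (x : EV n) : Measurable fun p : 𝔼 n ↦ vv a (‖p.1‖ • nv x, p.2) := by
  have : Measurable fun p : 𝔼 n ↦ ((‖p.1‖ • nv x, p.2) : 𝔼 n) := by fun_prop
  exact (vv_meas ha).comp this
lemma bb_meas : Measurable (bb a) := by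
  have : Measurable fun q : EV n × (𝔼 n) ↦ vv a (‖q.2.1‖ • nv q.1, q.2.2) • q.2.2 := (bb_m ha).smul ♩
  exact (this.stronglyMeasurable.integral_prod_right' (ν := gp n)).measurable
include hb hδ
lemma bb_bd1 (x : EV n) (p : 𝔼 n) : |vv a (‖p.1‖ • nv x, p.2)| ≤ 8 * δ * ‖p‖ :=
  (vv_bd hb hδ _).trans (mul_le_mul_of_nonneg_left (pr_norm x p) ♠)
lemma bb_int (x : EV n) : Integrable (fun p : 𝔼 n ↦ vv a (‖p.1‖ • nv x, p.2) • p.2) (gp n) := by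
  refine (gp_sq.const_mul (8 * δ)).mono' ((bb_m1 ha x).smul measurable_snd).aestronglyMeasurable (Eventually.of_forall fun p ↦ ?_)
  rw [norm_smul]
  exact (mul_le_mul (bb_bd1 ha hb hδ x p) (norm_snd_le p) (norm_nonneg _) ♠).trans (le_of_eq (by ring))
lemma bb_bd (x : EV n) : ‖bb a x‖ ≤ (8 * ∫ p : 𝔼 n, ‖p‖ ^ 2 ∂(gp n)) * δ := by
  refine (norm_integral_le_integral_norm _).trans ?_
  rw [mul_comm, ← mul_assoc, mul_comm δ, ← integral_const_mul]
  refine integral_mono (bb_int ha hb hδ x).norm (gp_sq.const_mul (8 * δ)) fun p ↦ ?_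
  change ‖vv a (‖p.1‖ • nv x, p.2) • p.2‖ ≤ 8 * δ * ‖p‖ ^ 2
  rw [norm_smul]
  exact (mul_le_mul (bb_bd1 ha hb hδ x p) (norm_snd_le p) (norm_nonneg _) ♠).trans (le_of_eq (by ring))
lemma bb_sq1 (x : EV n) : ‖bb a x‖ ^ 2 ≤ ∫ p : 𝔼 n, vv a (‖p.1‖ • nv x, p.2) ^ 2 ∂(gp n) := by
  have h1 : ‖bb a x‖ ^ 2 = ∫ p : 𝔼 n, vv a (‖p.1‖ • nv x, p.2) * inner ℝ (bb a x) p.2 ∂(gp n) := by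
    have := integral_inner (𝕜 := ℝ) (bb_int ha hb hδ x) (bb a x)
    simp_rw [inner_smul_right] at this
    rw [this, ← real_inner_self_eq_norm_sq]; rfl
  have i1 : Integrable (fun p : 𝔼 n ↦ (inner ℝ (bb a x) p.2) ^ 2) (gp n) :=
    intP' (K := ‖bb a x‖ ^ 2) ♩ fun p ↦ by
      have h := (abs_real_inner_le_norm (bb a x) p.2).trans (mul_le_mul_of_nonneg_left (norm_snd_le p) (norm_nonneg _))
      rw [sq (inner ℝ _ _)]; exact (bnd h h).trans (le_of_eq (by ring))
  have i2 : Integrable (fun p : 𝔼 n ↦ vv a (‖p.1‖ • nv x, p.2) ^ 2) (gp n) :=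
    intP' (K := (8 * δ) ^ 2) ((bb_m1 ha x).pow_const 2) fun p ↦ by
      rw [sq (vv _ _)]; exact (bnd (bb_bd1 ha hb hδ x p) (bb_bd1 ha hb hδ x p)).trans (le_of_eq (by ring))
  have h2 : ∫ p : 𝔼 n, (inner ℝ (bb a x) p.2) ^ 2 ∂(gp n) = ‖bb a x‖ ^ 2 := by
    rw [integral_fun_snd (fun z ↦ (inner ℝ (bb a x) z) ^ 2), gm_sq]; simp
  have i3 : Integrable (fun p : 𝔼 n ↦ vv a (‖p.1‖ • nv x, p.2) * inner ℝ (bb a x) p.2) (gp n) := by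
    refine (i1.add i2).mono' ((bb_m1 ha x).mul ♩).aestronglyMeasurable (Eventually.of_forall fun p ↦ ?_)
    change |_| ≤ (inner ℝ (bb a x) p.2) ^ 2 + vv a (‖p.1‖ • nv x, p.2) ^ 2
    rw [abs_le]; constructor <;> nlinarith [sq_nonneg (inner ℝ (bb a x) p.2 + vv a (‖p.1‖ • nv x, p.2)), sq_nonneg (inner ℝ (bb a x) p.2 - vv a (‖p.1‖ • nv x, p.2))]
  have h3 := integral_mono (i3.const_mul 2) (i1.add i2) fun p ↦ by
    change 2 * (vv a (‖p.1‖ • nv x, p.2) * inner ℝ (bb a x) p.2) ≤ (inner ℝ (bb a x) p.2) ^ 2 + vv a (‖p.1‖ • nv x, p.2) ^ 2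
    nlinarith [sq_nonneg (inner ℝ (bb a x) p.2 - vv a (‖p.1‖ • nv x, p.2))]
  rw [integral_const_mul, ← h1, integral_add' i1 i2, h2] at h3
  linarith
lemma bb_sq (hn : 1 ≤ n) : ∫ x, ‖bb a x‖ ^ 2 ∂(gm n) ≤ ∫ p, vv a p ^ 2 ∂(gp n) := by
  have m2 : Measurable fun p ↦ vv a p ^ 2 := (vv_meas ha).pow_const 2
  have i2 : Integrable (fun q : EV n × (𝔼 n) ↦ vv a (‖q.2.1‖ • nv q.1, q.2.2) ^ 2) ((gm n).prod (gp n)) := by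
    have i3 : Integrable (fun p ↦ vv a p ^ 2) (gp n) := intP' (K := (8 * δ) ^ 2) m2 fun p ↦ by
      rw [sq (vv _ _)]; exact (bnd (vv_bd hb hδ p) (vv_bd hb hδ p)).trans (le_of_eq (by ring))
    exact (polC hn).integrable_comp_of_integrable i3
  have h := integral_map (μ := (gm n).prod (gp n)) (polC hn).measurable.aemeasurable (f := fun p ↦ vv a p ^ 2) m2.aestronglyMeasurable
  rw [(polC hn).map_eq] at h
  rw [h, integral_prod _ i2]
  exact integral_mono_of_nonneg (Eventually.of_forall fun x ↦ sq_nonneg _) i2.integral_prod_left (Eventually.of_forall fun x ↦ bb_sq1 ha hb hδ x)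
end
variable {n : ℕ}
lemma vv_pair {a F : EV n → ℝ} {D : EV n → EV n →L[ℝ] ℝ} {δ K : ℝ} (ha : Measurable a) (hb : ∀ x, |a x| ≤ δ * ‖x‖) (hδ : 0 ≤ δ)
    (h0 : ∫ x, a x ∂(gm n) = 0) (h1 : ∀ l : EV n →L[ℝ] ℝ, ∫ x, a x * l x ∂(gm n) = 0)
    (hF : Continuous F) (hFK : ∀ x, |F x| ≤ K * ‖x‖) (hD : ∀ x ≠ 0, HasFDerivAt F (D x) x)
    (mD : Measurable fun q : 𝔼 n ↦ D q.1 q.2) (hDK : ∀ x, ‖D x‖ ≤ K) :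
    ∫ p, vv a p * D p.1 p.2 ∂(gp n) = ∫ x, a x * F x ∂(gm n) := by
  have hK : 0 ≤ K := (norm_nonneg _).trans (hDK 0)
  have bD : ∀ q : 𝔼 n, |D q.1 q.2| ≤ K * ‖q‖ := fun q ↦ by
    rw [← Real.norm_eq_abs]
    exact ((D q.1).le_opNorm q.2).trans (mul_le_mul (hDK _) (norm_snd_le q) (norm_nonneg _) hK)
  have ba : ∀ q : 𝔼 n, |a q.1| ≤ δ * ‖q‖ := fun q ↦ (hb _).trans (mul_le_mul_of_nonneg_left (norm_fst_le q) hδ)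
  have hp := Real.pi_pos
  have p1 := rotPair ha ba hF hD mD bD hK hδ (α := 0) (β := Real.pi / 2) ♠ ♦
  have p2 := rotPair ha ba hF hD mD bD hK hδ (α := -(Real.pi / 2)) (β := 0) ♦ ♦
  have iaF : Integrable (fun x ↦ a x * F x) (gm n) := gm_int2 (K := δ * K) (ha.mul hF.measurable) fun x ↦
    (bnd (hb x) (hFK x)).trans (le_of_eq (by ring))
  have iF : Integrable F (gm n) := gm_int1 hF.measurable hFK
  have ia : Integrable a (gm n) := gm_int1 ha hb
  have iFn : Integrable (fun x ↦ F (-x)) (gm n) := gm_int1 (K := K) ♩ fun x ↦ by simpa using hFK (-x)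
  have v1 : ∫ p : 𝔼 n, a p.1 * F p.1 ∂(gp n) = ∫ x, a x * F x ∂(gm n) := by
    rw [integral_fun_fst (fun x ↦ a x * F x)]; simp
  have v2 : ∫ p : 𝔼 n, a p.1 * F p.2 ∂(gp n) = 0 := by rw [integral_prod_mul a F, h0, zero_mul]
  have v3 : ∫ p : 𝔼 n, a p.1 * F (-p.2) ∂(gp n) = 0 := by rw [integral_prod_mul a fun x ↦ F (-x), h0, zero_mul]
  have q1 : ∫ p, a p.1 * (F (ro (-0) p).1 - F (ro (-(Real.pi / 2)) p).1) ∂(gp n) = ∫ x, a x * F x ∂(gm n) := by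
    have e : ∀ p : 𝔼 n, a p.1 * (F (ro (-0) p).1 - F (ro (-(Real.pi / 2)) p).1) = a p.1 * F p.1 - a p.1 * F (-p.2) := fun p ↦ by
      simp [ro]; ring
    simp_rw [e]
    rw [integral_sub (iaF.comp_fst _) (ia.mul_prod iFn), v1, v3, sub_zero]
  have q2 : ∫ p, a p.1 * (F (ro (- -(Real.pi / 2)) p).1 - F (ro (-0) p).1) ∂(gp n) = -∫ x, a x * F x ∂(gm n) := by
    have e : ∀ p : 𝔼 n, a p.1 * (F (ro (- -(Real.pi / 2)) p).1 - F (ro (-0) p).1) = a p.1 * F p.2 - a p.1 * F p.1 := fun p ↦ by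
      simp [ro]; ring
    simp_rw [e]
    rw [integral_sub (ia.mul_prod iF) (iaF.comp_fst _), v1, v2, zero_sub]
  rw [q1] at p1
  rw [q2] at p2
  have m1 : Measurable fun q : (𝔼 n) × ℝ ↦ D q.1.1 q.1.2 * a (ro q.2 q.1).1 := by
    have rm1 : Measurable fun q : (𝔼 n) × ℝ ↦ (ro q.2 q.1).1 := by unfold ro; fun_prop
    have mD1 : Measurable fun q : (𝔼 n) × ℝ ↦ D q.1.1 q.1.2 := mD.comp measurable_fst
    exact mD1.mul (ha.comp rm1)
  have b1 : ∀ (p : 𝔼 n) (s : ℝ), |D p.1 p.2 * a (ro s p).1| ≤ 2 * K * δ * ‖p‖ ^ 2 := fun p s ↦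
    (bnd (bD p) ((ba (ro s p)).trans (mul_le_mul_of_nonneg_left (ro_norm s p) hδ))).trans (le_of_eq (by ring))
  have ii : ∀ (p : 𝔼 n) (u v : ℝ), IntervalIntegrable (fun s ↦ D p.1 p.2 * a (ro s p).1) volume u v := fun p u v ↦ by
    rw [intervalIntegrable_iff]
    exact Measure.integrableOn_of_bounded (M := 2 * K * δ * ‖p‖ ^ 2) ♥ (m1.comp (measurable_const.prodMk measurable_id)).aestronglyMeasurable (Eventually.of_forall (b1 p))
  have i1 : ∀ u v, u ≤ v → Integrable (fun p : 𝔼 n ↦ ∫ s in u..v, D p.1 p.2 * a (ro s p).1) (gp n) := fun u v huv ↦ by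
    simp_rw [intervalIntegral.integral_of_le huv]
    exact (intP (K := 2 * K * δ) (ν := volume.restrict (Ioc u v)) m1 fun q ↦ b1 q.1 q.2).integral_prod_left
  have e1 : ∀ p : 𝔼 n, vv a p * D p.1 p.2 = 1 / 2 * ((∫ s in ♮0..(Real.pi / 2), D p.1 p.2 * a (ro s p).1) -
      ∫ s in (-(Real.pi / 2))..0, D p.1 p.2 * a (ro s p).1) - Real.pi / 20 * (a p.2 * D p.1 p.2 - a (-p.2) * D p.1 p.2) := fun p ↦ by
    have s1 := intervalIntegral.integral_comp_sub_right (a := 0) (b := Real.pi / 2) (fun s ↦ D p.1 p.2 * a (ro s p).1) (Real.pi / 2)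
    rw [zero_sub, sub_self] at s1
    have i3 : IntervalIntegrable (fun s ↦ D p.1 p.2 * a (ro (s - Real.pi / 2) p).1) volume 0 (Real.pi / 2) := by
      have := (ii p (-(Real.pi / 2)) 0).comp_sub_right (Real.pi / 2)
      rw [zero_add, neg_add_cancel] at this
      exact this
    rw [← s1, ← intervalIntegral.integral_sub (ii p _ _) i3]
    have s2 : ∀ s, D p.1 p.2 * a (ro s p).1 - D p.1 p.2 * a (ro (s - Real.pi / 2) p).1 = D p.1 p.2 * dd a (ro s p) := fun s ↦ by
      have : (ro (s - Real.pi / 2) p).1 = -(ro s p).2 := by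
        simp only [ro, Real.cos_sub_pi_div_two, Real.sin_sub_pi_div_two]; module
      rw [this, dd]; ring
    simp_rw [s2]
    rw [intervalIntegral.integral_const_mul, vv]
    simp only [dd, roA, neg_neg]; ring
  have i4 : Integrable (fun p : 𝔼 n ↦ a p.2 * D p.1 p.2) (gp n) := intP' (K := δ * K) ((ha.comp measurable_snd).mul mD) fun p ↦
    (bnd ((hb p.2).trans (mul_le_mul_of_nonneg_left (norm_snd_le p) hδ)) (bD p)).trans (le_of_eq (by ring))
  have i5 : Integrable (fun p : 𝔼 n ↦ a (-p.2) * D p.1 p.2) (gp n) := intP' (K := δ * K) ((ha.comp measurable_snd.neg).mul mD) fun p ↦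
    (bnd ((hb (-p.2)).trans (mul_le_mul_of_nonneg_left ((norm_neg p.2).le.trans (norm_snd_le p)) hδ)) (bD p)).trans (le_of_eq (by ring))
  have z1 : ∫ p : 𝔼 n, a p.2 * D p.1 p.2 ∂(gp n) = 0 := by
    rw [integral_prod _ i4]; simp [h1]
  have z2 : ∫ p : 𝔼 n, a (-p.2) * D p.1 p.2 ∂(gp n) = 0 := by
    rw [integral_prod _ i5]
    have : ∀ x : EV n, ∫ y, a (-y) * D x y ∂(gm n) = 0 := fun x ↦ by
      have e := gm_neg fun y ↦ a y * -(D x y)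
      simp only [map_neg, neg_neg] at e
      rw [e]; simp only [mul_neg]; rw [integral_neg, h1, neg_zero]
    simp [this]
  simp_rw [e1]
  have i6 : Integrable (fun p : 𝔼 n ↦ a p.2 * D p.1 p.2 - a (-p.2) * D p.1 p.2) (gp n) := i4.sub i5
  have i7 : Integrable (fun p : 𝔼 n ↦ (∫ s in ♮0..(Real.pi / 2), D p.1 p.2 * a (ro s p).1) -
      ∫ s in (-(Real.pi / 2))..0, D p.1 p.2 * a (ro s p).1) (gp n) := (i1 0 (Real.pi / 2) ♠).sub (i1 (-(Real.pi / 2)) 0 ♦)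
  rw [integral_sub (i7.const_mul _) (i6.const_mul _), integral_const_mul, integral_const_mul, integral_sub i4 i5, z1, z2,
    integral_sub (i1 0 (Real.pi / 2) ♠) (i1 (-(Real.pi / 2)) 0 ♦), p1, p2]
  ring
lemma bb_pair (hn : 1 ≤ n) {a F : EV n → ℝ} {D : EV n → EV n →L[ℝ] ℝ} {δ K : ℝ} (ha : Measurable a) (hb : ∀ x, |a x| ≤ δ * ‖x‖) (hδ : 0 ≤ δ)
    (h0 : ∫ x, a x ∂(gm n) = 0) (h1 : ∀ l : EV n →L[ℝ] ℝ, ∫ x, a x * l x ∂(gm n) = 0)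
    (hF : Continuous F) (hFK : ∀ x, |F x| ≤ K * ‖x‖) (hD : ∀ x ≠ 0, HasFDerivAt F (D x) x)
    (mD : Measurable fun q : 𝔼 n ↦ D q.1 q.2) (hDK : ∀ x, ‖D x‖ ≤ K) (hDh : ∀ x (r : ℝ), 0 < r → D (r • x) = D x) :
    ∫ x, D x (bb a x) ∂(gm n) = ∫ x, a x * F x ∂(gm n) := by
  have hK : 0 ≤ K := (norm_nonneg _).trans (hDK 0)
  rw [← vv_pair ha hb hδ h0 h1 hF hFK hD mD hDK]
  have m2 : Measurable fun p : 𝔼 n ↦ vv a p * D p.1 p.2 := (vv_meas ha).mul mD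
  have h := integral_map (μ := (gm n).prod (gp n)) (polC hn).measurable.aemeasurable (f := fun p : 𝔼 n ↦ vv a p * D p.1 p.2) m2.aestronglyMeasurable
  rw [(polC hn).map_eq] at h
  have i2 : Integrable (fun q : EV n × (𝔼 n) ↦ vv a (‖q.2.1‖ • nv q.1, q.2.2) * D (‖q.2.1‖ • nv q.1) q.2.2) ((gm n).prod (gp n)) := by
    have i3 : Integrable (fun p : 𝔼 n ↦ vv a p * D p.1 p.2) (gp n) := intP' (K := (8 * δ) * K) m2 fun p ↦ by
      have : |D p.1 p.2| ≤ K * ‖p‖ := by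
        rw [← Real.norm_eq_abs]
        exact ((D p.1).le_opNorm p.2).trans (mul_le_mul (hDK _) (norm_snd_le p) (norm_nonneg _) hK)
      exact (bnd (vv_bd hb hδ p) this).trans (le_of_eq (by ring))
    exact (polC hn).integrable_comp_of_integrable i3
  rw [h, integral_prod _ i2]
  have hz : ∀ᵐ x ∂(gm n), x ≠ 0 := by
    have hac : gm n ≪ volume := by rw [gm_dens]; exact withDensity_absolutelyContinuous _ _
    have : Nontrivial (EV n) := Module.nontrivial_of_finrank_pos (R := ℝ) (by rw [finrank_euclideanSpace_fin]; omega)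
    exact hac.ae_le (Measure.ae_ne volume 0)
  refine integral_congr_ae ?_
  filter_upwards [hz] with x hx
  have e := (D x).integral_comp_comm (bb_int ha hb hδ x)
  refine e.symm.trans (integral_congr_ae ?_)
  have hz2 : ∀ᵐ p : 𝔼 n ∂(gp n), p.1 ≠ 0 := Measure.quasiMeasurePreserving_fst.ae hz
  filter_upwards [hz2] with p hp
  change D x (vv a (‖p.1‖ • nv x, p.2) • p.2) = vv a (‖p.1‖ • nv x, p.2) * D (‖p.1‖ • nv x) p.2
  rw [map_smul, smul_eq_mul, nv, smul_smul, hDh x _ (mul_pos (norm_pos_iff.2 hp) (inv_pos.2 (norm_pos_iff.2 hx)))]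
variable {n : ℕ}
lemma gm_ne (hn : 1 ≤ n) : ∀ᵐ x ∂(gm n), x ≠ 0 := by
  have hac : gm n ≪ volume := by rw [gm_dens]; exact withDensity_absolutelyContinuous _ _
  have : Nontrivial (EV n) := Module.nontrivial_of_finrank_pos (R := ℝ) (by rw [finrank_euclideanSpace_fin]; omega)
  exact hac.ae_le (Measure.ae_ne volume 0)
lemma nv_one {x : EV n} (hx : x ≠ 0) : ‖nv x‖ = 1 := by
  rw [norm_smul, norm_inv, norm_norm, inv_mul_cancel₀ (norm_ne_zero_iff.2 hx)]
lemma nv_smul (x : EV n) {r : ℝ} (hr : 0 < r) : nv (r • x) = nv x := by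
  simp only [nv, norm_smul, Real.norm_of_nonneg hr.le, smul_smul]
  congr 1; field_simp
lemma nv_mul (x : EV n) : ‖x‖ • nv x = x := by
  by_cases h : x = 0
  · simp [h]
  · simp only [nv, smul_smul]; rw [mul_inv_cancel₀ (norm_ne_zero_iff.2 h), one_smul]
lemma bdd_nv {Φ : EV n → ℝ} (h : Continuous Φ) : ∃ M, 0 ≤ M ∧ ∀ x, |Φ (nv x)| ≤ M := by
  obtain ⟨M, hM⟩ := (isCompact_closedBall (0 : EV n) 1).exists_bound_of_continuousOn h.continuousOn
  have hM' : ∀ x, |Φ (nv x)| ≤ M := fun x ↦ hM _ (by simpa using nv_le x)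
  exact ⟨M, (abs_nonneg _).trans (hM' 0), hM'⟩
lemma int_nv {Φ : EV n → ℝ} (h : Continuous Φ) : Integrable (fun x ↦ Φ (nv x)) (gm n) := by
  obtain ⟨M, -, hM⟩ := bdd_nv h
  exact (integrable_const M).mono' (h.measurable.comp nv_meas).aestronglyMeasurable (Eventually.of_forall hM)
abbrev av (n : ℕ) (Φ : EV n → ℝ) : ℝ := ∫ x, Φ (nv x) ∂(gm n)
lemma av_pow (hn : 1 ≤ n) {Φ : EV n → ℝ} (h : Continuous Φ) (j : ℕ) :
    ∫ x, ‖x‖ ^ j * Φ (nv x) ∂(gm n) = (∫ x : EV n, ‖x‖ ^ j ∂(gm n)) * av n Φ := by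
  have m1 : Measurable fun p : 𝔼 n ↦ ‖p.2‖ • nv p.1 := by fun_prop
  have hm : Measurable fun x ↦ Φ (nv x) := h.measurable.comp nv_meas
  have e := integral_map (μ := (gm n).prod (gm n)) m1.aemeasurable (f := fun x ↦ ‖x‖ ^ j * Φ (nv x)) ♩
  rw [polB hn] at e
  rw [e, mul_comm, ← integral_prod_mul]
  have hz := gm_ne hn
  refine integral_congr_ae ?_
  filter_upwards [Measure.quasiMeasurePreserving_fst.ae hz, Measure.quasiMeasurePreserving_snd.ae hz] with p h1 h2
  have h3 : 0 < ‖p.2‖ := norm_pos_iff.2 h2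
  have h4 : nv (nv p.1) = nv p.1 := nv_smul _ (inv_pos.2 (norm_pos_iff.2 h1))
  change ‖‖p.2‖ • nv p.1‖ ^ j * Φ (nv (‖p.2‖ • nv p.1)) = _
  rw [nv_smul _ h3, norm_smul, nv_one h1, h4, norm_norm, mul_one, mul_comm]
lemma av_two : ∫ x : EV n, ‖x‖ ^ 2 ∂(gm n) = n := by
  have : ∀ x : EV n, ‖x‖ ^ 2 = ∑ i : Fin n, (inner ℝ (EuclideanSpace.single i ♮1) x) ^ 2 := fun x ↦ by
    rw [EuclideanSpace.real_norm_sq_eq]; simp [EuclideanSpace.inner_single_left]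
  simp_rw [this]
  rw [integral_finsetSum _ fun i _ ↦ gm_int2 (K := 1) ♩ fun x ↦ ?_]
  · simp [gm_sq]
  · have := abs_real_inner_le_norm (EuclideanSpace.single i ♮1) x
    rw [abs_pow, one_mul]; exact pow_le_pow_left₀ (abs_nonneg _) (this.trans ♥) 2
lemma av_sq (hn : 1 ≤ n) {Φ : EV n → ℝ} (h : Continuous Φ) : ∫ x, ‖x‖ ^ 2 * Φ (nv x) ∂(gm n) = n * av n Φ := by
  rw [av_pow hn h, av_two]
lemma av_inner (p : EV n) : av n (fun y ↦ inner ℝ p y) = 0 := by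
  have := gm_neg (fun x : EV n ↦ inner ℝ p (nv x))
  simp only [nv, norm_neg, smul_neg, inner_neg_right, integral_neg] at this ⊢
  linarith
lemma av_inner2 (hn : 1 ≤ n) (p q : EV n) : n * av n (fun y ↦ inner ℝ p y * inner ℝ q y) = inner ℝ p q := by
  have key : ∀ p : EV n, n * av n (fun y ↦ inner ℝ p y ^ 2) = ‖p‖ ^ 2 := fun p ↦ by
    rw [← av_sq hn ♩, ← gm_sq p]
    refine integral_congr_ae (Eventually.of_forall fun x ↦ ?_)
    change ‖x‖ ^ 2 * inner ℝ p (nv x) ^ 2 = _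
    rw [← mul_pow, ← real_inner_smul_right, nv_mul]
  have k1 := key (p + q)
  have k2 := key (p - q)
  have e : av n (fun y ↦ inner ℝ p y * inner ℝ q y) =
      (av n (fun y ↦ inner ℝ (p + q) y ^ 2) - av n (fun y ↦ inner ℝ (p - q) y ^ 2)) / 4 := by
    rw [av, av, av, ← integral_sub (int_nv (Φ := fun y ↦ inner ℝ (p + q) y ^ 2) ♩)
      (int_nv (Φ := fun y ↦ inner ℝ (p - q) y ^ 2) ♩), ← integral_div]
    congr 1; ext x; rw [inner_add_left, inner_sub_left]; ring
  rw [norm_add_sq_real] at k1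
  rw [norm_sub_sq_real] at k2
  rw [e]
  linear_combination (k1 - k2) / 4
lemma hasF {G : EV n → ℝ} (hG : ContDiff ℝ 1 G) (c : ℝ) {x : EV n} (hx : x ≠ 0) :
    HasFDerivAt (fun x ↦ ‖x‖ * (G (nv x) - c)) ((G (nv x) - c) • innerSL ℝ (nv x) +
      (fderiv ℝ G (nv x)).comp (ContinuousLinearMap.id ℝ (EV n) - (innerSL ℝ (nv x)).smulRight (nv x))) x := by
  have hp : ‖x‖ ≠ 0 := norm_ne_zero_iff.2 hx
  have h1 : HasFDerivAt (fun x : EV n ↦ ‖x‖) (innerSL ℝ (nv x)) x := by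
    have := (hasStrictFDerivAt_norm_sq x).hasFDerivAt.sqrt ♠
    simp only [Real.sqrt_sq (norm_nonneg _)] at this
    refine this.congr_fderiv ?_
    ext v; simp [nv]; field_simp
  have h2 := ((hasDerivAt_inv hp).comp_hasFDerivAt x h1).smul (hasFDerivAt_id x)
  have h3 := ((hG.differentiable one_ne_zero (nv x)).hasFDerivAt).comp x h2
  have h4 := h1.mul (h3.sub_const c)
  refine h4.congr_fderiv ?_
  ext v
  simp [nv]
  generalize fderiv ℝ G (‖x‖⁻¹ • x) v = A
  generalize fderiv ℝ G (‖x‖⁻¹ • x) x = B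
  generalize G (‖x‖⁻¹ • x) = C
  generalize (inner ℝ x v : ℝ) = I
  field_simp
  ring
lemma sph_sc {t w N : ℝ} (h0 : 0 ≤ t) (h1 : t ≤ 1 / 20) (hw : |w| ≤ 1 / 20) (hN : 0 ≤ N) :
    1 + w + N - 1 / 2 * (21 / 20) ^ 2 * t ≤ √(1 - t) * (1 + w + 2 * N) := by
  have h2 : 1 - t / 2 - t ^ 2 / 2 ≤ √(1 - t) := by
    refine Real.le_sqrt_of_sq_le ?_
    have h3 : t ^ 3 ≤ t ^ 2 := by nlinarith [sq_nonneg t]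
    have h4 : t ^ 4 ≤ t ^ 2 := by nlinarith [sq_nonneg t, sq_nonneg (t ^ 2)]
    nlinarith [sq_nonneg t]
  obtain ⟨hw1, hw2⟩ := abs_le.1 hw
  refine le_trans ?_ (mul_le_mul_of_nonneg_right h2 ♦)
  have h5 : t / 2 + t ^ 2 / 2 ≤ 21 / 40 * t := by nlinarith
  have h6 := mul_le_mul_of_nonneg_right h5 (show 0 ≤ 1 + w by linarith)
  have h7 := mul_le_mul_of_nonneg_left (show 1 + w ≤ 21 / 20 by linarith) (show 0 ≤ 21 / 40 * t by linarith)
  have h8 : (t / 2 + t ^ 2 / 2) * N ≤ 1 / 2 * N := mul_le_mul_of_nonneg_right ♦ hN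
  linarith
set_option maxHeartbeats 1000000 in
lemma sph (k : ℕ) : ∃ δ > 0, ∀ G T N : EV (k + 2) → ℝ, ContDiff ℝ 1 G → Continuous T → Continuous N →
    (∀ y, ‖y‖ = 1 → |G y - 1 / (k + 1)| ≤ δ) → (∀ y, ‖y‖ = 1 → 0 ≤ N y) →
    (∀ y τ, ‖y‖ = 1 → inner ℝ y τ = 0 → ‖τ‖ ≤ 1 → √(1 - ‖τ‖ ^ 2) * ((k + 1) * G y + 2 * N y) + fderiv ℝ G y τ ≤ T y) →
    ∃ s : ℝ, 0 ≤ s ∧ ∃ p : EV (k + 2),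
      av _ (fun y ↦ (G y - 1 / (k + 1)) ^ 2) = av _ (fun y ↦ G y - 1 / (k + 1)) ^ 2 + s + ‖p‖ ^ 2 / (k + 2) ∧
      (k + 1) * av _ (fun y ↦ G y - 1 / (k + 1)) + av _ N + ((k + 2) - 1 / 2 - 3 / 8 * (21 / 20) ^ 2 * (k + 2)) * s
        - ‖p‖ ^ 2 / (2 * (k + 2)) ≤ av _ T - 1 ∧
      ∀ v, inner ℝ p v = (k + 2) * av _ (fun y ↦ (G y - 1 / (k + 1)) * inner ℝ y v) := by
  set n := k + 2 with hn
  have hn1 : 1 ≤ n := by omega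
  have hnR : ♮n = k + 2 := by rw [hn]; push_cast; ring
  rw [← hnR]
  set M := 8 * ∫ p : 𝔼 n, ‖p‖ ^ 2 ∂(gp n) with hM
  have hM0 : 0 ≤ M := mul_nonneg ♣ (integral_nonneg fun _ ↦ by positivity)
  refine ⟨min (1 / (20 * (k + 1))) (1 / (5 * (M + 1) * (2 + 2 * n))), by positivity, ?_⟩
  intro G T N hG hT hN hu hN0 hp
  set δ := min (1 / (20 * (♮k + 1))) (1 / (5 * (M + 1) * (2 + 2 * n))) with hδ
  have hδ0 : 0 < δ := by positivity
  have hδ1 : (k + 1) * δ ≤ 1 / 20 := by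
    calc (♮k + 1) * δ ≤ (k + 1) * (1 / (20 * (♮k + 1))) := by gcongr; exact min_le_left _ _
      _ = 1 / 20 := by field_simp
  have hδ2 : M * (2 * δ + n * (2 * δ)) ≤ 1 / 5 := by
    calc M * (2 * δ + n * (2 * δ)) ≤ (M + 1) * (2 + 2 * n) * δ := by nlinarith [mul_nonneg (Nat.cast_nonneg (α := ℝ) n) hδ0.le]
      _ ≤ (M + 1) * (2 + 2 * n) * (1 / (5 * (M + 1) * (2 + 2 * n))) := by gcongr; exact min_le_right _ _
      _ = 1 / 5 := by field_simp
  have hGc : Continuous G := hG.continuous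
  have hz := gm_ne hn1
  set u : EV n → ℝ := fun y ↦ G y - 1 / (k + 1) with hud
  have huc : Continuous u := by fun_prop
  set b := av n u with hb
  have hub : ∀ᵐ x ∂(gm n), |u (nv x)| ≤ δ := by filter_upwards [hz] with x hx using hu _ (nv_one hx)
  have hbb : |b| ≤ δ := by
    have := norm_integral_le_of_norm_le_const (μ := gm n) (f := fun x ↦ u (nv x)) hub
    simpa using this
  set U : EV n → ℝ := fun y ↦ u y - b with hU
  have hUc : Continuous U := by fun_prop
  have hUb : ∀ y, ‖y‖ = 1 → |U y| ≤ 2 * δ := fun y hy ↦ (abs_sub _ _).trans (by linarith [hu y hy])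
  have hU0 : av n U = 0 := by
    rw [av, hU, integral_sub (int_nv huc) (integrable_const _)]; simp [hb]
  have iU : Integrable (fun x ↦ U (nv x) • nv x) (gm n) := by
    refine (integrable_const (2 * δ)).mono' ((hUc.measurable.comp nv_meas).smul nv_meas).aestronglyMeasurable ?_
    filter_upwards [hz] with x hx
    rw [norm_smul, nv_one hx, mul_one]; exact hUb _ (nv_one hx)
  set p : EV n := ♮n • ∫ x, U (nv x) • nv x ∂(gm n) with hpd
  have hpn : ‖p‖ ≤ n * (2 * δ) := by
    rw [hpd, norm_smul, Real.norm_of_nonneg ♠]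
    gcongr
    have := norm_integral_le_of_norm_le_const (μ := gm n) (f := fun x ↦ U (nv x) • nv x) (C := 2 * δ) (by
      filter_upwards [hz] with x hx
      rw [norm_smul, nv_one hx, mul_one]; exact hUb _ (nv_one hx))
    simpa using this
  have hpv : ∀ v, inner ℝ p v = n * av n (fun y ↦ U y * inner ℝ y v) := fun v ↦ by
    rw [hpd, real_inner_smul_left, real_inner_comm, ← integral_inner iU]
    refine congrArg _ (integral_congr_ae (Eventually.of_forall fun x ↦ ?_))
    change inner ℝ v (U (nv x) • nv x) = U (nv x) * inner ℝ (nv x) v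
    rw [real_inner_smul_right, real_inner_comm]
  set u1 : EV n → ℝ := fun y ↦ U y - inner ℝ p y with hu1
  have hu1c : Continuous u1 := by fun_prop
  have hu1b : ∀ y, ‖y‖ = 1 → |u1 y| ≤ 2 * δ + n * (2 * δ) := fun y hy ↦ (abs_sub _ _).trans (by
    have := abs_real_inner_le_norm p y
    rw [hy, mul_one] at this
    linarith [hUb y hy])
  have hu10 : av n u1 = 0 := by
    have := av_inner p
    simp only [av] at this hU0
    rw [av, hu1, integral_sub (int_nv hUc) (int_nv (Φ := fun y ↦ inner ℝ p y) ♩), this, hU0, sub_zero]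
  have hu1v : ∀ v, av n (fun y ↦ u1 y * inner ℝ v y) = 0 := fun v ↦ by
    have h1 := hpv v
    have h2 := av_inner2 hn1 p v
    have e : av n (fun y ↦ u1 y * inner ℝ v y) = av n (fun y ↦ U y * inner ℝ y v) - av n (fun y ↦ inner ℝ p y * inner ℝ v y) := by
      rw [av, av, av, ← integral_sub (int_nv (Φ := fun y ↦ U y * inner ℝ y v) ♩)
        (int_nv (Φ := fun y ↦ inner ℝ p y * inner ℝ v y) ♩)]
      congr 1; ext x; rw [hu1, real_inner_comm v]; ring
    rw [e, sub_eq_zero]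
    have hn0 : ♮n ≠ 0 := by positivity
    exact mul_left_cancel₀ hn0 ♦
  set s := av n (fun y ↦ u1 y ^ 2) with hs
  have hUu : av n (fun y ↦ u1 y * U y) = s := by
    have h1 := hu1v p
    have e : av n (fun y ↦ u1 y * U y) = av n (fun y ↦ u1 y ^ 2) + av n (fun y ↦ u1 y * inner ℝ p y) := by
      rw [av, av, av, ← integral_add (int_nv (Φ := fun y ↦ u1 y ^ 2) ♩)
        (int_nv (Φ := fun y ↦ u1 y * inner ℝ p y) ♩)]
      congr 1; ext x; rw [hu1]; ring
    rw [e, h1, add_zero]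
  have hUU : av n (fun y ↦ U y ^ 2) = s + ‖p‖ ^ 2 / n := by
    have h1 := hu1v p
    have h2 := av_inner2 hn1 p p
    rw [real_inner_self_eq_norm_sq] at h2
    have e : av n (fun y ↦ U y ^ 2) = av n (fun y ↦ u1 y * U y) + (av n (fun y ↦ u1 y * inner ℝ p y) + av n (fun y ↦ inner ℝ p y * inner ℝ p y)) := by
      rw [av, av, av, av, ← integral_add (int_nv (Φ := fun y ↦ u1 y * inner ℝ p y) ♩)
        (int_nv (Φ := fun y ↦ inner ℝ p y * inner ℝ p y) ♩), ← integral_add (int_nv (Φ := fun y ↦ u1 y * U y) ♩)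
        (int_nv (Φ := fun y ↦ u1 y * inner ℝ p y + inner ℝ p y * inner ℝ p y) ♩)]
      congr 1; ext x; rw [hu1]; ring
    rw [e, h1, hUu, ← h2]; field_simp; ring
  refine ⟨s, integral_nonneg fun _ ↦ sq_nonneg _, p, ?_, ?_, ?_⟩
  · have e : av n (fun y ↦ u y ^ 2) = av n (fun y ↦ U y ^ 2) + 2 * b * av n U + b ^ 2 := by
      have ec : b ^ 2 = ∫ x, b ^ 2 ∂(gm n) := by simp
      rw [av, av, av, ec, ← integral_const_mul, ← integral_add (int_nv (Φ := fun y ↦ U y ^ 2) ♩)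
        (int_nv (Φ := fun y ↦ 2 * b * U y) ♩), ← integral_add (int_nv (Φ := fun y ↦ U y ^ 2 + 2 * b * U y) ♩) (integrable_const _)]
      congr 1; ext x; rw [hU]; ring
    change av n (fun y ↦ u y ^ 2) = b ^ 2 + s + _
    rw [e, hU0, hUU]; ring
  · set a : EV n → ℝ := fun x ↦ ‖x‖ * u1 (nv x) with had
    set δ' := 2 * δ + n * (2 * δ) with hδ'
    have hδ'0 : 0 ≤ δ' := by positivity
    have ha : Measurable a := measurable_norm.mul (hu1c.measurable.comp nv_meas)
    have hab : ∀ x, |a x| ≤ δ' * ‖x‖ := fun x ↦ by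
      by_cases hx : x = 0
      · simp [had, hx]
      · rw [had, abs_mul, abs_norm, mul_comm]; gcongr; exact hu1b _ (nv_one hx)
    have ha0 : ∫ x, a x ∂(gm n) = 0 := by
      have := av_pow hn1 hu1c 1
      simp only [pow_one] at this
      rw [had, this, hu10, mul_zero]
    have hal : ∀ l : EV n →L[ℝ] ℝ, ∫ x, a x * l x ∂(gm n) = 0 := fun l ↦ by
      have h1 := av_sq hn1 (Φ := fun y ↦ u1 y * l y) ♩
      have h2 := hu1v ((InnerProductSpace.toDual ℝ (EV n)).symm l)
      simp only [InnerProductSpace.toDual_symm_apply] at h2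
      rw [h2, mul_zero] at h1
      rw [← h1]
      refine integral_congr_ae (Eventually.of_forall fun x ↦ ?_)
      change ‖x‖ * u1 (nv x) * l x = ‖x‖ ^ 2 * (u1 (nv x) * l (nv x))
      conv_lhs => rw [← nv_mul x, map_smul, smul_eq_mul, nv_mul x]
      ring
    have haa : ∫ x, a x ^ 2 ∂(gm n) = n * s := by
      rw [hs, ← av_sq hn1 (Φ := fun y ↦ u1 y ^ 2) ♩]
      congr 1; ext x; rw [had]; ring
    set c := 1 / (♮k + 1) + b with hc
    have hUG : ∀ y, G y - c = U y := fun y ↦ by rw [hc, hU, hud]; ring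
    set F : EV n → ℝ := fun x ↦ ‖x‖ * (G (nv x) - c) with hF
    set D : EV n → EV n →L[ℝ] ℝ := fun x ↦ (G (nv x) - c) • innerSL ℝ (nv x) +
      (fderiv ℝ G (nv x)).comp (ContinuousLinearMap.id ℝ (EV n) - (innerSL ℝ (nv x)).smulRight (nv x)) with hD
    have hDe : ∀ x v, D x v = U (nv x) * inner ℝ (nv x) v + fderiv ℝ G (nv x) (v - (inner ℝ (nv x) v : ℝ) • nv x) := fun x v ↦ by
      rw [← hUG]; rfl
    have haF : ∫ x, a x * F x ∂(gm n) = n * s := by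
      rw [← hUu, ← av_sq hn1 (Φ := fun y ↦ u1 y * U y) ♩]
      congr 1; ext x; rw [had, hF, ← hUG]; ring
    have hfc : Continuous fun y ↦ fderiv ℝ G y := hG.continuous_fderiv one_ne_zero
    obtain ⟨M1, hM10, hM1⟩ := bdd_nv hUc
    obtain ⟨M2, hM20, hM2⟩ := bdd_nv (Φ := fun y ↦ ‖fderiv ℝ G y‖) hfc.norm
    have hM2' : ∀ x, ‖fderiv ℝ G (nv x)‖ ≤ M2 := fun x ↦ by simpa using hM2 x
    have hFK : ∀ x, |F x| ≤ (M1 + 2 * M2) * ‖x‖ := fun x ↦ by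
      rw [hF, abs_mul, abs_norm, mul_comm, hUG]; gcongr; linarith [hM1 x]
    have hDK : ∀ x, ‖D x‖ ≤ M1 + 2 * M2 := fun x ↦ by
      refine ContinuousLinearMap.opNorm_le_bound _ ♠ fun v ↦ ?_
      have hi : |inner ℝ (nv x) v| ≤ ‖v‖ := (abs_real_inner_le_norm _ _).trans (mul_le_of_le_one_left (norm_nonneg _) (nv_le x))
      have h1 : ‖v - (inner ℝ (nv x) v : ℝ) • nv x‖ ≤ 2 * ‖v‖ := by
        refine (norm_sub_le _ _).trans ?_
        rw [norm_smul, Real.norm_eq_abs]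
        have := mul_le_mul hi (nv_le x) (norm_nonneg _) (norm_nonneg _)
        linarith
      rw [hDe]
      refine (norm_add_le _ _).trans ?_
      have h2 := (fderiv ℝ G (nv x)).le_opNorm (v - (inner ℝ (nv x) v : ℝ) • nv x)
      have h3 := mul_le_mul (hM2' x) h1 (norm_nonneg _) hM20
      have h4 := bnd (hM1 x) hi
      rw [← Real.norm_eq_abs] at h4
      calc _ ≤ M1 * ‖v‖ + M2 * (2 * ‖v‖) := add_le_add h4 (h2.trans h3)
        _ = _ := by ring
    have hDF : ∀ x ≠ 0, HasFDerivAt F (D x) x := fun x hx ↦ hasF hG c hx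
    have hFc : Continuous F := by
      rw [continuous_iff_continuousAt]
      intro x
      by_cases hx : x = 0
      · subst hx
        have h0 : F 0 = 0 := by simp [hF]
        rw [ContinuousAt, h0]
        refine squeeze_zero_norm hFK ?_
        have : Continuous fun x : EV n ↦ (M1 + 2 * M2) * ‖x‖ := by fun_prop
        simpa using this.tendsto 0
      · exact (hDF x hx).continuousAt
    have m0 : Measurable fun q : 𝔼 n ↦ nv q.1 := nv_meas.comp measurable_fst
    have mDD : Measurable fun q : 𝔼 n ↦ D q.1 q.2 := by
      simp_rw [hDe]
      have h1 : Continuous fun q : 𝔼 n ↦ U q.1 * inner ℝ q.1 q.2 + fderiv ℝ G q.1 (q.2 - (inner ℝ q.1 q.2 : ℝ) • q.1) := by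
        have h2 : Continuous fun q : 𝔼 n ↦ fderiv ℝ G q.1 (q.2 - (inner ℝ q.1 q.2 : ℝ) • q.1) :=
          (hfc.comp continuous_fst).clm_apply ♩
        fun_prop
      have h2 : Measurable fun q : 𝔼 n ↦ (nv q.1, q.2) := m0.prodMk measurable_snd
      exact h1.measurable.comp h2
    have hDh : ∀ x (r : ℝ), 0 < r → D (r • x) = D x := fun x r hr ↦ by simp only [hD, nv_smul x hr]
    have key := bb_pair hn1 ha hab hδ'0 ha0 hal hFc hFK hDF mDD hDK hDh
    rw [haF] at key
    have hsq := (bb_sq ha hab hδ'0 hn1).trans (vv_sq ha hab hδ'0 ha0)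
    rw [haa] at hsq
    have hβ : ∀ x, ‖bb a x‖ ≤ 1 / 5 := fun x ↦ (bb_bd ha hab hδ'0 x).trans hδ2
    have mβ := bb_meas ha
    have i1 : Integrable (fun x ↦ ‖bb a x‖ ^ 2) (gm n) := by
      refine (integrable_const ♮1).mono' ♩ (Eventually.of_forall fun x ↦ ?_)
      rw [Real.norm_of_nonneg ♠]
      exact pow_le_one₀ (norm_nonneg _) ((hβ x).trans ♣)
    have i2 : Integrable (fun x ↦ D x (bb a x)) (gm n) := by
      have h2 : Measurable fun x : EV n ↦ (x, bb a x) := measurable_id.prodMk mβ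
      refine (integrable_const (M1 + 2 * M2)).mono' (mDD.comp h2).aestronglyMeasurable (Eventually.of_forall fun x ↦ ?_)
      refine ((D x).le_opNorm _).trans ?_
      exact (mul_le_mul (hDK x) ((hβ x).trans (by norm_num : (1/5:ℝ) ≤ 1)) (norm_nonneg _) ♠).trans ♥
    have hpt : ∀ᵐ x ∂(gm n), 1 + (k + 1) * u (nv x) + N (nv x) - 1 / 2 * U (nv x) ^ 2 - 1 / 2 * (21 / 20) ^ 2 * ‖bb a x‖ ^ 2 + D x (bb a x) ≤ T (nv x) := by
      filter_upwards [hz] with x hx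
      have hy := nv_one hx
      rw [hDe]
      have hβx := hβ x
      generalize nv x = y at *
      generalize bb a x = β at *
      set r : ℝ := inner ℝ y β with hr
      set τ := β - r • y with hτ
      have t1 : inner ℝ y τ = 0 := by
        rw [hτ, inner_sub_right, real_inner_smul_right, real_inner_self_eq_norm_sq, hy]; simp [hr]
      have t2 : ‖τ‖ ^ 2 = ‖β‖ ^ 2 - r ^ 2 := by
        rw [hτ, norm_sub_sq_real, real_inner_smul_right, real_inner_comm, ← hr, norm_smul, hy, Real.norm_eq_abs, mul_one, sq_abs]; ring
      have t3 : ‖β‖ ^ 2 ≤ (1 / 5) ^ 2 := pow_le_pow_left₀ (norm_nonneg _) hβx 2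
      have t4 : ‖τ‖ ≤ 1 := by
        refine abs_le_of_sq_le_sq' (b := 1) ?_ zero_le_one |>.2
        linarith [sq_nonneg r]
      have q := hp y τ hy t1 t4
      have e : (k + 1) * G y = 1 + (k + 1) * u y := by rw [hud]; field_simp; ring
      have w1 : |(k + 1) * u y| ≤ 1 / 20 := by
        rw [abs_mul, abs_of_nonneg (by positivity : ♮0 ≤ k + 1)]
        exact (mul_le_mul_of_nonneg_left (hu y hy) ♠).trans hδ1
      have q2 := sph_sc (sq_nonneg ‖τ‖) (by linarith [sq_nonneg r]) w1 (hN0 y hy)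
      rw [e] at q
      have q3 := sq_nonneg (U y - r)
      rw [t2] at *
      linarith [sq_nonneg r]
    have iL : Integrable (fun x ↦ 1 + (k + 1) * u (nv x) + N (nv x) - 1 / 2 * U (nv x) ^ 2 ) (gm n) :=
      int_nv (Φ := fun y ↦ 1 + (k + 1) * u y + N y - 1 / 2 * U y ^ 2) ♩
    have iL2 : Integrable (fun x ↦ 1 + (k + 1) * u (nv x) + N (nv x) - 1 / 2 * U (nv x) ^ 2 - 1 / 2 * (21 / 20) ^ 2 * ‖bb a x‖ ^ 2) (gm n) :=
      iL.sub (i1.const_mul _)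
    have hI := integral_mono_ae (iL2.add i2) (int_nv hT) hpt
    rw [integral_add' iL2 i2, integral_sub iL (i1.const_mul _), integral_const_mul, key] at hI
    have e2 : ∫ x, (1 + (k + 1) * u (nv x) + N (nv x) - 1 / 2 * U (nv x) ^ 2) ∂(gm n) = 1 + (k + 1) * b + av n N - 1 / 2 * (s + ‖p‖ ^ 2 / n) := by
      rw [← hUU, integral_sub (int_nv (Φ := fun y ↦ 1 + (k + 1) * u y + N y) ♩) (int_nv (Φ := fun y ↦ 1 / 2 * U y ^ 2) ♩),
        integral_add (int_nv (Φ := fun y ↦ 1 + (k + 1) * u y) ♩) (int_nv hN),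
        integral_add (integrable_const _) (int_nv (Φ := fun y ↦ (k + 1) * u y) ♩), integral_const_mul, integral_const_mul]
      simp [hb]
    rw [e2] at hI
    have hn0 : ♮0 < n := by positivity
    have e3 : ‖p‖ ^ 2 / (2 * n) = 1 / 2 * (‖p‖ ^ 2 / n) := by field_simp
    change _ ≤ av n T - 1
    rw [e3]
    change _ ≤ av n T at hI
    have hb' : (k + 1) * av n (fun y ↦ G y - 1 / (♮k + 1)) = (k + 1) * b := rfl
    rw [hb']
    linarith
  · intro v
    rw [hpv]
    congr 1
    have e : av n (fun y ↦ U y * inner ℝ y v) = av n (fun y ↦ u y * inner ℝ y v) - b * av n (fun y ↦ inner ℝ v y) := by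
      rw [av, av, av, ← integral_const_mul, ← integral_sub (int_nv (Φ := fun y ↦ u y * inner ℝ y v) ♩)
        (int_nv (Φ := fun y ↦ b * inner ℝ v y) ♩)]
      congr 1; ext x; rw [hU, real_inner_comm v]; ring
    rw [e, av_inner, mul_zero, sub_zero]
lemma ray_aux (k : ℕ) {δ ρ : ℝ} (h0 : 0 < δ) (h1 : δ ≤ 1 / 2) (h2 : ♮k * δ ≤ 1 / 1000) (hρ : ρ ∈ Icc (1 - δ) (1 + δ)) :
    1 / (k + 2) - ρ ^ (k + 1) + (k + 1) / (k + 2) * ρ ^ (k + 2) ≤ (k + 1) / 2 * (41 / 40) * ((ρ ^ (k + 1) - 1) / (k + 1)) ^ 2 := by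
  set h : ℝ → ℝ := fun ρ ↦ (k + 1) / 2 * (41 / 40) * ((ρ ^ (k + 1) - 1) / (k + 1)) ^ 2 -
    (1 / (k + 2) - ρ ^ (k + 1) + (k + 1) / (k + 2) * ρ ^ (k + 2)) with hh
  have hd : ∀ ρ, HasDerivAt h ((k + 1) * ρ ^ k * ((41 / 40) * ((ρ ^ (k + 1) - 1) / (k + 1)) - (ρ - 1))) ρ := fun ρ ↦ by
    have p1 := hasDerivAt_pow (k + 1) ρ
    have p2 := hasDerivAt_pow (k + 2) ρ
    have := ((((p1.sub_const 1).div_const (♮k + 1)).pow 2).const_mul ((♮k + 1) / 2 * (41 / 40))).sub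
      (((p1.const_sub (1 / (♮k + 2)))).add (p2.const_mul ((♮k + 1) / (k + 2))))
    refine this.congr_deriv ?_
    have e1 : k + 1 - 1 = k := rfl
    have e2 : k + 2 - 1 = k + 1 := rfl
    rw [e1, e2]
    push_cast
    field_simp
    ring
  have hc : Continuous h := continuous_iff_continuousAt.2 fun x ↦ (hd x).continuousAt
  have hone : h 1 = 0 := by simp only [hh, one_pow]; field_simp; ring
  suffices 0 ≤ h ρ by simp only [hh] at this; linarith
  rcases le_total 1 ρ with hr | hr
  · have mono : MonotoneOn h (Icc 1 (1 + δ)) := by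
      refine monotoneOn_of_deriv_nonneg (convex_Icc _ _) hc.continuousOn (fun x _ ↦ (hd x).differentiableAt.differentiableWithinAt) fun x hx ↦ ?_
      rw [interior_Icc] at hx
      rw [(hd x).deriv]
      have hx0 : 0 < x := by linarith [hx.1]
      refine mul_nonneg ♠ ?_
      have b := one_add_mul_le_pow (show (-2:ℝ) ≤ x - 1 by linarith) (k + 1)
      rw [add_sub_cancel] at b
      push_cast at b
      have : x - 1 ≤ (x ^ (k + 1) - 1) / (k + 1) := by rw [le_div_iff₀ ♠]; linarith
      linarith [hx.1]
    rw [← hone]; exact mono ⟨le_rfl, by linarith⟩ ⟨hr, hρ.2⟩ hr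
  · have mono : AntitoneOn h (Icc (1 - δ) 1) := by
      refine antitoneOn_of_deriv_nonpos (convex_Icc _ _) hc.continuousOn (fun x _ ↦ (hd x).differentiableAt.differentiableWithinAt) fun x hx ↦ ?_
      rw [interior_Icc] at hx
      rw [(hd x).deriv]
      have hx0 : 0 < x := by linarith [hx.1]
      refine mul_nonpos_of_nonneg_of_nonpos ♠ ?_
      have b := one_add_mul_le_pow (show (-2:ℝ) ≤ x - 1 by linarith [hx.1]) k
      rw [add_sub_cancel] at b
      have b2 : 1 - 1 / 1000 ≤ x ^ k := by
        have : ♮k * (-δ) ≤ k * (x - 1) := by gcongr; linarith [hx.1]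
        linarith
      have b3 := geom_sum_mul x (k + 1)
      have b4 : (k + 1) * x ^ k ≤ ∑ i ∈ Finset.range (k + 1), x ^ i := by
        have : ∑ i ∈ Finset.range (k + 1), x ^ k ≤ ∑ i ∈ Finset.range (k + 1), x ^ i :=
          Finset.sum_le_sum fun i hi ↦ pow_le_pow_of_le_one hx0.le hx.2.le (by simp at hi; omega)
        simpa using this
      have b5 : (x ^ (k + 1) - 1) / (k + 1) ≤ (999 / 1000) * (x - 1) := by
        rw [div_le_iff₀ ♠, ← b3]
        have b6 : (k + 1) * (999 / 1000 : ℝ) ≤ ∑ i ∈ Finset.range (k + 1), x ^ i := le_trans (by gcongr; linarith) b4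
        have := mul_le_mul_of_nonpos_right b6 (show x - 1 ≤ 0 by linarith [hx.2])
        linarith
      linarith [hx.2]
    rw [← hone]; exact mono ⟨hρ.1, hr⟩ ⟨by linarith, le_rfl⟩ hr
lemma ray_split (k : ℕ) {δ ρ : ℝ} {g : ℝ → ℝ} (h0 : 0 < δ) (h1 : δ ≤ 1 / 2) (hρ : ρ ∈ Icc (1 - δ) (1 + δ)) (hg : Continuous g)
    (hg0 : ∀ r, 0 ≤ g r ∧ g r ≤ 1) (hg1 : ∀ r ∈ Icc 0 (1 - δ), g r = 1) (hg2 : ∀ r, 1 + δ ≤ r → g r = 0) :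
    ∃ A B : ℝ, A = ∫ r in 0..ρ, (1 - g r) * r ^ k ∧ B = ∫ r in ρ..2, g r * r ^ k ∧ 0 ≤ A ∧ 0 ≤ B ∧ A + B ≤ 2 ^ (k + 2) * δ ∧
      ∫ r in 0..2, g r * r ^ k = ρ ^ (k + 1) / (k + 1) - A + B ∧
      1 / (♮k + 2) - (k + 1) * ((∫ r in 0..2, g r * r ^ k) - ∫ r in 0..2, g r * r ^ (k + 1)) ≤
        1 / (k + 2) - ρ ^ (k + 1) + (k + 1) / (k + 2) * ρ ^ (k + 2) + (k + 1) * δ * (A + B) := by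
  obtain ⟨ha, hb⟩ := hρ
  have hs : ∀ h : ℝ → ℝ, Continuous h → ∫ r in 0..2, g r * h r = (∫ r in 0..ρ, h r) - (∫ r in 0..ρ, (1 - g r) * h r) + ∫ r in ρ..2, g r * h r := fun h hh ↦ by
    have i : ∀ a b, IntervalIntegrable (fun r ↦ g r * h r) volume a b := fun a b ↦ (by fun_prop : Continuous fun r ↦ g r * h r).intervalIntegrable a b
    rw [← intervalIntegral.integral_add_adjacent_intervals (i 0 ρ) (i ρ 2), ← intervalIntegral.integral_sub (hh.intervalIntegrable _ _)
      ((by fun_prop : Continuous fun r ↦ (1 - g r) * h r).intervalIntegrable _ _)]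
    congr 2; ext r; ring
  have z1 : ∀ r ∈ Icc 0 ρ, (1 - g r) * ((1 - r) * r ^ k) ≤ δ * ((1 - g r) * r ^ k) := fun r hr ↦ by
    by_cases hr1 : r ≤ 1 - δ
    · rw [hg1 r ⟨hr.1, hr1⟩]; simp
    · have := mul_nonneg (sub_nonneg.2 (hg0 r).2) (pow_nonneg hr.1 k)
      have h3 : 1 - r ≤ δ := by linarith
      calc _ = (1 - r) * ((1 - g r) * r ^ k) := by ring
        _ ≤ _ := mul_le_mul_of_nonneg_right h3 this
  have z2 : ∀ r ∈ Icc ρ 2, g r * ((r - 1) * r ^ k) ≤ δ * (g r * r ^ k) := fun r hr ↦ by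
    by_cases hr1 : 1 + δ ≤ r
    · rw [hg2 r hr1]; simp
    · have := mul_nonneg (hg0 r).1 (pow_nonneg (by linarith [hr.1] : 0 ≤ r) k)
      have h3 : r - 1 ≤ δ := by linarith
      calc _ = (r - 1) * (g r * r ^ k) := by ring
        _ ≤ _ := mul_le_mul_of_nonneg_right h3 this
  have hk := hs (fun r ↦ r ^ k) ♩
  have hk1 := hs (fun r ↦ r ^ (k + 1)) ♩
  simp only [integral_pow, zero_pow (Nat.succ_ne_zero _), sub_zero] at hk hk1
  push_cast at hk hk1
  have c1 : ∫ r in 0..ρ, (1 - g r) * ((1 - r) * r ^ k) ≤ δ * ∫ r in 0..ρ, (1 - g r) * r ^ k := by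
    rw [← intervalIntegral.integral_const_mul]
    exact intervalIntegral.integral_mono_on ♦ ((by fun_prop : Continuous _).intervalIntegrable _ _) ((by fun_prop : Continuous _).intervalIntegrable _ _) z1
  have c2 : ∫ r in ρ..2, g r * ((r - 1) * r ^ k) ≤ δ * ∫ r in ρ..2, g r * r ^ k := by
    rw [← intervalIntegral.integral_const_mul]
    exact intervalIntegral.integral_mono_on ♦ ((by fun_prop : Continuous _).intervalIntegrable _ _) ((by fun_prop : Continuous _).intervalIntegrable _ _) z2
  have d1 : ∫ r in 0..ρ, (1 - g r) * ((1 - r) * r ^ k) = (∫ r in 0..ρ, (1 - g r) * r ^ k) - ∫ r in 0..ρ, (1 - g r) * r ^ (k + 1) := by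
    rw [← intervalIntegral.integral_sub ((by fun_prop : Continuous _).intervalIntegrable _ _) ((by fun_prop : Continuous _).intervalIntegrable _ _)]
    congr 1; ext r; ring
  have d2 : ∫ r in ρ..2, g r * ((r - 1) * r ^ k) = (∫ r in ρ..2, g r * r ^ (k + 1)) - ∫ r in ρ..2, g r * r ^ k := by
    rw [← intervalIntegral.integral_sub ((by fun_prop : Continuous _).intervalIntegrable _ _) ((by fun_prop : Continuous _).intervalIntegrable _ _)]
    congr 1; ext r; ring
  rw [d1] at c1
  rw [d2] at c2
  have b1 : ∫ r in 0..ρ, (1 - g r) * r ^ k ≤ 2 ^ k * (2 * δ) := by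
    have i : ∀ a b, IntervalIntegrable (fun r ↦ (1 - g r) * r ^ k) volume a b := fun a b ↦ (by fun_prop : Continuous fun r ↦ (1 - g r) * r ^ k).intervalIntegrable a b
    rw [← intervalIntegral.integral_add_adjacent_intervals (i 0 (1 - δ)) (i (1 - δ) ρ)]
    have e : ∫ r in 0..(1 - δ), (1 - g r) * r ^ k = 0 := by
      rw [intervalIntegral.integral_congr (g := fun _ ↦ 0) fun r hr ↦ ?_]
      · simp
      · rw [uIcc_of_le ♦] at hr; simp [hg1 r hr]
    have := intervalIntegral.integral_mono_on ha (i (1 - δ) ρ) (intervalIntegrable_const (c := ♮2 ^ k)) fun r hr ↦ by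
      have : r ^ k ≤ 2 ^ k := pow_le_pow_left₀ (by linarith [hr.1]) (by linarith [hr.2]) k
      calc (1 - g r) * r ^ k ≤ 1 * 2 ^ k := mul_le_mul (by linarith [(hg0 r).1]) this (pow_nonneg (by linarith [hr.1]) k) zero_le_one
        _ = _ := one_mul _
    rw [intervalIntegral.integral_const, smul_eq_mul] at this
    rw [e, zero_add]
    refine this.trans ?_
    rw [mul_comm]; gcongr; linarith
  have b2 : ∫ r in ρ..2, g r * r ^ k ≤ 2 ^ k * (2 * δ) := by
    have i : ∀ a b, IntervalIntegrable (fun r ↦ g r * r ^ k) volume a b := fun a b ↦ (by fun_prop : Continuous fun r ↦ g r * r ^ k).intervalIntegrable a b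
    rw [← intervalIntegral.integral_add_adjacent_intervals (i ρ (1 + δ)) (i (1 + δ) 2)]
    have e : ∫ r in (1 + δ)..2, g r * r ^ k = 0 := by
      rw [intervalIntegral.integral_congr (g := fun _ ↦ 0) fun r hr ↦ ?_]
      · simp
      · rw [uIcc_of_le ♦] at hr; simp [hg2 r hr.1]
    have := intervalIntegral.integral_mono_on hb (i ρ (1 + δ)) (intervalIntegrable_const (c := ♮2 ^ k)) fun r hr ↦ by
      have : r ^ k ≤ 2 ^ k := pow_le_pow_left₀ (by linarith [hr.1]) (by linarith [hr.2]) k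
      calc g r * r ^ k ≤ 1 * 2 ^ k := mul_le_mul (hg0 r).2 this (pow_nonneg (by linarith [hr.1]) k) zero_le_one
        _ = _ := one_mul _
    rw [intervalIntegral.integral_const, smul_eq_mul] at this
    rw [e, add_zero]
    refine this.trans ?_
    rw [mul_comm]; gcongr; linarith
  refine ⟨_, _, rfl, rfl, ?_, ?_, ?_, hk, ?_⟩
  · exact intervalIntegral.integral_nonneg ♦ fun r hr ↦ mul_nonneg (by linarith [(hg0 r).2]) (pow_nonneg hr.1 k)
  · exact intervalIntegral.integral_nonneg ♦ fun r hr ↦ mul_nonneg (hg0 r).1 (pow_nonneg (by linarith [hr.1]) k)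
  · rw [pow_add]; linarith
  · rw [hk, hk1]
    have := mul_le_mul_of_nonneg_left (add_le_add c1 c2) (show ♮0 ≤ k + 1 by positivity)
    have e1 : (♮k + 1) * (ρ ^ (k + 1) / (k + 1)) = ρ ^ (k + 1) := by field_simp
    have e2 : (♮k + 1) * (ρ ^ (k + 1 + 1) / (k + 1 + 1)) = (k + 1) / (k + 2) * ρ ^ (k + 2) := by
      rw [show ♮k + 1 + 1 = k + 2 by ring]; ring
    linear_combination this + e2 - e1
lemma ray (k : ℕ) {δ : ℝ} {g g' : ℝ → ℝ} (h0 : 0 < δ) (h1 : δ ≤ 1 / 2) (h2 : (♮k + 1) * 2 ^ (k + 8) * δ ≤ 1 / 20)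
    (hd : ∀ r, HasDerivAt g (g' r) r) (hg' : Continuous g')
    (hg0 : ∀ r, 0 ≤ g r ∧ g r ≤ 1) (hg1 : ∀ r ∈ Icc 0 (1 - δ), g r = 1) (hg2 : ∀ r, 1 + δ ≤ r → g r = 0) :
    1 / (♮k + 2) - (k + 1) * ((∫ r in 0..2, g r * r ^ k) - ∫ r in 0..2, g r * r ^ (k + 1)) ≤
      (k + 1) / 2 * (21 / 20) * ((∫ r in 0..2, g r * r ^ k) - 1 / (k + 1)) ^ 2 +
        1 / 20 * ((∫ r in 0..2, max (g' r) 0 * r ^ (k + 1)) + ∫ r in 0..2, g r * (1 - g r) * r ^ (k + 1)) := by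
  have hg : Continuous g := continuous_iff_continuousAt.2 fun x ↦ (hd x).continuousAt
  set P : ℝ := 2 ^ k with hP
  have hP1 : 1 ≤ P := one_le_pow₀ ♣
  have hk0 : ♮0 ≤ k := Nat.cast_nonneg k
  have hS : (k + 1) * (P * δ) ≤ 1 / 5120 := by rw [pow_add, ← hP] at h2; linarith
  have hkP : (k + 1) * δ ≤ (k + 1) * (P * δ) := by gcongr; exact le_mul_of_one_le_left h0.le hP1
  have hPk : P * δ ≤ (k + 1) * (P * δ) := le_mul_of_one_le_left ♠ ♦
  have hN : ∫ r in (1/2:ℝ)..2, max (g' r) 0 ≤ 2 * P * ∫ r in 0..2, max (g' r) 0 * r ^ (k + 1) := by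
    have i : ∀ a b, IntervalIntegrable (fun r ↦ max (g' r) 0 * r ^ (k + 1)) volume a b := fun a b ↦ (by fun_prop : Continuous fun r ↦ max (g' r) 0 * r ^ (k + 1)).intervalIntegrable a b
    rw [← intervalIntegral.integral_add_adjacent_intervals (i 0 (1/2)) (i (1/2) 2)]
    have a1 : 0 ≤ ∫ r in 0..(1/2:ℝ), max (g' r) 0 * r ^ (k + 1) := intervalIntegral.integral_nonneg ♣ fun r hr ↦ mul_nonneg (le_max_right _ _) (pow_nonneg hr.1 _)
    have a2 : ∫ r in (1/2:ℝ)..2, max (g' r) 0 ≤ ∫ r in (1/2:ℝ)..2, 2 * P * (max (g' r) 0 * r ^ (k + 1)) := by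
      refine intervalIntegral.integral_mono_on ♣ ((by fun_prop : Continuous _).intervalIntegrable _ _) ((by fun_prop : Continuous _).intervalIntegrable _ _) fun r hr ↦ ?_
      have h5 : 1 ≤ 2 * P * r ^ (k + 1) := by
        have : (2 * r) ^ (k + 1) = 2 * P * r ^ (k + 1) := by rw [mul_pow, hP]; ring
        rw [← this]; exact one_le_pow₀ (by linarith [hr.1])
      calc max (g' r) 0 ≤ (max (g' r) 0) * (2 * P * r ^ (k + 1)) := le_mul_of_one_le_right (le_max_right _ _) h5
        _ = _ := by ring
    rw [intervalIntegral.integral_const_mul] at a2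
    have := mul_nonneg (show 0 ≤ 2 * P by positivity) a1
    linarith
  have hQ0 : 0 ≤ ∫ r in 0..2, g r * (1 - g r) * r ^ (k + 1) := intervalIntegral.integral_nonneg ♣ fun r hr ↦
    mul_nonneg (mul_nonneg (hg0 r).1 (by linarith [(hg0 r).2])) (pow_nonneg hr.1 _)
  have hN0 : 0 ≤ ∫ r in 0..2, max (g' r) 0 * r ^ (k + 1) := intervalIntegral.integral_nonneg ♣ fun r hr ↦
    mul_nonneg (le_max_right _ _) (pow_nonneg hr.1 _)
  obtain ⟨A, B, -, -, hA0, hB0, hAB, hG, hL⟩ := ray_split k h0 h1 (ρ := 1) ⟨by linarith, by linarith⟩ hg hg0 hg1 hg2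
  have hAB' : A + B ≤ 4 * (P * δ) := by rw [pow_add, ← hP] at hAB; linarith
  by_cases hc : 1 / 4 ≤ ∫ r in (1/2:ℝ)..2, max (g' r) 0
  · have e : 1 / (♮k + 2) - 1 ^ (k + 1) + (k + 1) / (k + 2) * 1 ^ (k + 2) = 0 := by simp only [one_pow]; field_simp; ring
    rw [e, zero_add] at hL
    refine hL.trans ?_
    have q1 : 0 ≤ (♮k + 1) / 2 * (21 / 20) * ((∫ r in 0..2, g r * r ^ k) - 1 / (k + 1)) ^ 2 := by positivity
    have q2 := hc.trans hN
    have q3 : (k + 1) * δ * (A + B) ≤ 1 / 5120 * (4 * δ) := by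
      calc (k + 1) * δ * (A + B) ≤ (k + 1) * δ * (4 * (P * δ)) := by gcongr
        _ = ((k + 1) * (P * δ)) * (4 * δ) := by ring
        _ ≤ _ := by gcongr
    have q4 : P * δ ≤ 1 / 5120 := hPk.trans hS
    have q5 : δ * (1 / 4) ≤ 2 * (P * δ) * ∫ r in 0..2, max (g' r) 0 * r ^ (k + 1) := by
      calc δ * (1 / 4) ≤ δ * (2 * P * ∫ r in 0..2, max (g' r) 0 * r ^ (k + 1)) := by gcongr
        _ = _ := by ring
    have q6 : 2 * (P * δ) * ∫ r in 0..2, max (g' r) 0 * r ^ (k + 1) ≤ 2 * (1 / 5120) * ∫ r in 0..2, max (g' r) 0 * r ^ (k + 1) := by gcongr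
    linarith
  · push Not at hc
    set S : Set ℝ := Icc 0 2 ∩ g ⁻¹' Ici (5 / 8) with hSd
    have hSc : IsCompact S := isCompact_Icc.inter_right (isClosed_Ici.preimage hg)
    have m1 : 1 - δ ∈ S := ⟨⟨by linarith, by linarith⟩, by
      rw [mem_preimage, hg1 _ ⟨by linarith, le_rfl⟩]; norm_num⟩
    set ρ := sSup S with hρ
    have hρS : ρ ∈ S := hSc.sSup_mem ⟨_, m1⟩
    have hρg : 5 / 8 ≤ g ρ := hρS.2
    have hρ1 : 1 - δ ≤ ρ := le_csSup hSc.bddAbove m1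
    have hρ2 : ρ ≤ 1 + δ := by
      by_contra! hcon
      rw [hg2 ρ hcon.le] at hρg; norm_num at hρg
    have hlt : ∀ r ∈ Icc 0 ρ, 3 / 8 ≤ g r := fun r hr ↦ by
      by_cases hr2 : r ≤ 1 / 2
      · rw [hg1 r ⟨hr.1, by linarith⟩]; norm_num
      · push Not at hr2
        have f1 := intervalIntegral.integral_eq_sub_of_hasDerivAt (a := r) (b := ρ) (fun x _ ↦ hd x) (hg'.intervalIntegrable _ _)
        have f2 : ∫ x in r..ρ, g' x ≤ ∫ x in r..ρ, max (g' x) 0 :=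
          intervalIntegral.integral_mono_on hr.2 (hg'.intervalIntegrable _ _) ((by fun_prop : Continuous _).intervalIntegrable _ _) fun x _ ↦ le_max_left _ _
        have f3 : ∫ x in r..ρ, max (g' x) 0 ≤ ∫ x in (1/2:ℝ)..2, max (g' x) 0 :=
          intervalIntegral.integral_mono_interval hr2.le hr.2 hρS.1.2 (Eventually.of_forall fun x ↦ le_max_right _ _) ((by fun_prop : Continuous _).intervalIntegrable _ _)
        linarith
    have hgt : ∀ r ∈ Ioc ρ 2, g r ≤ 5 / 8 := fun r hr ↦ by
      by_contra! hcon
      exact absurd (le_csSup hSc.bddAbove (show r ∈ S from ⟨⟨by linarith [hr.1], hr.2⟩, hcon.le⟩)) (not_le.2 hr.1)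
    have hgt' : ∀ r ∈ Icc ρ 2, g r ≤ 5 / 8 := fun r hr ↦ by
      rcases hr.1.eq_or_lt with h | h
      · subst h
        by_contra! hcon
        have ev : ∀ᶠ r in 𝓝[>] ρ, 5 / 8 < g r := nhdsWithin_le_nhds (hg.continuousAt.eventually (lt_mem_nhds hcon))
        have ev2 : ∀ᶠ r in 𝓝[>] ρ, r ∈ Ioc ρ 2 := Ioc_mem_nhdsGT ♦
        obtain ⟨r, a, b⟩ := (ev.and ev2).exists
        linarith [hgt r b]
      · exact hgt r ⟨h, hr.2⟩
    obtain ⟨A', B', eA, eB, hA0', hB0', hAB2, hG', hL'⟩ := ray_split k h0 h1 (ρ := ρ) ⟨hρ1, hρ2⟩ hg hg0 hg1 hg2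
    have hAB2' : A' + B' ≤ 4 * (P * δ) := by rw [pow_add, ← hP] at hAB2; linarith
    have hAQ : A' + B' ≤ 16 / 3 * ∫ r in 0..2, g r * (1 - g r) * r ^ (k + 1) := by
      have i : ∀ a b, IntervalIntegrable (fun r ↦ g r * (1 - g r) * r ^ (k + 1)) volume a b := fun a b ↦ (by fun_prop : Continuous fun r ↦ g r * (1 - g r) * r ^ (k + 1)).intervalIntegrable a b
      have pw : ∀ r, 0 ≤ r → g r * (1 - g r) * r ^ k ≤ 2 * (g r * (1 - g r) * r ^ (k + 1)) := fun r hr ↦ by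
        by_cases hr2 : r ≤ 1 / 2
        · rw [hg1 r ⟨hr, by linarith⟩]; simp
        · have := mul_nonneg (mul_nonneg (hg0 r).1 (sub_nonneg.2 (hg0 r).2)) (pow_nonneg hr k)
          push Not at hr2
          calc _ ≤ (2 * r) * (g r * (1 - g r) * r ^ k) := le_mul_of_one_le_left this ♦
            _ = _ := by ring
      rw [← intervalIntegral.integral_add_adjacent_intervals (i 0 ρ) (i ρ 2), mul_add, eA, eB, ← intervalIntegral.integral_const_mul, ← intervalIntegral.integral_const_mul]
      refine add_le_add ?_ ?_
      · refine intervalIntegral.integral_mono_on ♦ ((by fun_prop : Continuous _).intervalIntegrable _ _) ((by fun_prop : Continuous _).intervalIntegrable _ _) fun r hr ↦ ?_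
        have s1 := pw r hr.1
        have s2 := mul_le_mul_of_nonneg_right (hlt r hr) (mul_nonneg (sub_nonneg.2 (hg0 r).2) (pow_nonneg hr.1 k))
        linarith
      · refine intervalIntegral.integral_mono_on ♦ ((by fun_prop : Continuous _).intervalIntegrable _ _) ((by fun_prop : Continuous _).intervalIntegrable _ _) fun r hr ↦ ?_
        have hr0 : 0 ≤ r := by linarith [hr.1]
        have s1 := pw r hr0
        have s2 := mul_le_mul_of_nonneg_right (show 3 / 8 ≤ 1 - g r by linarith [hgt' r hr]) (mul_nonneg (hg0 r).1 (pow_nonneg hr0 k))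
        linarith
    have hLρ := ray_aux k h0 h1 ♦ ⟨hρ1, hρ2⟩
    set u := (∫ r in 0..2, g r * r ^ k) - 1 / (♮k + 1) with hu
    have hu1 : |u| ≤ 4 * (P * δ) := by
      have : u = B - A := by rw [hu, hG, one_pow]; ring
      rw [this, abs_le]; constructor <;> linarith
    have hur : (ρ ^ (k + 1) - 1) / (♮k + 1) = u + (A' - B') := by rw [hu, hG', sub_div]; ring
    rw [hur] at hLρ
    have hsq : (u + (A' - B')) ^ 2 ≤ u ^ 2 + 12 * (P * δ) * (A' + B') := by
      have e : (u + (A' - B')) ^ 2 = u ^ 2 + (2 * u + (A' - B')) * (A' - B') := by ring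
      rw [e]
      refine add_le_add le_rfl ((le_abs_self _).trans (bnd (u := 12 * (P * δ)) (v := A' + B') ?_ ?_))
      · rw [abs_le] at hu1 ⊢; constructor <;> linarith
      · rw [abs_le]; constructor <;> linarith
    have h3 : (♮k + 1) / 2 * (41 / 40) * (u + (A' - B')) ^ 2 ≤ (k + 1) / 2 * (41 / 40) * (u ^ 2 + 12 * (P * δ) * (A' + B')) := by gcongr
    have h4 : (k + 1) * (P * δ) * (A' + B') ≤ 1 / 5120 * (A' + B') := by gcongr
    have h5 : (k + 1) * δ * (A' + B') ≤ (k + 1) * (P * δ) * (A' + B') := by gcongr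
    have h6 : 0 ≤ (k + 1) * u ^ 2 := by positivity
    linarith
lemma ray_bd (k : ℕ) {δ : ℝ} {g : ℝ → ℝ} (h0 : 0 < δ) (h1 : δ ≤ 1 / 2) (hg : Continuous g)
    (hg0 : ∀ r, 0 ≤ g r ∧ g r ≤ 1) (hg1 : ∀ r ∈ Icc 0 (1 - δ), g r = 1) (hg2 : ∀ r, 1 + δ ≤ r → g r = 0) :
    |(∫ r in 0..2, g r * r ^ k) - 1 / (♮k + 1)| ≤ 2 ^ (k + 2) * δ ∧
    0 ≤ 1 / (♮k + 2) - (k + 1) * ((∫ r in 0..2, g r * r ^ k) - ∫ r in 0..2, g r * r ^ (k + 1)) ∧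
    |(∫ r in 0..2, g r * r ^ (k + 2)) - 1 / (♮k + 3) - ((∫ r in 0..2, g r * r ^ k) - 1 / (♮k + 1))| ≤
      3 * (1 / (♮k + 2) - (k + 1) * ((∫ r in 0..2, g r * r ^ k) - ∫ r in 0..2, g r * r ^ (k + 1))) := by
  obtain ⟨A, B, -, -, hA0, hB0, hAB, hG, -⟩ := ray_split k h0 h1 (ρ := 1) ⟨by linarith, by linarith⟩ hg hg0 hg1 hg2
  have hs : ∀ j : ℕ, ∫ r in 0..2, g r * r ^ j = 1 / (j + 1) - (∫ r in 0..1, (1 - g r) * r ^ j) + ∫ r in ♮1..2, g r * r ^ j := fun j ↦ by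
    have i : ∀ a b, IntervalIntegrable (fun r ↦ g r * r ^ j) volume a b := fun a b ↦ (by fun_prop : Continuous fun r ↦ g r * r ^ j).intervalIntegrable a b
    have e : ♮1 / (j + 1) = ∫ r in 0..1, r ^ j := by simp
    rw [← intervalIntegral.integral_add_adjacent_intervals (i 0 1) (i 1 2), e, ← intervalIntegral.integral_sub ((by fun_prop : Continuous _).intervalIntegrable _ _)
      ((by fun_prop : Continuous fun r ↦ (1 - g r) * r ^ j).intervalIntegrable _ _)]
    congr 2; ext r; ring
  have cA : ∀ (j : ℕ), IntervalIntegrable (fun r ↦ (1 - g r) * r ^ j) volume 0 1 := fun j ↦ (by fun_prop : Continuous fun r ↦ (1 - g r) * r ^ j).intervalIntegrable _ _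
  have cB : ∀ (j : ℕ), IntervalIntegrable (fun r ↦ g r * r ^ j) volume 1 2 := fun j ↦ (by fun_prop : Continuous fun r ↦ g r * r ^ j).intervalIntegrable _ _
  have a1 : ∫ r in 0..1, (1 - g r) * r ^ (k + 1) ≤ ∫ r in 0..1, (1 - g r) * r ^ k :=
    intervalIntegral.integral_mono_on zero_le_one (cA _) (cA _) fun r hr ↦
      mul_le_mul_of_nonneg_left (pow_le_pow_of_le_one hr.1 hr.2 ♪) (sub_nonneg.2 (hg0 r).2)
  have a2 : ∫ r in 0..1, (1 - g r) * r ^ (k + 2) ≤ ∫ r in 0..1, (1 - g r) * r ^ (k + 1) :=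
    intervalIntegral.integral_mono_on zero_le_one (cA _) (cA _) fun r hr ↦
      mul_le_mul_of_nonneg_left (pow_le_pow_of_le_one hr.1 hr.2 ♪) (sub_nonneg.2 (hg0 r).2)
  have a3 : ∫ r in 0..1, (1 - g r) * r ^ (k + 1) ≤ ∫ r in 0..1, (1/2 * ((1 - g r) * r ^ k) + 1/2 * ((1 - g r) * r ^ (k + 2))) :=
    intervalIntegral.integral_mono_on zero_le_one (cA _) ((by fun_prop : Continuous _).intervalIntegrable _ _) fun r hr ↦ by
      have := mul_nonneg (mul_nonneg (sub_nonneg.2 (hg0 r).2) (pow_nonneg hr.1 k)) (sq_nonneg (1 - r))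
      rw [pow_add, pow_add]; linarith
  have b1 : ∫ r in ♮1..2, g r * r ^ k ≤ ∫ r in ♮1..2, g r * r ^ (k + 1) :=
    intervalIntegral.integral_mono_on ♣ (cB _) (cB _) fun r hr ↦
      mul_le_mul_of_nonneg_left (pow_le_pow_right₀ hr.1 ♪) (hg0 r).1
  have b2 : ∫ r in ♮1..2, g r * r ^ (k + 1) ≤ ∫ r in ♮1..2, g r * r ^ (k + 2) :=
    intervalIntegral.integral_mono_on ♣ (cB _) (cB _) fun r hr ↦
      mul_le_mul_of_nonneg_left (pow_le_pow_right₀ hr.1 ♪) (hg0 r).1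
  have b3 : ∫ r in ♮1..2, g r * r ^ (k + 2) ≤ ∫ r in ♮1..2, (3 * (g r * r ^ (k + 1)) - 2 * (g r * r ^ k)) :=
    intervalIntegral.integral_mono_on ♣ (cB _) ((by fun_prop : Continuous _).intervalIntegrable _ _) fun r hr ↦ by
      have := mul_nonneg (mul_nonneg (hg0 r).1 (pow_nonneg (by linarith [hr.1] : 0 ≤ r) k)) (mul_nonneg (sub_nonneg.2 hr.1) (sub_nonneg.2 hr.2))
      rw [pow_add, pow_add]; linarith
  rw [intervalIntegral.integral_add ((cA k).const_mul _) ((cA (k + 2)).const_mul _), intervalIntegral.integral_const_mul, intervalIntegral.integral_const_mul] at a3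
  rw [intervalIntegral.integral_sub ((cB (k + 1)).const_mul _) ((cB k).const_mul _), intervalIntegral.integral_const_mul, intervalIntegral.integral_const_mul] at b3
  have e0 := hs k
  have e1 := hs (k + 1)
  have e2 := hs (k + 2)
  push_cast at e1 e2
  rw [show ♮k + 1 + 1 = k + 2 by ring] at e1
  rw [show ♮k + 2 + 1 = k + 3 by ring] at e2
  have e3 : 1 / (♮k + 2) = (k + 1) * (1 / (k + 1) - 1 / (k + 2)) := by field_simp; ring
  have hk0 : ♮0 ≤ k := Nat.cast_nonneg k
  refine ⟨?_, ?_, ?_⟩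
  · rw [hG, one_pow, abs_le]; constructor <;> linarith
  · have : 1 / (♮k + 2) - (k + 1) * ((∫ r in 0..2, g r * r ^ k) - ∫ r in 0..2, g r * r ^ (k + 1)) = (k + 1) * (((∫ r in 0..1, (1 - g r) * r ^ k) -
      ∫ r in 0..1, (1 - g r) * r ^ (k + 1)) + ((∫ r in ♮1..2, g r * r ^ (k + 1)) - ∫ r in ♮1..2, g r * r ^ k)) := by
      rw [e0, e1]; linear_combination e3
    rw [this]
    exact mul_nonneg ♠ ♦
  · have : 1 / (♮k + 2) - (k + 1) * ((∫ r in 0..2, g r * r ^ k) - ∫ r in 0..2, g r * r ^ (k + 1)) = (k + 1) * (((∫ r in 0..1, (1 - g r) * r ^ k) -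
      ∫ r in 0..1, (1 - g r) * r ^ (k + 1)) + ((∫ r in ♮1..2, g r * r ^ (k + 1)) - ∫ r in ♮1..2, g r * r ^ k)) := by
      rw [e0, e1]; linear_combination e3
    rw [this, e0, e2]
    have h5 : ((∫ r in 0..1, (1 - g r) * r ^ k) -
      ∫ r in 0..1, (1 - g r) * r ^ (k + 1)) + ((∫ r in ♮1..2, g r * r ^ (k + 1)) - ∫ r in ♮1..2, g r * r ^ k) ≤ (k + 1) * (((∫ r in 0..1, (1 - g r) * r ^ k) -
      ∫ r in 0..1, (1 - g r) * r ^ (k + 1)) + ((∫ r in ♮1..2, g r * r ^ (k + 1)) - ∫ r in ♮1..2, g r * r ^ k)) :=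
      le_mul_of_one_le_left ♦ ♦
    rw [abs_le]; constructor <;> linarith
lemma polI (k : ℕ) {H : EV (k + 2) → ℝ} (hm : Measurable H) (hi : Integrable H volume) (h2 : ∀ x, 2 ≤ ‖x‖ → H x = 0) :
    ∫ x, H x = (k + 2) * ww (k + 2) * ∫ x, (∫ r in 0..2, H (r • nv x) * r ^ (k + 1)) ∂(gm (k + 2)) := by
  have hn : 1 ≤ k + 2 := by omega
  have m1 : Measurable fun p : EV (k + 2) × ℝ ↦ p.2 • nv p.1 := by fun_prop
  have e := integral_map (μ := (gm (k + 2)).prod (rm (k + 2))) m1.aemeasurable (f := H) hm.aestronglyMeasurable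
  have w0 : 0 < ((k + 2 : ℕ):ℝ) * ww (k + 2) := mul_pos ♠ (ww_pos _)
  have i1 : Integrable (fun p : EV (k + 2) × ℝ ↦ H (p.2 • nv p.1)) ((gm (k + 2)).prod (rm (k + 2))) := by
    refine (integrable_map_measure (μ := (gm (k + 2)).prod (rm (k + 2))) hm.aestronglyMeasurable m1.aemeasurable).1 ?_
    rw [polA hn]
    exact hi.smul_measure ♥
  rw [polA hn, integral_smul_measure, integral_prod _ i1, ENNReal.toReal_ofReal ♠, smul_eq_mul] at e
  have e2 : ∫ x, (∫ r, H (r • nv x) ∂(rm (k + 2))) ∂(gm (k + 2)) = ∫ x, (∫ r in 0..2, H (r • nv x) * r ^ (k + 1)) ∂(gm (k + 2)) := by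
    refine integral_congr_ae ?_
    filter_upwards [gm_ne hn] with x hx
    rw [rm, integral_withDensity_eq_integral_toReal_smul ♩ ♥, intervalIntegral.integral_of_le ♣]
    have e3 : ∫ r in Ioi 0, (ENNReal.ofReal (r ^ (k + 2 - 1))).toReal • H (r • nv x) = ∫ r in Ioi 0, H (r • nv x) * r ^ (k + 1) := by
      refine setIntegral_congr_fun measurableSet_Ioi fun r hr ↦ ?_
      change (ENNReal.ofReal (r ^ (k + 2 - 1))).toReal * H (r • nv x) = _
      rw [ENNReal.toReal_ofReal (pow_nonneg (le_of_lt hr) _), mul_comm]; rfl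
    rw [e3]
    refine (setIntegral_eq_of_subset_of_forall_sdiff_eq_zero measurableSet_Ioi Ioc_subset_Ioi_self fun r hr ↦ ?_)
    have h0 : 0 < r := hr.1
    have : 2 ≤ r := by
      by_contra! hc
      exact hr.2 ⟨h0, hc.le⟩
    rw [h2 _ (by rw [norm_smul, nv_one hx, Real.norm_of_nonneg h0.le]; linarith), zero_mul]
  rw [e2] at e
  rw [← e]
  push_cast at w0 ⊢
  rw [← mul_assoc, mul_inv_cancel₀ w0.ne', one_mul]
lemma sphC (k : ℕ) {f : EV (k + 2) → ℝ} (hf : ContDiff ℝ 1 f) (hc : HasCompactSupport f) :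
    ContDiff ℝ 1 (fun y ↦ ∫ r in 0..2, f (r • y) * r ^ k) ∧
    ∀ y τ, fderiv ℝ (fun y ↦ ∫ r in 0..2, f (r • y) * r ^ k) y τ = ∫ r in 0..2, fderiv ℝ f (r • y) τ * r ^ (k + 1) := by
  have hfc : Continuous fun x ↦ fderiv ℝ f x := hf.continuous_fderiv one_ne_zero
  have hfc0 := hf.continuous
  obtain ⟨M, hM⟩ := (hc.fderiv ℝ).exists_bound_of_continuous hfc
  have hM0 : 0 ≤ M := (norm_nonneg _).trans (hM 0)
  have cF' : Continuous (Function.uncurry fun (y : EV (k + 2)) (r : ℝ) ↦ r ^ (k + 1) • fderiv ℝ f (r • y)) := by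
    have : Continuous fun q : EV (k + 2) × ℝ ↦ q.2 ^ (k + 1) • fderiv ℝ f (q.2 • q.1) :=
      (by fun_prop : Continuous fun q : EV (k + 2) × ℝ ↦ q.2 ^ (k + 1)).smul (hfc.comp ♩)
    exact this
  have cr : ∀ y : EV (k + 2), Continuous fun r : ℝ ↦ r ^ (k + 1) • fderiv ℝ f (r • y) := fun y ↦
    (by fun_prop : Continuous fun r : ℝ ↦ r ^ (k + 1)).smul (hfc.comp ♩)
  have hd : ∀ y, HasFDerivAt (fun y ↦ ∫ r in 0..2, f (r • y) * r ^ k) (∫ r in 0..2, r ^ (k + 1) • fderiv ℝ f (r • y)) y := fun y ↦ by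
    refine intervalIntegral.hasFDerivAt_integral_of_dominated_of_fderiv_le (𝕜 := ℝ) (F := fun (y : EV (k + 2)) (r : ℝ) ↦ f (r • y) * r ^ k) (F' := fun y r ↦ r ^ (k + 1) • fderiv ℝ f (r • y)) (s := univ) (bound := fun _ ↦ 2 ^ (k + 1) * M) univ_mem ?_ ?_ ?_ ?_ ?_ ?_
    · exact Eventually.of_forall fun x ↦ (by fun_prop : Continuous fun r : ℝ ↦ f (r • x) * r ^ k).aestronglyMeasurable
    · exact (by fun_prop : Continuous fun r : ℝ ↦ f (r • y) * r ^ k).intervalIntegrable _ _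
    · exact (cr y).aestronglyMeasurable
    · refine Eventually.of_forall fun r hr x _ ↦ ?_
      rw [uIoc_of_le ♣] at hr
      rw [norm_smul, norm_pow, Real.norm_of_nonneg hr.1.le]
      exact mul_le_mul (pow_le_pow_left₀ hr.1.le hr.2 _) (hM _) (norm_nonneg _) ♠
    · exact intervalIntegrable_const
    · refine Eventually.of_forall fun r _ x _ ↦ ?_
      have h1 : HasFDerivAt (fun x : EV (k + 2) ↦ r • x) (r • ContinuousLinearMap.id ℝ (EV (k + 2))) x := (hasFDerivAt_id x).const_smul r
      have h2 := ((hf.differentiable one_ne_zero (r • x)).hasFDerivAt.comp x h1).mul_const (r ^ k)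
      refine h2.congr_fderiv ?_
      ext v
      simp
      ring
  refine ⟨contDiff_one_iff_hasFDerivAt.2 ⟨_, ?_, hd⟩, fun y τ ↦ ?_⟩
  · exact intervalIntegral.continuous_parametric_intervalIntegral_of_continuous' cF' 0 2
  · rw [(hd y).fderiv, ContinuousLinearMap.intervalIntegral_apply ((cr y).intervalIntegrable _ _)]
    congr 1; ext r; simp [mul_comm]
lemma sphT (k : ℕ) {f : EV (k + 2) → ℝ} (hf : ContDiff ℝ 1 f) (hz : ∀ x, 2 ≤ ‖x‖ → f x = 0) {y τ : EV (k + 2)} (hy : ‖y‖ = 1)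
    (hτ : inner ℝ y τ = 0) (hτ1 : ‖τ‖ ≤ 1) :
    √(1 - ‖τ‖ ^ 2) * ((k + 1) * (∫ r in 0..2, f (r • y) * r ^ k) + 2 * ∫ r in 0..2, max (fderiv ℝ f (r • y) y) 0 * r ^ (k + 1)) +
      ∫ r in 0..2, fderiv ℝ f (r • y) τ * r ^ (k + 1) ≤ ∫ r in 0..2, ‖fderiv ℝ f (r • y)‖ * r ^ (k + 1) := by
  have hfc : Continuous fun x ↦ fderiv ℝ f x := hf.continuous_fderiv one_ne_zero
  have hfc0 := hf.continuous
  have cv : ∀ v, Continuous fun r : ℝ ↦ fderiv ℝ f (r • y) v := fun v ↦ (hfc.comp ♩).clm_apply continuous_const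
  have c1 := cv y
  have c2 := cv τ
  have c3 : Continuous fun r : ℝ ↦ ‖fderiv ℝ f (r • y)‖ := (hfc.comp ♩).norm
  set α := √(1 - ‖τ‖ ^ 2) with hα
  have ht : ‖τ‖ ^ 2 ≤ 1 := pow_le_one₀ (norm_nonneg _) hτ1
  have hα0 : 0 ≤ α := Real.sqrt_nonneg _
  have hα2 : α ^ 2 = 1 - ‖τ‖ ^ 2 := Real.sq_sqrt ♦
  have pt : ∀ r : ℝ, α * |fderiv ℝ f (r • y) y| + fderiv ℝ f (r • y) τ ≤ ‖fderiv ℝ f (r • y)‖ := fun r ↦ by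
    have key : ∀ s : ℝ, |s| = 1 → α * (s * fderiv ℝ f (r • y) y) + fderiv ℝ f (r • y) τ ≤ ‖fderiv ℝ f (r • y)‖ := fun s hs ↦ by
      have n1 : ‖(α * s) • y + τ‖ ≤ 1 := by
        have : ‖(α * s) • y + τ‖ ^ 2 = 1 := by
          rw [norm_add_sq_real, real_inner_smul_left, hτ, norm_smul, hy, Real.norm_eq_abs, abs_mul, hs, mul_one, mul_one, sq_abs, hα2]; ring
        exact (abs_le_of_sq_le_sq' (b := 1) ♦ zero_le_one).2
      have := (le_abs_self _).trans ((fderiv ℝ f (r • y)).le_opNorm ((α * s) • y + τ))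
      rw [map_add, map_smul, smul_eq_mul] at this
      have := this.trans (mul_le_of_le_one_right (norm_nonneg _) n1)
      linarith
    rcases le_total 0 (fderiv ℝ f (r • y) y) with h | h
    · rw [abs_of_nonneg h]; simpa using key 1 ♥
    · rw [abs_of_nonpos h]; simpa using key (-1) ♥
  have ibpR : ∫ r in 0..2, fderiv ℝ f (r • y) y * r ^ (k + 1) = - ((k + 1) * ∫ r in 0..2, f (r • y) * r ^ k) := by
    have hd : ∀ r : ℝ, HasDerivAt (fun r : ℝ ↦ f (r • y)) (fderiv ℝ f (r • y) y) r := fun r ↦ by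
      have := (hf.differentiable one_ne_zero (r • y)).hasFDerivAt.comp_hasDerivAt r ((hasDerivAt_id r).smul_const y)
      refine HasDerivAt.congr_deriv this ?_
      simp
    have := intervalIntegral.integral_mul_deriv_eq_deriv_mul (a := 0) (b := 2) (u := fun r : ℝ ↦ r ^ (k + 1)) (u' := fun r ↦ (k + 1) * r ^ k)
      (fun r _ ↦ by simpa using hasDerivAt_pow (k + 1) r) (fun r _ ↦ hd r) ((by fun_prop : Continuous _).intervalIntegrable _ _) (c1.intervalIntegrable _ _)
    rw [hz (♮2 • y) (by rw [norm_smul, hy]; norm_num)] at this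
    simp only [mul_zero, zero_pow (Nat.succ_ne_zero k), zero_mul, sub_zero, zero_sub] at this
    rw [← intervalIntegral.integral_const_mul]
    refine Eq.trans ?_ (this.trans ?_)
    · congr 1; ext r; ring
    · congr 2; ext r; ring
  have hm := intervalIntegral.integral_mono_on (a := 0) (b := 2) (μ := volume) (f := fun r : ℝ ↦ α * ((2 * (max (fderiv ℝ f (r • y) y) 0 * r ^ (k + 1)) - fderiv ℝ f (r • y) y * r ^ (k + 1))) + fderiv ℝ f (r • y) τ * r ^ (k + 1))
    (g := fun r : ℝ ↦ ‖fderiv ℝ f (r • y)‖ * r ^ (k + 1)) ♣ ((by fun_prop : Continuous _).intervalIntegrable _ _) ((by fun_prop : Continuous _).intervalIntegrable _ _) fun r hr ↦ by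
      have e : 2 * max (fderiv ℝ f (r • y) y) 0 - fderiv ℝ f (r • y) y = |fderiv ℝ f (r • y) y| := by
        rcases le_total 0 (fderiv ℝ f (r • y) y) with h | h
        · rw [abs_of_nonneg h, max_eq_left h]; ring
        · rw [abs_of_nonpos h, max_eq_right h]; ring
      have := mul_le_mul_of_nonneg_right (pt r) (pow_nonneg hr.1 (k + 1))
      rw [← e] at this
      linarith
  rw [intervalIntegral.integral_add ((by fun_prop : Continuous _).intervalIntegrable _ _) ((by fun_prop : Continuous _).intervalIntegrable _ _),
    intervalIntegral.integral_const_mul, intervalIntegral.integral_sub ((by fun_prop : Continuous _).intervalIntegrable _ _) ((by fun_prop : Continuous _).intervalIntegrable _ _),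
    intervalIntegral.integral_const_mul, ibpR] at hm
  linarith
lemma invB (k : ℕ) {s : ℝ} (hs : 0 ≤ s) :
    IntegrableOn (fun x : EV (k + 2) ↦ (♮k + 1) / ‖x‖) (ball 0 s) ∧ ∫ x in ball (0 : EV (k + 2)) s, (♮k + 1) / ‖x‖ = (k + 2) * ww (k + 2) * s ^ (k + 1) := by
  have e0 : (ball (0 : EV (k + 2)) s).indicator (fun x ↦ (♮k + 1) / ‖x‖) = fun x ↦ (fun r : ℝ ↦ (Iio s).indicator (fun r ↦ (♮k + 1) / r) r) ‖x‖ := by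
    ext x
    by_cases h : ‖x‖ < s
    · rw [indicator_of_mem (by simpa using h)]; simp only [indicator_of_mem (show ‖x‖ ∈ Iio s from h)]
    · rw [indicator_of_notMem (by simpa using h)]; simp only [indicator_of_notMem (show ‖x‖ ∉ Iio s from h)]
  have dm : Module.finrank ℝ (EV (k + 2)) - 1 = k + 1 := by simp
  have e1 : EqOn (fun y : ℝ ↦ y ^ (Module.finrank ℝ (EV (k + 2)) - 1) • (Iio s).indicator (fun r ↦ (♮k + 1) / r) y) ((Iio s).indicator fun y ↦ (k + 1) * y ^ k) (Ioi 0) := fun y hy ↦ by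
    have hy : 0 < y := hy
    simp only [dm, smul_eq_mul]
    by_cases h : y < s
    · rw [indicator_of_mem (show y ∈ Iio s from h), indicator_of_mem (show y ∈ Iio s from h), pow_succ]; field_simp
    · rw [indicator_of_notMem (show y ∉ Iio s from h), indicator_of_notMem (show y ∉ Iio s from h)]; simp
  have hI : Ioi 0 ∩ Iio s = Ioo 0 s := by ext; simp
  have i1 : IntegrableOn ((Iio s).indicator fun y ↦ (♮k + 1) * y ^ k) (Ioi 0) := by
    rw [IntegrableOn, integrable_indicator_iff measurableSet_Iio, IntegrableOn, Measure.restrict_restrict measurableSet_Iio, inter_comm, hI]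
    exact ((by fun_prop : Continuous fun y : ℝ ↦ (♮k + 1) * y ^ k).continuousOn.integrableOn_Icc).mono_set Ioo_subset_Icc_self
  constructor
  · rw [← integrable_indicator_iff measurableSet_ball, e0, integrable_fun_norm_addHaar volume]
    exact (integrableOn_congr_fun e1 measurableSet_Ioi).2 i1
  · rw [← integral_indicator measurableSet_ball, e0, integral_fun_norm_addHaar volume, setIntegral_congr_fun measurableSet_Ioi e1,
      setIntegral_indicator measurableSet_Iio, hI, ← integral_Ioc_eq_integral_Ioo, ← intervalIntegral.integral_of_le hs, intervalIntegral.integral_const_mul, integral_pow]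
    simp only [ww, nsmul_eq_mul, smul_eq_mul]
    simp
    have : ♮k + 1 ≠ 0 := by positivity
    field_simp
lemma near_alg {k A a2 s P l N Q T v R e : ℝ} (hk : 0 ≤ k) (h1 : a2 = A ^ 2 + s + P ^ 2 / (k + 2))
    (h2 : (k + 1) * A + N + ((k + 2) - 1/2 - 3/8*(21/20)^2*(k + 2)) * s - P ^ 2 / (2 * (k + 2)) ≤ T - 1)
    (h3 : (k + 1) * A = - l + (k + 1) * v) (h4 : l ≤ (k + 1) / 2 * (21/20) * a2 + 1/20 * (N + Q)) (hl : 0 ≤ l) (hs : 0 ≤ s) (hN : 0 ≤ N) (hQ : 0 ≤ Q)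
    (he : 3 * (k + 2) ^ 2 * e ≤ 1/40) (he0 : 0 ≤ e) (hA : |A| ≤ e) (hP : P ≤ (k + 2) * e) (hP0 : 0 ≤ P) (hPR : P ≤ R + 3 * (k + 2) * l) (hR : 0 ≤ R) :
    1 + 1/20 * (l - (k + 1) * v) - (2 * ((k + 1) * |v|) + Q + R) ≤ T := by
  have e1 : e ≤ 1/40 := by nlinarith
  have a1 : (k + 1) * A ^ 2 ≤ 1/40 * (l + (k + 1) * |v|) := by
    have : (k + 1) * |A| ≤ l + (k + 1) * |v| := by
      rw [← abs_of_pos (show 0 < k + 1 by linarith), ← abs_mul, ← abs_mul, h3]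
      calc _ ≤ |-l| + |(k + 1) * v| := abs_add_le _ _
        _ = _ := by rw [abs_neg, abs_of_nonneg hl]
    calc (k + 1) * A ^ 2 = |A| * ((k + 1) * |A|) := by rw [← sq_abs]; ring
      _ ≤ (1/40) * (l + (k + 1) * |v|) := mul_le_mul (hA.trans e1) this ♠ ♣
  have e2 : (k + 2) * e ≤ 1/40 := by nlinarith
  have a2' : P ^ 2 ≤ 1/40 * R + 1/40 * l := by
    calc P ^ 2 = P * P := sq P
      _ ≤ ((k + 2) * e) * (R + 3 * (k + 2) * l) := mul_le_mul hP hPR hP0 ♠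
      _ = ((k + 2) * e) * R + (3 * (k + 2) ^ 2 * e) * l := by ring
      _ ≤ _ := add_le_add (mul_le_mul_of_nonneg_right e2 hR) (mul_le_mul_of_nonneg_right he hl)
  have a3 : P ^ 2 / (2 * (k + 2)) ≤ P ^ 2 / 4 := by gcongr; linarith
  have a4 : (k + 1) * (P ^ 2 / (k + 2)) ≤ P ^ 2 := by
    rw [mul_div_assoc', div_le_iff₀ ♦]; nlinarith [sq_nonneg P]
  have vb := neg_abs_le ((k + 1) * v)
  have vb2 := le_abs_self ((k + 1) * v)
  rw [abs_mul, abs_of_pos (show 0 < k + 1 by linarith)] at vb vb2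
  have ks : 0 ≤ k * s := by positivity
  rw [h1] at h4
  generalize P ^ 2 / (2 * (k + 2)) = p1 at *
  have h4' : l ≤ 21/40 * ((k + 1) * A ^ 2) + 21/40 * (k * s) + 21/40 * s + 21/40 * ((k + 1) * (P ^ 2 / (k + 2))) + 1/20 * (N + Q) := by linarith
  generalize (k + 1) * (P ^ 2 / (k + 2)) = p2 at *
  generalize (k + 1) * A ^ 2 = p3 at *
  have h2' : (k + 1) * A + N + (1 - 3/8*(21/20)^2) * (k * s) + (3/2 - 3/4*(21/20)^2) * s - p1 ≤ T - 1 := by linarith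
  rw [h3] at h2'
  have : 0 ≤ (k + 1) * |v| := by positivity
  generalize (k + 1) * |v| = V at *
  generalize (k + 1) * v = V' at *
  generalize k * s = ks' at *
  linarith
lemma par_cont {n : ℕ} {H : EV n → ℝ → ℝ} (h : Continuous fun q : EV n × ℝ ↦ H q.1 q.2) : Continuous fun y ↦ ∫ r in 0..2, H y r :=
  intervalIntegral.continuous_parametric_intervalIntegral_of_continuous' (f := H) h 0 2
lemma av_mono {n : ℕ} (hn : 1 ≤ n) {Φ Ψ : EV n → ℝ} (h1 : Continuous Φ) (h2 : Continuous Ψ) (h : ∀ y, ‖y‖ = 1 → Φ y ≤ Ψ y) : av n Φ ≤ av n Ψ := by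
  refine integral_mono_ae (int_nv h1) (int_nv h2) ?_
  filter_upwards [gm_ne hn] with x hx
  exact h _ (nv_one hx)
lemma av_congr {n : ℕ} (hn : 1 ≤ n) {Φ Ψ : EV n → ℝ} (h : ∀ y, ‖y‖ = 1 → Φ y = Ψ y) : av n Φ = av n Ψ := by
  refine integral_congr_ae ?_
  filter_upwards [gm_ne hn] with x hx
  exact h _ (nv_one hx)
lemma av_const {n : ℕ} (c : ℝ) : av n (fun _ ↦ c) = c := by simp [av]
lemma av_add {n : ℕ} {Φ Ψ : EV n → ℝ} (h1 : Continuous Φ) (h2 : Continuous Ψ) : av n (fun y ↦ Φ y + Ψ y) = av n Φ + av n Ψ :=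
  integral_add (int_nv h1) (int_nv h2)
lemma av_sub {n : ℕ} {Φ Ψ : EV n → ℝ} (h1 : Continuous Φ) (h2 : Continuous Ψ) : av n (fun y ↦ Φ y - Ψ y) = av n Φ - av n Ψ :=
  integral_sub (int_nv h1) (int_nv h2)
lemma av_smul {n : ℕ} (c : ℝ) (Φ : EV n → ℝ) : av n (fun y ↦ c * Φ y) = c * av n Φ := integral_const_mul _ _
set_option maxHeartbeats 1000000 in
lemma near_pol (k : ℕ) {f : EV (k + 2) → ℝ} (hf : ContDiff ℝ 1 f) (hc : HasCompactSupport f) (h01 : ∀ x, 0 ≤ f x ∧ f x ≤ 1)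
    (hz : ∀ x, 3/2 ≤ ‖x‖ → f x = 0) :
    ∫ x, ‖fderiv ℝ f x‖ = (k + 2) * ww (k + 2) * av (k + 2) (fun y ↦ ∫ r in 0..2, ‖fderiv ℝ f (r • y)‖ * r ^ (k + 1)) ∧
    ∫ x, f x = (k + 2) * ww (k + 2) * av (k + 2) (fun y ↦ ∫ r in 0..2, f (r • y) * r ^ (k + 1)) ∧
    ∫ x, f x * (1 - f x) = (k + 2) * ww (k + 2) * av (k + 2) (fun y ↦ ∫ r in 0..2, f (r • y) * (1 - f (r • y)) * r ^ (k + 1)) ∧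
    (∀ v, ∫ x, f x * inner ℝ x v = (k + 2) * ww (k + 2) * av (k + 2) (fun y ↦ (∫ r in 0..2, f (r • y) * r ^ (k + 2)) * inner ℝ y v)) ∧
    ∫ x, f x * ((k + 1) / ‖x‖) = (k + 2) * ww (k + 2) * ((k + 1) * av (k + 2) (fun y ↦ (∫ r in 0..2, f (r • y) * r ^ k))) := by
  have hn : 1 ≤ k + 2 := by omega
  have hfc : Continuous fun x ↦ fderiv ℝ f x := hf.continuous_fderiv one_ne_zero
  have hfc0 := hf.continuous
  have hz' : ∀ x, 2 ≤ ‖x‖ → f x = 0 := fun x hx ↦ hz x ♦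
  have hd0 : ∀ x, 2 ≤ ‖x‖ → fderiv ℝ f x = 0 := fun x hx ↦ by
    have : f =ᶠ[𝓝 x] fun _ ↦ 0 := by
      filter_upwards [(isOpen_lt continuous_const continuous_norm).mem_nhds (show (3/2:ℝ) < ‖x‖ by linarith)] with y hy
      exact hz y (le_of_lt hy)
    rw [this.fderiv_eq]; simp
  refine ⟨?_, ?_, ?_, fun v ↦ ?_, ?_⟩
  · exact polI k hfc.norm.measurable (hfc.norm.integrable_of_hasCompactSupport (hc.fderiv ℝ).norm) (fun x hx ↦ by rw [hd0 x hx, norm_zero])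
  · exact polI k hfc0.measurable (hfc0.integrable_of_hasCompactSupport hc) hz'
  · exact polI k (H := fun x ↦ f x * (1 - f x)) ♩ ((by fun_prop : Continuous fun x ↦ f x * (1 - f x)).integrable_of_hasCompactSupport hc.mul_right) (fun x hx ↦ by simp [hz' x hx])
  · rw [polI k (H := fun x ↦ f x * inner ℝ x v) ♩ ((by fun_prop : Continuous fun x ↦ f x * inner ℝ x v).integrable_of_hasCompactSupport hc.mul_right) (fun x hx ↦ by simp [hz' x hx])]
    congr 2
    ext x
    change _ = (∫ r in 0..2, f (r • nv x) * r ^ (k + 2)) * inner ℝ (nv x) v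
    rw [← intervalIntegral.integral_mul_const]
    congr 1
    ext r
    rw [real_inner_smul_left]; ring
  · have i1 : Integrable fun x ↦ f x * ((k + 1) / ‖x‖) := by
      refine Integrable.mono' ((integrable_indicator_iff measurableSet_ball).2 (invB k (s := 2) ♣).1) (by fun_prop : Measurable fun x : EV (k + 2) ↦ f x * ((k + 1) / ‖x‖)).aestronglyMeasurable (Eventually.of_forall fun x ↦ ?_)
      by_cases h : ‖x‖ < 2
      · rw [indicator_of_mem (by simpa using h), norm_mul, Real.norm_of_nonneg (h01 x).1, Real.norm_of_nonneg ♠]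
        exact mul_le_of_le_one_left ♠ (h01 x).2
      · rw [indicator_of_notMem (by simpa using h), hz' x (not_lt.1 h)]; simp
    rw [polI k (H := fun x ↦ f x * ((k + 1) / ‖x‖)) ♩ i1 (fun x hx ↦ by simp [hz' x hx]), ← av_smul]
    congr 1
    refine integral_congr_ae ?_
    filter_upwards [gm_ne hn] with x hx
    rw [← intervalIntegral.integral_const_mul]
    rw [intervalIntegral.integral_of_le ♣, intervalIntegral.integral_of_le ♣]
    refine setIntegral_congr_fun measurableSet_Ioc fun r hr ↦ ?_
    change f (r • nv x) * ((k + 1) / ‖r • nv x‖) * r ^ (k + 1) = (k + 1) * (f (r • nv x) * r ^ k)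
    have h := hr.1
    rw [norm_smul, nv_one hx, Real.norm_of_nonneg h.le, pow_succ, mul_one]
    field_simp
lemma near_core (k : ℕ) {e : ℝ} {G T N Q V X : EV (k + 2) → ℝ} (cG : Continuous G) (cN : Continuous N) (cQ : Continuous Q) (cV : Continuous V) (cX : Continuous X)
    (hS : ∃ s, 0 ≤ s ∧ ∃ p : EV (k + 2), av (k + 2) (fun y ↦ (G y - 1/(♮k+1))^2) = av (k + 2) (fun y ↦ G y - 1/(♮k+1))^2 + s + ‖p‖^2/(♮k+2) ∧
      (♮k+1)*av (k + 2) (fun y ↦ G y - 1/(♮k+1)) + av (k + 2) N + ((♮k+2) - 1/2 - 3/8*(21/20)^2*(♮k+2))*s - ‖p‖^2/(2*(♮k+2)) ≤ av (k + 2) T - 1 ∧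
      ∀ v, inner ℝ p v = (♮k+2) * av (k + 2) (fun y ↦ (G y - 1/(♮k+1)) * inner ℝ y v))
    (he : 3 * (♮k + 2) ^ 2 * e ≤ 1/40) (he0 : 0 ≤ e)
    (hB : ∀ y, ‖y‖ = 1 → |G y - 1/(♮k+1)| ≤ e ∧ 0 ≤ 1/(♮k+2) - (k+1)*(G y - V y) ∧ |X y - 1/(♮k+3) - (G y - 1/(♮k+1))| ≤ 3*(1/(♮k+2) - (k+1)*(G y - V y)))
    (hR : ∀ y, ‖y‖ = 1 → 1/(♮k+2) - (k+1)*(G y - V y) ≤ (♮k+1)/2*(21/20)*(G y - 1/(♮k+1))^2 + 1/20*(N y + Q y))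
    (N0 : ∀ y, ‖y‖ = 1 → 0 ≤ N y) (Q0 : ∀ y, ‖y‖ = 1 → 0 ≤ Q y) {M : EV (k + 2)} (hM : ∀ v, av (k + 2) (fun y ↦ X y * inner ℝ y v) = inner ℝ M v) :
    1 + 1/20 * (- ((♮k + 1) * (av (k + 2) G - 1/(♮k+1)))) - (2 * ((♮k + 1) * |av (k + 2) V - 1/(♮k+2)|) + av (k + 2) Q + (♮k + 2) * ‖M‖) ≤ av (k + 2) T := by
  have hn : 1 ≤ k + 2 := by omega
  obtain ⟨s, hs, p, a1, a2, a3⟩ := hS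
  have eA : av (k + 2) (fun y ↦ G y - 1/(♮k+1)) = av (k + 2) G - 1/(♮k+1) := by rw [av_sub cG continuous_const, av_const]
  have nn : ∀ Φ : EV (k + 2) → ℝ, Continuous Φ → (∀ y, ‖y‖ = 1 → 0 ≤ Φ y) → 0 ≤ av (k + 2) Φ := fun Φ c h ↦ by
    have := av_mono hn continuous_const c h
    rwa [av_const] at this
  have eL : av (k + 2) (fun y ↦ 1/(♮k+2) - (k+1)*(G y - V y)) = 1/(♮k+2) - (k+1)*(av (k + 2) G - av (k + 2) V) := by
    rw [av_sub continuous_const ♩, av_const, av_smul, av_sub cG cV]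
  have hl0 := nn _ ♩ (fun y hy ↦ (hB y hy).2.1)
  have hR' := av_mono hn ♩ ♩ hR
  rw [av_add ♩ ♩, av_smul, av_smul, av_add cN cQ] at hR'
  have habs : ∀ Φ : EV (k + 2) → ℝ, |av (k + 2) Φ| ≤ av (k + 2) (fun y ↦ |Φ y|) := fun Φ ↦ abs_integral_le_integral_abs
  have hA : |av (k + 2) (fun y ↦ G y - 1/(♮k+1))| ≤ e := by
    refine (habs _).trans ?_
    have := av_mono (Φ := fun y ↦ |G y - 1/(♮k+1)|) hn ♩ continuous_const (fun y hy ↦ (hB y hy).1)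
    rwa [av_const] at this
  have cs : ∀ y v : EV (k + 2), ‖y‖ = 1 → |inner ℝ y v| ≤ ‖v‖ := fun y v hy ↦ by
    have := abs_real_inner_le_norm y v
    rwa [hy, one_mul] at this
  have canc : ∀ c : ℝ, 0 ≤ c → ‖p‖ ^ 2 ≤ c * ‖p‖ → ‖p‖ ≤ c := fun c hc h ↦ by
    rcases (norm_nonneg p).eq_or_lt with h' | h'
    · rwa [← h']
    · rw [sq] at h; exact le_of_mul_le_mul_right h h'
  have hpp := a3 p
  rw [real_inner_self_eq_norm_sq] at hpp
  have hP : ‖p‖ ≤ (♮k + 2) * e := by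
    refine canc _ ♠ ?_
    rw [hpp, mul_assoc]
    refine mul_le_mul_of_nonneg_left ?_ ♠
    have := av_mono (Φ := fun y ↦ (G y - 1/(♮k+1)) * inner ℝ y p) hn ♩ continuous_const (fun y hy ↦ (le_abs_self _).trans (bnd (hB y hy).1 (cs y p hy)))
    rwa [av_const] at this
  have hPR : ‖p‖ ≤ (♮k + 2) * ‖M‖ + 3 * (♮k + 2) * av (k + 2) (fun y ↦ 1/(♮k+2) - (k+1)*(G y - V y)) := by
    refine canc _ ♠ ?_
    have e1 : av (k + 2) (fun y ↦ (X y - 1/(♮k+3)) * inner ℝ y p) = inner ℝ M p := by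
      rw [← hM]
      have : (fun y : EV (k + 2) ↦ (X y - 1/(♮k+3)) * inner ℝ y p) = fun y ↦ X y * inner ℝ y p - 1/(♮k+3) * inner ℝ p y := by
        ext y; rw [real_inner_comm y p]; ring
      rw [this, av_sub ♩ ♩, av_smul, av_inner, mul_zero, sub_zero]
    have e2 := av_mono (Φ := fun y ↦ (G y - 1/(♮k+1)) * inner ℝ y p) (Ψ := fun y ↦ (X y - 1/(♮k+3)) * inner ℝ y p + ‖p‖ * (3*(1/(♮k+2) - (k+1)*(G y - V y)))) hn ♩ ♩ (fun y hy ↦ by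
      have := (abs_le.1 (bnd (hB y hy).2.2 (cs y p hy))).1
      linarith)
    rw [av_add ♩ ♩, av_smul, av_smul, e1] at e2
    have e3 := real_inner_le_norm M p
    rw [hpp]
    have : (♮k + 2) * av (k + 2) (fun y ↦ (G y - 1/(♮k+1)) * inner ℝ y p) ≤ (♮k + 2) * (‖M‖ * ‖p‖ + ‖p‖ * (3 * av (k + 2) (fun y ↦ 1/(♮k+2) - (k+1)*(G y - V y)))) :=
      mul_le_mul_of_nonneg_left ♦ ♠
    linarith
  have h3 : (♮k + 1) * av (k + 2) (fun y ↦ G y - 1/(♮k+1)) = - av (k + 2) (fun y ↦ 1/(♮k+2) - (k+1)*(G y - V y)) + (♮k + 1) * (av (k + 2) V - 1/(♮k+2)) := by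
    rw [eL, eA]
    field_simp
    ring
  have := near_alg (k := k) ♠ a1 a2 h3 hR' hl0 hs (nn N cN N0) (nn Q cQ Q0) he he0 hA hP (norm_nonneg _) hPR ♠
  rw [eA] at h3
  rw [h3]
  linarith
set_option maxHeartbeats 2000000 in
lemma near (k : ℕ) : ∃ δ > 0, δ ≤ 1/2 ∧ ∀ f : EV (k + 2) → ℝ, ContDiff ℝ 1 f → HasCompactSupport f → (∀ x, 0 ≤ f x ∧ f x ≤ 1) →
    (∀ x, ‖x‖ ≤ 1 - δ → f x = 1) → (∀ x, 1 + δ ≤ ‖x‖ → f x = 0) →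
    (k + 2) * ww (k + 2) + 1/20 * ((k + 2) * ww (k + 2) - ∫ x, f x * ((k + 1) / ‖x‖)) -
      (2 * ((k + 1) * |(∫ x, f x) - ww (k + 2)|) + (∫ x, f x * (1 - f x)) + (k + 2) * ‖∫ x, f x • x‖) ≤ ∫ x, ‖fderiv ℝ f x‖ := by
  obtain ⟨δs, hδs, hS⟩ := sph k
  have hn : 1 ≤ k + 2 := by omega
  obtain ⟨δ, ⟨⟨⟨h1, h2⟩, h3⟩, h4⟩, h0⟩ : ∃ δ : ℝ, (((δ < 1/2 ∧ (♮k + 1) * 2 ^ (k + 8) * δ < 1/20) ∧ 2 ^ (k + 2) * δ < δs) ∧ 3 * (♮k + 2) ^ 2 * (2 ^ (k + 2) * δ) < 1/40) ∧ 0 < δ := by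
    have t : ∀ c b : ℝ, 0 < b → ∀ᶠ d in 𝓝[>] ♮0, c * d < b := fun c b hb ↦ by
      have : Tendsto (fun d : ℝ ↦ c * d) (𝓝 0) (𝓝 (c * 0)) := (continuous_const.mul continuous_id).tendsto 0
      rw [mul_zero] at this
      exact nhdsWithin_le_nhds (this.eventually (gt_mem_nhds hb))
    have q1 := t 1 (1/2) ♣
    have q2 := t ((♮k + 1) * 2 ^ (k + 8)) (1/20) ♣
    have q3 := t (2 ^ (k + 2)) δs hδs
    have q4 := t (3 * (♮k + 2) ^ 2 * 2 ^ (k + 2)) (1/40) ♣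
    have q5 : ∀ᶠ d in 𝓝[>] ♮0, 0 < d := self_mem_nhdsWithin
    obtain ⟨d, ⟨⟨⟨⟨a, b⟩, c⟩, d'⟩, e⟩⟩ := ((((q1.and q2).and q3).and q4).and q5).exists
    exact ⟨d, ⟨⟨⟨by linarith, b⟩, c⟩, by rw [← mul_assoc]; exact d'⟩, e⟩
  refine ⟨δ, h0, h1.le, fun f hf hc h01 hf1 hf2 ↦ ?_⟩
  have hfc : Continuous fun x ↦ fderiv ℝ f x := hf.continuous_fderiv one_ne_zero
  have hfc0 := hf.continuous
  have hz : ∀ x, 3/2 ≤ ‖x‖ → f x = 0 := fun x hx ↦ hf2 x ♦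
  obtain ⟨pT, pV, pQ, pX, pG⟩ := near_pol k hf hc h01 hz
  obtain ⟨cG, dG⟩ := sphC k hf hc
  have cT : Continuous fun y ↦ ∫ r in 0..2, ‖fderiv ℝ f (r • y)‖ * r ^ (k + 1) := by
    refine par_cont (H := fun y r ↦ ‖fderiv ℝ f (r • y)‖ * r ^ (k + 1)) ?_
    exact (hfc.comp (by fun_prop : Continuous fun q : EV (k + 2) × ℝ ↦ q.2 • q.1)).norm.mul ♩
  have cN : Continuous fun y ↦ ∫ r in 0..2, max (fderiv ℝ f (r • y) y) 0 * r ^ (k + 1) := by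
    refine par_cont (H := fun y r ↦ max (fderiv ℝ f (r • y) y) 0 * r ^ (k + 1)) ?_
    exact (((hfc.comp (by fun_prop : Continuous fun q : EV (k + 2) × ℝ ↦ q.2 • q.1)).clm_apply continuous_fst).max continuous_const).mul ♩
  have cp : ∀ j : ℕ, Continuous fun y ↦ ∫ r in 0..2, f (r • y) * r ^ j := fun j ↦
    par_cont (H := fun y r ↦ f (r • y) * r ^ j) ♩
  have cQ : Continuous fun y ↦ ∫ r in 0..2, f (r • y) * (1 - f (r • y)) * r ^ (k + 1) :=
    par_cont (H := fun y r ↦ f (r • y) * (1 - f (r • y)) * r ^ (k + 1)) ♩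
  have nr : ∀ y : EV (k + 2), ‖y‖ = 1 → ∀ r : ℝ, 0 ≤ r → ‖r • y‖ = r := fun y hy r hr ↦ by rw [norm_smul, hy, Real.norm_of_nonneg hr, mul_one]
  have g1 : ∀ y : EV (k + 2), ‖y‖ = 1 → ∀ r ∈ Icc 0 (1 - δ), f (r • y) = 1 := fun y hy r hr ↦ hf1 _ (by rw [nr y hy r hr.1]; exact hr.2)
  have g2 : ∀ y : EV (k + 2), ‖y‖ = 1 → ∀ r, 1 + δ ≤ r → f (r • y) = 0 := fun y hy r hr ↦ hf2 _ (by rw [nr y hy r ♦]; exact hr)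
  have rB := fun y hy ↦ ray_bd k h0 h1.le (g := fun r ↦ f (r • y)) ♩ (fun r ↦ h01 _) (g1 y hy) (g2 y hy)
  have rR : ∀ y, ‖y‖ = 1 → _ := fun y hy ↦ ray k h0 h1.le h2.le (g := fun r ↦ f (r • y)) (g' := fun r ↦ fderiv ℝ f (r • y) y) (fun r ↦ by
      have := (hf.differentiable one_ne_zero (r • y)).hasFDerivAt.comp_hasDerivAt r ((hasDerivAt_id r).smul_const y)
      refine HasDerivAt.congr_deriv this ?_
      simp) ((hfc.comp ♩).clm_apply continuous_const) (fun r ↦ h01 _) (g1 y hy) (g2 y hy)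
  have sT : ∀ y τ, ‖y‖ = 1 → inner ℝ y τ = 0 → ‖τ‖ ≤ 1 → _ := fun y τ hy h h' ↦ sphT k hf (fun x hx ↦ hz x ♦) (y := y) (τ := τ) hy h h'
  simp only [← dG] at sT
  have N0 : ∀ y : EV (k + 2), ‖y‖ = 1 → 0 ≤ ∫ r in 0..2, max (fderiv ℝ f (r • y) y) 0 * r ^ (k + 1) := fun y _ ↦
    intervalIntegral.integral_nonneg ♣ fun r hr ↦ mul_nonneg (le_max_right _ _) (pow_nonneg hr.1 _)
  have Q0 : ∀ y : EV (k + 2), ‖y‖ = 1 → 0 ≤ ∫ r in 0..2, f (r • y) * (1 - f (r • y)) * r ^ (k + 1) := fun y _ ↦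
    intervalIntegral.integral_nonneg ♣ fun r hr ↦ mul_nonneg (mul_nonneg (h01 _).1 (sub_nonneg.2 (h01 _).2)) (pow_nonneg hr.1 _)
  have cV := cp (k + 1)
  have cX := cp (k + 2)
  have cG0 := cp k
  have w0 : 0 < (♮k + 2) * ww (k + 2) := mul_pos ♠ (ww_pos _)
  have hM : ∀ v, av (k + 2) (fun y ↦ (∫ r in 0..2, f (r • y) * r ^ (k + 2)) * inner ℝ y v) = inner ℝ (((♮k + 2) * ww (k + 2))⁻¹ • ∫ x, f x • x) v := fun v ↦ by
    have ix : Integrable fun x ↦ f x • x := (by fun_prop : Continuous fun x ↦ f x • x).integrable_of_hasCompactSupport hc.smul_right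
    rw [real_inner_smul_left, real_inner_comm, ← integral_inner ix v]
    have : (fun x ↦ inner ℝ v (f x • x)) = fun x ↦ f x * inner ℝ x v := by ext x; rw [real_inner_smul_right, real_inner_comm]
    rw [this, pX v, ← mul_assoc, inv_mul_cancel₀ w0.ne', one_mul]
  have := near_core k cG0 cN cQ cV cX
    (hS _ _ _ cG cT cN (fun y hy ↦ (rB y hy).1.trans h3.le) N0 sT) h4.le ♠ rB rR N0 Q0 hM
  have := mul_le_mul_of_nonneg_left this w0.le
  rw [← pT] at this
  rw [pG, pQ]
  refine le_trans (le_of_eq ?_) this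
  have w1 := ww_pos (k + 2)
  have eV : (∫ x, f x) - ww (k + 2) = ((♮k + 2) * ww (k + 2)) * (av (k + 2) (fun y ↦ ∫ r in 0..2, f (r • y) * r ^ (k + 1)) - 1 / (♮k + 2)) := by
    rw [pV]; field_simp
  rw [eV, abs_mul, abs_of_pos w0, norm_smul, Real.norm_of_nonneg (inv_nonneg.2 w0.le)]
  field_simp
  ring
set_option maxHeartbeats 1000000 in
lemma near_set (k : ℕ) : ∃ δ > 0, δ ≤ 1/2 ∧ ∀ (E : Set (EV (k + 2))) (p : ℝ), MeasurableSet E → PerLe E p → ball 0 (1 - δ) ⊆ E → E ⊆ ball 0 (1 + δ) →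
    ∫ x in E, x = 0 →
    (k + 2) * ww (k + 2) + 1/20 * ((k + 2) * ww (k + 2) - ∫ x in E, (k + 1) / ‖x‖) - 2 * ((k + 1) * |volume.real E - ww (k + 2)|) ≤ p := by
  obtain ⟨δ, hδ, hδ2, hN⟩ := near k
  refine ⟨δ / 2, half_pos hδ, by linarith, fun E p hE hp hin hout hb ↦ ?_⟩
  have hfin : volume E ≠ ⊤ := ((measure_mono hout).trans_lt measure_ball_lt_top).ne
  refine le_of_forall_pos_le_add fun η hη ↦ ?_
  set D : ℝ := 5 * k + 10 with hD
  have hD0 : 0 < D := by positivity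
  set ε := min (δ / 4) (η / D) with hε
  have hε0 : 0 < ε := lt_min ♦ ♠
  have hε1 : ε ≤ δ / 4 := min_le_left _ _
  have hε2 : ε * D ≤ η := by rw [← le_div_iff₀ hD0]; exact min_le_right _ _
  obtain ⟨f, hf, hc, h01, hL1, hP, hf1, hf2⟩ := approx hE hfin hp hε0
  have f1 : ∀ x, ‖x‖ ≤ 1 - δ → f x = 1 := fun x hx ↦ hf1 (1 - δ / 2) ♦ hin x ♦
  have f2 : ∀ x, 1 + δ ≤ ‖x‖ → f x = 0 := fun x hx ↦ hf2 (1 + δ / 2) hout x ♦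
  have key := hN f hf hc h01 f1 f2
  have hfc := hf.continuous
  have i1 : Integrable f := hfc.integrable_of_hasCompactSupport hc
  have i2 : Integrable (E.indicator (1 : EV (k + 2) → ℝ)) := (integrable_indicator_iff hE).2 (integrableOn_const hfin)
  have i3 : Integrable (fun x ↦ f x - E.indicator 1 x) := i1.sub i2
  have χ : ∀ x, E.indicator (1 : EV (k + 2) → ℝ) x = 0 ∨ E.indicator (1 : EV (k + 2) → ℝ) x = 1 := fun x ↦ by
    by_cases h : x ∈ E <;> simp [h]
  have z1 : ∀ x, ‖x‖ < 1 / 2 → f x - E.indicator 1 x = 0 := fun x hx ↦ by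
    rw [f1 x ♦, indicator_of_mem (hin (by simp; linarith))]; simp
  have z2 : ∀ x, 2 ≤ ‖x‖ → f x - E.indicator 1 x = 0 := fun x hx ↦ by
    rw [f2 x ♦, indicator_of_notMem (fun h ↦ by have := hout h; simp at this; linarith)]; simp
  have b1 : |(∫ x, f x) - volume.real E| ≤ ε := by
    have : volume.real E = ∫ x, E.indicator (1 : EV (k + 2) → ℝ) x := (integral_indicator_one hE).symm
    rw [this, ← integral_sub i1 i2]
    exact abs_integral_le_integral_abs.trans hL1
  have b2 : ∫ x, f x * (1 - f x) ≤ ε := by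
    refine (integral_mono ?_ i3.abs fun x ↦ ?_).trans hL1
    · exact (by fun_prop : Continuous fun x ↦ f x * (1 - f x)).integrable_of_hasCompactSupport hc.mul_right
    · change f x * (1 - f x) ≤ |f x - E.indicator 1 x|
      have := h01 x
      rcases χ x with h | h
      · rw [h, sub_zero, abs_of_nonneg this.1]; nlinarith
      · rw [h, abs_of_nonpos ♦]; nlinarith
  have b3 : ‖∫ x, f x • x‖ ≤ 2 * ε := by
    have ix : Integrable fun x ↦ f x • x := (by fun_prop : Continuous fun x ↦ f x • x).integrable_of_hasCompactSupport hc.smul_right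
    have ie : IntegrableOn (fun x : EV (k + 2) ↦ x) E :=
      Measure.integrableOn_of_bounded (M := 2) hfin ♩ ((ae_restrict_iff' hE).2 (Eventually.of_forall fun x hx ↦ by have := hout hx; simp at this; linarith))
    have e : ∫ x, f x • x = ∫ x, (f x - E.indicator 1 x) • x := by
      have : (fun x ↦ (f x - E.indicator 1 x) • x) = fun x ↦ f x • x - E.indicator (fun x ↦ x) x := by
        ext1 x
        by_cases h : x ∈ E <;> simp [h, sub_smul]
      rw [this, integral_sub ix ((integrable_indicator_iff hE).2 ie), integral_indicator hE, hb, sub_zero]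
    rw [e]
    refine (norm_integral_le_of_norm_le (i3.abs.const_mul 2) (Eventually.of_forall fun x ↦ ?_)).trans ?_
    · rw [norm_smul, Real.norm_eq_abs]
      rcases lt_or_ge ‖x‖ 2 with h | h
      · nlinarith [abs_nonneg (f x - E.indicator 1 x)]
      · rw [z2 x h]; simp
    · rw [integral_const_mul]; linarith
  have b4 : ∫ x, f x * ((k + 1) / ‖x‖) ≤ (∫ x in E, (k + 1) / ‖x‖) + 2 * (k + 1) * ε := by
    have I2 := (invB k (s := 2) ♣).1
    have hE2 : E ⊆ ball 0 2 := hout.trans (ball_subset_ball ♦)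
    have j1 : Integrable (E.indicator fun x : EV (k + 2) ↦ (♮k + 1) / ‖x‖) := (integrable_indicator_iff hE).2 (I2.mono_set hE2)
    have j2 : Integrable fun x ↦ f x * ((♮k + 1) / ‖x‖) := by
      refine Integrable.mono' ((integrable_indicator_iff measurableSet_ball).2 I2) (by fun_prop : Measurable fun x : EV (k + 2) ↦ f x * ((k + 1) / ‖x‖)).aestronglyMeasurable (Eventually.of_forall fun x ↦ ?_)
      by_cases h : ‖x‖ < 2
      · rw [indicator_of_mem (by simpa using h), norm_mul, Real.norm_of_nonneg (h01 x).1, Real.norm_of_nonneg ♠]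
        exact mul_le_of_le_one_left ♠ (h01 x).2
      · rw [indicator_of_notMem (by simpa using h), f2 x ♦]; simp
    have := integral_mono j2 (j1.add (i3.abs.const_mul (2 * (♮k + 1)))) fun x ↦ ?_
    · rw [integral_add' j1 (i3.abs.const_mul _), integral_indicator hE, integral_const_mul] at this
      refine this.trans (add_le_add le_rfl (mul_le_mul_of_nonneg_left hL1 ♠))
    · change f x * ((♮k + 1) / ‖x‖) ≤ E.indicator (fun x : EV (k + 2) ↦ (♮k + 1) / ‖x‖) x + 2 * (♮k + 1) * |f x - E.indicator 1 x|
      have e : E.indicator (fun x : EV (k + 2) ↦ (♮k + 1) / ‖x‖) x = E.indicator 1 x * ((♮k + 1) / ‖x‖) := by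
        by_cases h : x ∈ E <;> simp [h]
      rw [e]
      rcases lt_or_ge ‖x‖ (1/2) with h | h
      · rw [z1 x h]; have := z1 x h; rw [sub_eq_zero.1 this]; simp
      · have q : (♮k + 1) / ‖x‖ ≤ 2 * (k + 1) := by
          rw [div_le_iff₀ ♦]
          nlinarith [show ♮0 ≤ k by positivity]
        have q0 : 0 ≤ (♮k + 1) / ‖x‖ := by positivity
        have := (mul_le_mul_of_nonneg_right (le_abs_self (f x - E.indicator 1 x)) q0).trans (mul_le_mul_of_nonneg_left q (abs_nonneg _))
        linarith
  have b5 : |(∫ x, f x) - ww (k + 2)| ≤ |volume.real E - ww (k + 2)| + ε := by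
    have := abs_sub_le (∫ x, f x) (volume.real E) (ww (k + 2))
    linarith
  have hk : ♮0 ≤ k := by positivity
  have b6 := mul_le_mul_of_nonneg_left b5 (show ♮0 ≤ k + 1 by positivity)
  have b7 := mul_le_mul_of_nonneg_left b3 (show ♮0 ≤ k + 2 by positivity)
  have kε : 0 ≤ k * ε := by positivity
  rw [hD] at hε2
  linarith
lemma setInt_tr {n : ℕ} {F : Type*} [NormedAddCommGroup F] [NormedSpace ℝ F] (g : EV n → F) (H : Set (EV n)) (y : EV n) :
    ∫ x in H, g (x - y) = ∫ x in (fun z ↦ z - -y) ⁻¹' H, g x := by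
  have := (measurePreserving_add_right volume y).setIntegral_preimage_emb (measurableEmbedding_addRight y) (fun x ↦ g (x - y)) H
  simp only [add_sub_cancel_right] at this
  simp only [sub_neg_eq_add]
  exact this.symm
lemma vol_tr {n : ℕ} (H : Set (EV n)) (y : EV n) : volume ((fun z ↦ z - y) ⁻¹' H) = volume H := by
  simp only [sub_eq_add_neg]; exact measure_preimage_add_right _ _ _
lemma ker_int (k : ℕ) {H : Set (EV (k + 2))} (hH : MeasurableSet H) (hfin : volume H ≠ ⊤) : IntegrableOn (fun x : EV (k + 2) ↦ (♮k + 1) / ‖x‖) H := by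
  have h1 := (invB k (s := 1) ♣).1
  have h2 : IntegrableOn (fun x : EV (k + 2) ↦ (♮k + 1) / ‖x‖) (H \ ball 0 1) := by
    refine Measure.integrableOn_of_bounded (M := k + 1) (((measure_mono Set.sdiff_subset).trans_lt hfin.lt_top).ne)
      (by fun_prop : Measurable fun x : EV (k + 2) ↦ (♮k + 1) / ‖x‖).aestronglyMeasurable ((ae_restrict_iff' (hH.diff measurableSet_ball)).2 (Eventually.of_forall fun x hx ↦ ?_))
    have : 1 ≤ ‖x‖ := by simpa using hx.2
    rw [Real.norm_of_nonneg ♠]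
    exact div_le_self ♠ this
  refine (h1.union h2).mono_set fun x hx ↦ ?_
  by_cases h : x ∈ ball (0 : EV (k + 2)) 1
  · exact Or.inl h
  · exact Or.inr ⟨hx, h⟩
lemma pot (k : ℕ) {H : Set (EV (k + 2))} (hH : MeasurableSet H) (hfin : volume H ≠ ⊤) :
    ∫ x in H, (♮k + 1) / ‖x‖ ≤ ((k + 2) * ww (k + 2) + (k + 1)) * volume.real H ^ (((k + 1 : ℕ):ℝ) / ((k + 1 : ℕ) + 1)) := by
  rcases (measureReal_nonneg (μ := volume) (s := H)).eq_or_lt with h0 | h0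
  · have : volume H = 0 := (measureReal_eq_zero_iff hfin).1 h0.symm
    rw [setIntegral_measure_zero _ this]
    have := ww_pos (k + 2)
    positivity
  set s := volume.real H ^ (1 / (♮k + 2)) with hs
  have hs0 : 0 < s := Real.rpow_pos_of_pos h0 _
  have e1 : volume.real H ^ (((k + 1 : ℕ):ℝ) / ((k + 1 : ℕ) + 1)) = s ^ (k + 1) := by
    rw [hs, ← Real.rpow_mul_natCast h0.le]; congr 1; push_cast; field_simp; ring
  have e2 : volume.real H = s * s ^ (k + 1) := by
    rw [← pow_succ', hs, ← Real.rpow_mul_natCast h0.le]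
    push_cast
    rw [show (1 / (♮k + 2) * (k + 1 + 1)) = 1 by field_simp; ring, Real.rpow_one]
  have i0 := ker_int k hH hfin
  have i1 := invB k hs0.le
  rw [← integral_inter_add_sdiff (measurableSet_ball (x := (0 : EV (k + 2))) (ε := s)) i0, e1]
  have c1 : ∫ x in H ∩ ball 0 s, (♮k + 1) / ‖x‖ ≤ (k + 2) * ww (k + 2) * s ^ (k + 1) := by
    rw [← i1.2]
    exact setIntegral_mono_set i1.1 (Eventually.of_forall fun x ↦ by positivity) inter_subset_right.eventuallyLE
  have hf2 : volume (H \ ball 0 s) ≠ ⊤ := ((measure_mono Set.sdiff_subset).trans_lt hfin.lt_top).ne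
  have c2 : ∫ x in H \ ball 0 s, (♮k + 1) / ‖x‖ ≤ (k + 1) * s ^ (k + 1) := by
    have := setIntegral_mono_on (i0.mono_set Set.sdiff_subset) (integrableOn_const (C := (♮k + 1) / s) hf2) (hH.diff measurableSet_ball) fun x hx ↦ by
      have : s ≤ ‖x‖ := by simpa using hx.2
      exact div_le_div_of_nonneg_left ♠ hs0 this
    refine this.trans ?_
    rw [setIntegral_const, smul_eq_mul]
    calc _ ≤ volume.real H * ((k + 1) / s) := mul_le_mul_of_nonneg_right (measureReal_mono Set.sdiff_subset hfin) ♠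
      _ = _ := by rw [e2]; field_simp
  linarith
lemma bathS (k : ℕ) {H : Set (EV (k + 2))} (hH : MeasurableSet H) (hfin : volume H ≠ ⊤) :
    ∫ x in H, (♮k + 1) / ‖x‖ ≤ (k + 2) * ww (k + 2) + (k + 1) * (volume.real H - ww (k + 2)) := by
  have i1 := invB k (s := 1) ♣
  have i0 := ker_int k hH hfin
  have c0 : ∀ F : Set (EV (k + 2)), MeasurableSet F → volume F ≠ ⊤ → IntegrableOn (fun x : EV (k + 2) ↦ (♮k + 1) / ‖x‖) F →
      Integrable (F.indicator fun x ↦ (♮k + 1) / ‖x‖ - (k + 1)) ∧ ∫ x, F.indicator (fun x ↦ (♮k + 1) / ‖x‖ - (k + 1)) x = (∫ x in F, (♮k + 1) / ‖x‖) - (k + 1) * volume.real F := fun F hF hf hi ↦ by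
    have j := integrableOn_const (μ := volume) (s := F) (C := ♮k + 1) hf
    refine ⟨(integrable_indicator_iff hF).2 (hi.sub j), ?_⟩
    rw [integral_indicator hF, integral_sub hi j, setIntegral_const, smul_eq_mul, mul_comm]
  obtain ⟨a1, a2⟩ := c0 H hH hfin i0
  obtain ⟨b1, b2⟩ := c0 (ball 0 1) measurableSet_ball measure_ball_lt_top.ne i1.1
  have ne : ∀ᵐ x ∂(volume : Measure (EV (k + 2))), x ≠ 0 := compl_mem_ae_iff.2 (measure_singleton 0)
  have := integral_mono_ae a1 b1 ?_
  · rw [a2, b2, i1.2, one_pow, mul_one] at this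
    change _ ≤ _ - (♮k + 1) * ww (k + 2) at this
    linarith
  · filter_upwards [ne] with x hx0
    have h0 : 0 < ‖x‖ := norm_pos_iff.2 hx0
    have hk : ♮0 ≤ k := by positivity
    by_cases hx : ‖x‖ < 1
    · rw [indicator_of_mem (a := x) (s := ball 0 1) (by simpa using hx)]
      have : 0 ≤ (♮k + 1) / ‖x‖ - (k + 1) := by
        rw [sub_nonneg, le_div_iff₀ h0]
        nlinarith
      by_cases hH : x ∈ H <;> simp only [hH, indicator_of_mem, indicator_of_notMem, not_false_eq_true, le_refl, this]
    · rw [indicator_of_notMem (a := x) (s := ball 0 1) (by simpa using hx)]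
      have : (♮k + 1) / ‖x‖ - (k + 1) ≤ 0 := by
        rw [sub_nonpos, div_le_iff₀ h0]
        nlinarith
      by_cases hH : x ∈ H <;> simp only [hH, indicator_of_mem, indicator_of_notMem, not_false_eq_true, le_refl, this]
lemma bary (k : ℕ) {δ : ℝ} (hδ : 0 < δ) (hδ2 : δ ≤ 1/2) : ∃ t > 0, t < 1 ∧ t < δ / 4 ∧ ∀ E : Set (EV (k + 2)), MeasurableSet E → closedBall 0 (1 - t) ⊆ E → E ⊆ closedBall 0 (1 + t) →
    ∃ b : EV (k + 2), ‖b‖ ≤ δ / 2 ∧ ∫ x in E, (x - b) = 0 := by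
  have w0 := ww_pos (k + 2)
  have q : ∀ᶠ t in 𝓝[>] ♮0, 2 * (((1 + t) ^ (k + 2) - (1 - t) ^ (k + 2)) * ww (k + 2)) < δ / 2 * ((1/2) ^ (k + 2) * ww (k + 2)) := by
    have : Tendsto (fun t : ℝ ↦ 2 * (((1 + t) ^ (k + 2) - (1 - t) ^ (k + 2)) * ww (k + 2))) (𝓝 0) (𝓝 (2 * (((1 + 0) ^ (k + 2) - (1 - 0) ^ (k + 2)) * ww (k + 2)))) :=
      (by fun_prop : Continuous fun t : ℝ ↦ 2 * (((1 + t) ^ (k + 2) - (1 - t) ^ (k + 2)) * ww (k + 2))).tendsto 0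
    rw [show 2 * (((1 + ♮0) ^ (k + 2) - (1 - 0) ^ (k + 2)) * ww (k + 2)) = 0 by simp] at this
    exact nhdsWithin_le_nhds (this.eventually (gt_mem_nhds ♠))
  have q2 : ∀ᶠ t in 𝓝[>] ♮0, t < δ / 4 := nhdsWithin_le_nhds (gt_mem_nhds ♠)
  have q3 : ∀ᶠ t in 𝓝[>] ♮0, 0 < t := self_mem_nhdsWithin
  obtain ⟨t, ⟨h1, h2⟩, h3⟩ := ((q.and q2).and q3).exists
  refine ⟨t, h3, by linarith, h2, fun E hE hin hout ↦ ?_⟩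
  have hfin : volume E ≠ ⊤ := ((measure_mono hout).trans_lt measure_closedBall_lt_top).ne
  have fc : ∀ r, volume (closedBall (0 : EV (k + 2)) r) ≠ ⊤ := fun r ↦ measure_closedBall_lt_top.ne
  have ie : IntegrableOn (fun x : EV (k + 2) ↦ x) E :=
    Measure.integrableOn_of_bounded (M := 2) hfin ♩ ((ae_restrict_iff' hE).2 (Eventually.of_forall fun x hx ↦ by have := hout hx; simp at this; linarith))
  have eb : ∫ x in closedBall (0 : EV (k + 2)) (1 - t), x = 0 := by
    have a := (Measure.measurePreserving_neg (volume : Measure (EV (k + 2)))).setIntegral_preimage_emb (MeasurableEquiv.neg (EV (k + 2))).measurableEmbedding (fun x ↦ x) (closedBall 0 (1 - t))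
    have : (Neg.neg : EV (k + 2) → EV (k + 2)) ⁻¹' closedBall 0 (1 - t) = closedBall 0 (1 - t) := by ext x; simp
    rw [this, integral_neg] at a
    have h2 : ♮2 • ∫ x in closedBall (0 : EV (k + 2)) (1 - t), x = 0 := by
      rw [two_smul]; nth_rewrite 1 [← a]; simp
    exact (smul_eq_zero.1 h2).resolve_left two_ne_zero
  have n1 : ‖∫ x in E, x‖ ≤ 2 * (((1 + t) ^ (k + 2) - (1 - t) ^ (k + 2)) * ww (k + 2)) := by
    have e := setIntegral_sdiff (measurableSet_closedBall) ie hin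
    rw [eb, sub_zero] at e
    rw [← e]
    have hfd : volume (E \ closedBall 0 (1 - t)) < ⊤ := (measure_mono Set.sdiff_subset).trans_lt hfin.lt_top
    refine (norm_setIntegral_le_of_norm_le_const (C := 2) hfd fun x hx ↦ by have := hout hx.1; simp at this; linarith).trans ?_
    refine mul_le_mul_of_nonneg_left ?_ ♣
    have a1 : volume.real (E \ closedBall 0 (1 - t)) ≤ volume.real (closedBall (0 : EV (k + 2)) (1 + t) \ closedBall 0 (1 - t)) :=
      measureReal_mono (Set.sdiff_subset_sdiff_left hout) (((measure_mono Set.sdiff_subset).trans_lt (fc (1 + t)).lt_top).ne)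
    rw [measureReal_sdiff (closedBall_subset_closedBall ♦) measurableSet_closedBall (fc _), vol_cball _ ♦, vol_cball _ ♦] at a1
    linarith
  have v1 : (1/2) ^ (k + 2) * ww (k + 2) ≤ volume.real E := by
    refine le_trans ?_ (measureReal_mono hin hfin)
    rw [vol_cball _ ♦]
    exact mul_le_mul_of_nonneg_right (pow_le_pow_left₀ ♣ ♦ _) w0.le
  have v0 : 0 < volume.real E := lt_of_lt_of_le ♠ v1
  refine ⟨(volume.real E)⁻¹ • ∫ x in E, x, ?_, ?_⟩
  · rw [norm_smul, Real.norm_of_nonneg (inv_nonneg.2 v0.le), inv_mul_le_iff₀ v0]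
    have := mul_le_mul_of_nonneg_left v1 (half_pos hδ).le
    linarith
  · rw [integral_sub ie (integrableOn_const hfin), setIntegral_const, smul_smul, mul_inv_cancel₀ v0.ne', one_smul, sub_self]
lemma rp_small {V a x : ℝ} {k : ℕ} (hV : 0 ≤ V) (ha : 0 ≤ a) (h : V ≤ a ^ (k + 2)) (hx : x = ((k + 1 : ℕ):ℝ) / ((k + 1 : ℕ) + 1)) : V ≤ a * V ^ x := by
  rcases hV.eq_or_lt with h0 | h0
  · subst h0; rw [Real.zero_rpow (by rw [hx]; positivity)]; simp
  have e : V = V ^ (1 / (♮k + 2)) * V ^ x := by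
    rw [← Real.rpow_add h0, hx]
    push_cast
    rw [show 1 / (♮k + 2) + (k + 1) / (k + 1 + 1) = 1 by field_simp; ring, Real.rpow_one]
  have : V ^ (1 / (♮k + 2)) ≤ a := by
    have := Real.rpow_le_rpow hV h (show ♮0 ≤ 1 / (♮k + 2) by positivity)
    rwa [← Real.rpow_natCast, ← Real.rpow_mul ha, show ((k + 2 : ℕ):ℝ) * (1 / (♮k + 2)) = 1 by push_cast; field_simp, Real.rpow_one] at this
  calc V = V ^ (1 / (♮k + 2)) * V ^ x := e
    _ ≤ _ := mul_le_mul_of_nonneg_right this ♠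
lemma fin_alg {k W I2 IE v w V1 V2 S1 S2 K Cp c p a : ℝ} (hk : 0 ≤ k) (hK : 0 ≤ K) (c0 : 0 ≤ c) (c1 : c ≤ 1/20) (c2 : c * Cp ≤ K / 8) (h1 : 0 ≤ S1) (h2 : 0 ≤ S2)
    (hE : W + 1/20 * (W - I2) - 2 * ((k + 1) * |v - w|) ≤ p - K / 2 * (S1 + S2)) (bt : I2 ≤ W + (k + 1) * (v - w)) (cmp : I2 ≤ IE + Cp * S2) (vd : |v - w| ≤ V1 + V2)
    (s1 : V1 ≤ a * S1) (s2 : V2 ≤ a * S2) (ka : (k + 1) * a = K / 12) : c * (W - IE) ≤ p - W := by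
  have q1 : (k + 1) * |v - w| ≤ K / 12 * (S1 + S2) := by
    rw [← ka, mul_assoc]
    exact mul_le_mul_of_nonneg_left ♦ ♦
  have q2 : - (K / 12 * (S1 + S2)) ≤ W - I2 := by
    have := mul_le_mul_of_nonneg_left (le_abs_self (v - w)) (show 0 ≤ k + 1 by linarith)
    linarith
  have q3 := mul_le_mul_of_nonneg_left q2 (show 0 ≤ 1/20 - c by linarith)
  have q4 : c * (W - IE) ≤ c * (W - I2) + c * Cp * S2 := by
    have := mul_le_mul_of_nonneg_left cmp c0
    linarith
  have q5 := mul_le_mul_of_nonneg_right c2 h2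
  have k1 : 0 ≤ K * S1 := by positivity
  have k2 : 0 ≤ K * S2 := by positivity
  have q6 : c * (K / 12 * (S1 + S2)) ≥ 0 := by positivity
  linarith
set_option maxHeartbeats 1000000 in
lemma fin1 (k : ℕ) : ∃ ε > 0, ∃ c > 0, ∀ (E : Set (EV (k + 2))) (p : ℝ), MeasurableSet E → volume E = volume (ball (0 : EV (k + 2)) 1) → PerLe E p →
    volume.real (ball 0 1 \ E) < ε → ∃ b : EV (k + 2), c * ((k + 2) * ww (k + 2) - ∫ x in E, (♮k + 1) / ‖x - b‖) ≤ p - (k + 2) * ww (k + 2) := by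
  have w0 := ww_pos (k + 2)
  obtain ⟨δ, hδ, hδ2, hN⟩ := near_set k
  obtain ⟨t, t0, t1, t2, hb⟩ := bary k hδ hδ2
  obtain ⟨ε1, he1, hT⟩ := trunc (m := k + 1) ♪ t0 t1
  set K : ℝ := (((k + 1 : ℕ) : ℝ) + 1) * ww (k + 1 + 1) ^ (1 / (((k + 1 : ℕ) : ℝ) + 1)) with hK
  have K0 : 0 < K := mul_pos ♠ (Real.rpow_pos_of_pos (ww_pos _) _)
  set a := K / (12 * (♮k + 1)) with ha
  have a0 : 0 < a := by positivity
  set Cp := (♮k + 2) * ww (k + 2) + (k + 1) with hCp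
  have Cp0 : 0 < Cp := by positivity
  refine ⟨min ε1 (a ^ (k + 2)), lt_min he1 ♠, min (1/20) (K / (8 * Cp)), lt_min ♣ ♠, fun E p hE hv hp hs ↦ ?_⟩
  have hfin : volume E ≠ ⊤ := by rw [hv]; exact measure_ball_lt_top.ne
  have vE : volume.real E = ww (k + 2) := by rw [measureReal_def, hv]; rfl
  have fc : ∀ r, volume (closedBall (0 : EV (k + 2)) r) ≠ ⊤ := fun r ↦ measure_closedBall_lt_top.ne
  have fd : ∀ {A B : Set (EV (k + 2))}, volume A ≠ ⊤ → volume (A \ B) ≠ ⊤ := fun h ↦ ((measure_mono Set.sdiff_subset).trans_lt h.lt_top).ne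
  have s2 : volume.real (closedBall 0 1 \ E) < min ε1 (a ^ (k + 2)) := by
    refine lt_of_le_of_lt ?_ hs
    have h0 : volume.real (sphere (0 : EV (k + 2)) 1) = 0 := by rw [measureReal_def, Measure.addHaar_sphere]; rfl
    have := (measureReal_mono (s₁ := closedBall 0 1 \ E) (s₂ := (ball 0 1 \ E) ∪ sphere 0 1) (fun x hx ↦ ?_) ?_).trans (measureReal_union_le (μ := volume) _ _)
    · rwa [h0, add_zero] at this
    · rcases (show ‖x‖ ≤ 1 by simpa using hx.1).lt_or_eq with h | h
      · exact Or.inl ⟨by simpa using h, hx.2⟩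
      · exact Or.inr (by simpa using h)
    · exact measure_union_ne_top (fd measure_ball_lt_top.ne) (by rw [Measure.addHaar_sphere]; simp)
  have s1 : volume.real (E \ closedBall 0 1) < min ε1 (a ^ (k + 2)) := by
    have q1 := measureReal_inter_add_sdiff (μ := volume) (s := E) (t := closedBall 0 1) measurableSet_closedBall hfin
    have q2 := measureReal_inter_add_sdiff (μ := volume) (s := closedBall 0 1) (t := E) hE (fc 1)
    rw [inter_comm, vol_cball _ zero_le_one, one_pow, one_mul] at q2
    linarith
  obtain ⟨r1, r2, hr1, hr1', hr2, hr2', hP⟩ := hT E p hE hfin hp (lt_of_lt_of_le s1 (min_le_left _ _)) (lt_of_lt_of_le s2 (min_le_left _ _))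
  set E2 : Set (EV (k + 2)) := (E ∩ closedBall 0 r1) ∪ closedBall 0 r2 with hE2
  set θ : ℝ := ((k + 1 : ℕ):ℝ) / ((k + 1 : ℕ) + 1) with hθ
  have mE2 : MeasurableSet E2 := (hE.inter measurableSet_closedBall).union measurableSet_closedBall
  have in2 : closedBall 0 (1 - t) ⊆ E2 := (closedBall_subset_closedBall hr2'.le).trans subset_union_right
  have out2 : E2 ⊆ closedBall 0 (1 + t) := union_subset (inter_subset_right.trans (closedBall_subset_closedBall hr1'.le)) (closedBall_subset_closedBall ♦)
  have f2 : volume E2 ≠ ⊤ := ((measure_mono out2).trans_lt (fc _).lt_top).ne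
  obtain ⟨b, hb1, hb2⟩ := hb E2 mE2 in2 out2
  have V1s : volume.real (E \ closedBall 0 r1) ≤ a * volume.real (E \ closedBall 0 r1) ^ θ := by
    refine rp_small (k := k) measureReal_nonneg a0.le ?_ hθ
    refine (measureReal_mono (Set.sdiff_subset_sdiff_right (closedBall_subset_closedBall hr1)) (fd hfin)).trans (s1.le.trans (min_le_right _ _))
  have V2s : volume.real (closedBall 0 r2 \ E) ≤ a * volume.real (closedBall 0 r2 \ E) ^ θ := by
    refine rp_small (k := k) measureReal_nonneg a0.le ?_ hθ
    refine (measureReal_mono (Set.sdiff_subset_sdiff_left (closedBall_subset_closedBall hr2)) (fd (fc 1))).trans (s2.le.trans (min_le_right _ _))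
  have vd : |volume.real E2 - ww (k + 2)| ≤ volume.real (E \ closedBall 0 r1) + volume.real (closedBall 0 r2 \ E) := by
    rw [← vE, abs_le]
    constructor
    · have : volume.real E ≤ volume.real E2 + volume.real (E \ closedBall 0 r1) := by
        refine (measureReal_mono (s₂ := E2 ∪ (E \ closedBall 0 r1)) (fun x hx ↦ ?_) ?_).trans (measureReal_union_le _ _)
        · by_cases h : x ∈ closedBall 0 r1
          · exact Or.inl (Or.inl ⟨hx, h⟩)
          · exact Or.inr ⟨hx, h⟩
        · exact measure_union_ne_top f2 (fd hfin)
      linarith [measureReal_nonneg (μ := volume) (s := closedBall 0 r2 \ E)]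
    · have : volume.real E2 ≤ volume.real E + volume.real (closedBall 0 r2 \ E) := by
        refine (measureReal_mono (s₂ := E ∪ (closedBall 0 r2 \ E)) (fun x hx ↦ ?_) ?_).trans (measureReal_union_le _ _)
        · by_cases h : x ∈ E
          · exact Or.inl h
          · exact Or.inr ⟨hx.resolve_left (fun h' ↦ h h'.1), h⟩
        · exact measure_union_ne_top hfin (fd (fc _))
      linarith [measureReal_nonneg (μ := volume) (s := E \ closedBall 0 r1)]
  refine ⟨b, ?_⟩
  have mτ : Measurable (fun z : EV (k + 2) ↦ z - -b) := by fun_prop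
  have hE3 := hN ((fun z ↦ z - -b) ⁻¹' E2) _ (mτ mE2) (hP.translate mE2 (-b)) ?_ ?_ ?_
  rotate_left
  · intro x hx
    refine in2 ?_
    have : ‖x‖ < 1 - δ := by simpa using hx
    have := norm_add_le x b
    simp; linarith
  · intro x hx
    have h1 : ‖x + b‖ ≤ 1 + t := by simpa using out2 hx
    have := norm_sub_le (x + b) b
    rw [add_sub_cancel_right] at this
    simp; linarith
  · rw [← setInt_tr (fun x ↦ x) E2 b]; exact hb2
  have e3 : volume.real ((fun z ↦ z - -b) ⁻¹' E2) = volume.real E2 := by rw [measureReal_def, vol_tr]; rfl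
  have bt := bathS k (mτ mE2) (by rw [vol_tr]; exact f2)
  rw [e3] at hE3 bt
  have mH : MeasurableSet (closedBall 0 r2 \ E) := measurableSet_closedBall.diff hE
  have fH : volume (closedBall 0 r2 \ E) ≠ ⊤ := fd (fc _)
  have iH := ker_int k (mτ mH) (by rw [vol_tr]; exact fH)
  have iE := ker_int k (mτ hE) (by rw [vol_tr]; exact hfin)
  have pt := pot k (mτ mH) (by rw [vol_tr]; exact fH)
  rw [measureReal_def, vol_tr] at pt
  have cmp : ∫ x in (fun z ↦ z - -b) ⁻¹' E2, (♮k + 1) / ‖x‖ ≤ (∫ x in (fun z ↦ z - -b) ⁻¹' E, (♮k + 1) / ‖x‖) + ∫ x in (fun z ↦ z - -b) ⁻¹' (closedBall 0 r2 \ E), (♮k + 1) / ‖x‖ := by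
    rw [← setIntegral_union (disjoint_sdiff_right.preimage _) (mτ mH) iE iH]
    refine setIntegral_mono_set (iE.union iH) (Eventually.of_forall fun x ↦ by positivity) (LE.le.eventuallyLE fun x hx ↦ ?_)
    by_cases h : x - -b ∈ E
    · exact Or.inl h
    · exact Or.inr ⟨hx.resolve_left (fun h' ↦ h h'.1), h⟩
  rw [setInt_tr (fun x ↦ (♮k + 1) / ‖x‖) E b]
  change _ ≤ Cp * (volume.real (closedBall 0 r2 \ E)) ^ θ at pt
  have S10 : 0 ≤ volume.real (E \ closedBall 0 r1) ^ θ := by positivity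
  have S20 : 0 ≤ volume.real (closedBall 0 r2 \ E) ^ θ := by positivity
  set c := min (1/20) (K / (8 * Cp)) with hc
  have c1 : c ≤ 1/20 := min_le_left _ _
  have c0 : 0 < c := lt_min ♣ ♠
  have c2 : c * Cp ≤ K / 8 := by
    calc c * Cp ≤ K / (8 * Cp) * Cp := mul_le_mul_of_nonneg_right (min_le_right _ _) Cp0.le
      _ = _ := by field_simp
  have ka : (♮k + 1) * a = K / 12 := by rw [ha]; field_simp
  exact fin_alg ♠ K0.le c0.le c1 c2 S10 S20 hE3 bt (cmp.trans (add_le_add le_rfl pt)) vd V1s V2s ka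
theorem statement2 (n : ℕ) (hn : 2 ≤ n) :
    ∃ C : ℝ, 0 < C ∧ ∀ E : Set (EuclideanSpace ℝ (Fin n)), HasFinitePerimeter E →
      volume E = volume (ball (0 : EuclideanSpace ℝ (Fin n)) 1) →
      perimeter E - perimeter (ball (0 : EuclideanSpace ℝ (Fin n)) 1) ≥ C * gammaAsym E := by
  obtain ⟨k, rfl⟩ : ∃ k, n = k + 2 := ⟨n - 2, by omega⟩
  obtain ⟨ε, hε, c, hc, h1⟩ := fin1 k
  obtain ⟨d, hd, hW⟩ := weak (m := k + 1) ♪ (half_pos hε)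
  have w0 := ww_pos (k + 2)
  have W0 : 0 < (♮k + 2) * ww (k + 2) := by positivity
  have C0 : 0 < min c (d / ((♮k + 2) * ww (k + 2))) := lt_min hc ♠
  refine ⟨_, C0, fun E hE hv ↦ ?_⟩
  have hfin : volume E ≠ ⊤ := by rw [hv]; exact measure_ball_lt_top.ne
  have vE : volume.real E = ww (k + 2) := by rw [measureReal_def, hv]; rfl
  have hp := perLe_of_fin hE
  have pb : perimeter (ball (0 : EV (k + 2)) 1) ≤ (k + 2) * ww (k + 2) := by
    have := perimeter_le (perLe_ball (k + 2))
    push_cast at this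
    exact this
  have val : ∀ y : EV (k + 2), (∫ x in ball y 1, (((k + 2 : ℕ):ℝ) - 1) / ‖x - y‖) - ∫ x in E, (((k + 2 : ℕ):ℝ) - 1) / ‖x - y‖ =
      (k + 2) * ww (k + 2) - ∫ x in E, (♮k + 1) / ‖x - y‖ := fun y ↦ by
    have e : (((k + 2 : ℕ):ℝ) - 1) = ♮k + 1 := by push_cast; ring
    have e2 : (fun z ↦ z - -y) ⁻¹' ball y 1 = ball 0 1 := by ext z; simp
    rw [e, setInt_tr (fun x ↦ (♮k + 1) / ‖x‖) (ball y 1) y, e2, (invB k zero_le_one).2, one_pow, mul_one]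
  have nonneg : ∀ y : EV (k + 2), 0 ≤ (k + 2) * ww (k + 2) - ∫ x in E, (♮k + 1) / ‖x - y‖ := fun y ↦ by
    have mτ : Measurable (fun z : EV (k + 2) ↦ z - -y) := by fun_prop
    have := bathS k (mτ hE.1) (by rw [vol_tr]; exact hfin)
    rw [measureReal_def, vol_tr, ← measureReal_def, vE, sub_self, mul_zero, add_zero, ← setInt_tr (fun x ↦ (♮k + 1) / ‖x‖) E y] at this
    linarith
  have gle : ∀ y : EV (k + 2), gammaAsym E ≤ (k + 2) * ww (k + 2) - ∫ x in E, (♮k + 1) / ‖x - y‖ := fun y ↦ by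
    rw [← val y]
    exact ciInf_le (f := fun y : EV (k + 2) ↦ (∫ x in ball y 1, (((k + 2 : ℕ):ℝ) - 1) / ‖x - y‖) - ∫ x in E, (((k + 2 : ℕ):ℝ) - 1) / ‖x - y‖)
      ⟨0, by rintro _ ⟨z, rfl⟩; exact (nonneg z).trans_eq (val z).symm⟩ y
  have main : min c (d / ((♮k + 2) * ww (k + 2))) * gammaAsym E ≤ perimeter E - (k + 2) * ww (k + 2) := by
    rcases le_or_gt ((♮k + 2) * ww (k + 2) + d) (perimeter E) with hD | hD
    · have g0 : gammaAsym E ≤ (k + 2) * ww (k + 2) := by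
        have := gle 0
        have : 0 ≤ ∫ x in E, (♮k + 1) / ‖x - 0‖ := integral_nonneg fun x ↦ by positivity
        linarith
      calc _ ≤ min c (d / ((♮k + 2) * ww (k + 2))) * ((k + 2) * ww (k + 2)) := mul_le_mul_of_nonneg_left g0 C0.le
        _ ≤ d / ((♮k + 2) * ww (k + 2)) * ((k + 2) * ww (k + 2)) := mul_le_mul_of_nonneg_right (min_le_right _ _) W0.le
        _ = d := by field_simp
        _ ≤ _ := by linarith
    · have hp' : PerLe E ((((k + 1 : ℕ):ℝ) + 1) * ww (k + 1 + 1) + d) := fun φ a1 a2 a3 ↦ (hp φ a1 a2 a3).trans (by push_cast; rw [show (♮k + 1 + 1) = k + 2 by ring]; exact hD.le)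
      obtain ⟨z, hz⟩ := hW E hE.1 hv hp'
      have mτ : Measurable (fun x : EV (k + 2) ↦ x - -z) := by fun_prop
      obtain ⟨b, hb⟩ := h1 ((fun x ↦ x - -z) ⁻¹' E) (perimeter E) (mτ hE.1) (by rw [vol_tr, hv]) (hp.translate hE.1 (-z)) (by
        have e2 : (fun x ↦ x - -z) ⁻¹' ball z 1 = ball 0 1 := by ext x; simp
        rw [← e2, ← preimage_sdiff, measureReal_def, vol_tr, ← measureReal_def]
        linarith)
      rw [← setInt_tr (fun x ↦ (♮k + 1) / ‖x - b‖) E z] at hb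
      have e : ∀ x : EV (k + 2), x - z - b = x - (z + b) := fun x ↦ by abel
      simp only [e] at hb
      refine le_trans ?_ hb
      exact mul_le_mul (min_le_left _ _) (gle _) ((Real.iInf_nonneg fun y ↦ by rw [val y]; exact nonneg y)) hc.le
  change _ ≤ _
  linarith
end
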